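/- Let d ≥ 1 and λ > 1. There exists ε > 0 (depending only on d and λ) such that the following holds. Let g₀ : ℝᵈ → Sym⁺(d) be a uniformly continuous map into symmetric positive definite d×d matrices with λ⁻¹ I ≤ g₀(x) ≤ λ I for all x. Then there exist T > 0 and a continuous map g : [0,T]×ℝᵈ → Sym⁺(d), smooth for t > 0, with g(0,·) = g₀, solving the Ricci–DeTurck flow with Euclidean background metric pointwise on (0,T)×ℝᵈ: ∂ₜg_{ij} = Σ_{a,b} g^{ab} ∂ₐ∂_b g_{ij} + (1/2) Σ g^{ab} g^{pq} ( ∂ᵢg_{pa}∂ⱼg_{qb} + 2∂ₐg_{jp}∂_q g_{ib} − 2∂ₐg_{jp}∂_b g_{iq} − 2∂ⱼg_{pa}∂_b g_{iq} − 2∂ᵢg_{pa}∂_b g_{jq} ), where (g^{ab}) is the inverse matrix of (g_{ab}), and satisfying t^{1/2}‖∂g(t,·)‖_{L^∞} ≤ ε for 0 < t ≤ T. Moreover g is the unique such solution satisfying this gradient bound. -/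

import Mathlib

open MeasureTheory Set Metric

noncomputable section

/-- Partial derivative of a scalar function on `ℝᵈ` in the `i`-th coordinate
direction. -/
def pd {d : ℕ} (i : Fin d) (g : EuclideanSpace ℝ (Fin d) → ℝ) :
    EuclideanSpace ℝ (Fin d) → ℝ :=
  fun x => fderiv ℝ g x (EuclideanSpace.single i 1)

/-- Second spatial partial derivative. -/
def pd2 {d : ℕ} (a b : Fin d) (g : EuclideanSpace ℝ (Fin d) → ℝ) :
    EuclideanSpace ℝ (Fin d) → ℝ :=
  pd a (pd b g)

/-- The Ricci–DeTurck flow with Euclidean background metric, componentwise: for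
a matrix-valued `g` and a point `z = (t,x)`, with `G := (g z)⁻¹`,
`∂ₜ g_ij = Σ G^{ab} ∂ₐ∂_b g_ij + (1/2) Σ G^{ab} G^{rs} (∂ᵢg_{ra}∂ⱼg_{sb}
 + 2∂ₐg_{jr}∂_sg_{ib} − 2∂ₐg_{jr}∂_bg_{is} − 2∂ⱼg_{ra}∂_bg_{is} − 2∂ᵢg_{ra}∂_bg_{js})`. -/
def IsRicciDeTurck {d : ℕ}
    (g : ℝ × EuclideanSpace ℝ (Fin d) → Fin d → Fin d → ℝ)
    (z : ℝ × EuclideanSpace ℝ (Fin d)) : Prop :=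
  ∀ i j : Fin d,
    deriv (fun s => g (s, z.2) i j) z.1 =
      (∑ a, ∑ b, ((Matrix.of (g z))⁻¹ : Matrix (Fin d) (Fin d) ℝ) a b *
        pd2 a b (fun y => g (z.1, y) i j) z.2)
      + (1/2) * ∑ a, ∑ b, ∑ r, ∑ s,
          ((Matrix.of (g z))⁻¹ : Matrix (Fin d) (Fin d) ℝ) a b *
          ((Matrix.of (g z))⁻¹ : Matrix (Fin d) (Fin d) ℝ) r s *
          (pd i (fun y => g (z.1, y) r a) z.2 * pd j (fun y => g (z.1, y) s b) z.2
            + 2 * pd a (fun y => g (z.1, y) j r) z.2 * pd s (fun y => g (z.1, y) i b) z.2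
            - 2 * pd a (fun y => g (z.1, y) j r) z.2 * pd b (fun y => g (z.1, y) i s) z.2
            - 2 * pd j (fun y => g (z.1, y) r a) z.2 * pd b (fun y => g (z.1, y) i s) z.2
            - 2 * pd i (fun y => g (z.1, y) r a) z.2 * pd b (fun y => g (z.1, y) j s) z.2)

section
open Finset (sum_congr mul_sum sum_le_sum sum_comm sum_add_distrib sum_nonneg sum_sub_distrib sum_mul single_le_sum abs_sum_le_sum_abs sum_const sum_neg_distrib sum_ite_eq sum_insert sum_div)
open Filter (Tendsto)
open Real (sq_sqrt sqrt_nonneg exp norm_eq_abs)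
open Fintype (card_fin card_prod)
abbrev Pt (d : ℕ) := Fin d → ℤ
abbrev Mt (d : ℕ) := Fin d → Fin d → ℝ
abbrev Qt (d : ℕ) := Option (Fin d) → ℤ
abbrev SF (d : ℕ) := ℕ → Qt d → ℝ
abbrev EE (d : ℕ) := EuclideanSpace ℝ (Fin d)
abbrev Ix (d : ℕ) := Fin d × Fin d
abbrev Ze (d : ℕ) := ℝ × EE d
abbrev Op (d : ℕ) := Option (Fin d)
local notation "fnp" => (by fun_prop)
local notation "smp" => (by simp)
local notation "omg" => (by omega)
local notation "psv" => (by positivity)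
local notation "lna" => (by linarith)
local notation "nmn" => (by norm_num)
local notation "mof" => Matrix.of
variable {d k j : ℕ} {L a N K μ M Mp c0 C0 θ τ R x Y Cr Vt η B t b s κ C1 C2 LF G A lam δ e C T ε D σ ω χ Wt C5 : ℝ} {w p : Pt d} {W : Finset (Pt d)} {Z : List (Pt d)} {f : EE d → ℝ} {g : Pt d → ℝ} {c : Pt d → Pt d → ℝ} {F : SF d} {n : WithTop ℕ∞} {u r : Pt d → Mt d} {m : Mt d} {h g₀ : EE d → Mt d} {z : Ze d} {Bk : ℕ → ℝ}
lemma exi {α : Sort*} (a : α) : ∃ b, b = a := ⟨_, rfl⟩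

def EllM (L : ℝ) (a : Mt d) : Prop :=
  (∀ i j, a i j = a j i) ∧ ∀ ξ : Fin d → ℝ,
    L⁻¹ * ∑ i, ξ i ^ 2 ≤ ∑ i, ∑ j, a i j * ξ i * ξ j ∧
    ∑ i, ∑ j, a i j * ξ i * ξ j ≤ L * ∑ i, ξ i ^ 2

lemma quad_pair (a : Mt d) (hs : ∀ i j, a i j = a j i) (k l)
    (s) : ∑ i, ∑ j, a i j * ((Pi.single k 1 : Fin d → ℝ) i + s * (Pi.single l 1 : Fin d → ℝ) i)
      * ((Pi.single k 1 : Fin d → ℝ) j + s * (Pi.single l 1 : Fin d → ℝ) j)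
      = a k k + 2 * s * a k l + s ^ 2 * a l l := by
  have e : ∀ i j, a i j * ((Pi.single k 1 : Fin d → ℝ) i + s * (Pi.single l 1 : Fin d → ℝ) i)
      * ((Pi.single k 1 : Fin d → ℝ) j + s * (Pi.single l 1 : Fin d → ℝ) j)
      = (if k = j then (if k = i then a i j else 0) else 0)
        + s * (if l = j then (if k = i then a i j else 0) else 0)
        + s * (if k = j then (if l = i then a i j else 0) else 0)
        + s ^ 2 * (if l = j then (if l = i then a i j else 0) else 0) := by
    intro i j
    simp only [Pi.single_apply, eq_comm (a := i), eq_comm (a := j)]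
    split_ifs <;> ring
  simp only [e, sum_add_distrib, ← mul_sum, sum_ite_eq, Finset.mem_univ,
    if_true]
  rw [hs l k]
  ring

lemma quad_bound {a : Mt d} (hs : ∀ i j, a i j = a j i)
    (h0 : ∀ ξ : Fin d → ℝ, 0 ≤ ∑ i, ∑ j, a i j * ξ i * ξ j)
    (h1 : ∀ ξ : Fin d → ℝ, ∑ i, ∑ j, a i j * ξ i * ξ j ≤ L * ∑ i, ξ i ^ 2) (k l) :
    |a k l| ≤ L := by
  have hd : ∀ k, a k k ≤ L := by
    intro k
    have := h1 (fun i  ↦ (Pi.single k 1 : Fin d → ℝ) i + 0 * (Pi.single k 1 : Fin d → ℝ) i)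
    rw [quad_pair a hs k k 0] at this
    simpa [Pi.single_apply] using this
  have hp := h0 (fun i  ↦ (Pi.single k 1 : Fin d → ℝ) i + 1 * (Pi.single l 1 : Fin d → ℝ) i)
  have hm := h0 (fun i  ↦ (Pi.single k 1 : Fin d → ℝ) i + (-1) * (Pi.single l 1 : Fin d → ℝ) i)
  rw [quad_pair a hs] at hp hm
  have := hd k
  have := hd l
  rw [abs_le]; constructor <;> nlinarith

lemma EllM.bound (hL : 0 < L) {a : Mt d} (h : EllM L a) (i j) :
    |a i j| ≤ L :=
  quad_bound h.1 (fun ξ  ↦ le_trans psv (h.2 ξ).1) (fun ξ  ↦ (h.2 ξ).2) i j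

lemma isCompact_EllM (hL : 0 < L) :
    IsCompact {a : Mt d | EllM L a} := by
  refine Metric.isCompact_of_isClosed_isBounded ?_ ?_
  · have : {a : Mt d | EllM L a} =
      (⋂ i, ⋂ j, {a | a i j = a j i}) ∩ ⋂ ξ : Fin d → ℝ,
        ({a | L⁻¹ * ∑ i, ξ i ^ 2 ≤ ∑ i, ∑ j, a i j * ξ i * ξ j} ∩
        {a | ∑ i, ∑ j, a i j * ξ i * ξ j ≤ L * ∑ i, ξ i ^ 2}) := by
      ext a
      simp [EllM, forall_and]
    rw [this]
    refine IsClosed.inter (isClosed_iInter fun i  ↦ isClosed_iInter fun j  ↦ ?_)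
      (isClosed_iInter fun ξ  ↦ IsClosed.inter ?_ ?_)
    · exact isClosed_eq fnp fnp
    · exact isClosed_le fnp fnp
    · exact isClosed_le fnp fnp
  · refine (Metric.isBounded_iff_subset_closedBall 0).2 ⟨L, fun a ha  ↦ ?_⟩
    rw [mem_closedBall_zero_iff, pi_norm_le_iff_of_nonneg hL.le]
    intro i
    rw [pi_norm_le_iff_of_nonneg hL.le]
    intro j
    exact EllM.bound hL ha i j

lemma psd_decomp (m : Mt d) (hs : ∀ i j, m i j = m j i)
    (h0 : ∀ ξ : Fin d → ℝ, 0 ≤ ∑ i, ∑ j, m i j * ξ i * ξ j) :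
    ∃ B : Mt d, ∀ i j, m i j = ∑ k, B k i * B k j := by
  have hp : (mof m).PosSemidef := by
    refine Matrix.PosSemidef.of_dotProduct_mulVec_nonneg ?_ ?_
    · ext i j
      simp [hs i j]
    · intro x
      have := h0 x
      simp only [dotProduct, Matrix.mulVec, mul_sum, Matrix.of_apply]
      refine this.trans_eq (sum_congr rfl fun i _  ↦ sum_congr rfl fun j _  ↦ ?_)
      simp only [Pi.star_apply, star_trivial]
      ring
  open scoped MatrixOrder in
  obtain ⟨B, hB⟩ := CStarAlgebra.nonneg_iff_eq_star_mul_self.mp hp.nonneg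
  refine ⟨B, fun i j  ↦ ?_⟩
  have := congrFun (congrFun hB i) j
  simpa [Matrix.mul_apply, Matrix.star_apply] using this

def bx (d : ℕ) (N : ℕ) : Finset (Pt d) := Finset.Icc (fun _  ↦ -(N:ℤ)) (fun _  ↦ (N:ℤ))

lemma mem_bx {N} : w ∈ bx d N ↔ ∀ i, |w i| ≤ N := by
  simp only [bx, Finset.mem_Icc, Pi.le_def, ← forall_and, abs_le]

def ee (i : Fin d) : Pt d := Pi.single i 1

def lw (w : Pt d) (m : Mt d) : ℝ :=
  (1/4) * ∑ i, ∑ j, m i j * ((if ee i + ee j = w then 1 else 0) - (if ee i - ee j = w then 1 else 0))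

lemma ee_mem {N} (hN : 2 ≤ N) (i j) : ee i + ee j ∈ bx d N ∧ ee i - ee j ∈ bx d N := by
  constructor <;> rw [mem_bx] <;> intro k <;> simp only [ee, Pi.add_apply, Pi.sub_apply, Pi.single_apply] <;>
    split_ifs <;> norm_num <;> omega

lemma lw_sum {N} (hN : 2 ≤ N) (m) (hs : ∀ i j, m i j = m j i) (k l) :
    ∑ w ∈ bx d N, lw w m * w k * w l = m k l := by
  have e : ∀ w, lw w m * w k * w l = ∑ i, ∑ j, (1/4) * m i j *
      ((if ee i + ee j = w then ((w k : ℝ) * w l) else 0) - (if ee i - ee j = w then ((w k : ℝ) * w l) else 0)) := by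
    intro w
    simp only [lw, mul_sum, sum_mul]
    refine sum_congr rfl fun i _  ↦ sum_congr rfl fun j _  ↦ ?_
    split_ifs <;> ring
  simp only [e]
  rw [sum_comm]
  simp_rw [sum_comm (s := bx d N), ← mul_sum, sum_sub_distrib, sum_ite_eq,
    ee_mem hN, if_true]
  have e2 : ∀ i j, 1/4 * m i j * ((((ee i + ee j) k : ℤ) : ℝ) * ((ee i + ee j) l : ℤ) -
      (((ee i - ee j) k : ℤ):ℝ) * ((ee i - ee j) l : ℤ)) =
      (if l = j then (if k = i then 1/2 * m i j else 0) else 0)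
      + (if k = j then (if l = i then 1/2 * m i j else 0) else 0) := by
    intro i j
    simp only [ee, Pi.add_apply, Pi.sub_apply, Pi.single_apply]
    split_ifs <;> norm_num <;> ring
  simp only [e2, sum_add_distrib, sum_ite_eq, Finset.mem_univ, if_true]
  rw [hs l k]
  ring

lemma lw_bound (w : Pt d) (m e) (he : ∀ i j, |m i j| ≤ e) :
    |lw w m| ≤ d ^ 2 * e := by
  have : |lw w m| ≤ (1/4) * ∑ i : Fin d, ∑ j : Fin d, e * 1 := by
    unfold lw
    rw [abs_mul, abs_of_pos (by norm_num : (0:ℝ) < 1/4)]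
    gcongr
    refine (abs_sum_le_sum_abs _ _).trans (sum_le_sum fun i _  ↦ ?_)
    refine (abs_sum_le_sum_abs _ _).trans (sum_le_sum fun j _  ↦ ?_)
    rw [abs_mul]
    have := he i j
    have h0 := (abs_nonneg _).trans this
    gcongr
    split_ifs <;> norm_num
  refine this.trans ?_
  simp only [sum_const, Finset.card_univ, card_fin, nsmul_eq_mul, mul_one]
  rcases Nat.eq_zero_or_pos d with h | h
  · subst h
    simp
  · have h0 := (abs_nonneg _).trans (he ⟨0, h⟩ ⟨0, h⟩)
    nlinarith [mul_nonneg (sq_nonneg (d:ℝ)) h0]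

lemma lw_zero (w) (hw : w ∉ bx d 2) (m) : lw w m = 0 := by
  unfold lw
  have : ∀ i j, ee i + ee j ≠ w ∧ ee i - ee j ≠ w := fun i j  ↦
    ⟨fun h  ↦ hw (h ▸ (ee_mem le_rfl i j).1), fun h  ↦ hw (h ▸ (ee_mem le_rfl i j).2)⟩
  simp [this]

lemma lw_continuous (w) : Continuous (lw w : (Mt d) → ℝ) := by
  unfold lw
  fun_prop

lemma bx_quad (s : Finset (Pt d)) (ξ : Fin d → ℝ) :
    ∑ i, ∑ j, (∑ w ∈ s, (w i : ℝ) * w j) * ξ i * ξ j = ∑ w ∈ s, (∑ i, (w i) * ξ i) ^ 2 := by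
  simp only [sum_mul, sq, mul_sum]
  simp_rw [sum_comm (t := s)]
  refine sum_congr rfl fun w _  ↦ ?_
  rw [sum_comm]
  exact sum_congr rfl fun i _  ↦ sum_congr rfl fun j _  ↦ by ring

lemma bx_quad_bound (s : Finset (Pt d)) : ∃ C > 0, ∀ ξ : Fin d → ℝ,
    ∑ w ∈ s, (∑ i, (w i) * ξ i) ^ 2 ≤ C * ∑ i, ξ i ^ 2 := by
  refine ⟨1 + ∑ w ∈ s, ∑ i, (w i : ℝ) ^ 2, by positivity, fun ξ  ↦ ?_⟩
  calc _ ≤ ∑ w ∈ s, (∑ i, (w i : ℝ) ^ 2) * ∑ i, ξ i ^ 2 :=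
        sum_le_sum fun w _  ↦ Finset.sum_mul_sq_le_sq_mul_sq _ _ _
    _ ≤ _ := by
        rw [← sum_mul]
        have : 0 ≤ ∑ i, ξ i ^ 2 := by positivity
        nlinarith

lemma stencil_pt (d L) (hL : 1 ≤ L) : ∃ N, 2 ≤ N ∧ ∃ σ > 0, ∀ a,
    EllM L a → ∃ c : (Pt d) → ℝ, (∀ w ∈ bx d N, σ ≤ c w) ∧
      ∀ i j, ∑ w ∈ bx d N, c w * w i * w j = 2 * a i j := by
  have hL0 : 0 < L := by linarith
  obtain ⟨C2, hC2, hq2⟩ := bx_quad_bound (bx d 2)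
  set μ : ℝ := 1 / (2 * L * C2) with hμ
  have hμ0 : 0 < μ := by positivity
  obtain ⟨M, hM⟩ := exists_nat_ge (1 + 2 * (d:ℝ) ^ 3 * (4 * L + 1) / μ)
  have hM1 : (1:ℝ) ≤ M := le_trans (by have : 0 ≤ 2 * (d:ℝ) ^ 3 * (4 * L + 1) / μ := by positivity
                                       linarith) hM
  have hM0 : (0:ℝ) < M := by linarith
  obtain ⟨N, hN⟩ := exists_nat_ge (2 + M * (2 * L) + 1)
  have hN2 : 2 ≤ N := by
    have : (2:ℝ) ≤ N := le_trans (by nlinarith) hN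
    exact_mod_cast this
  obtain ⟨CN, hCN, hqN⟩ := bx_quad_bound (bx d N)
  set σ : ℝ := 1 / (2 * L * CN) with hσ
  have hσ0 : 0 < σ := by positivity
  refine ⟨N, hN2, σ, hσ0, fun a ha  ↦ ?_⟩
  set m : Mt d := fun i j  ↦ 2 * a i j - μ * (∑ w ∈ bx d 2, (w i : ℝ) * w j)
    - σ * (∑ w ∈ bx d N, (w i : ℝ) * w j) with hm
  have hms : ∀ i j, m i j = m j i := by
    intro i j
    simp only [hm, ha.1 i j, mul_comm]
  have hmq : ∀ ξ : Fin d → ℝ, ∑ i, ∑ j, m i j * ξ i * ξ j = 2 * (∑ i, ∑ j, a i j * ξ i * ξ j)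
      - μ * (∑ w ∈ bx d 2, (∑ i, (w i : ℝ) * ξ i) ^ 2)
      - σ * (∑ w ∈ bx d N, (∑ i, (w i : ℝ) * ξ i) ^ 2) := by
    intro ξ
    rw [← bx_quad, ← bx_quad]
    simp only [hm, mul_sum (s := Finset.univ), ← sum_sub_distrib]
    exact sum_congr rfl fun i _  ↦ sum_congr rfl fun j _  ↦ by ring
  have h0 : ∀ ξ : Fin d → ℝ, 0 ≤ ∑ i, ∑ j, m i j * ξ i * ξ j := by
    intro ξ
    rw [hmq]
    have h1 := (ha.2 ξ).1
    have h2 := mul_le_mul_of_nonneg_left (hq2 ξ) hμ0.le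
    have h3 := mul_le_mul_of_nonneg_left (hqN ξ) hσ0.le
    have e2 : μ * (C2 * ∑ i, ξ i ^ 2) = L⁻¹ * (∑ i, ξ i ^ 2) / 2 := by rw [hμ]; field_simp
    have e3 : σ * (CN * ∑ i, ξ i ^ 2) = L⁻¹ * (∑ i, ξ i ^ 2) / 2 := by rw [hσ]; field_simp
    have : 0 ≤ L⁻¹ * ∑ i, ξ i ^ 2 := by positivity
    linarith
  obtain ⟨B, hB⟩ := psd_decomp m hms h0
  have hBb : ∀ k i, |B k i| ≤ 2 * L := by
    intro k i
    have h1 : |m i i| ≤ 2 * L := by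
      refine quad_bound hms h0 (fun ξ  ↦ ?_) i i
      rw [hmq]
      have := (ha.2 ξ).2
      have : 0 ≤ μ * (∑ w ∈ bx d 2, (∑ i, (w i : ℝ) * ξ i) ^ 2) := by positivity
      have : 0 ≤ σ * (∑ w ∈ bx d N, (∑ i, (w i : ℝ) * ξ i) ^ 2) := by positivity
      linarith
    have h2 : B k i * B k i ≤ m i i := by
      rw [hB]
      exact single_le_sum (f := fun k  ↦ B k i * B k i) (fun k _  ↦ mul_self_nonneg _)
        (Finset.mem_univ k)
    have h3 := (abs_le.1 h1).2
    rw [← sq_le_sq₀ (abs_nonneg _) psv, sq_abs]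
    nlinarith
  set W : Fin d → Pt d := fun k i  ↦ round (M * B k i) with hW
  have hr : ∀ k i, |M * B k i - W k i| ≤ 1 / 2 := fun k i  ↦ abs_sub_round _
  have hWm : ∀ k, W k ∈ bx d N := by
    intro k
    rw [mem_bx]
    intro i
    have : |(W k i : ℝ)| ≤ N := by
      have h1 := hr k i
      have h2 := hBb k i
      have h3 : |(M:ℝ) * B k i| ≤ M * (2 * L) := by
        rw [abs_mul, abs_of_pos hM0]
        gcongr
      have := abs_sub_abs_le_abs_sub ((W k i : ℝ)) (M * B k i)
      rw [abs_sub_comm] at this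
      linarith
    exact_mod_cast this
  set E : Mt d := fun i j  ↦ ∑ k, ((M:ℝ)⁻¹ ^ 2 * (W k i) * W k j) - m i j with hE
  have hEs : ∀ i j, E i j = E j i := by
    intro i j
    simp only [hE, hms i j]
    congr 1
    exact sum_congr rfl fun k _  ↦ by ring
  have hEb : ∀ i j, |E i j| ≤ d * ((4 * L + 1) / M) := by
    intro i j
    have : E i j = ∑ k, ((M:ℝ)⁻¹ ^ 2 * (W k i) * W k j - B k i * B k j) := by
      simp only [hE, hB, sum_sub_distrib]
    rw [this]
    refine (abs_sum_le_sum_abs _ _).trans ?_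
    have : ∀ k ∈ Finset.univ, |(M:ℝ)⁻¹ ^ 2 * (W k i) * W k j - B k i * B k j| ≤ (4 * L + 1) / M := by
      intro k _
      have e : (M:ℝ)⁻¹ ^ 2 * (W k i) * W k j - B k i * B k j =
        (-(M * B k i - W k i) * ((W k j) / M) - B k i * (M * B k j - W k j)) / M := by
        field_simp
        ring
      rw [e, abs_div, abs_of_pos hM0]
      gcongr
      have h1 := hr k i
      have h2 := hr k j
      have h3 : |(W k j : ℝ) / M| ≤ 2 * L + 1 := by
        rw [abs_div, abs_of_pos hM0, div_le_iff₀ hM0]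
        have h3 : |(M:ℝ) * B k j| ≤ M * (2 * L) := by
          rw [abs_mul, abs_of_pos hM0]
          gcongr
          exact hBb k j
        have := abs_sub_abs_le_abs_sub ((W k j : ℝ)) (M * B k j)
        rw [abs_sub_comm] at this
        nlinarith
      refine (abs_sub _ _).trans ?_
      rw [abs_mul, abs_mul, abs_neg]
      have := hBb k i
      calc _ ≤ 1/2 * (2 * L + 1) + 2 * L * (1/2) := by gcongr
        _ ≤ _ := by linarith
    refine (sum_le_sum this).trans ?_
    simp
  refine ⟨fun w  ↦ (if w ∈ bx d 2 then μ else 0) + σ + (∑ k, if W k = w then (M:ℝ)⁻¹ ^ 2 else 0)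
    + lw w (fun i j  ↦ - E i j), fun w _  ↦ ?_, fun i j  ↦ ?_⟩
  · have h1 : 0 ≤ ∑ k, if W k = w then (M:ℝ)⁻¹ ^ 2 else 0 :=
      sum_nonneg fun k _  ↦ by split_ifs <;> positivity
    by_cases hw : w ∈ bx d 2
    · have := lw_bound w (fun i j  ↦ - E i j) (d * ((4 * L + 1) / M)) (fun i j  ↦ by
        rw [abs_neg]
        exact hEb i j)
      have h2 : (d:ℝ) ^ 2 * (d * ((4 * L + 1) / M)) ≤ μ := by
        have : 2 * (d:ℝ) ^ 3 * (4 * L + 1) / μ ≤ M := by linarith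
        rw [div_le_iff₀ hμ0] at this
        rw [show (d:ℝ) ^ 2 * (d * ((4 * L + 1) / M)) = (d^3 * (4 * L + 1)) / M by ring,
          div_le_iff₀ hM0]
        have : 0 ≤ (d:ℝ) ^ 3 * (4 * L + 1) := by positivity
        linarith
      have := (abs_le.1 this).1
      simp only [hw, if_true]
      linarith
    · simp only [hw, if_false, lw_zero w hw]
      linarith
  · have e : ∀ w : Pt d, ((if w ∈ bx d 2 then μ else 0) + σ +
        (∑ k, if W k = w then (M:ℝ)⁻¹ ^ 2 else 0)
        + lw w (fun i j  ↦ - E i j)) * w i * w j = μ * (if w ∈ bx d 2 then (w i : ℝ) * w j else 0)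
        + σ * ((w i : ℝ) * w j) + (∑ k, if W k = w then (M:ℝ)⁻¹ ^ 2 * w i * w j else 0)
        + lw w (fun i j  ↦ - E i j) * w i * w j := by
      intro w
      rw [add_mul, add_mul, add_mul, add_mul, add_mul, add_mul, sum_mul, sum_mul]
      congr 2
      · split_ifs <;> ring
      · refine sum_congr rfl fun k _  ↦ ?_
        split_ifs <;> ring
    simp only [e, sum_add_distrib, ← mul_sum]
    rw [lw_sum hN2 _ (fun i j  ↦ by rw [hEs]), sum_comm (s := bx d N)]
    simp only [sum_ite_eq, hWm, if_true]
    rw [← Finset.sum_filter]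
    have : (bx d N).filter (fun w  ↦ w ∈ bx d 2) = bx d 2 := by
      ext w
      simp only [Finset.mem_filter, mem_bx]
      refine ⟨fun h  ↦ h.2, fun h  ↦ ⟨fun i  ↦ (h i).trans (by exact_mod_cast hN2), h⟩⟩
    rw [this]
    simp only [hE, hm]
    ring

abbrev Pol (d : ℕ) := MvPolynomial (Ix d) ℝ

def ev (a : Mt d) (p : Pol d) : ℝ :=
  MvPolynomial.eval (fun ij : Ix d  ↦ a ij.1 ij.2) p

lemma ev_continuous (p : Pol d) : Continuous (fun a  ↦ ev a p) := by
  unfold ev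
  exact (MvPolynomial.continuous_eval p).comp fnp

lemma poly_approx {K : Set (Mt d)} (hK : IsCompact K) (f : C(K, ℝ)) (e)
    (he : 0 < e) : ∃ p, ∀ a : K, |ev a.1 p - f a| < e := by
  have : CompactSpace K := isCompact_iff_compactSpace.1 hK
  let φ : Pol d →ₐ[ℝ] C(K, ℝ) := MvPolynomial.aeval
    (fun ij : Ix d  ↦ (⟨fun a  ↦ a.1 ij.1 ij.2,
      (by fun_prop : Continuous fun a : Mt d  ↦ a ij.1 ij.2).comp continuous_subtype_val⟩ : C(K, ℝ)))
  have hφ : ∀ p (a : K), φ p a = ev a.1 p := by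
    intro p a
    induction p using MvPolynomial.induction_on with
    | C r => simp [φ, ev]
    | add p q hp hq => rw [map_add, ContinuousMap.add_apply, hp, hq]; simp [ev]
    | mul_X p i hp => rw [map_mul, ContinuousMap.mul_apply, hp]; simp [ev, φ]
  obtain ⟨⟨g, hg⟩, hgf⟩ := ContinuousMap.exists_mem_subalgebra_near_continuousMap_of_separatesPoints
    φ.range (by
      intro a b hab
      have : ∃ i j, a.1 i j ≠ b.1 i j := by
        by_contra! h
        exact hab (Subtype.ext (funext fun i  ↦ funext fun j  ↦ h i j))
      obtain ⟨i, j, hij⟩ := this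
      refine ⟨_, ⟨φ (MvPolynomial.X (i, j)), ⟨_, rfl⟩, rfl⟩, ?_⟩
      simpa [φ] using hij) f e he
  obtain ⟨p, rfl⟩ := hg
  refine ⟨p, fun a  ↦ ?_⟩
  rw [ContinuousMap.norm_lt_iff _ he] at hgf
  have := hgf a
  rw [← hφ]
  simpa using this

set_option maxHeartbeats 1000000 in
theorem stencil (d : ℕ) (L : ℝ) (hL : 1 ≤ L) : ∃ N : ℕ, 2 ≤ N ∧ ∃ c : (Pt d) → Pol d,
    ∃ c0 > 0, ∃ C0 : ℝ, (∀ w, c (-w) = c w) ∧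
    (∀ a, EllM L a → ∀ w ∈ bx d N, c0 ≤ ev a (c w) ∧ ev a (c w) ≤ C0) ∧
    (∀ a : Mt d, (∀ i j, a i j = a j i) → ∀ i j,
      ∑ w ∈ bx d N, ev a (c w) * w i * w j = 2 * a i j) := by
  obtain ⟨N, hN, σ, hσ, hpt⟩ := stencil_pt d L hL
  refine ⟨N, hN, ?_⟩
  have hL0 : 0 < L := by linarith
  have hKc := isCompact_EllM (d := d) hL0
  set K := {a : Mt d | EllM L a} with hKd
  have : CompactSpace K := isCompact_iff_compactSpace.1 hKc
  obtain ⟨g, hg⟩ := exists_continuous_forall_mem_convex_of_local (X := K)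
    (E := (Pt d) → ℝ) (t := fun a  ↦ {c | (∀ w ∈ bx d N, σ / 2 < c w) ∧
      ∀ i j, ∑ w ∈ bx d N, c w * w i * w j = 2 * a.1 i j})
    (by
      intro a c hc cz hcp s t hs ht hst
      refine ⟨fun w hw  ↦ ?_, fun i j  ↦ ?_⟩
      · have h1 := hc.1 w hw
        have h2 := hcp.1 w hw
        simp only [Pi.add_apply, Pi.smul_apply, smul_eq_mul]
        have : σ / 2 = s * (σ / 2) + t * (σ / 2) := by rw [← add_mul, hst, one_mul]
        rw [this]
        rcases hs.eq_or_lt with h | h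
        · subst h
          have : t = 1 := by linarith
          subst this
          linarith
        · have := mul_lt_mul_of_pos_left h1 h
          have := mul_le_mul_of_nonneg_left h2.le ht
          linarith
      · have h1 := hc.2 i j
        have h2 := hcp.2 i j
        simp only [Pi.add_apply, Pi.smul_apply, smul_eq_mul]
        have e : ∀ w, (s * c w + t * cz w) * w i * w j = s * (c w * w i * w j)
          + t * (cz w * w i * w j) := fun w  ↦ by ring
        simp only [e, sum_add_distrib, ← mul_sum, h1, h2]
        rw [← add_mul, hst, one_mul])
    (by
      intro b
      obtain ⟨c, hc1, hc2⟩ := hpt b.1 b.2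
      have hcont : ∀ w, Continuous (fun a : K  ↦ c w + lw w (fun i j  ↦ 2 * (a.1 i j - b.1 i j))) :=
        fun w  ↦ continuous_const.add ((lw_continuous w).comp ((by fun_prop :
          Continuous fun (a : Mt d) i j  ↦ 2 * (a i j - b.1 i j)).comp continuous_subtype_val))
      refine ⟨{a | ∀ w ∈ bx d N, σ / 2 < c w + lw w (fun i j  ↦ 2 * (a.1 i j - b.1 i j))}, ?_,
        fun a w  ↦ c w + lw w (fun i j  ↦ 2 * (a.1 i j - b.1 i j)), ?_, ?_⟩
      · have : ∀ w ∈ bx d N, ∀ᶠ a in nhds b, σ / 2 < c w + lw w (fun i j  ↦ 2 * (a.1 i j - b.1 i j)) := by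
          intro w hw
          have := (hcont w).tendsto b
          refine this.eventually_const_lt ?_
          have := hc1 w hw
          have e : lw w (fun i j  ↦ 2 * (b.1 i j - b.1 i j)) = 0 := by simp [lw]
          rw [e]
          linarith
        exact (Filter.eventually_all_finset (bx d N)).2 this
      · exact (continuous_pi hcont).continuousOn
      · intro a ha
        refine ⟨ha, fun i j  ↦ ?_⟩
        simp only [add_mul, sum_add_distrib, hc2]
        rw [lw_sum hN _ (fun i j  ↦ by rw [a.2.1 i j, b.2.1 i j])]
        ring)
  obtain ⟨CN, hCN0, hCN⟩ : ∃ CN, 0 < CN ∧ ∀ i j, ∑ w ∈ bx d N, |(w i : ℝ) * w j| ≤ CN := by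
    refine ⟨1 + ∑ w ∈ bx d N, (N:ℝ) * N, by positivity, fun i j  ↦ ?_⟩
    have : ∑ w ∈ bx d N, |(w i : ℝ) * w j| ≤ ∑ w ∈ bx d N, (N:ℝ) * N := by
      refine sum_le_sum fun w hw  ↦ ?_
      rw [mem_bx] at hw
      rw [abs_mul]
      have h1 : |(w i : ℝ)| ≤ N := by exact_mod_cast hw i
      have h2 : |(w j : ℝ)| ≤ N := by exact_mod_cast hw j
      gcongr
    linarith
  set η : ℝ := σ / (4 * (1 + d ^ 2 * CN)) with hη
  have hη0 : 0 < η := by positivity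
  have hap : ∀ w, ∃ p, ∀ a : K, |ev a.1 p - g a w| < η := fun w  ↦
    poly_approx hKc ⟨fun a  ↦ g a w, (continuous_apply w).comp g.continuous⟩ η hη0
  choose P hP using hap
  let Rm : Fin d → Fin d → Pol d := fun i j  ↦ MvPolynomial.X (i, j) + MvPolynomial.X (j, i)
    - ∑ w ∈ bx d N, P w * MvPolynomial.C ((w i : ℝ) * w j)
  let c1 : (Pt d) → Pol d := fun w  ↦ P w + MvPolynomial.C (1/4 : ℝ) *
    ∑ i, ∑ j, Rm i j * MvPolynomial.C ((if ee i + ee j = w then 1 else 0) - (if ee i - ee j = w then 1 else 0))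
  have hRm : ∀ (a : Mt d) i j, ev a (Rm i j) = a i j + a j i - ∑ w ∈ bx d N, ev a (P w) * (w i * w j) := by
    intro a i j
    simp [ev, Rm, map_sum]
  have hc1 : ∀ (a : Mt d) w, ev a (c1 w) = ev a (P w) + lw w (fun i j  ↦ ev a (Rm i j)) := by
    intro a w
    simp [ev, c1, lw, map_sum]
  have hsum1 : ∀ a, (∀ i j, a i j = a j i) → ∀ i j,
      ∑ w ∈ bx d N, ev a (c1 w) * w i * w j = 2 * a i j := by
    intro a ha i j
    simp only [hc1, add_mul, sum_add_distrib]
    rw [lw_sum hN]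
    · rw [hRm, ha j i]
      simp only [mul_assoc]
      ring
    · intro i j
      rw [hRm, hRm, add_comm]
      congr 1
      exact sum_congr rfl fun w _  ↦ by ring
  have hlow1 : ∀ a, EllM L a → ∀ w ∈ bx d N, σ / 4 ≤ ev a (c1 w) := by
    intro a ha w hw
    rw [hc1]
    have h1 := (hg ⟨a, ha⟩).1 w hw
    have h2 := hP w ⟨a, ha⟩
    have h3 : |lw w (fun i j  ↦ ev a (Rm i j))| ≤ d ^ 2 * (η * CN) := by
      refine lw_bound w _ _ fun i j  ↦ ?_
      rw [hRm, ha.1 j i]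
      have h4 := (hg ⟨a, ha⟩).2 i j
      have : a i j + a i j - ∑ w ∈ bx d N, ev a (P w) * (w i * w j) =
          ∑ w ∈ bx d N, (g ⟨a, ha⟩ w - ev a (P w)) * (w i * w j) := by
        simp only [sub_mul, sum_sub_distrib]
        simp only [mul_assoc] at h4 ⊢
        rw [h4]
        ring
      rw [this]
      refine (abs_sum_le_sum_abs _ _).trans ?_
      refine le_trans (sum_le_sum (g := fun w  ↦ η * |(w i : ℝ) * w j|) fun w _  ↦ ?_) ?_
      · rw [abs_mul]
        gcongr
        have := hP w ⟨a, ha⟩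
        rw [abs_sub_comm] at this
        exact this.le
      · rw [← mul_sum]
        gcongr
        exact hCN i j
    have h5 : η + d ^ 2 * (η * CN) = σ / 4 := by rw [hη]; field_simp
    have := (abs_lt.1 h2).1
    have := (abs_le.1 h3).1
    simp only at *
    linarith
  let c : (Pt d) → Pol d := fun w  ↦ MvPolynomial.C (1/2 : ℝ) * (c1 w + c1 (-w))
  have hc : ∀ (a : Mt d) w, ev a (c w) = 1/2 * (ev a (c1 w) + ev a (c1 (-w))) := by
    intro a w
    simp [ev, c]
  have hneg : ∀ w, w ∈ bx d N → -w ∈ bx d N := by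
    intro w hw
    rw [mem_bx] at *
    simpa using hw
  have hup : ∃ C0, ∀ a, EllM L a → ∀ w ∈ bx d N, ev a (c w) ≤ C0 := by
    have : ∀ w, ∃ C, ∀ a ∈ K, ev a (c w) ≤ C := by
      intro w
      obtain ⟨C, hC⟩ := (hKc.image (ev_continuous (c w))).bddAbove
      exact ⟨C, fun a ha  ↦ hC ⟨a, ha, rfl⟩⟩
    choose C hC using this
    refine ⟨∑ w ∈ bx d N, |C w|, fun a ha w hw  ↦ (hC w a ha).trans ((le_abs_self _).trans ?_)⟩
    exact single_le_sum (f := fun w  ↦ |C w|) (fun _ _  ↦ abs_nonneg _) hw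
  obtain ⟨C0, hC0⟩ := hup
  refine ⟨c, σ / 4, by positivity, C0, fun w  ↦ ?_, fun a ha w hw  ↦ ⟨?_, hC0 a ha w hw⟩, fun a ha i j  ↦ ?_⟩
  · show MvPolynomial.C (1/2 : ℝ) * (c1 (-w) + c1 (- -w)) = MvPolynomial.C (1/2 : ℝ) * (c1 w + c1 (-w))
    rw [neg_neg, add_comm (c1 (-w))]
  · rw [hc]
    have := hlow1 a ha w hw
    have := hlow1 a ha (-w) (hneg w hw)
    linarith
  · have e : ∀ w, ev a (c w) * w i * w j = 1/2 * (ev a (c1 w) * w i * w j)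
      + 1/2 * (ev a (c1 (-w)) * (-w) i * (-w) j) := by
      intro w
      rw [hc]
      simp
      ring
    simp only [e, sum_add_distrib, ← mul_sum]
    have : ∑ w ∈ bx d N, ev a (c1 (-w)) * ((-w) i : ℤ) * ((-w) j : ℤ) = ∑ w ∈ bx d N, ev a (c1 w) * w i * w j :=
      Finset.sum_bij' (fun w _  ↦ -w) (fun w _  ↦ -w) (fun w hw  ↦ hneg w hw) (fun w hw  ↦ hneg w hw)
        smp smp smp
    rw [this, hsum1 a ha]
    ring

def DD (μ : ℝ) (w : Pt d) (f : Pt d → ℝ) : Pt d → ℝ := fun p  ↦ μ * (f (p + w) - f p)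

def sh (w : Pt d) (f : Pt d → ℝ) : Pt d → ℝ := fun p  ↦ f (p + w)

def TT (μ : ℝ) : List (Pt d) → (Pt d → ℝ) → Pt d → ℝ
  | [], f => f
  | w :: Z, f => TT μ Z (DD μ w f)

def ls (W : Finset (Pt d)) : ℕ → Finset (List (Pt d))
  | 0 => {[]}
  | k + 1 => (W ×ˢ ls W k).map ⟨fun x  ↦ x.1 :: x.2, fun x y h  ↦ by
      simp only [List.cons.injEq] at h; exact Prod.ext h.1 h.2⟩

def HH (W : Finset (Pt d)) (μ N : ℝ) : ℕ → ℝ → (Pt d → ℝ) → Prop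
  | 0, M, f => ∀ p, |f p| ≤ M * (1 + N)
  | k + 1, M, f => (∀ p, |f p| ≤ M) ∧ ∀ w ∈ W, HH W μ N k M (DD μ w f)

lemma mem_ls_succ :
    Z ∈ ls W (k + 1) ↔ ∃ w ∈ W, ∃ Zp ∈ ls W k, Z = w :: Zp := by
  simp only [ls, Finset.mem_map, Finset.mem_product, Prod.exists]
  constructor
  · rintro ⟨a, b, ⟨ha, hb⟩, rfl⟩
    exact ⟨a, ha, b, hb, rfl⟩
  · rintro ⟨a, ha, b, hb, rfl⟩
    exact ⟨a, b, ⟨ha, hb⟩, rfl⟩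

lemma sum_ls_succ (W k) (Φ : List (Pt d) → ℝ) :
    ∑ Z ∈ ls W (k + 1), Φ Z = ∑ w ∈ W, ∑ Z ∈ ls W k, Φ (w :: Z) := by
  simp only [ls, Finset.sum_map, Finset.sum_product]
  rfl

lemma mem_ls_cons
    (hw : w ∈ W) (hZ : Z ∈ ls W k) : w :: Z ∈ ls W (k + 1) := mem_ls_succ.2 ⟨w, hw, Z, hZ, rfl⟩

section ops
variable (μ : ℝ)

lemma DD_add (w : Pt d) (f g) : DD μ w (f + g) = DD μ w f + DD μ w g := by
  funext p
  simp only [DD, Pi.add_apply]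
  ring

lemma DD_smul (w : Pt d) (r : ℝ) (f) : DD μ w (r • f) = r • DD μ w f := by
  funext p
  simp only [DD, Pi.smul_apply, smul_eq_mul]
  ring

lemma DD_mul (w : Pt d) (f g) :
    DD μ w (f * g) = DD μ w f * g + sh w f * DD μ w g := by
  funext p
  simp only [DD, sh, Pi.mul_apply, Pi.add_apply]
  ring

lemma DD_comm (w v : Pt d) (f) : DD μ w (DD μ v f) = DD μ v (DD μ w f) := by
  funext p
  simp only [DD]
  rw [show p + w + v = p + v + w by abel]; ring

lemma DD_sh (w v : Pt d) (f) : DD μ w (sh v f) = sh v (DD μ w f) := by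
  funext p
  simp only [DD, sh]
  rw [show p + w + v = p + v + w by abel]

lemma DD_neg_DD (w : Pt d) (f) :
    DD μ (-w) (DD μ w f) = (-μ) • (DD μ w f + DD μ (-w) f) := by
  funext p
  simp only [DD, Pi.smul_apply, Pi.add_apply, smul_eq_mul]
  rw [neg_add_cancel_right]
  ring

lemma TT_add (Z : List (Pt d)) : ∀ (f g), TT μ Z (f + g) = TT μ Z f + TT μ Z g := by
  induction Z with
  | nil => intro f g; rfl
  | cons w Z ih => intro f g; simp only [TT, DD_add, ih]

lemma TT_smul (Z : List (Pt d)) (r : ℝ) : ∀ (f), TT μ Z (r • f) = r • TT μ Z f := by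
  induction Z with
  | nil => intro f; rfl
  | cons w Z ih => intro f; simp only [TT, DD_smul, ih]

lemma TT_zero (Z : List (Pt d)) : TT μ Z (0) = 0 := by
  have := TT_smul μ Z 0 0
  simpa using this

lemma TT_sum {ι : Type*} (s : Finset ι) (Z) (f : ι → Pt d → ℝ) :
    TT μ Z (∑ i ∈ s, f i) = ∑ i ∈ s, TT μ Z (f i) := by
  classical
  induction s using Finset.induction_on with
  | empty => simp [TT_zero]
  | insert a s ha ih => rw [sum_insert ha, sum_insert ha, TT_add, ih]

lemma TT_DD (Z : List (Pt d)) (w) : ∀ f, TT μ Z (DD μ w f) = DD μ w (TT μ Z f) := by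
  induction Z with
  | nil => intro f; rfl
  | cons v Z ih => intro f; simp only [TT]; rw [DD_comm, ih]

lemma DD_scale (r) (w : Pt d) (f) : DD (r * μ) w f = r • DD μ w f := by
  funext p
  simp only [DD, Pi.smul_apply, smul_eq_mul]
  ring

lemma TT_scale (r) (Z : List (Pt d)) : ∀ f,
    TT (r * μ) Z f = r ^ Z.length • TT μ Z f := by
  induction Z with
  | nil => intro f; simp [TT]
  | cons w Z ih => intro f; simp only [TT, DD_scale, ih, TT_smul, smul_smul, List.length_cons]; rw [pow_succ]

end ops

lemma ls_length : ∀ {Z}, Z ∈ ls W k → Z.length = k := by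
  induction k with
  | zero => intro Z hZ; simp only [ls, Finset.mem_singleton] at hZ; subst hZ; rfl
  | succ k ih =>
    intro Z hZ
    obtain ⟨w, _, Zp, hZp, rfl⟩ := mem_ls_succ.1 hZ
    simp [ih hZp]

section Hclass
variable (hN : 0 ≤ N)
include hN

lemma HH.nonneg {f} (h : HH W μ N k M f) : 0 ≤ M := by
  cases k with
  | zero =>
    have := (abs_nonneg _).trans (h 0)
    by_contra hM; push Not at hM
    have : M * (1 + N) < 0 := mul_neg_of_neg_of_pos hM lna
    linarith
  | succ k => exact (abs_nonneg _).trans (h.1 0)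

lemma HH.mono : ∀ {M Mp f}, HH W μ N k M f → M ≤ Mp → HH W μ N k Mp f := by
  induction k with
  | zero => intro M Mp f h hM p; exact (h p).trans (by gcongr)
  | succ k ih => intro M Mp f h hM; exact ⟨fun p  ↦ (h.1 p).trans hM, fun w hw  ↦ ih (h.2 w hw) hM⟩

lemma HH.down : ∀ {M f}, HH W μ N (k + 1) M f → HH W μ N k M f := by
  induction k with
  | zero =>
    intro M f h p
    have h0 := HH.nonneg hN h
    exact (h.1 p).trans (by nlinarith)
  | succ k ih => intro M f h; exact ⟨h.1, fun w hw  ↦ ih (h.2 w hw)⟩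

omit hN in
lemma HH.add : ∀ {M Mp f g}, HH W μ N k M f → HH W μ N k Mp g →
    HH W μ N k (M + Mp) (f + g) := by
  induction k with
  | zero =>
    intro M Mp f g hf hg p
    refine (abs_add_le _ _).trans ?_
    have := hf p
    have := hg p
    linarith
  | succ k ih =>
    intro M Mp f g hf hg
    refine ⟨fun p  ↦ (abs_add_le _ _).trans (add_le_add (hf.1 p) (hg.1 p)), fun w hw  ↦ ?_⟩
    rw [DD_add]
    exact ih (hf.2 w hw) (hg.2 w hw)

omit hN in
lemma HH.shift (v) : ∀ {M f}, HH W μ N k M f → HH W μ N k M (sh v f) := by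
  induction k with
  | zero => intro M f h p; exact h _
  | succ k ih => intro M f h; exact ⟨fun p  ↦ h.1 _, fun w hw  ↦ by rw [DD_sh]; exact ih (h.2 w hw)⟩

lemma HH.mul : ∀ {M Mp f g}, HH W μ N k M f → HH W μ N k Mp g →
    (∀ p, |g p| ≤ Mp) → HH W μ N k (2 ^ k * (M * Mp)) (f * g) := by
  induction k with
  | zero =>
    intro M Mp f g hf hg hb p
    have h0 := HH.nonneg hN hf
    have h1 := HH.nonneg hN hg
    rw [Pi.mul_apply, abs_mul]
    calc _ ≤ (M * (1 + N)) * Mp := mul_le_mul (hf p) (hb p) (abs_nonneg _) psv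
      _ = _ := by ring
  | succ k ih =>
    intro M Mp f g hf hg hb
    have h0 := HH.nonneg hN hf
    have h1 := HH.nonneg hN hg
    refine ⟨fun p  ↦ ?_, fun w hw  ↦ ?_⟩
    · rw [Pi.mul_apply, abs_mul]
      have : (1:ℝ) ≤ 2 ^ (k + 1) := one_le_pow₀ nmn
      calc _ ≤ M * Mp := mul_le_mul (hf.1 p) (hb p) (abs_nonneg _) h0
        _ ≤ _ := by nlinarith [mul_nonneg h0 h1]
    · rw [DD_mul]
      have a1 := ih (hf.2 w hw) (HH.down hN hg) hb
      have a2 := ih (hg.2 w hw) (HH.shift w (HH.down hN hf)) (fun p  ↦ hf.1 _)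
      rw [mul_comm (DD μ w g)] at a2
      refine HH.mono hN (HH.add a1 a2) (le_of_eq ?_)
      rw [pow_succ]
      ring

omit hN in
lemma HH.TT_le : ∀ {M f}, HH W μ N k M f → ∀ Z ∈ ls W k, ∀ p,
    |TT μ Z f p| ≤ M * (1 + N) := by
  induction k with
  | zero => intro M f h Z hZ p; simp only [ls, Finset.mem_singleton] at hZ; subst hZ; exact h p
  | succ k ih =>
    intro M f h Z hZ p
    obtain ⟨w, hw, Zp, hZp, rfl⟩ := mem_ls_succ.1 hZ
    exact ih (h.2 w hw) Zp hZp p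

lemma HH.mul_TT {f} (hf : HH W μ N k M f) (hg : HH W μ N k Mp g)
    (Z) (hZ : Z ∈ ls W k) (p) :
    |TT μ Z (f * g) p| ≤ 2 ^ k * (M * Mp) * (1 + N) ^ 2 := by
  have h0 := HH.nonneg hN hf
  have h1 := HH.nonneg hN hg
  cases k with
  | zero =>
    simp only [ls, Finset.mem_singleton] at hZ
    subst hZ
    simp only [TT, Pi.mul_apply, abs_mul]
    calc _ ≤ (M * (1 + N)) * (Mp * (1 + N)) := mul_le_mul (hf p) (hg p) (abs_nonneg _) psv
      _ = _ := by ring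
  | succ k =>
    refine ((HH.mul hN hf hg hg.1).TT_le Z hZ p).trans ?_
    gcongr
    nlinarith

lemma QL : ∀ {M B f v Vt p}, 0 ≤ B → HH W μ N j M f →
    (∀ p, |f p| ≤ M) → (∀ Y ∈ ls W j, |TT μ Y v p| ≤ Vt) → (∀ i, j = i + 1 → HH W μ N i B v) →
    ∀ Z ∈ ls W j, |TT μ Z (f * v) p| ≤ M * Vt + j * 2 ^ j * (M * B) * (1 + N) ^ 2 := by
  induction j with
  | zero =>
    intro M B f v Vt p hB hf hb hv _ Z hZ
    have h0 := HH.nonneg hN hf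
    have := hv Z hZ
    simp only [ls, Finset.mem_singleton] at hZ
    subst hZ
    simp only [TT, Pi.mul_apply, abs_mul] at *
    simp only [Nat.cast_zero, zero_mul, add_zero]
    exact mul_le_mul (hb p) this (abs_nonneg _) h0
  | succ j ih =>
    intro M B f v Vt p hB hf hb hv hi Z hZ
    have h0 := HH.nonneg hN hf
    obtain ⟨w, hw, Zp, hZp, rfl⟩ := mem_ls_succ.1 hZ
    have hvj := hi j rfl
    simp only [TT, DD_mul, TT_add, Pi.add_apply]
    have a1 := HH.mul_TT hN (hf.2 w hw) hvj Zp hZp p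
    have a2 := ih (p := p) (Vt := Vt) hB (HH.shift w (HH.down hN hf)) (fun p  ↦ hf.1 _)
      (v := DD μ w v) (fun Y hY  ↦ hv (w :: Y) (mem_ls_cons hw hY))
      (fun i hji  ↦ by subst hji; exact hvj.2 w hw) Zp hZp
    refine (abs_add_le _ _).trans ((add_le_add a1 a2).trans ?_)
    have e : ((j + 1 : ℕ) : ℝ) * 2 ^ (j + 1) * (M * B) * (1 + N) ^ 2 =
      (2 ^ j * (M * B) * (1 + N) ^ 2) + j * 2 ^ j * (M * B) * (1 + N) ^ 2
      + (j + 1) * (2 ^ j * (M * B) * (1 + N) ^ 2) := by push_cast; ring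
    have : 0 ≤ (j + 1 : ℝ) * (2 ^ j * (M * B) * (1 + N) ^ 2) := by positivity
    rw [e]
    linarith

lemma PR : ∀ {M B c v Vt p}, 0 ≤ B → 0 ≤ Vt →
    HH W μ N (j + 1) M c →
    (∀ w ∈ W, ∀ p, |DD μ w c p| ≤ M) → (∀ Y ∈ ls W j, |TT μ Y v p| ≤ Vt) →
    (∀ i, j = i + 1 → HH W μ N i B v) →
    ∀ Z ∈ ls W (j + 1), |TT μ Z (c * v) p - c (p + Z.sum) * TT μ Z v p| ≤
      (j + 1) * (M * Vt + j * 2 ^ j * (M * B) * (1 + N) ^ 2) := by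
  induction j with
  | zero =>
    intro M B c v Vt p hB hVt hc hD hv _ Z hZ
    obtain ⟨w, hw, Zp, hZp, rfl⟩ := mem_ls_succ.1 hZ
    simp only [ls, Finset.mem_singleton] at hZp
    subst hZp
    have h1 := hv [] (by simp [ls])
    simp only [TT, DD_mul, Pi.add_apply, Pi.mul_apply, sh, List.sum_cons, List.sum_nil, add_zero] at *
    rw [add_sub_cancel_right, abs_mul]
    simp only [Nat.cast_zero, zero_mul, add_zero, zero_add, one_mul]
    exact mul_le_mul (hD w hw p) h1 (abs_nonneg _) ((abs_nonneg _).trans (hD w hw p))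
  | succ j ih =>
    intro M B c v Vt p hB hVt hc hD hv hi Z hZ
    have h0 := HH.nonneg hN hc
    obtain ⟨w, hw, Zp, hZp, rfl⟩ := mem_ls_succ.1 hZ
    have hvj := hi j rfl
    simp only [TT, DD_mul, TT_add, Pi.add_apply]
    have a1 := QL hN (p := p) (Vt := Vt) hB (hc.2 w hw) (hD w hw) hv hi Zp hZp
    have a2 := ih (p := p) (Vt := Vt) hB hVt (HH.shift w (HH.down hN hc))
      (fun wp hwz p  ↦ by rw [DD_sh]; exact hD wp hwz _)
      (v := DD μ w v) (fun Y hY  ↦ hv (w :: Y) (mem_ls_cons hw hY))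
      (fun i hji  ↦ by subst hji; exact hvj.2 w hw) Zp hZp
    have e : c (p + (w :: Zp).sum) = sh w c (p + Zp.sum) := by
      simp only [sh, List.sum_cons]
      congr 1
      abel
    rw [e, add_sub_assoc]
    refine (abs_add_le _ _).trans ((add_le_add a1 a2).trans ?_)
    have : (j:ℝ) * 2 ^ j * (M * B) * (1 + N) ^ 2 ≤ ((j + 1 : ℕ) : ℝ) * 2 ^ (j + 1) * (M * B) * (1 + N) ^ 2 := by
      gcongr <;> norm_num
    push_cast at *
    have h2 : (j + 1 : ℝ) * (M * Vt + j * 2 ^ j * (M * B) * (1 + N) ^ 2) ≤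
      (j + 1 : ℝ) * (M * Vt + (j + 1) * 2 ^ (j + 1) * (M * B) * (1 + N) ^ 2) := by gcongr
    linarith

end Hclass

def Lop (W : Finset (Pt d)) (μ : ℝ) (c : Pt d → Pt d → ℝ) (f : Pt d → ℝ) : Pt d → ℝ :=
  fun p  ↦ μ * ∑ w ∈ W, c w p * DD μ w f p

section
variable (hW : ∀ w ∈ W, -w ∈ W)

include hW in
lemma sum_negW (Φ : Pt d → ℝ) : ∑ w ∈ W, Φ (-w) = ∑ w ∈ W, Φ w :=
  Finset.sum_bij' (fun w _  ↦ -w) (fun w _  ↦ -w) hW hW smp smp smp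

include hW in
lemma Lop_sym (hc : ∀ w, c (-w) = c w) (f) :
    Lop W μ c f = (-(1/2) : ℝ) • ∑ w ∈ W, c w * DD μ (-w) (DD μ w f) := by
  funext p
  have h := sum_negW hW (fun w  ↦ c w p * DD μ w f p)
  simp only [hc] at h
  simp only [DD_neg_DD, Pi.smul_apply, Finset.sum_apply, Pi.mul_apply, Pi.add_apply, smul_eq_mul, Lop]
  have e : ∀ w, c w p * (-μ * (DD μ w f p + DD μ (-w) f p)) = (-μ) * (c w p * DD μ w f p)
    + (-μ) * (c w p * DD μ (-w) f p) := fun w  ↦ by ring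
  simp only [e, sum_add_distrib, ← mul_sum]
  rw [h]
  ring

lemma Lop_sq (c : Pt d → Pt d → ℝ) (V p) (hμ : μ ≠ 0) :
    Lop W μ c (fun p  ↦ V p ^ 2) p = 2 * V p * Lop W μ c V p + ∑ w ∈ W, c w p * (DD μ w V p) ^ 2 := by
  simp only [Lop, mul_sum, ← sum_add_distrib]
  refine sum_congr rfl fun w _  ↦ ?_
  simp only [DD]
  ring

lemma Lop_sum {ι : Type*} (s : Finset ι) (c : Pt d → Pt d → ℝ) (V : ι → Pt d → ℝ) (p) :
    Lop W μ c (fun p  ↦ ∑ i ∈ s, V i p) p = ∑ i ∈ s, Lop W μ c (V i) p := by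
  simp only [Lop, DD, mul_sum]
  rw [sum_comm]
  refine sum_congr rfl fun w _  ↦ ?_
  rw [← mul_sum, ← mul_sum, ← mul_sum, sum_sub_distrib]

lemma onestep {V}
    (hμ : 0 < μ) (hτ : τ * μ ^ 2 = θ) (hτ0 : 0 ≤ τ) (hθ0 : 0 ≤ θ) (hc0 : 0 ≤ c0)
    (hc : ∀ w ∈ W, c0 ≤ c w p ∧ c w p ≤ C0) (hθ : 2 * θ * W.card * C0 ^ 2 ≤ c0 / 2)
    (hx : x = V p + τ * (Lop W μ c V p + R)) :
    x ^ 2 ≤ V p ^ 2 + τ * Lop W μ c (fun p  ↦ V p ^ 2) p - τ * (c0 / 2) * ∑ w ∈ W, (DD μ w V p) ^ 2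
      + 2 * τ * |V p| * |R| + 2 * τ ^ 2 * R ^ 2 := by
  rw [Lop_sq c V p hμ.ne']
  set S := ∑ w ∈ W, (DD μ w V p) ^ 2 with hS
  have h1 : c0 * S ≤ ∑ w ∈ W, c w p * (DD μ w V p) ^ 2 := by
    rw [hS, mul_sum]
    exact sum_le_sum fun w hw  ↦ by gcongr; exact (hc w hw).1
  have h2 : (Lop W μ c V p) ^ 2 ≤ μ ^ 2 * (W.card * C0 ^ 2 * S) := by
    simp only [Lop, mul_pow]
    gcongr
    refine sq_sum_le_card_mul_sum_sq.trans ?_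
    rw [mul_assoc]
    gcongr
    rw [hS, mul_sum]
    refine sum_le_sum fun w hw  ↦ ?_
    rw [mul_pow]
    have := hc w hw
    gcongr
    · linarith
    · exact this.2
  have hS0 : 0 ≤ S := sum_nonneg fun _ _  ↦ sq_nonneg _
  have h3 : 2 * τ ^ 2 * (Lop W μ c V p) ^ 2 ≤ τ * (c0 / 2) * S := by
    calc _ ≤ 2 * τ ^ 2 * (μ ^ 2 * (W.card * C0 ^ 2 * S)) := by gcongr
      _ = τ * (2 * (τ * μ ^ 2) * W.card * C0 ^ 2) * S := by ring
      _ ≤ τ * (c0 / 2) * S := by rw [hτ]; gcongr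
  have h4 : 2 * τ * V p * R ≤ 2 * τ * |V p| * |R| := by
    have := le_abs_self (V p * R)
    rw [abs_mul] at this
    nlinarith
  have h5 : τ * (c0 * S) ≤ τ * ∑ w ∈ W, c w p * (DD μ w V p) ^ 2 := by gcongr
  have h6 : τ ^ 2 * (Lop W μ c V p + R) ^ 2 ≤ 2 * τ ^ 2 * (Lop W μ c V p) ^ 2 + 2 * τ ^ 2 * R ^ 2 := by
    nlinarith [mul_nonneg (sq_nonneg τ) (sq_nonneg (Lop W μ c V p - R))]
  rw [hx]
  nlinarith

lemma avg_le {F}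
    (hτ : τ * μ ^ 2 = θ) (hθ0 : 0 ≤ θ) (hc0 : 0 ≤ c0)
    (hc : ∀ w ∈ W, c0 ≤ c w p ∧ c w p ≤ C0) (hθ : θ * (W.card * C0) ≤ 1 / 2) {y}
    (hY : ∀ q, F q ≤ Y) (hy : F p ≤ y) (hyY : y ≤ Y) :
    F p + τ * Lop W μ c F p ≤ (y + Y) / 2 := by
  have e : τ * Lop W μ c F p = ∑ w ∈ W, (θ * c w p) * (F (p + w) - F p) := by
    simp only [Lop, DD, mul_sum, ← hτ]
    exact sum_congr rfl fun w _  ↦ by ring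
  have h1 : ∑ w ∈ W, (θ * c w p) * (F (p + w) - F p) ≤ ∑ w ∈ W, (θ * c w p) * (Y - F p) :=
    sum_le_sum fun w hw  ↦ by
      have := (hc w hw).1
      have := hY (p + w)
      gcongr
      exact mul_nonneg hθ0 lna
  have h2 : ∑ w ∈ W, (θ * c w p) ≤ 1 / 2 := by
    rw [← mul_sum]
    refine le_trans ?_ hθ
    gcongr
    calc _ ≤ ∑ w ∈ W, C0 := sum_le_sum fun w hw  ↦ (hc w hw).2
      _ = _ := by simp
  rw [e]
  rw [← sum_mul] at h1
  have h3 : (∑ w ∈ W, (θ * c w p)) * (Y - F p) ≤ 1 / 2 * (Y - F p) := by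
    gcongr
    linarith [hY p]
  linarith

lemma stepG {ι : Type*} (s : Finset ι) {V : ι → Pt d → ℝ}
    {R x : ι → ℝ} {S n n2 : ℝ}
    (hμ : 0 < μ) (hτ : τ * μ ^ 2 = θ) (hτ0 : 0 ≤ τ) (hθ0 : 0 ≤ θ) (hc0 : 0 < c0)
    (hc : ∀ w ∈ W, c0 ≤ c w p ∧ c w p ≤ C0) (hθ : 2 * θ * W.card * C0 ^ 2 ≤ c0 / 2)
    (hx : ∀ i ∈ s, x i = V i p + τ * (Lop W μ c (V i) p + R i))
    (hR : ∀ i ∈ s, |R i| ≤ Cr * (Vt + S)) (hCr : 0 ≤ Cr) (hVt : 0 ≤ Vt) (hS : 0 ≤ S)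
    (hn : s.card ≤ n) (hn2 : Vt ^ 2 ≤ n2 * ∑ i ∈ s, ∑ w ∈ W, (DD μ w (V i) p) ^ 2)
    (hn20 : 0 < n2) (hn0 : 0 < n) (hη : η = c0 / (8 * n * n2))
    (hsm : 32 * τ * Cr ^ 2 * n * n2 ≤ c0) :
    ∑ i ∈ s, x i ^ 2 ≤ ∑ i ∈ s, V i p ^ 2 + τ * Lop W μ c (fun p  ↦ ∑ i ∈ s, V i p ^ 2) p
      - τ * (c0 / 4) * ∑ i ∈ s, ∑ w ∈ W, (DD μ w (V i) p) ^ 2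
      + τ * (Cr ^ 2 / η) * (∑ i ∈ s, V i p ^ 2) + 2 * τ * Cr * S * (∑ i ∈ s, |V i p|)
      + 4 * τ ^ 2 * Cr ^ 2 * n * S ^ 2 := by
  set G2 := ∑ i ∈ s, ∑ w ∈ W, (DD μ w (V i) p) ^ 2 with hG2
  have hη0 : 0 < η := by rw [hη]; positivity
  have hG20 : 0 ≤ G2 := sum_nonneg fun _ _  ↦ sum_nonneg fun _ _  ↦ sq_nonneg _
  have h1 : ∀ i ∈ s, x i ^ 2 ≤ V i p ^ 2 + τ * Lop W μ c (fun p  ↦ V i p ^ 2) p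
      - τ * (c0 / 2) * ∑ w ∈ W, (DD μ w (V i) p) ^ 2
      + τ * (Cr ^ 2 / η) * V i p ^ 2 + 2 * τ * Cr * S * |V i p| +
      (τ * η * Vt ^ 2 + 4 * τ ^ 2 * Cr ^ 2 * Vt ^ 2 + 4 * τ ^ 2 * Cr ^ 2 * S ^ 2) := by
    intro i hi
    have a := onestep (W := W) (μ := μ) hμ hτ hτ0 hθ0 hc0.le hc hθ (hx i hi)
    have b := hR i hi
    have a1 : 2 * τ * |V i p| * |R i| ≤ 2 * τ * |V i p| * (Cr * (Vt + S)) := by gcongr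
    have a2 : R i ^ 2 ≤ 2 * Cr ^ 2 * Vt ^ 2 + 2 * Cr ^ 2 * S ^ 2 := by
      rw [← sq_abs]
      calc |R i| ^ 2 ≤ (Cr * (Vt + S)) ^ 2 := by gcongr
        _ = Cr ^ 2 * (Vt + S) ^ 2 := by ring
        _ ≤ Cr ^ 2 * (2 * Vt ^ 2 + 2 * S ^ 2) := by gcongr; nlinarith [sq_nonneg (Vt - S)]
        _ = _ := by ring
    have a3 : 2 * |V i p| * (Cr * Vt) ≤ (Cr ^ 2 / η) * V i p ^ 2 + η * Vt ^ 2 := by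
      rw [← sq_abs (V i p)]
      have : 0 ≤ η * (Vt - Cr * |V i p| / η) ^ 2 := by positivity
      have e : η * (Vt - Cr * |V i p| / η) ^ 2 = η * Vt ^ 2 - 2 * |V i p| * (Cr * Vt)
        + Cr ^ 2 / η * |V i p| ^ 2 := by field_simp; ring
      linarith
    have a4 := mul_le_mul_of_nonneg_left a3 hτ0
    have a5 := mul_le_mul_of_nonneg_left a2 (by positivity : 0 ≤ 2 * τ ^ 2)
    nlinarith
  have h2 := sum_le_sum h1
  simp only [sum_add_distrib, sum_sub_distrib, ← mul_sum, sum_const,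
    nsmul_eq_mul] at h2
  rw [Lop_sum]
  have h3 : (s.card : ℝ) * (τ * η * Vt ^ 2) ≤ τ * (c0 / 8) * G2 := by
    calc _ ≤ n * (τ * η * (n2 * G2)) := by gcongr
      _ = τ * (c0 / 8) * G2 := by rw [hη]; field_simp
  have h4 : (s.card : ℝ) * (4 * τ ^ 2 * Cr ^ 2 * Vt ^ 2) ≤ τ * (c0 / 8) * G2 := by
    calc _ ≤ n * (4 * τ ^ 2 * Cr ^ 2 * (n2 * G2)) := by gcongr
      _ = τ * ((32 * τ * Cr ^ 2 * n * n2) / 8) * G2 := by ring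
      _ ≤ _ := by gcongr
  have h5 : (s.card : ℝ) * (4 * τ ^ 2 * Cr ^ 2 * S ^ 2) ≤ n * (4 * τ ^ 2 * Cr ^ 2 * S ^ 2) := by gcongr
  nlinarith

lemma shift_bound {c} (hμ : 0 < μ) (hc : ∀ w ∈ W, ∀ p, |DD μ w c p| ≤ M) :
    ∀ Z ∈ ls W k, ∀ p, μ * |c (p + Z.sum) - c p| ≤ k * M := by
  induction k with
  | zero => intro Z hZ p; simp only [ls, Finset.mem_singleton] at hZ; subst hZ; simp
  | succ k ih =>
    intro Z hZ p
    obtain ⟨w, hw, Zp, hZp, rfl⟩ := mem_ls_succ.1 hZ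
    have h1 := ih Zp hZp (p + w)
    have h2 := hc w hw p
    simp only [DD, abs_mul, abs_of_pos hμ] at h2
    have e : c (p + (w :: Zp).sum) - c p = (c (p + w + Zp.sum) - c (p + w)) + (c (p + w) - c p) := by
      rw [List.sum_cons, add_assoc]
      ring
    rw [e]
    have := mul_le_mul_of_nonneg_left (abs_add_le (c (p + w + Zp.sum) - c (p + w)) (c (p + w) - c p)) hμ.le
    push_cast
    linarith

include hW in
lemma commut_bd {f}
    (hμ : 0 < μ) (hN : 0 ≤ N) (hsym : ∀ w, c (-w) = c w) (hB : 0 ≤ B) (hVt : 0 ≤ Vt)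
    (hc : ∀ w ∈ W, HH W μ N (j + 1) M (c w)) (hD : ∀ w ∈ W, ∀ v ∈ W, ∀ p, |DD μ v (c w) p| ≤ M)
    (hf : HH W μ N (j + 1) B f) (hv : ∀ Y ∈ ls W (j + 2), |TT μ Y f p| ≤ Vt)
    (Z) (hZ : Z ∈ ls W (j + 1)) :
    |TT μ Z (Lop W μ c f) p - Lop W μ c (TT μ Z f) p| ≤
      W.card * ((j + 1) * (M * Vt + j * 2 ^ j * (M * B) * (1 + N) ^ 2) + 2 * (j + 1) * M * Vt) := by
  rw [Lop_sym hW hsym, Lop_sym hW hsym, TT_smul, TT_sum]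
  simp only [Pi.smul_apply, Finset.sum_apply, smul_eq_mul, Pi.mul_apply]
  rw [← mul_sub, ← sum_sub_distrib, abs_mul]
  have h1 : ∀ w ∈ W, |TT μ Z (c w * DD μ (-w) (DD μ w f)) p - c w p * DD μ (-w) (DD μ w (TT μ Z f)) p|
      ≤ ((j + 1) * (M * Vt + j * 2 ^ j * (M * B) * (1 + N) ^ 2) + 2 * (j + 1) * M * Vt) := by
    intro w hw
    have a1 := PR hN (p := p) (Vt := Vt) hB hVt (hc w hw) (hD w hw) (v := DD μ (-w) (DD μ w f))
      (fun Y hY  ↦ hv (w :: -w :: Y) (mem_ls_cons hw (mem_ls_cons (hW w hw) hY)))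
      (fun i hi  ↦ by subst hi; exact (hf.2 w hw).2 (-w) (hW w hw)) Z hZ
    have a2 : |(c w (p + Z.sum) - c w p) * TT μ Z (DD μ (-w) (DD μ w f)) p| ≤ 2 * (j + 1) * M * Vt := by
      rw [DD_neg_DD, TT_smul, TT_add, TT_DD, TT_DD]
      simp only [Pi.smul_apply, Pi.add_apply, smul_eq_mul]
      have b1 := hv (w :: Z) (mem_ls_cons hw hZ)
      have b2 := hv ((-w) :: Z) (mem_ls_cons (hW w hw) hZ)
      simp only [TT] at b1 b2
      rw [TT_DD] at b1 b2
      have b3 := shift_bound hμ (hD w hw) Z hZ p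
      rw [abs_mul, abs_mul, abs_neg, abs_of_pos hμ]
      calc _ = (μ * |c w (p + Z.sum) - c w p|) * |DD μ w (TT μ Z f) p + DD μ (-w) (TT μ Z f) p| := by ring
        _ ≤ (((j + 1 : ℕ):ℝ) * M) * (Vt + Vt) := by
            refine mul_le_mul b3 ((abs_add_le _ _).trans (add_le_add b1 b2)) (abs_nonneg _)
              (le_trans psv b3)
        _ = _ := by push_cast; ring
    have e : TT μ Z (c w * DD μ (-w) (DD μ w f)) p - c w p * DD μ (-w) (DD μ w (TT μ Z f)) p =
      (TT μ Z (c w * DD μ (-w) (DD μ w f)) p - c w (p + Z.sum) * TT μ Z (DD μ (-w) (DD μ w f)) p)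
      + (c w (p + Z.sum) - c w p) * TT μ Z (DD μ (-w) (DD μ w f)) p := by
      rw [← TT_DD, ← TT_DD]
      ring
    rw [e]
    exact (abs_add_le _ _).trans (add_le_add a1 a2)
  have h2 := (abs_sum_le_sum_abs _ _).trans (sum_le_sum h1)
  simp only [sum_const, nsmul_eq_mul] at h2
  have : |(-(1/2) : ℝ)| = 1 / 2 := by norm_num
  rw [this]
  have := (abs_nonneg _).trans h2
  linarith
end

def Ai (a : Mt d) : Mt d := fun i j  ↦ ((mof a)⁻¹ : Matrix (Fin d) (Fin d) ℝ) i j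

def cp (u : Pt d → Mt d) (i j : Fin d) : Pt d → ℝ := fun p  ↦ u p i j

def aA (u : Pt d → Mt d) : Pt d → Mt d := fun p  ↦ Ai (u p)

def Quad (μ : ℝ) (u : Pt d → Mt d) (i j : Fin d) : Pt d → ℝ := fun p  ↦
  (1/2) * ∑ a, ∑ b, ∑ r, ∑ s, aA u p a b * aA u p r s *
    (DD μ (ee i) (cp u r a) p * DD μ (ee j) (cp u s b) p
      + 2 * DD μ (ee a) (cp u j r) p * DD μ (ee s) (cp u i b) p
      - 2 * DD μ (ee a) (cp u j r) p * DD μ (ee b) (cp u i s) p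
      - 2 * DD μ (ee j) (cp u r a) p * DD μ (ee b) (cp u i s) p
      - 2 * DD μ (ee i) (cp u r a) p * DD μ (ee b) (cp u j s) p)

def St (L : ℝ) (a : Mt d) : Prop :=
  EllM L (Ai a) ∧ (mof a) * (mof a)⁻¹ = 1

def HB (W : Finset (Pt d)) (μ N : ℝ) (k : ℕ) (M : ℝ) (f : Pt d → ℝ) : Prop :=
  HH W μ N k M f ∧ ∀ p, |f p| ≤ M

section

lemma HH.smul (r) : ∀ {M f}, HH W μ N k M f → HH W μ N k (|r| * M) (r • f) := by
  induction k with
  | zero =>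
    intro M f h p
    simp only [Pi.smul_apply, smul_eq_mul, abs_mul, mul_assoc]
    exact mul_le_mul_of_nonneg_left (h p) (abs_nonneg _)
  | succ k ih =>
    intro M f h
    refine ⟨fun p  ↦ ?_, fun w hw  ↦ by rw [DD_smul]; exact ih (h.2 w hw)⟩
    simp only [Pi.smul_apply, smul_eq_mul, abs_mul]
    exact mul_le_mul_of_nonneg_left (h.1 p) (abs_nonneg _)

lemma HH.zero (hN : 0 ≤ N) (hM : 0 ≤ M) : HH W μ N k M 0 := by
  induction k with
  | zero => intro p; simp; positivity
  | succ k ih =>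
    refine ⟨fun p  ↦ by simpa using hM, fun w _  ↦ ?_⟩
    have : DD μ w (0 : Pt d → ℝ) = 0 := by funext p; simp [DD]
    rw [this]
    exact ih

lemma HH.sum (hN : 0 ≤ N) {ι : Type*} (s : Finset ι) {M : ι → ℝ} {f : ι → Pt d → ℝ}
    (h : ∀ i ∈ s, HH W μ N k (M i) (f i)) : HH W μ N k (∑ i ∈ s, M i) (∑ i ∈ s, f i) := by
  classical
  induction s using Finset.induction_on with
  | empty => simpa using HH.zero hN le_rfl
  | insert a s ha ih =>
    rw [sum_insert ha, sum_insert ha]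
    exact HH.add (h a smp) (ih fun i hi  ↦ h i (by simp [hi]))

lemma HH.const (hN : 0 ≤ N) (r) : HH W μ N k |r| (fun _  ↦ r) := by
  cases k with
  | zero => intro p; nlinarith [abs_nonneg r]
  | succ k =>
    refine ⟨fun p  ↦ le_rfl, fun w _  ↦ ?_⟩
    have : DD μ w (fun _  ↦ r) = 0 := by funext p; simp [DD]
    rw [this]
    exact HH.zero hN (abs_nonneg _)

lemma HB.add {f} (hf : HB W μ N k M f) (hg : HB W μ N k Mp g) :
    HB W μ N k (M + Mp) (f + g) :=
  ⟨hf.1.add hg.1, fun p  ↦ (abs_add_le _ _).trans (add_le_add (hf.2 p) (hg.2 p))⟩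

lemma HB.mul (hN : 0 ≤ N) {f} (hf : HB W μ N k M f)
    (hg : HB W μ N k Mp g) : HB W μ N k (2 ^ k * (M * Mp)) (f * g) := by
  refine ⟨HH.mul hN hf.1 hg.1 hg.2, fun p  ↦ ?_⟩
  have h0 := HH.nonneg hN hf.1
  have h1 := HH.nonneg hN hg.1
  rw [Pi.mul_apply, abs_mul]
  have : (1:ℝ) ≤ 2 ^ k := one_le_pow₀ nmn
  calc _ ≤ M * Mp := mul_le_mul (hf.2 p) (hg.2 p) (abs_nonneg _) h0
    _ ≤ _ := by nlinarith [mul_nonneg h0 h1]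

lemma HB.shift {f} (hf : HB W μ N k M f) (w) :
    HB W μ N k M (sh w f) := ⟨hf.1.shift w, fun p  ↦ hf.2 _⟩

lemma HB.mono (hN : 0 ≤ N) {f} (hf : HB W μ N k M f) (h : M ≤ Mp) :
    HB W μ N k Mp f := ⟨HH.mono hN hf.1 h, fun p  ↦ (hf.2 p).trans h⟩

lemma HB.down (hN : 0 ≤ N) {f} (hf : HB W μ N (k + 1) M f) :
    HB W μ N k M f := ⟨HH.down hN hf.1, hf.2⟩

lemma HB.const (hN : 0 ≤ N) (r) : HB W μ N k |r| (fun _  ↦ r) :=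
  ⟨HH.const hN r, fun _  ↦ le_rfl⟩

lemma Ai_mul {a : Mt d} (h : St L a) : (mof a)⁻¹ * (mof a) = 1 :=
  mul_eq_one_comm.1 h.2

lemma DD_aA (h : ∀ p, St L (u p)) (w i j) :
    DD μ w (cp (aA u) i j) = (-1 : ℝ) • ∑ a, ∑ b, DD μ w (cp u a b) *
      (sh w (cp (aA u) i a) * cp (aA u) b j) := by
  funext p
  have e1 : (mof (u (p + w)))⁻¹ - (mof (u p))⁻¹ =
      -((mof (u (p + w)))⁻¹ * (mof (u (p + w)) - mof (u p)) * (mof (u p))⁻¹) := by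
    rw [mul_sub, sub_mul, Ai_mul (h (p + w)), mul_assoc, (h p).2]
    simp
  have e2 := congrFun (congrFun e1 i) j
  simp only [Matrix.sub_apply, Matrix.neg_apply, Matrix.mul_apply, Matrix.of_apply] at e2
  simp only [DD, cp, aA, Ai, sh, Pi.smul_apply, Finset.sum_apply, Pi.mul_apply, smul_eq_mul]
  rw [e2]
  simp only [mul_sum, sum_mul, ← sum_neg_distrib]
  rw [sum_comm]
  exact sum_congr rfl fun a _  ↦ sum_congr rfl fun b _  ↦ by ring

lemma aA_HB (d L) (hL : 0 < L) (B) (hB : 0 ≤ B) (k) : ∃ M, ∀ (W : Finset (Pt d)) (μ N) (u),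
    0 ≤ N → (∀ p, St L (u p)) → (∀ i j, HH W μ N k B (cp u i j)) →
    ∀ i j, HB W μ N k M (cp (aA u) i j) := by
  induction k with
  | zero =>
    refine ⟨L, fun W μ N u hN hu _ i j  ↦ ?_⟩
    have h := fun p  ↦ EllM.bound hL (hu p).1 i j
    exact ⟨fun p  ↦ (h p).trans (by nlinarith), h⟩
  | succ k ih =>
    obtain ⟨M, hM⟩ := ih
    refine ⟨L + ∑ a : Fin d, ∑ b : Fin d, 2 ^ k * (B * (2 ^ k * (M * M))), fun W μ N u hN hu hk i j  ↦ ?_⟩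
    have hA := hM W μ N u hN hu (fun i j  ↦ HH.down hN (hk i j))
    have hM0 := HH.nonneg hN (hA i j).1
    have h := fun p  ↦ EllM.bound hL (hu p).1 i j
    have hS : 0 ≤ ∑ a : Fin d, ∑ b : Fin d, 2 ^ k * (B * (2 ^ k * (M * M))) := by positivity
    refine ⟨⟨fun p  ↦ (h p).trans lna, fun w hw  ↦ ?_⟩, fun p  ↦ (h p).trans lna⟩
    rw [DD_aA hu]
    have := HH.smul (-1) (HH.sum hN Finset.univ (W := W) (μ := μ) (k := k) (M := fun a : Fin d  ↦ ∑ b : Fin d, 2 ^ k * (B * (2 ^ k * (M * M))))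
      (f := fun a  ↦ ∑ b, DD μ w (cp u a b) * (sh w (cp (aA u) i a) * cp (aA u) b j))
      (fun a _  ↦ HH.sum hN Finset.univ (fun b _  ↦ ?_)))
    · refine HH.mono hN this ?_
      simp only [abs_neg, abs_one, one_mul]
      linarith
    · have h1 := HB.mul hN ((hA i a).shift w) (hA b j)
      exact HH.mul hN ((hk a b).2 w hw) h1.1 h1.2

lemma pol_HB (d k M) (q : Pol d) : ∃ Mp, ∀ (W) (μ N) (A),
    0 ≤ N → (∀ i j, HB W μ N k M (cp A i j)) → HB W μ N k Mp (fun p  ↦ ev (A p) q) := by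
  induction q using MvPolynomial.induction_on with
  | C r =>
    refine ⟨|r|, fun W μ N A hN _  ↦ ?_⟩
    simpa [ev] using HB.const hN r
  | add p q hp hq =>
    obtain ⟨M1, h1⟩ := hp
    obtain ⟨M2, h2⟩ := hq
    refine ⟨M1 + M2, fun W μ N A hN h  ↦ ?_⟩
    have := HB.add (h1 W μ N A hN h) (h2 W μ N A hN h)
    have e : (fun x  ↦ ev (A x) (p + q)) = (fun x  ↦ ev (A x) p) + (fun x  ↦ ev (A x) q) := by
      funext x
      simp [ev]
    rw [e]
    exact this
  | mul_X p i hp =>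
    obtain ⟨M1, h1⟩ := hp
    refine ⟨2 ^ k * (M1 * M), fun W μ N A hN h  ↦ ?_⟩
    have := HB.mul hN (h1 W μ N A hN h) (h i.1 i.2)
    have e : (fun x  ↦ ev (A x) (p * MvPolynomial.X i)) = (fun x  ↦ ev (A x) p) * cp A i.1 i.2 := by
      funext x
      simp [ev, cp]
    rw [e]
    exact this

lemma quad_term {i q f} (hN : 0 ≤ N)
    (hVt : 0 ≤ Vt) (hq : HB W μ N (i + 2) M q) (hf : HB W μ N (i + 1) B f) (hg : HB W μ N (i + 1) B g)
    (hfv : ∀ Y ∈ ls W (i + 2), |TT μ Y f p| ≤ Vt) (hgv : ∀ Y ∈ ls W (i + 2), |TT μ Y g p| ≤ Vt)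
    (Z) (hZ : Z ∈ ls W (i + 2)) :
    |TT μ Z (q * f * g) p| ≤ (2 ^ (i + 1) * (2 ^ (i + 1) * (M * B) * B)
      + 2 * (2 ^ (i + 1) * (M * B) + (i + 1 : ℕ) * 2 ^ (i + 1) * (2 ^ (i + 1) * (M * B) * B)))
        * (Vt + (1 + N) ^ 2) := by
  obtain ⟨w, hw, Zp, hZp, rfl⟩ := mem_ls_succ.1 hZ
  have hM0 := HH.nonneg hN hq.1
  have hB0 := HH.nonneg hN hf.1
  have e : DD μ w (q * f * g) = (DD μ w q * f) * g + (sh w q * g) * DD μ w f + sh w (q * f) * DD μ w g := by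
    funext x
    simp only [DD, sh, Pi.mul_apply, Pi.add_apply]
    ring
  simp only [TT, e, TT_add, Pi.add_apply]
  have hq1 : HB W μ N (i + 1) M q := HB.down hN hq
  have hDq : HB W μ N (i + 1) M (DD μ w q) := ⟨hq.1.2 w hw, (hq.1.2 w hw).1⟩
  have a1 := ((HB.mul hN (HB.mul hN hDq hf) hg).1).TT_le Zp hZp p
  have h2 := HB.mul hN (hq1.shift w) hg
  have a2 := QL hN (p := p) (Vt := Vt) hB0 h2.1 h2.2 (v := DD μ w f)
    (fun Y hY  ↦ hfv (w :: Y) (mem_ls_cons hw hY))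
    (fun ip hi  ↦ by obtain rfl : i = ip := by omega
                     exact hf.1.2 w hw) Zp hZp
  have h3 := (HB.mul hN hq1 hf).shift w
  have a3 := QL hN (p := p) (Vt := Vt) hB0 h3.1 h3.2 (v := DD μ w g)
    (fun Y hY  ↦ hgv (w :: Y) (mem_ls_cons hw hY))
    (fun ip hi  ↦ by obtain rfl : i = ip := by omega
                     exact hg.1.2 w hw) Zp hZp
  refine (abs_add_three _ _ _).trans ?_
  set X := (2:ℝ) ^ (i + 1) * (M * B) with hX
  have hX0 : 0 ≤ X := by positivity
  have hV1 : 1 + N ≤ Vt + (1 + N) ^ 2 := by nlinarith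
  have b1 : 2 ^ (i + 1) * (X * B) * (1 + N) ≤ 2 ^ (i + 1) * (X * B) * (Vt + (1 + N) ^ 2) :=
    mul_le_mul_of_nonneg_left hV1 psv
  have b2 : X * Vt ≤ X * (Vt + (1 + N) ^ 2) :=
    mul_le_mul_of_nonneg_left (by nlinarith) hX0
  have b3 : (i + 1 : ℕ) * 2 ^ (i + 1) * (X * B) * (1 + N) ^ 2 ≤
    (i + 1 : ℕ) * 2 ^ (i + 1) * (X * B) * (Vt + (1 + N) ^ 2) :=
    mul_le_mul_of_nonneg_left lna psv
  linarith

lemma Quad_eq (u : Pt d → Mt d) (i j) : Quad μ u i j =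
    (1/2 : ℝ) • ∑ a, ∑ b, ∑ r, ∑ s,
     (cp (aA u) a b * cp (aA u) r s * DD μ (ee i) (cp u r a) * DD μ (ee j) (cp u s b)
      + ((2:ℝ) • (cp (aA u) a b * cp (aA u) r s * DD μ (ee a) (cp u j r) * DD μ (ee s) (cp u i b))
      + ((-2:ℝ) • (cp (aA u) a b * cp (aA u) r s * DD μ (ee a) (cp u j r) * DD μ (ee b) (cp u i s))
      + ((-2:ℝ) • (cp (aA u) a b * cp (aA u) r s * DD μ (ee j) (cp u r a) * DD μ (ee b) (cp u i s))
      + (-2:ℝ) • (cp (aA u) a b * cp (aA u) r s * DD μ (ee i) (cp u r a) * DD μ (ee b) (cp u j s)))))) := by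
  funext p
  simp only [Quad, Pi.smul_apply, Finset.sum_apply, Pi.add_apply, Pi.mul_apply, smul_eq_mul, cp]
  congr 1
  refine sum_congr rfl fun a _  ↦ sum_congr rfl fun b _  ↦
    sum_congr rfl fun r _  ↦ sum_congr rfl fun s _  ↦ ?_
  ring

lemma Quad_TT
    (h : ∀ a b r s e1 i1 j1 e2 i2 j2, |TT μ Z (cp (aA u) a b * cp (aA u) r s *
      DD μ (ee e1) (cp u i1 j1) * DD μ (ee e2) (cp u i2 j2)) p| ≤ K) (i j) :
    |TT μ Z (Quad μ u i j) p| ≤ 5 * d ^ 4 * K := by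
  rw [Quad_eq]
  simp only [TT_smul, TT_sum, TT_add, Pi.smul_apply, Finset.sum_apply, Pi.add_apply, smul_eq_mul]
  have hK : d ≠ 0 → 0 ≤ K := fun hd  ↦ by
    have i0 : Fin d := ⟨0, Nat.pos_of_ne_zero hd⟩
    exact (abs_nonneg _).trans (h i0 i0 i0 i0 i0 i0 i0 i0 i0 i0)
  have hK := hK (by have := i.2; omega)
  rw [abs_mul]
  have : |∑ a : Fin d, ∑ b : Fin d, ∑ r : Fin d, ∑ s : Fin d,
     (TT μ Z (cp (aA u) a b * cp (aA u) r s * DD μ (ee i) (cp u r a) * DD μ (ee j) (cp u s b)) p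
      + ((2:ℝ) * (TT μ Z (cp (aA u) a b * cp (aA u) r s * DD μ (ee a) (cp u j r) * DD μ (ee s) (cp u i b)) p)
      + ((-2:ℝ) * (TT μ Z (cp (aA u) a b * cp (aA u) r s * DD μ (ee a) (cp u j r) * DD μ (ee b) (cp u i s)) p)
      + ((-2:ℝ) * (TT μ Z (cp (aA u) a b * cp (aA u) r s * DD μ (ee j) (cp u r a) * DD μ (ee b) (cp u i s)) p)
      + (-2:ℝ) * (TT μ Z (cp (aA u) a b * cp (aA u) r s * DD μ (ee i) (cp u r a) * DD μ (ee b) (cp u j s)) p)))))|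
      ≤ ∑ a : Fin d, ∑ b : Fin d, ∑ r : Fin d, ∑ s : Fin d, 9 * K := by
    refine (abs_sum_le_sum_abs _ _).trans (sum_le_sum fun a _  ↦ ?_)
    refine (abs_sum_le_sum_abs _ _).trans (sum_le_sum fun b _  ↦ ?_)
    refine (abs_sum_le_sum_abs _ _).trans (sum_le_sum fun r _  ↦ ?_)
    refine (abs_sum_le_sum_abs _ _).trans (sum_le_sum fun s _  ↦ ?_)
    have h1 := abs_le.1 (h a b r s i r a j s b)
    have h2 := abs_le.1 (h a b r s a j r s i b)
    have h3 := abs_le.1 (h a b r s a j r b i s)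
    have h4 := abs_le.1 (h a b r s j r a b i s)
    have h5 := abs_le.1 (h a b r s i r a b j s)
    rw [abs_le]
    constructor <;> linarith [h1.1, h1.2, h2.1, h2.2, h3.1, h3.2, h4.1, h4.2, h5.1, h5.2]
  simp only [sum_const, Finset.card_univ, card_fin, nsmul_eq_mul] at this
  have e : |(1/2:ℝ)| = 1/2 := by norm_num
  rw [e]
  have : 0 ≤ (d:ℝ) ^ 4 * K := by positivity
  nlinarith
end

structure SD (d : ℕ) (L : ℝ) where
  W : Finset (Pt d)
  c : Pt d → Pol d
  c0 : ℝ
  C0 : ℝ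
  hW : ∀ w ∈ W, -w ∈ W
  hee : ∀ i, ee i ∈ W
  hc0 : 0 < c0
  hsym : ∀ w, c (-w) = c w
  hb : ∀ a, EllM L a → ∀ w ∈ W, c0 ≤ ev a (c w) ∧ ev a (c w) ≤ C0
  hcons : ∀ a : Mt d, (∀ i j, a i j = a j i) → ∀ i j, ∑ w ∈ W, ev a (c w) * w i * w j = 2 * a i j

lemma SD.exists (d L) (hL : 1 ≤ L) : Nonempty (SD d L) := by
  obtain ⟨N, hN, c, c0, hc0, C0, h1, h2, h3⟩ := stencil d L hL
  exact ⟨⟨bx d N, c, c0, C0, fun w hw  ↦ by rw [mem_bx] at hw ⊢; simpa using hw,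
    fun i  ↦ by
      rw [mem_bx]; intro k; simp only [ee, Pi.single_apply]; split_ifs <;> norm_num <;> omega, hc0, h1, h2, h3⟩⟩

section
variable (D : SD d L)

def cc (u : Pt d → Mt d) (w p : Pt d) : ℝ := ev (aA u p) (D.c w)

def rhs (μ : ℝ) (u : Pt d → Mt d) (i j : Fin d) : Pt d → ℝ :=
  Lop D.W μ (cc D u) (cp u i j) + Quad μ u i j

def stp (θ : ℝ) (u : Pt d → Mt d) : Pt d → Mt d := fun p i j  ↦ u p i j + θ * rhs D 1 u i j p

def ix (k : ℕ) : Finset ((Ix d) × List (Pt d)) := Finset.univ ×ˢ ls D.W k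

def GG (μ : ℝ) (k : ℕ) (u : Pt d → Mt d) (p : Pt d) : ℝ :=
  ∑ x ∈ ix D k, (TT μ x.2 (cp u x.1.1 x.1.2) p) ^ 2

lemma mem_ix {x : (Ix d) × List (Pt d)} : x ∈ ix D k ↔ x.2 ∈ ls D.W k := by
  simp [ix]

lemma GG_nonneg (μ k u p) : 0 ≤ GG D μ k u p :=
  sum_nonneg fun _ _  ↦ sq_nonneg _

lemma TT_le_GG (hZ : Z ∈ ls D.W k)
    (i j) : |TT μ Z (cp u i j) p| ≤ √(GG D μ k u p) := by
  rw [← Real.sqrt_sq_eq_abs]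
  apply Real.sqrt_le_sqrt
  exact single_le_sum (f := fun x : (Ix d) × List (Pt d)  ↦ (TT μ x.2 (cp u x.1.1 x.1.2) p) ^ 2)
    (fun _ _  ↦ sq_nonneg _) ((mem_ix D (x := ((i, j), Z))).2 hZ)

lemma GG_succ (μ k u p) : GG D μ (k + 1) u p =
    ∑ x ∈ ix D k, ∑ w ∈ D.W, (DD μ w (TT μ x.2 (cp u x.1.1 x.1.2)) p) ^ 2 := by
  simp only [GG, ix, Finset.sum_product, sum_ls_succ, TT, TT_DD]
  refine sum_congr rfl fun a _  ↦ ?_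
  rw [sum_comm]

lemma GG_scale (r μ k u p) :
    GG D (r * μ) k u p = (r ^ 2) ^ k * GG D μ k u p := by
  simp only [GG, mul_sum]
  refine sum_congr rfl fun x hx  ↦ ?_
  rw [TT_scale, ls_length ((mem_ix D).1 hx), Pi.smul_apply, smul_eq_mul, mul_pow, ← pow_mul, ← pow_mul, mul_comm k]

lemma rhs_scale (μ u i j) : rhs D μ u i j = μ ^ 2 • rhs D 1 u i j := by
  funext p
  simp only [rhs, Lop, Quad, DD, Pi.add_apply, Pi.smul_apply, smul_eq_mul, mul_sum, mul_add]
  congr 1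
  · exact sum_congr rfl fun w _  ↦ by ring
  · refine sum_congr rfl fun a _  ↦ sum_congr rfl fun b _  ↦
      sum_congr rfl fun r _  ↦ sum_congr rfl fun s _  ↦ by ring

lemma stp_eq (hτ : τ * μ ^ 2 = θ) (u i j) :
    cp (stp D θ u) i j = cp u i j + τ • rhs D μ u i j := by
  rw [rhs_scale]
  funext p
  simp only [cp, stp, Pi.add_apply, Pi.smul_apply, smul_eq_mul, ← hτ]
  ring

def Th (θ : ℝ) : Prop := 0 < θ ∧ θ ≤ 1 / 8 ∧ 2 * θ * D.W.card * D.C0 ^ 2 ≤ D.c0 / 2 ∧ θ * (D.W.card * D.C0) ≤ 1 / 2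

def nn (k : ℕ) : ℝ := (ix D k).card + 1

lemma gstep (hθ : Th D θ) (hμ : 0 < μ) (hτ : τ * μ ^ 2 = θ) (hτ0 : 0 ≤ τ)
    (hu : St L (u p)) {S} (hCr : 0 ≤ Cr) (hS : 0 ≤ S)
    (hR : ∀ i j, ∀ Z ∈ ls D.W k, |TT μ Z (rhs D μ u i j) p - Lop D.W μ (cc D u) (TT μ Z (cp u i j)) p|
      ≤ Cr * (√(GG D μ (k + 1) u p) + S)) (hsm : 32 * τ * Cr ^ 2 * nn D k ≤ D.c0) :
    GG D μ k (stp D θ u) p ≤ GG D μ k u p + τ * Lop D.W μ (cc D u) (GG D μ k u) p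
      - τ * (D.c0 / 4) * GG D μ (k + 1) u p + τ * (8 * nn D k * Cr ^ 2 / D.c0) * GG D μ k u p
      + 2 * τ * Cr * S * (nn D k * √(GG D μ k u p)) + 4 * τ ^ 2 * Cr ^ 2 * nn D k * S ^ 2 := by
  have hn : 0 < nn D k := by unfold nn; positivity
  have h := stepG (W := D.W) (μ := μ) (c := cc D u) (c0 := D.c0) (C0 := D.C0) (θ := θ) (τ := τ) (p := p)
    (V := fun x : (Ix d) × List (Pt d)  ↦ TT μ x.2 (cp u x.1.1 x.1.2))
    (R := fun x  ↦ TT μ x.2 (rhs D μ u x.1.1 x.1.2) p - Lop D.W μ (cc D u) (TT μ x.2 (cp u x.1.1 x.1.2)) p)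
    (x := fun x  ↦ TT μ x.2 (cp (stp D θ u) x.1.1 x.1.2) p) (Cr := Cr) (S := S) (Vt := √(GG D μ (k + 1) u p))
    (n := nn D k) (n2 := 1)
    (ix D k) hμ hτ hτ0 hθ.1.le D.hc0 (D.hb _ hu.1) hθ.2.2.1
    (fun x _  ↦ by
      rw [stp_eq D hτ, TT_add, TT_smul]
      simp only [Pi.add_apply, Pi.smul_apply, smul_eq_mul]
      ring)
    (fun x hx  ↦ hR _ _ _ ((mem_ix D).1 hx)) hCr (sqrt_nonneg _) hS (by unfold nn; linarith)
    (by rw [sq_sqrt (GG_nonneg D _ _ _ _), one_mul, GG_succ]) one_pos hn rfl lna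
  have e : (∑ x ∈ ix D k, |TT μ x.2 (cp u x.1.1 x.1.2) p|) ≤ nn D k * √(GG D μ k u p) := by
    refine (Finset.sum_le_card_nsmul _ _ _ (fun x hx  ↦ TT_le_GG D ((mem_ix D).1 hx) _ _)).trans ?_
    rw [nsmul_eq_mul]
    unfold nn
    exact mul_le_mul_of_nonneg_right lna (sqrt_nonneg _)
  have e2 : Cr ^ 2 / (D.c0 / (8 * nn D k * 1)) = 8 * nn D k * Cr ^ 2 / D.c0 := by
    have := D.hc0
    field_simp
  rw [e2, ← GG_succ] at h
  have e3 := mul_le_mul_of_nonneg_left e (show 0 ≤ 2 * τ * Cr * S by positivity)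
  have e4 : (fun p  ↦ ∑ i ∈ ix D k, TT μ i.2 (cp u i.1.1 i.1.2) p ^ 2) = GG D μ k u := rfl
  have e5 : ∑ i ∈ ix D k, TT μ i.2 (cp u i.1.1 i.1.2) p ^ 2 = GG D μ k u p := rfl
  rw [e4, e5] at h
  exact h.trans lna

end

section
variable (D : SD d L)

lemma cc_HB (hL : 0 < L) (k B) (hB : 0 ≤ B) : ∃ M, 0 ≤ M ∧ ∀ (μ N) (u),
    0 ≤ N → (∀ p, St L (u p)) → (∀ i j, HH D.W μ N k B (cp u i j)) →
    (∀ w ∈ D.W, HB D.W μ N k M (cc D u w)) ∧ ∀ i j, HB D.W μ N k M (cp (aA u) i j) := by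
  obtain ⟨M1, h1⟩ := aA_HB d L hL B hB k
  choose M2 h2 using fun w  ↦ pol_HB d k M1 (D.c w)
  have hle : ∀ w ∈ D.W, M2 w ≤ |M1| + ∑ w ∈ D.W, |M2 w| := fun w hw  ↦ by
    have := single_le_sum (f := fun w  ↦ |M2 w|) (fun _ _  ↦ abs_nonneg _) hw
    have := le_abs_self (M2 w)
    have := abs_nonneg M1
    linarith
  refine ⟨|M1| + ∑ w ∈ D.W, |M2 w|, by positivity, fun μ N u hN hu hk  ↦ ?_⟩
  have a := h1 D.W μ N u hN hu hk
  refine ⟨fun w hw  ↦ HB.mono hN (h2 w D.W μ N (aA u) hN a) (hle w hw), fun i j  ↦ HB.mono hN (a i j) ?_⟩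
  have : 0 ≤ ∑ w ∈ D.W, |M2 w| := by positivity
  linarith [le_abs_self M1]

lemma Rb (hL : 0 < L) (i B) (hB : 0 ≤ B) : ∃ Cr, 0 ≤ Cr ∧ ∀ (μ N) (u),
    0 < μ → 0 ≤ N → (∀ p, St L (u p)) → (∀ a b, HH D.W μ N (i + 2) B (cp u a b)) →
    ∀ p a b, ∀ Z ∈ ls D.W (i + 2), |TT μ Z (rhs D μ u a b) p - Lop D.W μ (cc D u) (TT μ Z (cp u a b)) p|
      ≤ Cr * (√(GG D μ (i + 3) u p) + (1 + N) ^ 2) := by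
  obtain ⟨M, hM, h⟩ := cc_HB D hL (i + 2) B hB
  set M2 : ℝ := 2 ^ (i + 2) * (M * M) with hM2
  set K : ℝ := (2 ^ (i + 1) * (2 ^ (i + 1) * (M2 * B) * B)
      + 2 * (2 ^ (i + 1) * (M2 * B) + (i + 1 : ℕ) * 2 ^ (i + 1) * (2 ^ (i + 1) * (M2 * B) * B))) with hK
  set C1 : ℝ := D.W.card * (((i + 1 : ℕ) + 1) * (M + (i + 1 : ℕ) * 2 ^ (i + 1) * (M * B)) + 2 * ((i + 1 : ℕ) + 1) * M) with hC1
  have hM20 : 0 ≤ M2 := by positivity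
  have hK0 : 0 ≤ K := by positivity
  refine ⟨C1 + 5 * d ^ 4 * K, by positivity, fun μ N u hμ hN hu hk p a b Z hZ  ↦ ?_⟩
  obtain ⟨hc, hA⟩ := h μ N u hN hu hk
  set Vt := √(GG D μ (i + 3) u p) with hVt
  have hVt0 : 0 ≤ Vt := sqrt_nonneg _
  have b1 := commut_bd (W := D.W) D.hW (p := p) (j := i + 1) (Vt := Vt) hμ hN (c := cc D u) (B := B)
    (fun w  ↦ by funext q; simp only [cc, D.hsym]) hB hVt0
    (fun w hw  ↦ (hc w hw).1) (fun w hw v hv  ↦ ((hc w hw).1.2 v hv).1) (hk a b)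
    (fun Y hY  ↦ TT_le_GG D hY a b) Z hZ
  have hf : ∀ e x y, HB D.W μ N (i + 1) B (DD μ (ee e) (cp u x y)) := fun e x y  ↦
    ⟨(hk x y).2 _ (D.hee e), ((hk x y).2 _ (D.hee e)).1⟩
  have hv : ∀ e x y, ∀ Y ∈ ls D.W (i + 2), |TT μ Y (DD μ (ee e) (cp u x y)) p| ≤ Vt := fun e x y Y hY  ↦
    TT_le_GG D (mem_ls_cons (D.hee e) hY) x y
  have b2 := Quad_TT (μ := μ) (u := u) (Z := Z) (p := p) (K := K * (Vt + (1 + N) ^ 2))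
    (fun a b r s e1 i1 j1 e2 i2 j2  ↦ quad_term hN hVt0 (HB.mul hN (hA a b) (hA r s)) (hf e1 i1 j1) (hf e2 i2 j2)
      (hv _ _ _) (hv _ _ _) Z hZ) a b
  simp only [rhs, TT_add, Pi.add_apply]
  rw [add_sub_right_comm]
  refine (abs_add_le _ _).trans ?_
  have b3 : D.W.card * (((i + 1 : ℕ) + 1) * (M * Vt + (i + 1 : ℕ) * 2 ^ (i + 1) * (M * B) * (1 + N) ^ 2) + 2 * ((i + 1 : ℕ) + 1) * M * Vt)
      ≤ C1 * (Vt + (1 + N) ^ 2) := by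
    rw [hC1, mul_assoc (D.W.card : ℝ)]
    refine mul_le_mul_of_nonneg_left ?_ (Nat.cast_nonneg _)
    have q1 : 0 ≤ (((i + 1 : ℕ) : ℝ) + 1) * (M * (1 + N) ^ 2) := by positivity
    have q2 : 0 ≤ (((i + 1 : ℕ) : ℝ) + 1) * (((i + 1 : ℕ) * 2 ^ (i + 1) * (M * B)) * Vt) := by positivity
    linarith
  linarith

lemma R1 (hL : 0 < L) (B) (hB : 1 ≤ B) : ∃ Cr, 0 ≤ Cr ∧ ∀ (μ u),
    0 < μ → (∀ p, St L (u p)) → (∀ p a b, |u p a b| ≤ B) → (∀ p, GG D μ 1 u p ≤ 1) →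
    ∀ p a b, ∀ Z ∈ ls D.W 1, |TT μ Z (rhs D μ u a b) p - Lop D.W μ (cc D u) (TT μ Z (cp u a b)) p|
      ≤ Cr * (√(GG D μ 2 u p) + √(GG D μ 1 u p)) := by
  have hB0 : 0 ≤ B := by linarith
  obtain ⟨M, hM, h⟩ := cc_HB D hL 1 B hB0
  set M2 : ℝ := 2 ^ 1 * (M * M) with hM2
  have hM20 : 0 ≤ M2 := by positivity
  refine ⟨D.W.card * (M + 2 * M) + 5 * d ^ 4 * (2 * M2), by positivity, fun μ u hμ hu hb hG p a b Z hZ  ↦ ?_⟩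
  have hD : ∀ w ∈ D.W, ∀ a b q, |DD μ w (cp u a b) q| ≤ √(GG D μ 1 u q) := fun w hw a b q  ↦
    TT_le_GG D (Z := [w]) (by rw [mem_ls_succ]; exact ⟨w, hw, [], by simp [ls], rfl⟩) a b
  have hD1 : ∀ w ∈ D.W, ∀ a b q, |DD μ w (cp u a b) q| ≤ 1 := fun w hw a b q  ↦
    (hD w hw a b q).trans (Real.sqrt_le_one.2 (hG q))
  have hk : ∀ a b, HH D.W μ 0 1 B (cp u a b) := fun a b  ↦
    ⟨fun q  ↦ hb q a b, fun w hw q  ↦ (hD1 w hw a b q).trans lna⟩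
  obtain ⟨hc, hA⟩ := h μ 0 u le_rfl hu hk
  set Vt := √(GG D μ 2 u p) with hVt
  set S := √(GG D μ 1 u p) with hS
  have hVt0 : 0 ≤ Vt := sqrt_nonneg _
  have hS0 : 0 ≤ S := sqrt_nonneg _
  have b1 := commut_bd (W := D.W) D.hW (p := p) (j := 0) (Vt := Vt) hμ le_rfl (c := cc D u) (B := B)
    (fun w  ↦ by funext q; simp only [cc, D.hsym]) hB0 hVt0
    (fun w hw  ↦ (hc w hw).1) (fun w hw v hv q  ↦ by simpa using (hc w hw).1.2 v hv q) (hk a b)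
    (fun Y hY  ↦ TT_le_GG D hY a b) Z hZ
  obtain ⟨z, hz, Zp, hZp, rfl⟩ := mem_ls_succ.1 hZ
  simp only [ls, Finset.mem_singleton] at hZp
  subst hZp
  have b2 := Quad_TT (μ := μ) (u := u) (Z := [z]) (p := p) (K := 2 * M2 * (Vt + S))
    (fun a b r s e1 i1 j1 e2 i2 j2  ↦ by
      have hq := HB.mul le_rfl (hA a b) (hA r s)
      set q := cp (aA u) a b * cp (aA u) r s with hqd
      set f := DD μ (ee e1) (cp u i1 j1) with hf
      set g := DD μ (ee e2) (cp u i2 j2) with hg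
      have e : TT μ [z] (q * f * g) p = DD μ z q p * (f p * g p) + (q (p + z) * g p) * DD μ z f p
          + (q (p + z) * f (p + z)) * DD μ z g p := by
        simp only [TT, DD, Pi.mul_apply]
        ring
      rw [e]
      have m1 : |DD μ z q p| ≤ M2 := by simpa [hM2] using hq.1.2 z hz p
      have m2 := hq.2 (p + z)
      have f1 : |f p| ≤ 1 := hD1 _ (D.hee e1) _ _ _
      have f1' : |f (p + z)| ≤ 1 := hD1 _ (D.hee e1) _ _ _
      have g1 : |g p| ≤ 1 := hD1 _ (D.hee e2) _ _ _
      have g2 : |g p| ≤ S := hD _ (D.hee e2) _ _ _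
      have f3 : |DD μ z f p| ≤ Vt := TT_le_GG D (Z := [ee e1, z]) (mem_ls_cons (D.hee e1) hZ) i1 j1
      have g3 : |DD μ z g p| ≤ Vt := TT_le_GG D (Z := [ee e2, z]) (mem_ls_cons (D.hee e2) hZ) i2 j2
      refine (abs_add_three _ _ _).trans ?_
      simp only [abs_mul]
      have t1 : |DD μ z q p| * (|f p| * |g p|) ≤ M2 * (1 * S) := by gcongr
      have t2 : |q (p + z)| * |g p| * |DD μ z f p| ≤ M2 * 1 * Vt := by gcongr
      have t3 : |q (p + z)| * |f (p + z)| * |DD μ z g p| ≤ M2 * 1 * Vt := by gcongr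
      have : 0 ≤ M2 * S := by positivity
      linarith) a b
  simp only [rhs, TT_add, Pi.add_apply]
  rw [add_sub_right_comm]
  refine (abs_add_le _ _).trans ?_
  simp only [Nat.cast_zero, zero_add, zero_mul, add_zero, one_mul, mul_one] at b1
  have : 0 ≤ D.W.card * (M + 2 * M) * S := by positivity
  linarith

end

def mu (θ : ℝ) (n : ℕ) : ℝ := √(1 + θ * n)
def ta (θ : ℝ) (n : ℕ) : ℝ := θ / (1 + θ * n)

lemma mu_sq (hθ : 0 ≤ θ) (n) : mu θ n ^ 2 = 1 + θ * n := sq_sqrt psv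
lemma one_le_mu (hθ : 0 ≤ θ) (n) : 1 ≤ mu θ n :=
  Real.one_le_sqrt.2 (by have : 0 ≤ θ * n := by positivity
                         linarith)
lemma ta_mu (hθ : 0 ≤ θ) (n) : ta θ n * mu θ n ^ 2 = θ := by
  rw [mu_sq hθ, ta]
  have : 0 < 1 + θ * n := by positivity
  field_simp
lemma ta_nonneg (hθ : 0 ≤ θ) (n) : 0 ≤ ta θ n := by unfold ta; positivity
lemma ta_le (hθ : 0 ≤ θ) (n) : ta θ n ≤ θ := by
  have := ta_mu hθ n
  have := one_le_mu hθ n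
  have := ta_nonneg hθ n
  nlinarith [sq_nonneg (mu θ n - 1)]

lemma one_add_pow_le (k) (h0 : 0 ≤ t) (h1 : t ≤ 1) : (1 + t) ^ k ≤ 1 + 2 ^ k * t := by
  suffices (1 + t) ^ k ≤ 1 + (2 ^ k - 1) * t by nlinarith
  induction k with
  | zero => simp
  | succ k ih =>
    have : (1:ℝ) ≤ 2 ^ k := one_le_pow₀ nmn
    have h2 : ((2:ℝ) ^ k - 1) * t * (1 - t) ≥ 0 := by
      apply mul_nonneg (mul_nonneg _ h0) <;> linarith
    calc (1 + t) ^ (k + 1) = (1 + t) ^ k * (1 + t) := pow_succ _ _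
      _ ≤ (1 + (2 ^ k - 1) * t) * (1 + t) := by gcongr
      _ ≤ _ := by rw [pow_succ]; nlinarith

section
variable (D : SD d L)

lemma Lop_lin (W μ K) (c : Pt d → Pt d → ℝ) (f g p) :
    Lop W μ c (fun p  ↦ f p + K * g p) p = Lop W μ c f p + K * Lop W μ c g p := by
  simp only [Lop, DD, mul_sum, ← sum_add_distrib]
  exact sum_congr rfl fun w _  ↦ by ring

lemma GG_mu (θ) (hθ : 0 ≤ θ) (n k u p) :
    GG D (mu θ (n + 1)) k u p = (1 + ta θ n) ^ k * GG D (mu θ n) k u p := by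
  have h0 := one_le_mu hθ n
  have h1 : mu θ (n + 1) = mu θ (n + 1) / mu θ n * mu θ n := by field_simp
  rw [h1, GG_scale, div_pow, mu_sq hθ, mu_sq hθ, ta]
  have : 0 < 1 + θ * n := by positivity
  congr 2
  push_cast
  field_simp
  ring

def Good (B μ : ℝ) (u : Pt d → Mt d) : Prop :=
  (∀ p, St L (u p)) ∧ (∀ p a b, |u p a b| ≤ B) ∧ ∀ p, GG D μ 1 u p ≤ 1

lemma star1 (hL : 0 < L) (B) (hB : 1 ≤ B) : ∃ C, 0 ≤ C ∧ ∃ θ0 > 0, ∀ θ ≤ θ0, Th D θ → ∀ n u, Good D B (mu θ n) u →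
    ∀ p, GG D (mu θ n) 1 (stp D θ u) p ≤ GG D (mu θ n) 1 u p + ta θ n * Lop D.W (mu θ n) (cc D u) (GG D (mu θ n) 1 u) p
      - ta θ n * (D.c0 / 4) * GG D (mu θ n) 2 u p + ta θ n * C * GG D (mu θ n) 1 u p := by
  obtain ⟨Cr, hCr, h⟩ := R1 D hL B hB
  have hn : 0 < nn D 1 := by unfold nn; positivity
  have hc0 := D.hc0
  refine ⟨8 * nn D 1 * Cr ^ 2 / D.c0 + 2 * Cr * nn D 1 + 4 * Cr ^ 2 * nn D 1, by positivity,
    D.c0 / (32 * Cr ^ 2 * nn D 1 + 1), by positivity, fun θ hθ0 hθ n u hu p  ↦ ?_⟩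
  have hθp := hθ.1.le
  have hm := one_le_mu hθp n
  have ht := ta_le hθp n
  have ht0 := ta_nonneg hθp n
  have hX : 0 ≤ Cr ^ 2 * nn D 1 := by positivity
  rw [le_div_iff₀ psv] at hθ0
  have := gstep D (k := 1) hθ (by linarith : 0 < mu θ n) (ta_mu hθp n) ht0 (hu.1 p) hCr (sqrt_nonneg (GG D (mu θ n) 1 u p))
    (h _ u lna hu.1 hu.2.1 hu.2.2 p) (by nlinarith)
  refine this.trans ?_
  have hG := GG_nonneg D (mu θ n) 1 u p
  have e : 2 * ta θ n * Cr * √(GG D (mu θ n) 1 u p) * (nn D 1 * √(GG D (mu θ n) 1 u p)) =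
      2 * ta θ n * Cr * nn D 1 * GG D (mu θ n) 1 u p := by
    rw [mul_mul_mul_comm, Real.mul_self_sqrt hG]
  rw [e, sq_sqrt hG]
  have : 4 * ta θ n ^ 2 * Cr ^ 2 * nn D 1 * GG D (mu θ n) 1 u p ≤ ta θ n * (4 * Cr ^ 2 * nn D 1) * GG D (mu θ n) 1 u p := by
    have h8 := hθ.2.1
    refine mul_le_mul_of_nonneg_right ?_ hG
    nlinarith [mul_nonneg (mul_nonneg ht0 hX) (by linarith : 0 ≤ 1 - ta θ n)]
  linarith

lemma GG_le
    (h : ∀ i j, ∀ Z ∈ ls D.W k, |TT μ Z (cp u i j) p| ≤ b) : GG D μ k u p ≤ nn D k * b ^ 2 := by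
  refine (Finset.sum_le_card_nsmul _ _ (b ^ 2) (fun x hx  ↦ ?_)).trans ?_
  · rw [← sq_abs]
    exact pow_le_pow_left₀ (abs_nonneg _) (h _ _ _ ((mem_ix D).1 hx)) 2
  · rw [nsmul_eq_mul]
    unfold nn
    nlinarith [sq_nonneg b]

lemma starK (hL : 0 < L) (i B) (hB : 1 ≤ B) : ∃ C Λ, 0 ≤ C ∧ 1 ≤ Λ ∧ ∀ θ, Th D θ → ∀ n u N, 0 ≤ N →
    N ≤ 2 * mu θ n * B → Λ ≤ mu θ n ^ 2 → (∀ p, St L (u p)) → (∀ a b, HH D.W (mu θ n) N (i + 2) B (cp u a b)) →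
    ∀ p, GG D (mu θ n) (i + 2) (stp D θ u) p ≤ GG D (mu θ n) (i + 2) u p
      + ta θ n * Lop D.W (mu θ n) (cc D u) (GG D (mu θ n) (i + 2) u) p
      - ta θ n * (D.c0 / 4) * GG D (mu θ n) (i + 3) u p + ta θ n * C * (1 + N) ^ 3 := by
  obtain ⟨Cr, hCr, h⟩ := Rb D hL i B lna
  have hn : 1 ≤ nn D (i + 2) := by unfold nn; simp
  set m := nn D (i + 2) with hm
  have hc0 := D.hc0
  refine ⟨8 * m * Cr ^ 2 / D.c0 * (m * B ^ 2) + 2 * Cr * (m * (m * B)) + 4 * Cr ^ 2 * m * (9 * B ^ 2),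
    1 + 32 * Cr ^ 2 * m / D.c0, by positivity, by have : 0 ≤ 32 * Cr ^ 2 * m / D.c0 := by positivity
                                                  linarith, fun θ hθ n u N hN hN2 hΛ hu hk p  ↦ ?_⟩
  have hθp := hθ.1.le
  have hμ1 := one_le_mu hθp n
  have ht0 := ta_nonneg hθp n
  have htm := ta_mu hθp n
  have h8 := hθ.2.1
  set μ := mu θ n
  set τ := ta θ n
  have hsm : 32 * τ * Cr ^ 2 * m ≤ D.c0 := by
    have h1 : 32 * Cr ^ 2 * m / D.c0 ≤ μ ^ 2 := by linarith
    rw [div_le_iff₀ hc0] at h1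
    have := mul_le_mul_of_nonneg_left h1 ht0
    nlinarith
  have := gstep D (k := i + 2) hθ (by linarith : 0 < μ) htm ht0 (hu p) hCr (by positivity : 0 ≤ (1 + N) ^ 2)
    (h _ N u lna hN hu hk p) hsm
  refine this.trans ?_
  have hb : GG D μ (i + 2) u p ≤ m * (B * (1 + N)) ^ 2 := GG_le D fun a b Z hZ  ↦ (hk a b).TT_le Z hZ p
  have hb2 : √(GG D μ (i + 2) u p) ≤ m * B * (1 + N) := by
    rw [Real.sqrt_le_left psv]
    refine hb.trans ?_
    have : 0 ≤ (B * (1 + N)) ^ 2 * (m * (m - 1)) := mul_nonneg psv (mul_nonneg lna lna)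
    nlinarith
  have hG := GG_nonneg D μ (i + 2) u p
  have hτ2 : τ * (1 + N) ^ 2 ≤ 9 * B ^ 2 := by
    have : (1 + N) ^ 2 ≤ (3 * μ * B) ^ 2 := by
      apply pow_le_pow_left₀ psv
      nlinarith
    have := mul_le_mul_of_nonneg_left this ht0
    have e : τ * (3 * μ * B) ^ 2 = 9 * B ^ 2 * θ := by rw [← htm]; ring
    nlinarith [sq_nonneg B]
  have t1 : τ * (8 * m * Cr ^ 2 / D.c0) * GG D μ (i + 2) u p ≤ τ * (8 * m * Cr ^ 2 / D.c0) * (m * B ^ 2 * (1 + N) ^ 3) := by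
    refine mul_le_mul_of_nonneg_left (hb.trans ?_) psv
    have : 0 ≤ m * B ^ 2 * (1 + N) ^ 2 * N := by positivity
    nlinarith
  have t2 : 2 * τ * Cr * (1 + N) ^ 2 * (m * √(GG D μ (i + 2) u p)) ≤ 2 * τ * Cr * (1 + N) ^ 2 * (m * (m * B * (1 + N))) := by
    gcongr
  have t3 : 4 * τ ^ 2 * Cr ^ 2 * m * ((1 + N) ^ 2) ^ 2 ≤ τ * (4 * Cr ^ 2 * m * (9 * B ^ 2)) * (1 + N) ^ 3 := by
    have q1 : τ * (1 + N) ^ 2 * (1 + N) ^ 2 ≤ 9 * B ^ 2 * (1 + N) ^ 3 := by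
      refine mul_le_mul hτ2 ?_ psv psv
      have : 0 ≤ (1 + N) ^ 2 * N := by positivity
      nlinarith
    have := mul_le_mul_of_nonneg_left q1 (show 0 ≤ 4 * τ * Cr ^ 2 * m by positivity)
    linarith
  linarith

lemma HH_ext : ∀ {f}, HH W μ 0 k B f →
    (∀ Z ∈ ls W (k + 1), ∀ p, |TT μ Z f p| ≤ B * (1 + N)) → HH W μ N (k + 1) B f := by
  induction k with
  | zero =>
    intro f h h2
    refine ⟨fun p  ↦ by simpa using h p, fun w hw p  ↦ h2 [w] (mem_ls_cons hw (by simp [ls])) p⟩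
  | succ k ih =>
    intro f h h2
    exact ⟨h.1, fun w hw  ↦ ih (h.2 w hw) fun Z hZ p  ↦ h2 (w :: Z) (mem_ls_cons hw hZ) p⟩

lemma num_case {F G1} (hY : Y = s ^ 2) (hK : K = κ * (1 + s)) (hs : 1 ≤ s) (hκ : 0 ≤ κ)
    (hc0 : 0 ≤ c0) (hC1 : 0 ≤ C1) (hC2 : 0 ≤ C2)
    (ha : 2 ^ k + 4 * C1 ≤ c0 * κ / 32) (hb : C2 ≤ c0 * s ^ 2 / 32) (hc : K * G1 ≤ s ^ 2 / 4)
    (hd1 : C1 * (9 * B ^ 2) * (1 + s) ≤ s ^ 2 / 16) (hd2 : κ * (1 + s) * C2 ≤ s ^ 2 / 16)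
    (hτ0 : 0 ≤ τ) (hτ : 2 ^ k * τ ≤ 1 / 8) (hN : 0 ≤ N) (hNs : N ≤ s) (hτN : τ * (1 + N) ^ 2 ≤ 9 * B ^ 2)
    (hF : F = G + K * G1) (hG : 0 ≤ G) (h1 : F + τ * LF ≤ Y) (h2 : F ≤ Y / 2 → F + τ * LF ≤ 3 * Y / 4)
    (hx : x ≤ F + τ * LF - τ * (c0 / 4) * K * G + τ * (C1 * (1 + N) ^ 3 + K * C2)) :
    (1 + τ) ^ k * x ≤ Y := by
  subst hY
  have hk1 : (1:ℝ) ≤ 2 ^ k := one_le_pow₀ nmn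
  have hτ1 : τ ≤ 1 / 8 := by nlinarith
  have hp := one_add_pow_le k hτ0 lna
  have hp0 : 0 ≤ (1 + τ) ^ k := by positivity
  have hK0 : 0 ≤ K := by rw [hK]; positivity
  by_cases hc2 : F ≤ s ^ 2 / 2
  · have e1 : τ * (C1 * (1 + N) ^ 3) ≤ s ^ 2 / 16 := by
      have : τ * (C1 * (1 + N) ^ 3) = C1 * (τ * (1 + N) ^ 2) * (1 + N) := by ring
      rw [this]
      refine le_trans ?_ hd1
      gcongr
    have e2 : τ * (K * C2) ≤ s ^ 2 / 16 := by
      have : 0 ≤ K * C2 := by positivity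
      rw [← hK] at hd2
      nlinarith
    have e3 : 0 ≤ τ * (c0 / 4) * K * G := by positivity
    have := h2 hc2
    have hxp : x ≤ 7 / 8 * s ^ 2 := by linarith
    calc (1 + τ) ^ k * x ≤ (1 + τ) ^ k * (7 / 8 * s ^ 2) := by gcongr
      _ ≤ (1 + 1 / 8) * (7 / 8 * s ^ 2) := by
        have : 0 ≤ s ^ 2 := by positivity
        gcongr
        linarith
      _ ≤ s ^ 2 := by nlinarith [sq_nonneg s]
  · push Not at hc2
    have hGY : s ^ 2 / 4 ≤ G := by linarith
    have e1 : C1 * (1 + N) ^ 3 ≤ 4 * C1 * (s ^ 2 * (1 + s)) := by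
      have : (1 + N) ^ 3 ≤ (2 * s) ^ 2 * (1 + s) := by
        rw [pow_succ]
        gcongr
        linarith
      nlinarith
    have e2 : K * C2 ≤ κ * (1 + s) * (c0 * s ^ 2 / 32) := by rw [hK]; gcongr
    have e3 : (c0 / 4) * K * (s ^ 2 / 4) ≤ (c0 / 4) * K * G := by gcongr
    have e4 : (2 ^ k + 4 * C1) * (s ^ 2 * (1 + s)) ≤ c0 * κ / 32 * (s ^ 2 * (1 + s)) := by gcongr
    have e5 : (2:ℝ) ^ k * s ^ 2 ≤ 2 ^ k * (s ^ 2 * (1 + s)) := by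
      gcongr
      nlinarith [sq_nonneg s]
    have e6 : C1 * (1 + N) ^ 3 + K * C2 + 2 ^ k * s ^ 2 ≤ (c0 / 4) * K * G := by
      rw [hK] at e3 ⊢
      rw [hK] at e2
      linarith
    have hxp : x ≤ s ^ 2 - 2 ^ k * τ * s ^ 2 := by
      have := mul_le_mul_of_nonneg_left e6 hτ0
      linarith
    have hY0 : 0 ≤ s ^ 2 := by positivity
    have hq : 2 ^ k * τ * s ^ 2 ≤ 1 / 8 * s ^ 2 := mul_le_mul_of_nonneg_right hτ hY0
    have f1 := mul_le_mul_of_nonneg_left hxp hp0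
    have f2 := mul_le_mul_of_nonneg_right hp (show 0 ≤ s ^ 2 - 2 ^ k * τ * s ^ 2 by linarith)
    have f3 := mul_nonneg hY0 (sq_nonneg (2 ^ k * τ))
    have f4 : (1 + 2 ^ k * τ) * (s ^ 2 - 2 ^ k * τ * s ^ 2) = s ^ 2 - s ^ 2 * (2 ^ k * τ) ^ 2 := by ring
    linarith

end

lemma n1 (h : 2 * a ≤ s) (hs : 1 ≤ s) : a * (1 + s) ≤ s ^ 2 := by nlinarith
lemma n2 (h : a ≤ s) (hs : 1 ≤ s) : a ≤ s ^ 2 := by nlinarith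
lemma n3 (h : x ≤ N) (hN : 0 ≤ N) (hB : 1 ≤ B) : x ≤ B * (1 + N) := by nlinarith
lemma n4 (h : A + 8 * K ≤ μ ^ 2) (hA : 0 ≤ A) (ht : 0 ≤ τ) (htm : τ * μ ^ 2 = θ) (hθ : θ ≤ 1 / 8) :
    K * τ ≤ 1 / 8 := by
  have h1 := mul_le_mul_of_nonneg_left h ht
  have := mul_nonneg ht hA
  linarith
lemma n5 (hN0 : 0 ≤ N) (hN : N ≤ 2 * μ * B) (hμ : 1 ≤ μ) (hB : 1 ≤ B) (ht0 : 0 ≤ τ) (htm : τ * μ ^ 2 = θ)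
    (hθ : θ ≤ 1 / 8) : τ * (1 + N) ^ 2 ≤ 9 * B ^ 2 := by
  have h1 : 1 ≤ μ * B := by nlinarith
  have : (1 + N) ^ 2 ≤ (3 * μ * B) ^ 2 := pow_le_pow_left₀ psv lna 2
  have := mul_le_mul_of_nonneg_left this ht0
  have e : τ * (3 * μ * B) ^ 2 = 9 * B ^ 2 * θ := by rw [← htm]; ring
  have := mul_le_mul_of_nonneg_left hθ (by positivity : 0 ≤ 9 * B ^ 2)
  have := sq_nonneg B
  linarith

section
variable (D : SD d L)

def Run (θ B : ℝ) (J : ℕ) (u : ℕ → Pt d → Mt d) : Prop :=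
  (∀ n < J, u (n + 1) = stp D θ (u n)) ∧ ∀ n ≤ J, Good D B (mu θ n) (u n)

def Lev (θ1 B0 : ℝ) (k : ℕ) (B Λ C : ℝ) : Prop := ∀ θ ≤ θ1, Th D θ → ∀ J u, Run D θ B0 J u → ∀ n ≤ J,
  (∀ a b, HH D.W (mu θ n) 0 k B (cp (u n) a b)) ∧ (Λ ≤ mu θ n ^ 2 → ∀ p,
    GG D (mu θ n) k (stp D θ (u n)) p ≤ GG D (mu θ n) k (u n) p
      + ta θ n * Lop D.W (mu θ n) (cc D (u n)) (GG D (mu θ n) k (u n)) p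
      - ta θ n * (D.c0 / 4) * GG D (mu θ n) (k + 1) (u n) p + ta θ n * C)

lemma Lev_one (hL : 0 < L) (B0) (hB0 : 1 ≤ B0) : ∃ θ1 > 0, ∃ C, 0 ≤ C ∧ Lev D θ1 B0 1 B0 1 C := by
  obtain ⟨C, hC, θ0, hθ0, h⟩ := star1 D hL B0 hB0
  refine ⟨θ0, hθ0, C, hC, fun θ hθ1 hθ J u hu n hn  ↦ ?_⟩
  have g := hu.2 n hn
  refine ⟨fun a b  ↦ ⟨fun p  ↦ g.2.1 p a b, fun w hw p  ↦ ?_⟩, fun _ p  ↦ ?_⟩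
  · have := TT_le_GG D (μ := mu θ n) (u := u n) (p := p) (Z := [w]) (k := 0 + 1) (mem_ls_cons hw (by simp [ls])) a b
    exact this.trans ((Real.sqrt_le_one.2 (g.2.2 p)).trans lna)
  · refine (h θ hθ1 hθ n (u n) g p).trans ?_
    have : ta θ n * C * GG D (mu θ n) 1 (u n) p ≤ ta θ n * C * 1 :=
      mul_le_mul_of_nonneg_left (g.2.2 p) (mul_nonneg (ta_nonneg hθ.1.le n) hC)
    linarith

set_option maxHeartbeats 2000000 in
lemma Lev_succ (hL : 0 < L) (θ1 B0 i B Λ C) (hB : 1 ≤ B) (hΛ : 1 ≤ Λ) (hC : 0 ≤ C)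
    (h : Lev D θ1 B0 (i + 1) B Λ C) : ∃ Bp Λp Cp, 1 ≤ Bp ∧ 1 ≤ Λp ∧ 0 ≤ Cp ∧ Lev D θ1 B0 (i + 2) Bp Λp Cp := by
  obtain ⟨C1, Λ1, hC1, hΛ1, hs⟩ := starK D hL i B hB
  have hc0 := D.hc0
  obtain ⟨M, hMd⟩ := exi (nn D (i + 2))
  obtain ⟨m, hmd⟩ := exi (nn D (i + 1))
  have hM : 0 ≤ M := by rw [hMd]; unfold nn; positivity
  have hm : 0 ≤ m := by rw [hmd]; unfold nn; positivity
  obtain ⟨κ, hκ⟩ := exi (32 * (2 ^ (i + 2) + 4 * C1) / D.c0)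
  have hκ0 : 0 ≤ κ := by rw [hκ]; positivity
  obtain ⟨Λ2, hΛ2⟩ := exi (Λ + Λ1 + 8 * 2 ^ (i + 2))
  have hp2 : (0:ℝ) < 2 ^ (i + 2) := by positivity
  have hΛ20 : 0 ≤ Λ2 := by rw [hΛ2]; positivity
  obtain ⟨a1, ha1⟩ := exi (4 * κ * (m * B ^ 2))
  obtain ⟨a2, ha2⟩ := exi (16 * C1 * (9 * B ^ 2))
  obtain ⟨a3, ha3⟩ := exi (16 * κ * C)
  obtain ⟨a4, ha4⟩ := exi (32 * C / D.c0)
  obtain ⟨a5, ha5⟩ := exi (8 * (M * (4 * (Λ2 + 1) * B ^ 2)))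
  have h1 : 0 ≤ a1 := by rw [ha1]; positivity
  have h2 : 0 ≤ a2 := by rw [ha2]; positivity
  have h3 : 0 ≤ a3 := by rw [ha3]; positivity
  have h4 : 0 ≤ a4 := by rw [ha4]; positivity
  have h5 : 0 ≤ a5 := by rw [ha5]; positivity
  obtain ⟨s, hsd⟩ := exi (1 + 2 * a1 + 2 * a2 + 2 * a3 + a4 + a5)
  have hs1 : 1 ≤ s := by linarith
  have q : ∀ a, 2 * a ≤ s → a * (1 + s) ≤ s ^ 2 := fun a ha  ↦ n1 ha hs1
  have q1 := q a1 lna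
  have q2 := q a2 lna
  have q3 := q a3 lna
  have q4 : a4 ≤ s ^ 2 := n2 lna hs1
  have q5 : a5 ≤ s ^ 2 := n2 lna hs1
  clear q hsd
  obtain ⟨K, hK⟩ := exi (κ * (1 + s))
  have hK0 : 0 ≤ K := by rw [hK]; positivity
  have hKm : K * (m * B ^ 2) ≤ s ^ 2 / 4 := by rw [hK]; rw [ha1] at q1; linarith
  have main : ∀ θ ≤ θ1, Th D θ → ∀ J u, Run D θ B0 J u → ∀ n ≤ J, ∀ p,
      GG D (mu θ n) (i + 2) (u n) p + K * GG D (mu θ n) (i + 1) (u n) p ≤ s ^ 2 := by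
    intro θ hθ1 hθ J u hu n
    have hθ0 := hθ.1.le
    have hV : ∀ n ≤ J, ∀ a b, ∀ Z ∈ ls D.W (i + 2), ∀ p, |TT (mu θ n) Z (cp (u n) a b) p| ≤ 2 * mu θ n * B := by
      intro n hn a b Z hZ p
      obtain ⟨w, hw, Zp, hZp, rfl⟩ := mem_ls_succ.1 hZ
      simp only [TT]
      rw [TT_DD, DD, abs_mul, abs_of_pos (by linarith [one_le_mu hθ0 n])]
      have x1 := ((h θ hθ1 hθ J u hu n hn).1 a b).TT_le Zp hZp (p + w)
      have x2 := ((h θ hθ1 hθ J u hu n hn).1 a b).TT_le Zp hZp p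
      have := (abs_sub (TT (mu θ n) Zp (cp (u n) a b) (p + w)) (TT (mu θ n) Zp (cp (u n) a b) p))
      have := mul_le_mul_of_nonneg_left (this.trans (add_le_add x1 x2)) (by linarith [one_le_mu hθ0 n] : 0 ≤ mu θ n)
      linarith
    have hG1 : ∀ n ≤ J, ∀ p, GG D (mu θ n) (i + 1) (u n) p ≤ m * B ^ 2 := fun n hn p  ↦ hmd ▸
      GG_le D fun a b Z hZ  ↦ by simpa using ((h θ hθ1 hθ J u hu n hn).1 a b).TT_le Z hZ p
    have small : ∀ n ≤ J, mu θ n ^ 2 ≤ Λ2 + 1 → ∀ p,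
      GG D (mu θ n) (i + 2) (u n) p + K * GG D (mu θ n) (i + 1) (u n) p ≤ s ^ 2 := by
      intro n hn hμ p
      have x1 : GG D (mu θ n) (i + 2) (u n) p ≤ M * (2 * mu θ n * B) ^ 2 := hMd ▸ GG_le D fun a b Z hZ  ↦ hV n hn a b Z hZ p
      have x2 := mul_le_mul_of_nonneg_left (hG1 n hn p) hK0
      have x3 : M * (2 * mu θ n * B) ^ 2 ≤ M * (4 * (Λ2 + 1) * B ^ 2) := by
        rw [mul_pow, mul_pow]
        gcongr
        norm_num
      linarith
    induction n with
    | zero => exact fun hn p  ↦ small 0 hn (by rw [mu_sq hθ0]; push_cast; linarith) p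
    | succ n ih =>
      intro hn p
      by_cases hμ : mu θ (n + 1) ^ 2 ≤ Λ2 + 1
      · exact small _ hn hμ p
      · have hnp : n ≤ J := by omega
        have ih := ih hnp
        have hμp : Λ2 ≤ mu θ n ^ 2 := by
          rw [mu_sq hθ0] at hμ ⊢
          push_cast at hμ
          have := hθ.2.1
          linarith
        have hm1 := one_le_mu hθ0 n
        have ht0 := ta_nonneg hθ0 n
        have htm := ta_mu hθ0 n
        rw [hu.1 n omg, GG_mu D θ hθ0, GG_mu D θ hθ0]
        set μ := mu θ n
        set τ := ta θ n
        obtain ⟨N, hNd⟩ := exi (min s (2 * μ * B))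
        have hN0 : 0 ≤ N := by rw [hNd]; apply le_min <;> positivity
        have hNs : N ≤ s := by rw [hNd]; exact min_le_left _ _
        have hNμ : N ≤ 2 * μ * B := by rw [hNd]; exact min_le_right _ _
        have hVN : ∀ a b, ∀ Z ∈ ls D.W (i + 2), ∀ p, |TT μ Z (cp (u n) a b) p| ≤ B * (1 + N) := by
          intro a b Z hZ p
          have x1 := hV n hnp a b Z hZ p
          have x2 := TT_le_GG D (μ := μ) (u := u n) (p := p) hZ a b
          have x3 : √(GG D μ (i + 2) (u n) p) ≤ s := by
            rw [Real.sqrt_le_left lna]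
            have := ih p
            have := mul_nonneg hK0 (GG_nonneg D μ (i + 1) (u n) p)
            linarith
          have : |TT μ Z (cp (u n) a b) p| ≤ N := by rw [hNd]; exact le_min (x2.trans x3) x1
          exact n3 this hN0 hB
        have y1 := hs θ hθ n (u n) N hN0 hNμ lna (hu.2 n hnp).1
          (fun a b  ↦ HH_ext ((h θ hθ1 hθ J u hu n hnp).1 a b) (hVN a b)) p
        have y2 := (h θ hθ1 hθ J u hu n hnp).2 lna p
        have hτ1 : 2 ^ (i + 2) * τ ≤ 1 / 8 := n4 (A := Λ + Λ1) lna lna ht0 htm hθ.2.1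
        have hτN : τ * (1 + N) ^ 2 ≤ 9 * B ^ 2 := n5 hN0 hNμ hm1 hB ht0 htm hθ.2.1
        have hcb := fun w hw  ↦ D.hb _ ((hu.2 n hnp).1 p).1 w hw
        have lin := Lop_lin D.W μ K (cc D (u n)) (GG D μ (i + 2) (u n)) (GG D μ (i + 1) (u n)) p
        have av := fun y hy hyY  ↦ avg_le (W := D.W) (μ := μ) (c := cc D (u n)) (p := p) (y := y) htm hθ0 hc0.le hcb hθ.2.2.2
          (F := fun p  ↦ GG D μ (i + 2) (u n) p + K * GG D μ (i + 1) (u n) p) ih hy hyY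
        have hG3 := GG_nonneg D μ (i + 3) (u n) p
        have hGn := GG_nonneg D μ (i + 1) (stp D θ (u n)) p
        have key := num_case (k := i + 2) (Y := s ^ 2) (K := K) (C1 := C1) (C2 := C) (B := B) (τ := τ) (N := N)
          (G := GG D μ (i + 2) (u n) p) (G1 := GG D μ (i + 1) (u n) p)
          (F := GG D μ (i + 2) (u n) p + K * GG D μ (i + 1) (u n) p) (c0 := D.c0)
          (LF := Lop D.W μ (cc D (u n)) (fun p  ↦ GG D μ (i + 2) (u n) p + K * GG D μ (i + 1) (u n) p) p)
          (x := GG D μ (i + 2) (stp D θ (u n)) p + K * GG D μ (i + 1) (stp D θ (u n)) p) rfl hK hs1 hκ0 hc0.le hC1 hC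
          (by rw [hκ]; field_simp; exact le_rfl) (by rw [ha4] at q4; rw [div_le_iff₀ hc0] at q4; linarith)
          ((mul_le_mul_of_nonneg_left (hG1 n hnp p) hK0).trans hKm)
          (by rw [ha2] at q2; linarith) (by rw [ha3] at q3; linarith) ht0 hτ1 hN0 hNs hτN rfl (GG_nonneg D _ _ _ _)
          (by have := av (s ^ 2) (ih p) le_rfl; linarith)
          (fun hF  ↦ by have := av (s ^ 2 / 2) hF (by linarith [sq_nonneg s]); linarith)
          (by
            rw [lin]
            have z1 := mul_le_mul_of_nonneg_left y2 hK0
            have z2 : 0 ≤ τ * (D.c0 / 4) * GG D μ (i + 3) (u n) p := by positivity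
            linarith)
        refine le_trans ?_ key
        rw [mul_add]
        have z : (1 + τ) ^ (i + 1) ≤ (1 + τ) ^ (i + 2) := pow_le_pow_right₀ lna omg
        have := mul_le_mul_of_nonneg_right z (mul_nonneg hK0 hGn)
        linarith
  obtain ⟨C3, Λ3, hC3, hΛ3, hs3⟩ := starK D hL i (B + s) lna
  refine ⟨B + s, Λ3, C3, by linarith, hΛ3, hC3, fun θ hθ1 hθ J u hu n hn  ↦ ?_⟩
  have hH : ∀ a b, HH D.W (mu θ n) 0 (i + 2) (B + s) (cp (u n) a b) := by
    intro a b
    refine HH_ext (HH.mono le_rfl ((h θ hθ1 hθ J u hu n hn).1 a b) lna) fun Z hZ p  ↦ ?_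
    refine (TT_le_GG D hZ a b).trans ?_
    rw [Real.sqrt_le_left lna]
    have := main θ hθ1 hθ J u hu n hn p
    have := mul_nonneg hK0 (GG_nonneg D (mu θ n) (i + 1) (u n) p)
    have : 0 ≤ B * (B + 2 * s) := by positivity
    linarith
  refine ⟨hH, fun hΛp p  ↦ ?_⟩
  have := one_le_mu hθ.1.le n
  simpa using hs3 θ hθ n (u n) 0 le_rfl psv hΛp (hu.2 n hn).1 hH p

lemma Levels (hL : 0 < L) (B0) (hB0 : 1 ≤ B0) : ∃ θ1 > 0, ∀ k, ∃ B, ∀ θ ≤ θ1, Th D θ → ∀ J u, Run D θ B0 J u →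
    ∀ n ≤ J, ∀ a b, HH D.W (mu θ n) 0 (k + 1) B (cp (u n) a b) := by
  obtain ⟨θ1, hθ1, C, hC, h⟩ := Lev_one D hL B0 hB0
  refine ⟨θ1, hθ1, fun k  ↦ ?_⟩
  have : ∃ B Λ C, 1 ≤ B ∧ 1 ≤ Λ ∧ 0 ≤ C ∧ Lev D θ1 B0 (k + 1) B Λ C := by
    induction k with
    | zero => exact ⟨B0, 1, C, hB0, le_rfl, hC, h⟩
    | succ k ih =>
      obtain ⟨B, Λ, C, h1, h2, h3, h4⟩ := ih
      exact Lev_succ D hL θ1 B0 k B Λ C h1 h2 h3 h4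
  obtain ⟨B, Λ, C, _, _, _, h4⟩ := this
  exact ⟨B, fun θ a b J u c n hn  ↦ (h4 θ a b J u c n hn).1⟩
end

section

lemma bil_sym {a : Mt d} (hs : ∀ i j, a i j = a j i) (x y : Fin d → ℝ) :
    ∑ i, ∑ j, a i j * x i * y j = ∑ i, ∑ j, a i j * y i * x j := by
  rw [sum_comm]
  exact sum_congr rfl fun i _  ↦ sum_congr rfl fun j _  ↦ by rw [hs j i]; ring

lemma Ai_sym {a : Mt d} (hs : ∀ i j, a i j = a j i) (i j) : Ai a i j = Ai a j i := by
  have : ((mof a)⁻¹).transpose = (mof a)⁻¹ := by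
    rw [Matrix.transpose_nonsing_inv]
    congr 1
    ext i j
    simp [hs i j]
  exact congrFun (congrFun this.symm i) j

lemma EllM.St (hL : 0 < L) {a : Mt d} (h : EllM L a) : St L a := by
  classical
  have hpd : (mof a).PosDef := by
    refine Matrix.PosDef.of_dotProduct_mulVec_pos (by ext i j; simp [h.1 i j]) fun x hx  ↦ ?_
    have h1 := (h.2 x).1
    have h2 : 0 < ∑ i, x i ^ 2 := by
      obtain ⟨i, hi⟩ := Function.ne_iff.1 hx
      exact Finset.sum_pos' (fun _ _  ↦ sq_nonneg _) ⟨i, Finset.mem_univ _, by have : x i ≠ 0 := hi; positivity⟩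
    have h3 : 0 < L⁻¹ * ∑ i, x i ^ 2 := by positivity
    refine (h3.trans_le h1).trans_eq ?_
    simp only [dotProduct, Matrix.mulVec, mul_sum, Matrix.of_apply, Pi.star_apply, star_trivial]
    exact sum_congr rfl fun i _  ↦ sum_congr rfl fun j _  ↦ by ring
  have hu : IsUnit (mof a).det := hpd.det_pos.ne'.isUnit
  have hm := Matrix.mul_nonsing_inv _ hu
  refine ⟨⟨Ai_sym h.1, fun ξ  ↦ ?_⟩, hm⟩
  obtain ⟨η, hη⟩ : ∃ η : Fin d → ℝ, η = fun i  ↦ ∑ j, Ai a i j * ξ j := ⟨_, rfl⟩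
  have haη : ∀ i, ∑ j, a i j * η j = ξ i := by
    intro i
    have : (mof a).mulVec ((mof a)⁻¹.mulVec ξ) = ξ := by rw [Matrix.mulVec_mulVec, hm, Matrix.one_mulVec]
    have := congrFun this i
    rw [← this]
    simp [Matrix.mulVec, dotProduct, hη, Ai]
  have hQ : ∑ i, ∑ j, Ai a i j * ξ i * ξ j = ∑ i, η i * ξ i := by
    simp only [hη, sum_mul]
    exact sum_congr rfl fun i _  ↦ sum_congr rfl fun j _  ↦ by ring
  have hB : ∀ x : Fin d → ℝ, ∑ i, ∑ j, a i j * x i * η j = ∑ i, x i * ξ i := fun x  ↦ by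
    refine sum_congr rfl fun i _  ↦ ?_
    rw [← haη i, mul_sum]
    exact sum_congr rfl fun j _  ↦ by ring
  have hexp : ∀ s : ℝ, ∑ i, ∑ j, a i j * (η i - s * ξ i) * (η j - s * ξ j) = ∑ i, η i * ξ i - 2 * s * ∑ i, ξ i ^ 2 +
      s ^ 2 * ∑ i, ∑ j, a i j * ξ i * ξ j := fun s  ↦ by
    have e1 := hB ξ
    have e2 := bil_sym h.1 ξ η
    have e3 : ∑ i, ξ i ^ 2 = ∑ i, ξ i * ξ i := sum_congr rfl fun i _  ↦ by ring
    have : ∑ i, ∑ j, a i j * (η i - s * ξ i) * (η j - s * ξ j) = ∑ i, ∑ j, a i j * η i * η j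
      - s * ∑ i, ∑ j, a i j * ξ i * η j - s * ∑ i, ∑ j, a i j * η i * ξ j + s ^ 2 * ∑ i, ∑ j, a i j * ξ i * ξ j := by
      simp only [mul_sum, ← sum_sub_distrib, ← sum_add_distrib]
      exact sum_congr rfl fun i _  ↦ sum_congr rfl fun j _  ↦ by ring
    rw [this, ← e2, hB, hB, e3]
    ring
  have p1 := (h.2 fun i  ↦ η i - L⁻¹ * ξ i).1
  have p0 : 0 ≤ L⁻¹ * ∑ i, (η i - L⁻¹ * ξ i) ^ 2 := by positivity
  rw [hexp] at p1
  have q1 := (h.2 ξ).2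
  have q2 := (h.2 η).1
  rw [hB η] at q2
  have hi : L⁻¹ * L = 1 := inv_mul_cancel₀ hL.ne'
  have hi0 : 0 < L⁻¹ := by positivity
  rw [hQ]
  constructor
  · have := mul_le_mul_of_nonneg_left q1 (sq_nonneg L⁻¹)
    have e : L⁻¹ ^ 2 * (L * ∑ i, ξ i ^ 2) = L⁻¹ * (L⁻¹ * L) * ∑ i, ξ i ^ 2 := by ring
    rw [e, hi] at this
    linarith
  · have cs : 2 * ∑ i, η i * ξ i ≤ L⁻¹ * ∑ i, η i ^ 2 + L * ∑ i, ξ i ^ 2 := by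
      simp only [mul_sum, ← sum_add_distrib]
      refine sum_le_sum fun i _  ↦ ?_
      have : 0 ≤ L⁻¹ * (η i - L * ξ i) ^ 2 := by positivity
      have e : L⁻¹ * (η i - L * ξ i) ^ 2 = L⁻¹ * η i ^ 2 - 2 * (L⁻¹ * L) * (η i * ξ i) + (L⁻¹ * L) * L * ξ i ^ 2 := by ring
      rw [e, hi] at this
      linarith
    linarith

lemma EllM.pert (hl : 1 ≤ lam) {a} (hm : EllM lam m) (hs : ∀ i j, a i j = a j i)
    (h : ∀ i j, |a i j - m i j| ≤ δ) (hδ : 2 * lam * (d * δ) ≤ 1) : EllM (2 * lam) a := by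
  refine ⟨hs, fun ξ  ↦ ?_⟩
  obtain ⟨S, hS⟩ := exi (∑ i, ξ i ^ 2)
  have hS0 : 0 ≤ S := by rw [hS]; positivity
  have e : |∑ i, ∑ j, a i j * ξ i * ξ j - ∑ i, ∑ j, m i j * ξ i * ξ j| ≤ d * δ * S := by
    simp only [← sum_sub_distrib]
    have : ∀ i j, |a i j * ξ i * ξ j - m i j * ξ i * ξ j| ≤ δ / 2 * (ξ i ^ 2 + ξ j ^ 2) := fun i j  ↦ by
      rw [show a i j * ξ i * ξ j - m i j * ξ i * ξ j = (a i j - m i j) * (ξ i * ξ j) by ring, abs_mul]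
      have h1 : |ξ i * ξ j| ≤ (ξ i ^ 2 + ξ j ^ 2) / 2 := by
        rw [abs_le]; constructor <;> nlinarith [sq_nonneg (ξ i + ξ j), sq_nonneg (ξ i - ξ j)]
      have := mul_le_mul (h i j) h1 (abs_nonneg _) ((abs_nonneg _).trans (h i j))
      linarith
    refine (abs_sum_le_sum_abs _ _).trans ((sum_le_sum fun i _  ↦ (abs_sum_le_sum_abs _ _).trans
      (sum_le_sum fun j _  ↦ this i j)).trans_eq ?_)
    simp only [← mul_sum, sum_add_distrib, sum_const, Finset.card_univ, card_fin, ← hS]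
    simp only [nsmul_eq_mul, ← mul_sum, ← hS]
    ring
  have hi : lam⁻¹ * lam = 1 := inv_mul_cancel₀ lna
  have hi0 : 0 < lam⁻¹ := by positivity
  have h2 : d * δ ≤ lam⁻¹ / 2 := by
    have := mul_le_mul_of_nonneg_left hδ hi0.le
    rw [show lam⁻¹ * (2 * lam * (d * δ)) = 2 * (lam⁻¹ * lam) * (d * δ) by ring, hi] at this; linarith
  have h3 := mul_le_mul_of_nonneg_right h2 hS0
  have h4 : lam⁻¹ ≤ lam := (inv_le_one_of_one_le₀ hl).trans hl
  have h5 := mul_le_mul_of_nonneg_right h4 hS0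
  have h6 := hm.2 ξ
  rw [← hS] at h6 ⊢
  rw [abs_le] at e
  rw [mul_inv]
  constructor <;> linarith [mul_nonneg hi0.le hS0]

lemma Quad_sym (hs : ∀ p i j, u p i j = u p j i) (i j p) :
    Quad μ u i j p = Quad μ u j i p := by
  have hA : ∀ i j, aA u p i j = aA u p j i := fun i j  ↦ Ai_sym (hs p) i j
  unfold Quad
  congr 1
  have key : ∀ (f g : Fin d → Fin d → Mt d), (∀ a b r s, f a b r s + f b a s r + f s r b a + f r s a b =
      g a b r s + g b a s r + g s r b a + g r s a b) → ∑ a, ∑ b, ∑ r, ∑ s, f a b r s = ∑ a, ∑ b, ∑ r, ∑ s, g a b r s := by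
    intro f g h
    have s1 : ∀ f : Fin d → Fin d → Mt d, ∑ a, ∑ b, ∑ r, ∑ s, f b a s r = ∑ a, ∑ b, ∑ r, ∑ s, f a b r s := fun f  ↦ by
      rw [sum_comm]
      exact sum_congr rfl fun a _  ↦ sum_congr rfl fun b _  ↦ sum_comm
    have s2 : ∀ f : Fin d → Fin d → Mt d, ∑ a, ∑ b, ∑ r, ∑ s, f r s a b = ∑ a, ∑ b, ∑ r, ∑ s, f a b r s := fun f  ↦ by
      have e : ∀ F : Ix d → Ix d → ℝ, ∑ a, ∑ b, ∑ r, ∑ s, F (a, b) (r, s) = ∑ x, ∑ y, F x y := fun F  ↦ by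
        simp [Fintype.sum_prod_type]
      exact (e (fun x y  ↦ f y.1 y.2 x.1 x.2)).trans (sum_comm.trans (e (fun x y  ↦ f x.1 x.2 y.1 y.2)).symm)
    have s3 : ∀ f : Fin d → Fin d → Mt d, ∑ a, ∑ b, ∑ r, ∑ s, f s r b a = ∑ a, ∑ b, ∑ r, ∑ s, f a b r s := fun f  ↦ by
      rw [← s1 f, ← s2 (fun a b r s  ↦ f b a s r)]
    have h1 : ∑ a, ∑ b, ∑ r, ∑ s, (f a b r s + f b a s r + f s r b a + f r s a b) =
      ∑ a, ∑ b, ∑ r, ∑ s, (g a b r s + g b a s r + g s r b a + g r s a b) := by simp only [h]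
    simp only [sum_add_distrib] at h1
    rw [s1 f, s1 g, s2 f, s2 g, s3 f, s3 g] at h1
    linarith
  refine key _ _ fun a b r s  ↦ ?_
  rw [hA b a, hA s r]
  ring
end

section
variable (D : SD d L)

def psi (u r : Pt d → Mt d) (p : Pt d) : ℝ := ∑ x : Ix d, (u p x.1 x.2 - r p x.1 x.2) ^ 2

def Ref (M h : ℝ) (r : Pt d → Mt d) : Prop := ∀ w ∈ D.W, ∀ p i j,
  (DD 1 w (cp r i j) p) ^ 2 ≤ M * h ^ 2 ∧ |DD 1 (-w) (DD 1 w (cp r i j)) p| ≤ M * h ^ 2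

lemma psi_nonneg (u r : Pt d → Mt d) (p) : 0 ≤ psi u r p := sum_nonneg fun _ _  ↦ sq_nonneg _

lemma le_psi (u r : Pt d → Mt d) (p i j) : (u p i j - r p i j) ^ 2 ≤ psi u r p :=
  single_le_sum (f := fun x  ↦ (u p x.1 x.2 - r p x.1 x.2) ^ 2) (fun _ _  ↦ sq_nonneg _)
    (Finset.mem_univ (i, j))

lemma GG_one (μ u p) : GG D μ 1 u p =
    ∑ x : Ix d, ∑ w ∈ D.W, (DD μ w (cp u x.1 x.2) p) ^ 2 := by
  rw [GG_succ]
  simp [ix, ls, TT]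

lemma DD_le_GG (hw : w ∈ D.W) (i j) :
    |DD μ w (cp u i j) p| ≤ √(GG D μ 1 u p) :=
  TT_le_GG D (Z := [w]) (k := 0 + 1) (mem_ls_cons hw (by simp [ls])) i j

lemma Quad_le (hL : 0 < L) (hu : St L (u p)) (i j) :
    |Quad μ u i j p| ≤ 5 * d ^ 4 * L ^ 2 * GG D μ 1 u p := by
  have := Quad_TT (μ := μ) (u := u) (Z := []) (p := p) (K := L ^ 2 * GG D μ 1 u p) (fun a b r s e1 i1 j1 e2 i2 j2  ↦ by
    simp only [TT, Pi.mul_apply, abs_mul]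
    have hb : ∀ a b, |cp (aA u) a b p| ≤ L := fun a b  ↦ EllM.bound hL hu.1 a b
    have h1 := DD_le_GG D (μ := μ) (u := u) (p := p) (D.hee e1) i1 j1
    have h2 := DD_le_GG D (μ := μ) (u := u) (p := p) (D.hee e2) i2 j2
    calc _ ≤ L * L * √(GG D μ 1 u p) * √(GG D μ 1 u p) := by gcongr <;> exact hb _ _
      _ = _ := by rw [mul_assoc, Real.mul_self_sqrt (GG_nonneg D _ _ _ _)]; ring) i j
  simpa [TT, mul_assoc] using this

lemma DD_one (μ) (w : Pt d) (f p) : DD μ w f p = μ * DD 1 w f p := by simp [DD]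

lemma Lop_ref {m} (hu : ∀ p, St L (u p)) {f}
    (hf : ∀ w ∈ D.W, |DD μ (-w) (DD μ w f) p| ≤ m) : |Lop D.W μ (cc D u) f p| ≤ D.W.card * |D.C0| * m := by
  rw [Lop_sym D.hW (fun w  ↦ by funext q; simp [cc, D.hsym])]
  simp only [Pi.smul_apply, smul_eq_mul, Finset.sum_apply, Pi.mul_apply, abs_mul]
  have : |∑ w ∈ D.W, cc D u w p * DD μ (-w) (DD μ w f) p| ≤ D.W.card * (|D.C0| * m) := by
    refine (abs_sum_le_sum_abs _ _).trans ((Finset.sum_le_card_nsmul _ _ (|D.C0| * m) fun w hw  ↦ ?_).trans_eq (by rw [nsmul_eq_mul]))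
    have hb := D.hb _ (hu p).1 w hw
    have h0 := D.hc0
    rw [abs_mul]
    refine mul_le_mul ?_ (hf w hw) (abs_nonneg _) (abs_nonneg _)
    change |ev (Ai (u p)) (D.c w)| ≤ _
    rw [abs_of_nonneg lna]
    exact hb.2.trans (le_abs_self _)
  have h2 : |(-(1/2):ℝ)| = 1 / 2 := by norm_num
  rw [h2]
  have := abs_nonneg (∑ w ∈ D.W, cc D u w p * DD μ (-w) (DD μ w f) p)
  linarith

lemma Lop_sub (W μ) (c : Pt d → Pt d → ℝ) (f g p) :
    Lop W μ c (fun p  ↦ f p - g p) p = Lop W μ c f p - Lop W μ c g p := by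
  simp only [Lop, DD, ← mul_sub, ← sum_sub_distrib]
  congr 1
  exact sum_congr rfl fun w _  ↦ by ring

lemma lev0c (hL : 0 < L) {m} (hC1 : C1 = D.W.card * |D.C0|) (hC2 : C2 = 5 * (d) ^ 4 * L ^ 2)
    (he0 : 0 < e) (he : 2 * d ^ 2 * (e + e * (C1 + C2)) * C2 ≤ D.c0 / 8) (hθ : Th D θ) (hμ : 0 < μ) (hτ : τ * μ ^ 2 = θ)
    (hτ0 : 0 ≤ τ) (hτe : τ ≤ e) (hm0 : 0 ≤ m) (hm1 : m ≤ 1) (hu : ∀ p, St L (u p))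
    (hG1 : GG D μ 1 u p ≤ 1) (hδ : ∀ i j, |u p i j - r p i j| ≤ e)
    (r1 : ∀ w ∈ D.W, ∀ i j, (DD μ w (cp r i j) p) ^ 2 ≤ m) (r2 : ∀ w ∈ D.W, ∀ i j, |DD μ (-w) (DD μ w (cp r i j)) p| ≤ m) :
    psi (stp D θ u) r p ≤ psi u r p + τ * Lop D.W μ (cc D u) (psi u r) p
      - τ * (D.c0 / 8) * GG D μ 1 u p + τ * (D.c0 * d ^ 2 * D.W.card + 2 * d ^ 2 * (e + e * (C1 + C2)) * C1) * m := by
  have hc0 := D.hc0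
  have hC10 : 0 ≤ C1 := by rw [hC1]; positivity
  have hC20 : 0 ≤ C2 := by rw [hC2]; positivity
  obtain ⟨G, hG⟩ := exi (GG D μ 1 u p)
  have hG0 : 0 ≤ G := hG ▸ GG_nonneg D _ _ _ _
  have hR : ∀ i j, |Lop D.W μ (cc D u) (cp r i j) p + Quad μ u i j p| ≤ C1 * m + C2 * G := fun i j  ↦ by
    rw [hC1, hC2, hG]
    exact (abs_add_le _ _).trans (add_le_add (Lop_ref D hu fun w hw  ↦ r2 w hw i j) (Quad_le D hL (hu p) i j))
  have hX : C1 * m + C2 * G ≤ C1 + C2 := by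
    rw [← hG] at hG1
    exact add_le_add (mul_le_of_le_one_right hC10 hm1) (mul_le_of_le_one_right hC20 hG1)
  have hX0 : 0 ≤ C1 * m + C2 * G := by positivity
  obtain ⟨X, hXd⟩ := exi (C1 * m + C2 * G)
  have key : ∀ x : Ix d, (stp D θ u p x.1 x.2 - r p x.1 x.2) ^ 2 ≤ (u p x.1 x.2 - r p x.1 x.2) ^ 2
      + τ * Lop D.W μ (cc D u) (fun p  ↦ (u p x.1 x.2 - r p x.1 x.2) ^ 2) p
      - τ * (D.c0 / 2) * (∑ w ∈ D.W, (DD μ w (cp u x.1 x.2) p) ^ 2 / 2 - D.W.card * m)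
      + 2 * τ * (e + e * (C1 + C2)) * X := by
    rintro ⟨i, j⟩
    have h := onestep (W := D.W) (μ := μ) (c := cc D u) (c0 := D.c0) (C0 := D.C0) (θ := θ) (τ := τ) (p := p)
      (V := fun p  ↦ u p i j - r p i j) (R := Lop D.W μ (cc D u) (cp r i j) p + Quad μ u i j p)
      (x := stp D θ u p i j - r p i j) hμ hτ hτ0 hθ.1.le hc0.le (D.hb _ (hu p).1) hθ.2.2.1 (by
        have e1 : stp D θ u p i j = u p i j + τ * rhs D μ u i j p := congrFun (stp_eq D hτ u i j) p
        have e2 := Lop_sub D.W μ (cc D u) (cp u i j) (cp r i j) p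
        simp only [cp] at e2
        rw [e1, e2]
        simp only [rhs, Pi.add_apply, cp]
        ring)
    refine h.trans ?_
    have hS : ∑ w ∈ D.W, (DD μ w (cp u i j) p) ^ 2 / 2 - D.W.card * m ≤ ∑ w ∈ D.W, (DD μ w (fun p  ↦ u p i j - r p i j) p) ^ 2 := by
      rw [← nsmul_eq_mul, ← sum_const, ← sum_sub_distrib]
      refine sum_le_sum fun w hw  ↦ ?_
      have := r1 w hw i j
      have e3 : DD μ w (fun p  ↦ u p i j - r p i j) p = DD μ w (cp u i j) p - DD μ w (cp r i j) p := by simp only [DD, cp]; ring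
      rw [e3]
      have := sq_nonneg (DD μ w (cp u i j) p - 2 * DD μ w (cp r i j) p)
      linarith
    have h1 := mul_le_mul_of_nonneg_left hS (show 0 ≤ τ * (D.c0 / 2) by positivity)
    have hRR := hR i j
    rw [← hXd] at hRR hX
    have h2 : |u p i j - r p i j| * |Lop D.W μ (cc D u) (cp r i j) p + Quad μ u i j p| ≤ e * X :=
      mul_le_mul (hδ i j) hRR (abs_nonneg _) he0.le
    have h3 : (Lop D.W μ (cc D u) (cp r i j) p + Quad μ u i j p) ^ 2 ≤ (C1 + C2) * X := by
      rw [← sq_abs, pow_two]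
      exact mul_le_mul (hRR.trans hX) hRR (abs_nonneg _) lna
    have h4 : τ ^ 2 * (Lop D.W μ (cc D u) (cp r i j) p + Quad μ u i j p) ^ 2 ≤ τ * e * ((C1 + C2) * X) := by
      rw [pow_two τ]
      gcongr
    have h5 := mul_le_mul_of_nonneg_left h2 hτ0
    simp only at h1 ⊢
    linarith
  have hsum := sum_le_sum fun x (_ : x ∈ (Finset.univ : Finset (Ix d)))  ↦ key x
  simp only [sum_add_distrib, sum_sub_distrib, ← mul_sum, ← sum_div, ← Lop_sum, ← GG_one, ← hG,
    sum_const, Finset.card_univ, card_prod, card_fin, nsmul_eq_mul] at hsum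
  rw [← hG]
  refine hsum.trans ?_
  have e1 := mul_le_mul_of_nonneg_right he (mul_nonneg hτ0 hG0)
  rw [hXd]
  change psi u r p + τ * Lop D.W μ (cc D u) (psi u r) p - _ + _ ≤ _
  push_cast
  have e2 : 0 ≤ τ * D.c0 * (d ^ 2 * D.W.card) * m := by positivity
  linarith

lemma lev0 (hL : 0 < L) (B) : ∃ C, 0 ≤ C ∧ ∃ δ0 > 0, ∃ θ0 > 0, ∀ θ ≤ θ0, Th D θ → ∀ n u r M h, 0 ≤ M →
    M * h ^ 2 * mu θ n ^ 2 ≤ 1 → Good D B (mu θ n) u → (∀ p i j, |u p i j - r p i j| ≤ δ0) → Ref D M h r →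
    ∀ p, psi (stp D θ u) r p ≤ psi u r p + ta θ n * Lop D.W (mu θ n) (cc D u) (psi u r) p
      - ta θ n * (D.c0 / 8) * GG D (mu θ n) 1 u p + ta θ n * C * (M * h ^ 2 * mu θ n ^ 2) := by
  obtain ⟨C1, hC1⟩ := exi (D.W.card * |D.C0|)
  obtain ⟨C2, hC2⟩ := exi (5 * (d:ℝ) ^ 4 * L ^ 2)
  have hC10 : 0 ≤ C1 := by rw [hC1]; positivity
  have hC20 : 0 ≤ C2 := by rw [hC2]; positivity
  have hc0 := D.hc0
  have hpos : 0 < 16 * d ^ 2 * (1 + C1 + C2) * C2 + 1 := by positivity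
  obtain ⟨e, he⟩ := exi (D.c0 / (16 * d ^ 2 * (1 + C1 + C2) * C2 + 1))
  have he0 : 0 < e := by rw [he]; positivity
  have he1 : 2 * d ^ 2 * (e + e * (C1 + C2)) * C2 ≤ D.c0 / 8 := by
    have : e * (16 * d ^ 2 * (1 + C1 + C2) * C2 + 1) = D.c0 := by rw [he]; field_simp
    linarith
  refine ⟨_, ?_, e, he0, e, he0, fun θ hθe hθ n u r M h hM hm hu hδ hr p  ↦ lev0c D hL hC1 hC2 he0 he1 hθ
    (by linarith [one_le_mu hθ.1.le n]) (ta_mu hθ.1.le n) (ta_nonneg hθ.1.le n) ((ta_le hθ.1.le n).trans hθe) psv hm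
    hu.1 (hu.2.2 p) (hδ p) (fun w hw i j  ↦ ?_) (fun w hw i j  ↦ ?_)⟩
  · positivity
  · rw [DD_one, mul_pow, mul_comm]
    exact mul_le_mul_of_nonneg_right (hr w hw p i j).1 (sq_nonneg _)
  · have e : DD (mu θ n) (-w) (DD (mu θ n) w (cp r i j)) p = mu θ n ^ 2 * DD 1 (-w) (DD 1 w (cp r i j)) p := by simp only [DD]; ring
    rw [e, abs_mul, abs_of_nonneg (sq_nonneg _), mul_comm]
    exact mul_le_mul_of_nonneg_right (hr w hw p i j).2 (sq_nonneg _)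
end

lemma num1 {F Z m ψ} (hY : 0 ≤ Y) (hK : K * c0 / 8 = C1 + 8) (hτ0 : 0 ≤ τ) (hτ : τ ≤ 1 / 8)
    (hC1 : 0 ≤ C1) (hm : m ≤ Y / 16) (hF : F = G + K * ψ) (hψ : K * ψ ≤ Y / 4) (hG : 0 ≤ G)
    (h1 : F + τ * LF ≤ Y) (h2 : F ≤ Y / 2 → F + τ * LF ≤ 3 * Y / 4)
    (hx : x ≤ F + τ * LF - τ * 8 * G + τ * m) (hZ : Z ≤ (1 + τ) * x) : Z ≤ Y := by
  have hmp := mul_le_mul_of_nonneg_left hm hτ0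
  have hYp := mul_le_mul_of_nonneg_right hτ hY
  by_cases hc : F ≤ Y / 2
  · have := h2 hc
    have e : 0 ≤ τ * 8 * G := by positivity
    have hxp : x ≤ 4 / 5 * Y := by linarith
    have := mul_le_mul_of_nonneg_left hxp (by linarith : 0 ≤ 1 + τ)
    have := mul_le_mul_of_nonneg_right hτ (by positivity : 0 ≤ 4 / 5 * Y)
    linarith
  · push Not at hc
    have hg : Y / 4 ≤ G := by linarith
    have := mul_le_mul_of_nonneg_left hg (by positivity : 0 ≤ τ * 8)
    have hxp : x ≤ Y - τ * Y := by have := mul_nonneg hτ0 hY; linarith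
    have := mul_le_mul_of_nonneg_left hxp (by linarith : 0 ≤ 1 + τ)
    have := mul_nonneg (mul_nonneg hτ0 hτ0) hY
    linarith

section
variable (D : SD d L)

lemma Th_exists : ∃ θ2 > 0, ∀ θ, 0 < θ → θ ≤ θ2 → Th D θ := by
  have hc0 := D.hc0
  obtain ⟨a, ha⟩ := exi (2 * (D.W.card : ℝ) * D.C0 ^ 2)
  obtain ⟨b, hb⟩ := exi ((D.W.card : ℝ) * |D.C0|)
  have ha0 : 0 ≤ a := by rw [ha]; positivity
  have hb0 : 0 ≤ b := by rw [hb]; positivity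
  refine ⟨min (1 / 8) (min (D.c0 / (2 * (a + 1))) (1 / (2 * (b + 1)))), by positivity, fun θ h0 h  ↦ ?_⟩
  simp only [le_min_iff] at h
  obtain ⟨h1, h2, h3⟩ := h
  rw [le_div_iff₀ psv] at h2 h3
  refine ⟨h0, h1, ?_, ?_⟩
  · have e : 2 * θ * D.W.card * D.C0 ^ 2 = θ * a := by rw [ha]; ring
    linarith
  · have : θ * (D.W.card * D.C0) ≤ θ * b := by rw [hb]; gcongr; exact le_abs_self _
    linarith

lemma stp_sym (hs : ∀ p i j, u p i j = u p j i) (p i j) :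
    stp D θ u p i j = stp D θ u p j i := by
  have hc : cp u i j = cp u j i := funext fun p  ↦ hs p i j
  simp only [stp, rhs, Pi.add_apply, hc, hs p i j, Quad_sym hs i j p]

lemma psi_step {h n} (hθ : Th D θ) (hu : ∀ p, St L (u p))
    (hl : psi (stp D θ u) r p ≤ psi u r p + ta θ n * Lop D.W (mu θ n) (cc D u) (psi u r) p
      - ta θ n * (D.c0 / 8) * GG D (mu θ n) 1 u p + ta θ n * C * (M * h ^ 2 * mu θ n ^ 2))
    (ha : ∀ p, psi u r p ≤ a) : psi (stp D θ u) r p ≤ a + C * M * θ * h ^ 2 := by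
  have h1 := avg_le (W := D.W) (μ := mu θ n) (c := cc D u) (p := p) (ta_mu hθ.1.le n) hθ.1.le D.hc0.le (D.hb _ (hu p).1) hθ.2.2.2
    ha (ha p) le_rfl
  have h2 : 0 ≤ ta θ n * (D.c0 / 8) * GG D (mu θ n) 1 u p :=
    mul_nonneg (mul_nonneg (ta_nonneg hθ.1.le n) (by linarith [D.hc0])) (GG_nonneg D _ _ _ _)
  have h3 : ta θ n * C * (M * h ^ 2 * mu θ n ^ 2) = C * M * θ * h ^ 2 := by
    rw [show ta θ n * C * (M * h ^ 2 * mu θ n ^ 2) = C * M * (ta θ n * mu θ n ^ 2) * h ^ 2 by ring, ta_mu hθ.1.le]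
  linarith
end

def uu (D : SD d L) (θ : ℝ) (u0 : Pt d → Mt d) (n : ℕ) : Pt d → Mt d := (stp D θ)^[n] u0

lemma uu_succ (D : SD d L) (θ u0 n) : uu D θ u0 (n + 1) = stp D θ (uu D θ u0 n) :=
  Function.iterate_succ_apply' _ _ _

lemma psi_abs (hs : 0 ≤ s) (h : psi u r p ≤ s ^ 2) (i j) :
    |u p i j - r p i j| ≤ s := abs_le_of_sq_le_sq ((le_psi u r p i j).trans h) hs

set_option maxHeartbeats 1000000 in
theorem runs (d : ℕ) (lam : ℝ) (hlam : 1 < lam) (D : SD d (2 * lam)) : ∃ θ, Th D θ ∧ ∃ Bk : ℕ → ℝ, ∃ C, 0 ≤ C ∧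
    ∀ ε, 0 < ε → ε ≤ 1 → ∃ η > 0, ∀ M, 0 ≤ M → ∃ T > 0, ∀ h u0 r, (∀ p, EllM lam (u0 p)) → (∀ p, GG D 1 1 u0 p ≤ η) →
    (∀ p, psi u0 r p ≤ η) → Ref D M h r → ∀ J : ℕ, h ^ 2 * (1 + θ * J) ≤ T →
    ∀ n ≤ J, (∀ p, EllM (2 * lam) (uu D θ u0 n p)) ∧ (∀ p, GG D (mu θ n) 1 (uu D θ u0 n) p ≤ ε ^ 2) ∧
      (∀ k a b, HH D.W (mu θ n) 0 (k + 1) (Bk k) (cp (uu D θ u0 n) a b)) ∧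
      ∀ Mp rp a, 0 ≤ Mp → Ref D Mp h rp → (∀ p, psi u0 rp p ≤ η) → Mp * (h ^ 2 * (1 + θ * J)) ≤ 1 → (∀ p, psi u0 rp p ≤ a) →
        ∀ p, psi (uu D θ u0 n) rp p ≤ a + C * Mp * θ * h ^ 2 * n := by
  have hL : 0 < 2 * lam := by linarith
  have hc0 := D.hc0
  obtain ⟨θ1, hθ1, hlev⟩ := Levels D hL (2 * lam) lna
  choose Bk hBk using hlev
  obtain ⟨θ2, hθ2, hTh⟩ := Th_exists D
  obtain ⟨C1, hC1, θ3, hθ3, hst⟩ := star1 D hL (2 * lam) lna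
  obtain ⟨C, hC, δ0, hδ0, θ4, hθ4, hl0⟩ := lev0 D hL (2 * lam)
  obtain ⟨θ, hθd⟩ := exi (min (min θ1 θ2) (min θ3 θ4))
  have hθ0 : 0 < θ := by rw [hθd]; positivity
  have hle : (θ ≤ θ1 ∧ θ ≤ θ2) ∧ θ ≤ θ3 ∧ θ ≤ θ4 := by rw [hθd]; simp
  have hθ : Th D θ := hTh θ hθ0 hle.1.2
  refine ⟨θ, hθ, Bk, C, hC, fun ε hε hε1  ↦ ?_⟩
  obtain ⟨K, hK⟩ := exi (8 * (C1 + 8) / D.c0)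
  have hK0 : 0 ≤ K := by rw [hK]; positivity
  have hKc : K * D.c0 / 8 = C1 + 8 := by rw [hK]; field_simp
  obtain ⟨s, hs⟩ := exi (min (δ0 / 3) (1 / (4 * lam * (d + 1))))
  have hs0 : 0 < s := by rw [hs]; positivity
  have hsδ : 3 * s ≤ δ0 := by have : s ≤ δ0 / 3 := hs ▸ min_le_left _ _; linarith
  have hsl : 2 * lam * (d * (2 * s)) ≤ 1 := by
    have : s ≤ 1 / (4 * lam * (d + 1)) := hs ▸ min_le_right _ _
    rw [le_div_iff₀ psv] at this
    have : 0 ≤ s * lam := by positivity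
    linarith
  obtain ⟨β, hβ⟩ := exi (min (s ^ 2) (ε ^ 2 / (4 * (K + 1))))
  have hβ0 : 0 < β := by rw [hβ]; positivity
  have hβs : β ≤ s ^ 2 := hβ ▸ min_le_left _ _
  have hKβ : K * β ≤ ε ^ 2 / 4 := by
    have : β ≤ ε ^ 2 / (4 * (K + 1)) := hβ ▸ min_le_right _ _
    rw [le_div_iff₀ psv] at this
    linarith
  obtain ⟨η, hη⟩ := exi (min (β / 2) (ε ^ 2 / 4))
  have hη0 : 0 < η := by rw [hη]; positivity
  have hηβ : η ≤ β / 2 := hη ▸ min_le_left _ _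
  have hηε : η ≤ ε ^ 2 / 4 := hη ▸ min_le_right _ _
  refine ⟨η, hη0, fun M hM  ↦ ?_⟩
  have hCM : 0 ≤ C * M := by positivity
  have hKCM : 0 ≤ K * C * M := by positivity
  obtain ⟨T, hT⟩ := exi (min (1 / (M + 1)) (min (β / (2 * (C * M + 1))) (ε ^ 2 / (16 * (K * C * M + 1)))))
  have hT0 : 0 < T := by rw [hT]; positivity
  have hTT : T ≤ 1 / (M + 1) ∧ T ≤ β / (2 * (C * M + 1)) ∧ T ≤ ε ^ 2 / (16 * (K * C * M + 1)) := by rw [hT]; simp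
  rw [le_div_iff₀ psv, le_div_iff₀ psv, le_div_iff₀ psv] at hTT
  obtain ⟨hT1, hT2, hT3⟩ := hTT
  refine ⟨T, hT0, fun h u0 r hu0 hG0 hψ0 hr J hJ  ↦ ?_⟩
  have hnJ : ∀ n ≤ J, h ^ 2 * mu θ n ^ 2 ≤ h ^ 2 * (1 + θ * J) := fun n hn  ↦ by
    rw [mu_sq hθ0.le]
    have : (n:ℝ) ≤ J := by exact_mod_cast hn
    gcongr
  have main : ∀ n ≤ J, (∀ p, EllM (2 * lam) (uu D θ u0 n p)) ∧
      (∀ p, GG D (mu θ n) 1 (uu D θ u0 n) p + K * psi (uu D θ u0 n) r p ≤ ε ^ 2) ∧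
      ∀ p, psi (uu D θ u0 n) r p ≤ η + C * M * θ * h ^ 2 * n := by
    intro n
    induction n with
    | zero =>
      intro _
      refine ⟨fun p  ↦ EllM.pert hlam.le (hu0 p) (hu0 p).1 (δ := 0) (fun i j  ↦ by simp [uu]) smp, fun p  ↦ ?_,
        fun p  ↦ by simpa [uu] using hψ0 p⟩
      have e : mu θ 0 = 1 := by simp [mu]
      have h1 := hG0 p
      have h2 := mul_le_mul_of_nonneg_left (hψ0 p) hK0
      have h3 := mul_le_mul_of_nonneg_left hηβ hK0
      rw [e]
      simp only [uu, Function.iterate_zero, id]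
      linarith [sq_nonneg ε]
    | succ n ih =>
      intro hn
      obtain ⟨i1, i2, i3⟩ := ih omg
      have hψβ : ∀ n ≤ J, η + C * M * θ * h ^ 2 * n ≤ β := fun n hn  ↦ by
        have e1 : h ^ 2 * (θ * n) ≤ T := by
          refine le_trans ?_ ((hnJ n hn).trans hJ)
          rw [mu_sq hθ0.le]
          have := sq_nonneg h
          linarith
        have := mul_le_mul_of_nonneg_left e1 hCM
        linarith
      have hψb : ∀ p, psi (uu D θ u0 n) r p ≤ β := fun p  ↦ (i3 p).trans (hψβ n omg)
      have hm := (hnJ n omg).trans hJ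
      have hm2 := mul_le_mul_of_nonneg_left hm hM
      have hm3 := mul_le_mul_of_nonneg_left hm hKCM
      have hGd : Good D (2 * lam) (mu θ n) (uu D θ u0 n) := ⟨fun p  ↦ (i1 p).St hL, fun p a b  ↦ (i1 p).bound hL a b, fun p  ↦ by
        have := i2 p
        have := mul_nonneg hK0 (psi_nonneg (uu D θ u0 n) r p)
        have : ε ^ 2 ≤ 1 := pow_le_one₀ hε.le hε1
        linarith⟩
      have hl := hl0 θ hle.2.2 hθ n (uu D θ u0 n) r M h hM lna hGd
        (fun p i j  ↦ (psi_abs hs0.le ((hψb p).trans hβs) i j).trans lna) hr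
      have hψp : ∀ p, psi (uu D θ u0 (n + 1)) r p ≤ η + C * M * θ * h ^ 2 * (n + 1 : ℕ) := fun p  ↦ by
        rw [uu_succ]
        have := psi_step D hθ hGd.1 (hl p) i3
        push_cast
        linarith
      refine ⟨fun p  ↦ EllM.pert hlam.le (hu0 p) (fun i j  ↦ ?_) (fun i j  ↦ ?_) hsl, fun p  ↦ ?_, hψp⟩
      · rw [uu_succ]
        exact stp_sym D (fun p i j  ↦ (i1 p).1 i j) p i j
      · have h1 := psi_abs hs0.le (((hψp p).trans (hψβ _ hn)).trans hβs) i j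
        have h2 := psi_abs hs0.le ((hψ0 p).trans (by linarith : η ≤ s ^ 2)) i j
        rw [abs_le] at h1 h2 ⊢; constructor <;> linarith
      · rw [uu_succ, GG_mu D θ hθ0.le]
        have y1 := hst θ hle.2.1 hθ n _ hGd p
        have y2 := mul_le_mul_of_nonneg_left (hl p) hK0
        have ht0 := ta_nonneg hθ0.le n
        have ht1 := (ta_le hθ0.le n).trans hθ.2.1
        have av := fun y hy hyY  ↦ avg_le (W := D.W) (μ := mu θ n) (c := cc D (uu D θ u0 n)) (p := p) (y := y) (ta_mu hθ0.le n)
          hθ0.le hc0.le (D.hb _ (hGd.1 p).1) hθ.2.2.2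
          (F := fun p  ↦ GG D (mu θ n) 1 (uu D θ u0 n) p + K * psi (uu D θ u0 n) r p) i2 hy hyY
        have lin := Lop_lin D.W (mu θ n) K (cc D (uu D θ u0 n)) (GG D (mu θ n) 1 (uu D θ u0 n)) (psi (uu D θ u0 n) r) p
        refine num1 (x := GG D (mu θ n) 1 (stp D θ (uu D θ u0 n)) p + K * psi (stp D θ (uu D θ u0 n)) r p)
          (m := K * C * (M * h ^ 2 * mu θ n ^ 2)) (G := GG D (mu θ n) 1 (uu D θ u0 n) p) (ψ := psi (uu D θ u0 n) r p)
          (LF := Lop D.W (mu θ n) (cc D (uu D θ u0 n)) (fun p  ↦ GG D (mu θ n) 1 (uu D θ u0 n) p + K * psi (uu D θ u0 n) r p) p)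
          (sq_nonneg ε) hKc ht0 ht1 hC1 lna rfl
          ((mul_le_mul_of_nonneg_left (hψb p) hK0).trans hKβ) (GG_nonneg D _ _ _ _) ?_ (fun hF  ↦ ?_) ?_ ?_
        · have := av (ε ^ 2) (i2 p) le_rfl
          linarith
        · have := av (ε ^ 2 / 2) hF (by linarith [sq_nonneg ε]); linarith
        · rw [lin]
          have e : C1 + 8 = K * D.c0 / 8 := hKc.symm
          have : ta θ n * (C1 + 8) * GG D (mu θ n) 1 (uu D θ u0 n) p =
            ta θ n * (K * D.c0 / 8) * GG D (mu θ n) 1 (uu D θ u0 n) p := by rw [e]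
          have z2 : 0 ≤ ta θ n * (D.c0 / 4) * GG D (mu θ n) 2 (uu D θ u0 n) p :=
            mul_nonneg (mul_nonneg ht0 lna) (GG_nonneg D _ _ _ _)
          linarith
        · have := mul_nonneg ht0 (mul_nonneg hK0 (psi_nonneg (stp D θ (uu D θ u0 n)) r p))
          rw [pow_one]
          linarith
  have hRun : Run D θ (2 * lam) J (uu D θ u0) := ⟨fun n _  ↦ uu_succ D θ u0 n, fun n hn  ↦ by
    obtain ⟨i1, i2, i3⟩ := main n hn
    refine ⟨fun p  ↦ (i1 p).St hL, fun p a b  ↦ (i1 p).bound hL a b, fun p  ↦ ?_⟩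
    have := i2 p
    have := mul_nonneg hK0 (psi_nonneg (uu D θ u0 n) r p)
    have : ε ^ 2 ≤ 1 := pow_le_one₀ hε.le hε1
    linarith⟩
  have hψβ : ∀ n ≤ J, ∀ p, psi (uu D θ u0 n) r p ≤ s ^ 2 := fun n hn p  ↦ by
    refine ((main n hn).2.2 p).trans (le_trans ?_ hβs)
    have e1 : h ^ 2 * (θ * n) ≤ T := by
      refine le_trans ?_ ((hnJ n hn).trans hJ)
      rw [mu_sq hθ0.le]
      have := sq_nonneg h
      linarith
    have := mul_le_mul_of_nonneg_left e1 hCM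
    linarith
  intro n hn
  refine ⟨(main n hn).1, fun p  ↦ ?_, fun k  ↦ hBk k θ hle.1.1 hθ J _ hRun n hn, ?_⟩
  · have := (main n hn).2.1 p
    have := mul_nonneg hK0 (psi_nonneg (uu D θ u0 n) r p)
    linarith
  · intro Mp rp a hMp hrp hηp hMJ ha
    induction n with
    | zero => simpa [uu] using ha
    | succ n ih =>
      have ih := ih omg
      intro p
      rw [uu_succ]
      have := psi_step D hθ (n := n) (hRun.2 n omg).1 (hl0 θ hle.2.2 hθ n (uu D θ u0 n) rp Mp h hMp (by
        have := mul_le_mul_of_nonneg_left (hnJ n omg) hMp; linarith) (hRun.2 n omg) (fun p i j  ↦ by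
          have h1 := psi_abs hs0.le (hψβ n omg p) i j
          have h2 := psi_abs hs0.le ((hψ0 p).trans (by linarith : η ≤ s ^ 2)) i j
          have h3 := psi_abs hs0.le ((hηp p).trans (by linarith : η ≤ s ^ 2)) i j
          rw [abs_le] at h1 h2 h3 ⊢; constructor <;> linarith) hrp p) ih
      push_cast
      linarith

section

def sg (v : Qt d) (F : SF d) : SF d := fun n q  ↦ F n (q + v)
def DS (κ : ℕ → ℝ) (v : Qt d) (F : SF d) : SF d := fun n q  ↦ κ n * (F n (q + v) - F n q)

lemma DS_mul (κ) (v : Qt d) (F G) : DS κ v (F * G) = DS κ v F * G + sg v F * DS κ v G := by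
  funext n q
  simp only [DS, sg, Pi.mul_apply, Pi.add_apply]
  ring
lemma DS_add (κ) (v : Qt d) (F G) : DS κ v (F + G) = DS κ v F + DS κ v G := by
  funext n q
  simp only [DS, Pi.add_apply]
  ring
lemma DS_sg (κ) (v w : Qt d) (F) : DS κ v (sg w F) = sg w (DS κ v F) := by
  funext n q
  simp only [DS, sg, add_right_comm]
lemma DS_comm (κ κp) (v w : Qt d) (F) : DS κ v (DS κp w F) = DS κp w (DS κ v F) := by
  funext n q
  simp only [DS, add_right_comm q v w]
  ring

structure ShA (d : ℕ) where
  A : Subalgebra ℝ (SF d)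
  sh : ∀ v F, F ∈ A → sg v F ∈ A

abbrev Dir (d : ℕ) := Set ((ℕ → ℝ) × Qt d)

def ShA.st (Δ : Dir d) (S : ShA d) : ShA d where
  A := { carrier := {F | F ∈ S.A ∧ ∀ δ ∈ Δ, DS δ.1 δ.2 F ∈ S.A}
         mul_mem' := fun {F G} hF hG  ↦ ⟨mul_mem hF.1 hG.1, fun δ hδ  ↦ by
           rw [DS_mul]; exact add_mem (mul_mem (hF.2 δ hδ) hG.1) (mul_mem (S.sh _ _ hF.1) (hG.2 δ hδ))⟩
         add_mem' := fun {F G} hF hG  ↦ ⟨add_mem hF.1 hG.1, fun δ hδ  ↦ by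
           rw [DS_add]; exact add_mem (hF.2 δ hδ) (hG.2 δ hδ)⟩
         algebraMap_mem' := fun r  ↦ ⟨S.A.algebraMap_mem r, fun δ hδ  ↦ by
           have : DS δ.1 δ.2 (algebraMap ℝ (SF d) r) = 0 := by funext n q; simp [DS]
           rw [this]; exact zero_mem _⟩ }
  sh := fun v F hF  ↦ ⟨S.sh v F hF.1, fun δ hδ  ↦ by rw [DS_sg]; exact S.sh _ _ (hF.2 δ hδ)⟩

def ShA.lv (Δ : Dir d) (S : ShA d) : ℕ → ShA d
  | 0 => S
  | k + 1 => (ShA.lv Δ S k).st Δ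

def ShA.tot (Δ : Dir d) (S : ShA d) : ShA d where
  A := ⨅ k, (S.lv Δ k).A
  sh := fun v F hF  ↦ by
    rw [Algebra.mem_iInf] at hF ⊢; exact fun k  ↦ (S.lv Δ k).sh v F (hF k)

lemma mem_tot {Δ} {S : ShA d} : F ∈ (S.tot Δ).A ↔ ∀ k, F ∈ (S.lv Δ k).A := Algebra.mem_iInf

lemma tot_le {Δ} {S : ShA d} (h : F ∈ (S.tot Δ).A) : F ∈ S.A := mem_tot.1 h 0

lemma tot_D {Δ} {S : ShA d} (h : F ∈ (S.tot Δ).A) {δ} (hδ : δ ∈ Δ) :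
    DS δ.1 δ.2 F ∈ (S.tot Δ).A := mem_tot.2 fun k  ↦ (mem_tot.1 h (k + 1)).2 δ hδ

lemma lv_closed {Δ} {S : ShA d} {κ w} (h : ∀ F ∈ S.A, DS κ w F ∈ S.A) (k) :
    ∀ F ∈ (S.lv Δ k).A, DS κ w F ∈ (S.lv Δ k).A := by
  induction k with
  | zero => exact h
  | succ k ih => exact fun F hF  ↦ ⟨ih F hF.1, fun δ hδ  ↦ by rw [DS_comm]; exact ih _ (hF.2 δ hδ)⟩

def ka (θ : ℝ) (n : ℕ) : Op d → ℝ
  | none => (n + 1) ^ 2 / θ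
  | some _ => n + 1

abbrev UF : Filter ℕ := (Filter.hyperfilter ℕ : Filter ℕ)

lemma ka_pos (hθ : 0 < θ) (n) (o : Op d) : 0 < ka θ n o := by
  cases o <;> simp only [ka] <;> positivity

lemma nat_UF : Tendsto (fun n : ℕ  ↦ (n : ℝ) + 1) UF Filter.atTop :=
  (Filter.tendsto_atTop_add_const_right _ _ tendsto_natCast_atTop_atTop).mono_left Nat.hyperfilter_le_atTop

lemma ka_inf (hθ : 0 < θ) (o : Op d) : Tendsto (fun n  ↦ ka θ n o) UF Filter.atTop := by
  cases o with
  | none => exact ((Filter.tendsto_pow_atTop two_ne_zero).comp nat_UF).atTop_div_const hθ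
  | some i => exact nat_UF

abbrev Rg (θ : ℝ) (n : ℕ) (a b : ℝ) (q : Qt d) : Prop := (q none / ka (d := d) θ n none : ℝ) ∈ Icc a b

lemma Rg_shift (hθ : 0 < θ) (v : Qt d) (ha : 0 < a) (hb : b < T) :
    ∀ᶠ n in UF, ∀ q, Rg θ n a b q → Rg θ n (a / 2) ((b + T) / 2) (q + v) := by
  have h0 := Filter.Tendsto.const_div_atTop (ka_inf (d := d) hθ none) (v none : ℝ)
  have e : 0 < min (a / 2) ((T - b) / 2) := lt_min lna lna
  filter_upwards [h0 (Metric.ball_mem_nhds 0 e)] with n h2 q hq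
  have h2 : |(v none : ℝ) / ka (d := d) θ n none| < min (a / 2) ((T - b) / 2) := by
    rw [← Real.dist_0_eq_abs]
    exact h2
  rw [lt_min_iff, abs_lt, abs_lt] at h2
  rw [Rg, Pi.add_apply]
  push_cast
  rw [add_div (q none : ℝ)]
  constructor <;> linarith [hq.1, hq.2]

def BdA (θ T : ℝ) (hθ : 0 < θ) : ShA d where
  A := { carrier := {F | ∀ a b, 0 < a → b < T → ∃ C, ∀ᶠ n in UF, ∀ q : Qt d, Rg θ n a b q → |F n q| ≤ C}
         mul_mem' := fun {F G} hF hG a b ha hb  ↦ by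
           obtain ⟨C, hC⟩ := hF a b ha hb
           obtain ⟨Cp, hCp⟩ := hG a b ha hb
           refine ⟨C * Cp, ?_⟩
           filter_upwards [hC, hCp] with n h1 h2 q hq
           rw [Pi.mul_apply, Pi.mul_apply, abs_mul]
           exact mul_le_mul (h1 q hq) (h2 q hq) (abs_nonneg _) ((abs_nonneg _).trans (h1 q hq))
         add_mem' := fun {F G} hF hG a b ha hb  ↦ by
           obtain ⟨C, hC⟩ := hF a b ha hb
           obtain ⟨Cp, hCp⟩ := hG a b ha hb
           refine ⟨C + Cp, ?_⟩
           filter_upwards [hC, hCp] with n h1 h2 q hq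
           exact (abs_add_le _ _).trans (add_le_add (h1 q hq) (h2 q hq))
         algebraMap_mem' := fun r a b _ _  ↦ ⟨|r|, .of_forall fun n q _  ↦ le_rfl⟩ }
  sh := fun v F hF a b ha hb  ↦ by
    obtain ⟨C, hC⟩ := hF (a / 2) ((b + T) / 2) lna lna
    refine ⟨C, ?_⟩
    filter_upwards [hC, Rg_shift hθ v ha hb] with n h1 h2 q hq
    exact h1 _ (h2 q hq)

lemma mem_Bd {hθ : 0 < θ} : F ∈ (BdA θ T hθ).A ↔ ∀ a b, 0 < a → b < T → ∃ C, ∀ᶠ n in UF,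
    ∀ q, Rg θ n a b q → |F n q| ≤ C := Iff.rfl

def Eqv (θ T : ℝ) (F G : SF d) : Prop := ∀ a b, 0 < a → b < T → ∀ᶠ n in UF, ∀ q : Qt d, Rg θ n a b q → F n q = G n q

lemma Eqv.DS (hθ : 0 < θ) {G} (h : Eqv θ T F G) (κ v) : Eqv θ T (DS κ v F) (DS κ v G) := by
  intro a b ha hb
  filter_upwards [h a b ha hb, h (a / 2) ((b + T) / 2) lna lna, Rg_shift hθ v ha hb] with n h1 h2 h3 q hq
  simp only [_root_.DS, h1 q hq, h2 _ (h3 q hq)]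

def CC (θ T : ℝ) (S : ShA d) : Prop := ∀ F G, Eqv θ T G F → F ∈ S.A → G ∈ S.A

lemma Bd_CC (hθ : 0 < θ) : CC (d := d) θ T (BdA θ T hθ) := fun F G h hF a b ha hb  ↦ by
  obtain ⟨C, hC⟩ := hF a b ha hb
  refine ⟨C, ?_⟩
  filter_upwards [hC, h a b ha hb] with n h1 h2 q hq
  rw [h2 q hq]
  exact h1 q hq

lemma lv_CC (hθ : 0 < θ) {Δ : Dir d} {S} (h : CC θ T S) (k) : CC θ T (S.lv Δ k) := by
  induction k with
  | zero => exact h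
  | succ k ih => exact fun F G e hF  ↦ ⟨ih F G e hF.1, fun δ hδ  ↦ ih _ _ (e.DS hθ _ _) (hF.2 δ hδ)⟩

lemma tot_CC (hθ : 0 < θ) {Δ : Dir d} {S} (h : CC θ T S) : CC θ T (S.tot Δ) := fun F G e hF  ↦
  mem_tot.2 fun k  ↦ lv_CC hθ h k F G e (mem_tot.1 hF k)

lemma lv_inv (hθ : 0 < θ) {Δ S} (hc : CC θ T S) {u A : Fin d → Fin d → SF d} (hA : ∀ i j, A i j ∈ S.A)
    (hD : ∀ δ ∈ Δ, ∀ i j, Eqv θ T (DS δ.1 δ.2 (A i j)) (-∑ k, ∑ l, sg δ.2 (A i k) * DS δ.1 δ.2 (u k l) * A l j)) (k)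
    (hu : ∀ i j, u i j ∈ (S.lv Δ k).A) : ∀ i j, A i j ∈ (S.lv Δ k).A := by
  induction k with
  | zero => exact hA
  | succ k ih =>
    have ih := ih fun i j  ↦ (hu i j).1
    exact fun i j  ↦ ⟨ih i j, fun δ hδ  ↦ lv_CC hθ hc k _ _ (hD δ hδ i j)
      (neg_mem (sum_mem fun k _  ↦ sum_mem fun l _  ↦
        mul_mem (mul_mem ((ShA.lv Δ S _).sh _ _ (ih _ _)) ((hu _ _).2 δ hδ)) (ih _ _)))⟩

def eo (o : Op d) : Qt d := Pi.single o 1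

lemma path (φ : Qt d → ℝ) (c K : Op d → ℝ) (p) : ∀ (m q), ∑ o, (q o - p o).natAbs = m →
    (∀ qp o, (∀ k, qp k ∈ uIcc (p k) (q k)) → |φ (qp + eo o) - φ qp - c o| ≤ K o) →
    |φ q - φ p - ∑ o, ((q o - p o : ℤ) : ℝ) * c o| ≤ ∑ o, |((q o - p o : ℤ) : ℝ)| * K o := by
  intro m
  induction m with
  | zero =>
    intro q hq _
    have : q = p := by
      funext o
      have := Finset.sum_eq_zero_iff.1 hq o (Finset.mem_univ _)
      omega
    subst this
    simp
  | succ m ih =>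
    intro q hq hst
    obtain ⟨o, ho⟩ : ∃ o, q o ≠ p o := by
      by_contra h; push Not at h; simp [h] at hq
    have key : ∀ qp, (∀ k, k ≠ o → qp k = q k) → (qp o - p o).natAbs + 1 = (q o - p o).natAbs →
        (∀ k, qp k ∈ uIcc (p k) (q k)) →
        |φ qp - φ p - ∑ o, ((qp o - p o : ℤ) : ℝ) * c o| ≤ ∑ o, |((qp o - p o : ℤ) : ℝ)| * K o := by
      intro qp h1 h2 h3
      refine ih qp ?_ fun q'' i hk  ↦ hst q'' i fun k  ↦ uIcc_subset_uIcc_left (h3 k) (hk k)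
      rw [← Finset.add_sum_erase _ _ (Finset.mem_univ o)] at hq ⊢
      rw [sum_congr rfl fun k hk  ↦ by rw [h1 k (Finset.ne_of_mem_erase hk)]]
      omega
    have split : ∀ (qp : Qt d), (∀ k, k ≠ o → qp k = q k) → ∀ f : ℤ → Op d → ℝ,
        ∑ k, f (q k - p k) k = ∑ k, f (qp k - p k) k + (f (q o - p o) o - f (qp o - p o) o) := by
      intro qp h1 f
      rw [← Finset.add_sum_erase _ _ (Finset.mem_univ o), ← Finset.add_sum_erase (a := o) _ _ (Finset.mem_univ o),
        sum_congr rfl fun k hk  ↦ by rw [← h1 k (Finset.ne_of_mem_erase hk)]]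
      ring
    rcases lt_or_gt_of_ne ho with h | h
    · have e1 : ∀ k, k ≠ o → (q + eo o) k = q k := fun k hk  ↦ by simp [eo, hk]
      have e2 : (q + eo o) o = q o + 1 := by simp [eo]
      have h4 : ∀ k, (q + eo o) k ∈ uIcc (p k) (q k) := fun k  ↦ by
        by_cases hk : k = o
        · subst hk; rw [e2, mem_uIcc]; right; constructor <;> omega
        · rw [e1 k hk]
          exact right_mem_uIcc
      have := key _ e1 (by rw [e2]; omega) h4
      have h5 := hst q o fun k  ↦ right_mem_uIcc
      rw [split _ e1 (fun z k  ↦ (z : ℝ) * c k), split _ e1 (fun z k  ↦ |(z : ℝ)| * K k), e2]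
      have h6 : (q o : ℝ) + 1 ≤ p o := by exact_mod_cast h
      push_cast at *
      rw [abs_of_nonpos (by linarith : (q o : ℝ) - p o ≤ 0), abs_of_nonpos (by linarith : (q o : ℝ) + 1 - p o ≤ 0)]
      rw [abs_le] at *
      constructor <;> linarith
    · have e1 : ∀ k, k ≠ o → (q - eo o) k = q k := fun k hk  ↦ by simp [eo, hk]
      have e2 : (q - eo o) o = q o - 1 := by simp [eo]
      have h4 : ∀ k, (q - eo o) k ∈ uIcc (p k) (q k) := fun k  ↦ by
        by_cases hk : k = o
        · subst hk; rw [e2, mem_uIcc]; left; constructor <;> omega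
        · rw [e1 k hk]
          exact right_mem_uIcc
      have := key _ e1 (by rw [e2]; omega) h4
      have h5 := hst (q - eo o) o h4
      rw [sub_add_cancel] at h5
      rw [split _ e1 (fun z k  ↦ (z : ℝ) * c k), split _ e1 (fun z k  ↦ |(z : ℝ)| * K k), e2]
      have h6 : (p o : ℝ) + 1 ≤ q o := by exact_mod_cast h
      push_cast at *
      rw [abs_of_nonneg (by linarith : 0 ≤ (q o : ℝ) - p o), abs_of_nonneg (by linarith : 0 ≤ (q o : ℝ) - 1 - p o)]
      rw [abs_le] at *
      constructor <;> linarith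
end

section
variable {hθ : 0 < θ}

def rho (θ : ℝ) (n : ℕ) (p q : Qt d) : ℝ := ∑ o, |((q o - p o : ℤ) : ℝ)| / ka θ n o

abbrev Do (θ : ℝ) (o : Op d) (F : SF d) : SF d := DS (fun n  ↦ ka θ n o) (eo o) F

lemma box_time (hθ : 0 < θ) {n} {p q qp : Qt d} (hp : Rg θ n a b p)
    (hq : Rg θ n a b q) (h : qp none ∈ uIcc (p none) (q none)) :
    Rg θ n a b qp := by
  have hk := ka_pos (d := d) hθ n none
  rcases mem_uIcc.1 h with h | h <;> constructor
  · exact hp.1.trans (by gcongr; exact h.1)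
  · exact le_trans (by gcongr; exact h.2) hq.2
  · exact hq.1.trans (by gcongr; exact h.1)
  · exact le_trans (by gcongr; exact h.2) hp.2

lemma Lip (hF : ∀ o, Do θ o F ∈ (BdA θ T hθ).A) (ha : 0 < a) (hb : b < T) : ∃ C, 0 ≤ C ∧ ∀ᶠ n in UF,
    ∀ p q, Rg θ n a b p → Rg θ n a b q →
      |F n q - F n p| ≤ C * rho θ n p q := by
  choose C hC using fun o  ↦ mem_Bd.1 (hF o) a b ha hb
  refine ⟨∑ o, |C o|, sum_nonneg fun _ _  ↦ abs_nonneg _, ?_⟩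
  filter_upwards [Filter.eventually_all.2 hC] with n hn p q hp hq
  have := path (F n) 0 (fun o  ↦ (∑ o, |C o|) / ka θ n o) p _ q rfl fun qp o h  ↦ by
    have h1 := hn o qp (box_time hθ hp hq (h none))
    have hk := ka_pos hθ n o
    simp only [DS, abs_mul, abs_of_pos hk] at h1
    rw [Pi.zero_apply, sub_zero, le_div_iff₀ hk, mul_comm]
    exact h1.trans ((le_abs_self _).trans (single_le_sum (f := fun o  ↦ |C o|) (fun _ _  ↦ abs_nonneg _) (Finset.mem_univ o)))
  simp only [Pi.zero_apply, mul_zero, Finset.sum_const_zero, sub_zero] at this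
  refine this.trans (le_of_eq ?_)
  rw [rho, mul_sum]
  exact sum_congr rfl fun o _  ↦ by ring

lemma Tay (hF : ∀ o op, Do θ op (Do θ o F) ∈ (BdA θ T hθ).A) (ha : 0 < a) (hb : b < T) :
    ∃ C, 0 ≤ C ∧ ∀ᶠ n in UF, ∀ p q, Rg θ n a b p →
      Rg θ n a b q →
      |F n q - F n p - ∑ o, ((q o - p o : ℤ) : ℝ) / ka θ n o * Do θ o F n p| ≤ C * rho θ n p q ^ 2 := by
  choose C hC0 hC using fun o  ↦ Lip (hF o) ha hb
  refine ⟨∑ o, C o, sum_nonneg fun _ _  ↦ hC0 _, ?_⟩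
  filter_upwards [Filter.eventually_all.2 hC] with n hn p q hp hq
  have := path (F n) (fun o  ↦ Do θ o F n p / ka θ n o) (fun o  ↦ (∑ o, C o) * rho θ n p q / ka θ n o) p _ q rfl fun qp o h  ↦ by
    have h1 := hn o p qp hp (box_time hθ hp hq (h none))
    have hk := ka_pos hθ n o
    have h2 : rho θ n p qp ≤ rho θ n p q := sum_le_sum fun k _  ↦ by
      have := ka_pos hθ n k
      gcongr ?_ / _
      rw [← Int.cast_abs, ← Int.cast_abs]
      exact_mod_cast abs_sub_left_of_mem_uIcc (h k)
    have h0 : 0 ≤ rho θ n p qp := sum_nonneg fun k _  ↦ div_nonneg (abs_nonneg _) (ka_pos hθ n k).le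
    have e : F n (qp + eo o) - F n qp - Do θ o F n p / ka θ n o = (Do θ o F n qp - Do θ o F n p) / ka θ n o := by
      rw [sub_div]
      congr 1
      simp only [DS]
      field_simp
    simp only [e, abs_div, abs_of_pos hk]
    gcongr
    exact h1.trans (mul_le_mul (single_le_sum (f := C) (fun _ _  ↦ hC0 _) (Finset.mem_univ o)) h2 h0
      (sum_nonneg fun _ _  ↦ hC0 _))
  refine le_trans (le_of_eq ?_) (this.trans (le_of_eq ?_))
  · congr 2
    exact sum_congr rfl fun o _  ↦ by ring
  · rw [pow_two, ← mul_assoc]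
    generalize (∑ o, C o) * rho θ n p q = r
    rw [rho, mul_sum]
    exact sum_congr rfl fun o _  ↦ by ring

def zz (z : Ze d) : Op d → ℝ
  | none => z.1
  | some i => z.2 i

def qn (θ : ℝ) (n : ℕ) (z : Ze d) : Qt d := fun o  ↦ ⌊ka θ n o * zz z o⌋

lemma qn_lim (hθ : 0 < θ) (z : Ze d) (o) :
    Tendsto (fun n  ↦ (qn θ n z o) / ka θ n o) UF (nhds (zz z o)) := by
  have h0 := Filter.Tendsto.const_div_atTop (ka_inf (d := d) hθ o) 1
  have h1 := (tendsto_const_nhds (x := zz z o)).sub h0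
  rw [sub_zero] at h1
  refine tendsto_of_tendsto_of_tendsto_of_le_of_le h1 tendsto_const_nhds (fun n  ↦ ?_) fun n  ↦ ?_
  · have hk := ka_pos hθ n o
    have := Int.lt_floor_add_one (ka θ n o * zz z o)
    simp only [qn]
    rw [le_div_iff₀ hk, sub_mul, div_mul_cancel₀ _ hk.ne']
    linarith
  · have hk := ka_pos hθ n o
    have := Int.floor_le (ka θ n o * zz z o)
    simp only [qn]
    rw [div_le_iff₀ hk]
    linarith

lemma qn_time (hθ : 0 < θ) (h : z.1 ∈ Ioo a b) :
    ∀ᶠ n in UF, Rg θ n a b (qn θ n z) :=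
  (qn_lim hθ z none).eventually (Icc_mem_nhds h.1 h.2)

def U (θ : ℝ) (F : SF d) (z : Ze d) : ℝ := Filter.limUnder UF fun n  ↦ F n (qn θ n z)

lemma U_lim (hF : F ∈ (BdA θ T hθ).A) (hz : z.1 ∈ Ioo 0 T) :
    Tendsto (fun n  ↦ F n (qn θ n z)) UF (nhds (U θ F z)) := by
  obtain ⟨C, hC⟩ := mem_Bd.1 hF (z.1 / 2) ((z.1 + T) / 2) (by linarith [hz.1]) (by linarith [hz.2])
  refine tendsto_nhds_limUnder ?_
  have h1 : ∀ᶠ n in UF, F n (qn θ n z) ∈ Icc (-C) C := by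
    filter_upwards [hC, qn_time hθ (z := z) (a := z.1 / 2) (b := (z.1 + T) / 2) ⟨by linarith [hz.1], by linarith [hz.2]⟩] with n h1 h2
    exact abs_le.1 (h1 _ h2)
  obtain ⟨x, -, hx⟩ := (isCompact_Icc (a := -C) (b := C)).ultrafilter_le_nhds
    ((Filter.hyperfilter ℕ).map fun n  ↦ F n (qn θ n z)) (by rw [Ultrafilter.coe_map, Filter.le_principal_iff]; exact h1)
  exact ⟨x, hx⟩

lemma U_eq {c} (h : Tendsto (fun n  ↦ F n (qn θ n z)) UF (nhds c)) : U θ F z = c :=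
  h.limUnder_eq

lemma rho_lim (hθ : 0 < θ) (z zp : Ze d) :
    Tendsto (fun n  ↦ rho θ n (qn θ n z) (qn θ n zp)) UF (nhds (∑ o, |zz zp o - zz z o|)) := by
  refine tendsto_finsetSum _ fun o _  ↦ ?_
  refine ((qn_lim hθ zp o).sub (qn_lim hθ z o)).abs.congr fun n  ↦ ?_
  rw [← sub_div, abs_div, abs_of_pos (ka_pos hθ n o)]
  push_cast
  rfl

structure Tame (θ T : ℝ) (hθ : 0 < θ) (S : ShA d) : Prop where
  bd : ∀ F ∈ S.A, F ∈ (BdA θ T hθ).A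
  dc : ∀ F ∈ S.A, ∀ o, Do θ o F ∈ S.A

variable {S : ShA d} (hS : Tame θ T hθ S) (hF : F ∈ S.A)
include hS hF

lemma U_tay (ha : 0 < a) (hb : b < T) : ∃ C, 0 ≤ C ∧ ∀ z zp, z.1 ∈ Ioo a b → zp.1 ∈ Ioo a b →
    |U θ F zp - U θ F z - ∑ o, (zz zp o - zz z o) * U θ (Do θ o F) z| ≤ C * (∑ o, |zz zp o - zz z o|) ^ 2 := by
  obtain ⟨C, hC0, hC⟩ := Tay (hθ := hθ) (T := T) (F := F) (fun o op  ↦ hS.bd _ (hS.dc _ (hS.dc _ hF o) op)) ha hb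
  refine ⟨C, hC0, fun z zp hz hzp  ↦ ?_⟩
  have sub : ∀ t, t ∈ Ioo a b → t ∈ Ioo 0 T := fun t ht  ↦ ⟨ha.trans ht.1, ht.2.trans hb⟩
  refine le_of_tendsto_of_tendsto ((((U_lim (hS.bd _ hF) (sub _ hzp)).sub (U_lim (hS.bd _ hF) (sub _ hz))).sub
    (tendsto_finsetSum Finset.univ fun o _  ↦ ((qn_lim hθ zp o).sub (qn_lim hθ z o)).mul
      (U_lim (hS.bd _ (hS.dc _ hF o)) (sub _ hz)))).abs) (((rho_lim hθ z zp).pow 2).const_mul C) ?_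
  filter_upwards [hC, qn_time hθ hz, qn_time hθ hzp] with n h1 h2 h3
  have := h1 _ _ h2 h3
  push_cast [sub_div] at this ⊢
  exact this

def coo (o : Op d) : Ze d →L[ℝ] ℝ :=
  match o with
  | none => ContinuousLinearMap.fst ℝ ℝ (EE d)
  | some i => (EuclideanSpace.proj i).comp (ContinuousLinearMap.snd ℝ ℝ (EE d))

omit hS hF in
lemma coo_apply (o : Op d) (z) : coo o z = zz z o := by cases o <;> rfl

lemma U_deriv (hz : z.1 ∈ Ioo 0 T) : HasFDerivAt (U θ F) (∑ o, U θ (Do θ o F) z • coo o) z := by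
  obtain ⟨C, hC0, hC⟩ := U_tay hS hF (a := z.1 / 2) (b := (z.1 + T) / 2) (by linarith [hz.1]) (by linarith [hz.2])
  have hz1 : z.1 ∈ Ioo (z.1 / 2) ((z.1 + T) / 2) := ⟨by linarith [hz.1], by linarith [hz.2]⟩
  obtain ⟨L, hL⟩ : ∃ L : Ze d →L[ℝ] ℝ, L = ∑ o, U θ (Do θ o F) z • coo o := ⟨_, rfl⟩
  rw [← hL]
  have e : ∀ zp, L (zp - z) = ∑ o, (zz zp o - zz z o) * U θ (Do θ o F) z := fun zp  ↦ by
    rw [hL, _root_.sum_apply]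
    refine sum_congr rfl fun o _  ↦ ?_
    rw [_root_.smul_apply, map_sub, coo_apply, coo_apply, smul_eq_mul, mul_comm]
  have h1 : HasFDerivAt (fun zp  ↦ U θ F zp - U θ F z - L (zp - z)) (0 : Ze d →L[ℝ] ℝ) z := by
    refine Asymptotics.IsBigO.hasFDerivAt (n := 2) ?_ one_lt_two
    refine Asymptotics.IsBigO.of_bound (C * (∑ o : Op d, ‖coo o‖) ^ 2) ?_
    filter_upwards [(isOpen_Ioo.preimage continuous_fst).mem_nhds hz1] with zp hzp
    rw [e]
    refine (hC z zp hz1 hzp).trans ?_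
    rw [Real.norm_of_nonneg psv, mul_assoc, ← mul_pow]
    gcongr
    rw [sum_mul]
    refine sum_le_sum fun o _  ↦ ?_
    rw [← coo_apply, ← coo_apply, ← map_sub]
    exact (coo o).le_opNorm _
  have h2 : HasFDerivAt (fun zp  ↦ L (zp - z)) L z := L.hasFDerivAt.comp z ((hasFDerivAt_id z).sub_const z)
  have h3 := ((h1.add h2).add_const (U θ F z))
  rw [zero_add] at h3
  refine h3.congr_of_eventuallyEq (.of_forall fun zp  ↦ ?_)
  simp

omit hF in
include hS in
lemma U_smooth (m : ℕ) : ∀ F ∈ S.A, ContDiffOn ℝ m (U θ F) (Ioo 0 T ×ˢ univ) := by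
  have ho : IsOpen (Ioo 0 T ×ˢ (univ : Set (EE d))) := isOpen_Ioo.prod isOpen_univ
  have hdiff : ∀ F ∈ S.A, DifferentiableOn ℝ (U θ F) (Ioo 0 T ×ˢ univ) := fun F hF z hz  ↦
    (U_deriv hS hF hz.1).differentiableAt.differentiableWithinAt
  induction m with
  | zero => exact fun F hF  ↦ contDiffOn_zero.2 (hdiff F hF).continuousOn
  | succ m ih =>
    intro F hF
    push_cast
    refine (contDiffOn_succ_iff_fderiv_of_isOpen ho).2 ⟨hdiff F hF, by simp, ?_⟩
    refine ContDiffOn.congr (f := fun z  ↦ ∑ o, U θ (Do θ o F) z • coo o) ?_ fun z hz  ↦ (U_deriv hS hF hz.1).fderiv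
    exact ContDiffOn.sum fun o _  ↦ (ih _ (hS.dc _ hF o)).smul contDiffOn_const

def hat (w : Pt d) : Qt d
  | none => 0
  | some i => w i

lemma U_hat (w) (hz : z.1 ∈ Ioo 0 T) :
    Tendsto (fun n  ↦ DS (fun n  ↦ (n) + 1) (hat w) F n (qn θ n z)) UF (nhds (∑ i, w i * U θ (Do θ (some i) F) z)) := by
  obtain ⟨C, hC0, hC⟩ := Tay (hθ := hθ) (T := T) (F := F) (fun o op  ↦ hS.bd _ (hS.dc _ (hS.dc _ hF o) op))
    (a := z.1 / 2) (b := (z.1 + T) / 2) (by linarith [hz.1]) (by linarith [hz.2])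
  have hz1 : z.1 ∈ Ioo (z.1 / 2) ((z.1 + T) / 2) := ⟨by linarith [hz.1], by linarith [hz.2]⟩
  have h1 := tendsto_finsetSum Finset.univ fun i (_ : i ∈ Finset.univ)  ↦
    (U_lim (hS.bd _ (hS.dc _ hF (some i))) hz).const_mul (w i : ℝ)
  refine tendsto_of_tendsto_of_dist h1 ?_
  have h0 := Filter.Tendsto.const_div_atTop nat_UF (C * (∑ i, |(w i : ℝ)|) ^ 2)
  refine squeeze_zero' (.of_forall fun _  ↦ dist_nonneg) ?_ h0
  filter_upwards [hC, qn_time hθ hz1] with n h1 h2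
  have := h1 _ (qn θ n z + hat w) h2 (by simpa [hat] using h2)
  have hn : (0 : ℝ) < n + 1 := by positivity
  simp only [rho, Pi.add_apply, add_sub_cancel_left, Fintype.sum_option, hat, Int.cast_zero, zero_div, zero_mul, abs_zero,
    zero_add, ka] at this
  rw [← sum_div, div_pow] at this
  rw [dist_comm, Real.dist_eq, le_div_iff₀ hn]
  have e : DS (fun n  ↦ (n : ℝ) + 1) (hat w) F n (qn θ n z) - ∑ i, w i * Do θ (some i) F n (qn θ n z) =
      (n + 1) * (F n (qn θ n z + hat w) - F n (qn θ n z) - ∑ i, w i / ((n : ℝ) + 1) * Do θ (some i) F n (qn θ n z)) := by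
    rw [mul_sub, mul_sum]
    simp only [DS]
    congr 1
    exact sum_congr rfl fun i _  ↦ by field_simp
  rw [e, abs_mul, abs_of_pos hn]
  have h4 := mul_le_mul_of_nonneg_left this (by positivity : (0 : ℝ) ≤ (n + 1) ^ 2)
  have h5 : ((n : ℝ) + 1) ^ 2 * (C * ((∑ i, |(w i : ℝ)|) ^ 2 / (n + 1) ^ 2)) = C * (∑ i, |(w i : ℝ)|) ^ 2 := by field_simp
  linarith
end

section

def lf (f : ℕ → ℤ → Pt d → ℝ) : SF d := fun n q  ↦ f n (q none) fun i  ↦ q (some i)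

lemma DS_lf (w) (f : ℕ → ℤ → Pt d → ℝ) :
    DS (fun n  ↦ (n) + 1) (hat w) (lf f) = lf fun n j  ↦ DD (n + 1) w (f n j) := by
  funext n q
  simp only [DS, lf, DD, Pi.add_apply, hat, add_zero]
  rfl

lemma eo_hat (i) : (eo (some i) : Qt d) = hat (ee i) := by
  funext o
  cases o with
  | none => simp [eo, hat]
  | some j => simp [eo, hat, ee, Pi.single_apply]

def Ds (W : Finset (Pt d)) : Dir d := {δ | ∃ w ∈ W, δ = (fun n : ℕ  ↦ (n : ℝ) + 1, hat w)}
def Dt (θ : ℝ) : Dir d := {(fun n  ↦ ka (d := d) θ n none, eo none)}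

lemma lv_lf {S : ShA d} (k) : ∀ f : ℕ → ℤ → Pt d → ℝ,
    (∀ m, ∀ Z ∈ ls W m, lf (fun n j  ↦ TT (n + 1) Z (f n j)) ∈ S.A) → lf f ∈ (S.lv (Ds W) k).A := by
  induction k with
  | zero => exact fun f h  ↦ h 0 [] (by simp [ls])
  | succ k ih =>
    refine fun f h  ↦ ⟨ih f h, ?_⟩
    rintro _ ⟨w, hw, rfl⟩
    rw [DS_lf]
    exact ih _ fun m Z hZ  ↦ h (m + 1) (w :: Z) (mem_ls_cons hw hZ)

variable (D : SD d L) (hθ : 0 < θ) (u0 : ℕ → Pt d → Mt d)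

def un (θ : ℝ) (n : ℕ) (j : ℤ) : Pt d → Mt d := uu D θ (u0 n) j.toNat
def uF (θ : ℝ) (a b : Fin d) : SF d := lf fun n j  ↦ cp (un D u0 θ n j) a b
def AF (θ : ℝ) (a b : Fin d) : SF d := lf fun n j  ↦ cp (aA (un D u0 θ n j)) a b
def PF (θ : ℝ) (q : Pol d) : SF d := lf fun n j p  ↦ ev (aA (un D u0 θ n j) p) q
abbrev Dw (w : Pt d) (F : SF d) : SF d := DS (fun n  ↦ (n : ℝ) + 1) (hat w) F
def RH (θ : ℝ) (i j : Fin d) : SF d := (-(1/2) : ℝ) • ∑ w ∈ D.W, PF D u0 θ (D.c w) * Dw (-w) (Dw w (uF D u0 θ i j))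
  + (1/2 : ℝ) • ∑ a, ∑ b, ∑ r, ∑ s, AF D u0 θ a b * AF D u0 θ r s *
    (Dw (ee i) (uF D u0 θ r a) * Dw (ee j) (uF D u0 θ s b)
      + (2 : ℝ) • (Dw (ee a) (uF D u0 θ j r) * Dw (ee s) (uF D u0 θ i b))
      - (2 : ℝ) • (Dw (ee a) (uF D u0 θ j r) * Dw (ee b) (uF D u0 θ i s))
      - (2 : ℝ) • (Dw (ee j) (uF D u0 θ r a) * Dw (ee b) (uF D u0 θ i s))
      - (2 : ℝ) • (Dw (ee i) (uF D u0 θ r a) * Dw (ee b) (uF D u0 θ j s)))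

def OK (θ T ε : ℝ) (Bk : ℕ → ℝ) : Prop := ∀ᶠ n : ℕ in UF, ∀ J : ℕ, (1 + θ * J) / ((n : ℝ) + 1) ^ 2 ≤ T →
  (∀ p, EllM L (uu D θ (u0 n) J p)) ∧ (∀ p, GG D (mu θ J) 1 (uu D θ (u0 n) J) p ≤ ε ^ 2) ∧
  ∀ k a b, HH D.W (mu θ J) 0 (k + 1) (Bk k) (cp (uu D θ (u0 n) J) a b)

include hθ in
lemma reg (ha : 0 < a) (hb : b < T) : ∀ᶠ n in UF, ∀ q : Qt d, Rg θ n a b q →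
    ∃ J : ℕ, q none = J ∧ (1 + θ * J) / ((n) + 1) ^ 2 ≤ T ∧ a * ((n) + 1) ^ 2 ≤ θ * J := by
  have h1 := Filter.Tendsto.const_div_atTop ((Filter.tendsto_pow_atTop two_ne_zero).comp nat_UF) 1
  filter_upwards [h1.eventually (gt_mem_nhds (sub_pos.2 hb))] with n hn q hq
  simp only [Function.comp] at hn
  have hn0 : (0 : ℝ) < ((n : ℝ) + 1) ^ 2 := by positivity
  have hq1 : a * ((n : ℝ) + 1) ^ 2 ≤ θ * q none := by
    have := hq.1
    simp only [ka] at this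
    rw [le_div_iff₀ psv, mul_div_assoc', div_le_iff₀ hθ] at this
    linarith
  have hq2 : θ * q none ≤ b * ((n : ℝ) + 1) ^ 2 := by
    have := hq.2
    simp only [ka] at this
    rw [div_le_iff₀ psv, mul_div_assoc', le_div_iff₀ hθ] at this
    linarith
  have h0 : 0 ≤ q none := by
    have : 0 < θ * (q none : ℝ) := lt_of_lt_of_le psv hq1
    exact_mod_cast (pos_of_mul_pos_right this hθ.le).le
  obtain ⟨J, hJ⟩ := Int.eq_ofNat_of_zero_le h0
  refine ⟨J, hJ, ?_, by rw [hJ] at hq1; exact_mod_cast hq1⟩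
  rw [hJ] at hq2
  rw [div_lt_iff₀ hn0] at hn
  rw [div_le_iff₀ hn0]
  have : θ * (J : ℝ) ≤ b * ((n : ℝ) + 1) ^ 2 := by exact_mod_cast hq2
  linarith

lemma r_bound (ha : 0 < a) (hμ : 0 < μ) (h : a * x ^ 2 ≤ μ ^ 2) : x / μ ≤ √(1 / a) := by
  apply Real.le_sqrt_of_sq_le
  rw [div_pow, div_le_div_iff₀ psv ha]
  linarith

variable {D u0} (hL : 0 < L) (hok : OK D u0 θ T ε Bk)

include hok hθ in
lemma reg2 (ha : 0 < a) (hb : b < T) : ∀ᶠ n in UF, ∀ q : Qt d, Rg θ n a b q →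
    (∀ p, EllM L (un D u0 θ n (q none) p)) ∧ (∀ p i j, ∀ w ∈ D.W, |DD (n + 1) w (cp (un D u0 θ n (q none)) i j) p| ≤ √(1 / a) * |ε|) ∧
    ∀ k, ∀ Z ∈ ls D.W (k + 1), ∀ i j p, |TT (n + 1) Z (cp (un D u0 θ n (q none)) i j) p| ≤ √(1 / a) ^ (k + 1) * Bk k := by
  filter_upwards [reg hθ ha hb, hok] with n h1 h2 q hq
  obtain ⟨J, hJ, hJ1, hJ2⟩ := h1 q hq
  obtain ⟨e1, e2, e3⟩ := h2 J hJ1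
  rw [hJ, un, Int.toNat_natCast]
  have hm := lt_of_lt_of_le one_pos (one_le_mu hθ.le J)
  have hr := r_bound (x := (n : ℝ) + 1) ha hm (by rw [mu_sq hθ.le]; linarith)
  have hr0 : 0 ≤ ((n : ℝ) + 1) / mu θ J := by positivity
  have e : (n : ℝ) + 1 = ((n : ℝ) + 1) / mu θ J * mu θ J := by field_simp
  refine ⟨e1, fun p i j w hw  ↦ ?_, fun k Z hZ i j p  ↦ ?_⟩
  · have h3 := (DD_le_GG D hw i j).trans (Real.sqrt_le_sqrt (e2 p))
    rw [Real.sqrt_sq_eq_abs] at h3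
    rw [e]
    have : DD (((n : ℝ) + 1) / mu θ J * mu θ J) w (cp (uu D θ (u0 n) J) i j) p = ((n : ℝ) + 1) / mu θ J * DD (mu θ J) w (cp (uu D θ (u0 n) J) i j) p := by
      simp only [DD]
      ring
    rw [this, abs_mul, abs_of_nonneg hr0]
    exact mul_le_mul hr h3 (abs_nonneg _) (sqrt_nonneg _)
  · have h3 := HH.TT_le (e3 k i j) Z hZ p
    rw [e, TT_scale, Pi.smul_apply, smul_eq_mul, abs_mul, abs_of_nonneg psv, ls_length hZ]
    rw [add_zero, mul_one] at h3
    exact mul_le_mul (pow_le_pow_left₀ hr0 hr _) h3 (abs_nonneg _) psv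

include hok hL in
lemma uF_s (k i j) : uF D u0 θ i j ∈ ((BdA θ T hθ).lv (Ds D.W) k).A := by
  refine lv_lf k _ fun m Z hZ a b ha hb  ↦ ?_
  cases m with
  | zero =>
    refine ⟨L, ?_⟩
    filter_upwards [reg2 hθ hok ha hb] with n h q hq
    simp only [ls, Finset.mem_singleton] at hZ
    subst hZ
    exact ((h q hq).1 _).bound hL i j
  | succ m =>
    refine ⟨√(1 / a) ^ (m + 1) * Bk m, ?_⟩
    filter_upwards [reg2 hθ hok ha hb] with n h q hq
    exact (h q hq).2.2 m Z hZ i j _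

include hok hL in
lemma AF_bd (i j) : AF D u0 θ i j ∈ (BdA θ T hθ).A := fun a b ha hb  ↦ by
  refine ⟨L, ?_⟩
  filter_upwards [reg2 hθ hok ha hb] with n h q hq
  exact (((h q hq).1 _).St hL).1.bound hL i j

include hok hL hθ in
lemma AF_D (κ v i j) : Eqv θ T (DS κ v (AF D u0 θ i j))
    (-∑ k, ∑ l, sg v (AF D u0 θ i k) * DS κ v (uF D u0 θ k l) * AF D u0 θ l j) := by
  intro a b ha hb
  filter_upwards [reg2 hθ hok ha hb, reg2 hθ hok (a := a / 2) (b := (b + T) / 2) lna lna, Rg_shift hθ v ha hb] with n h1 h2 h3 q hq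
  have s1 := ((h1 q hq).1 fun i  ↦ q (some i)).St hL
  have s2 := ((h2 _ (h3 q hq)).1 fun i  ↦ (q + v) (some i)).St hL
  have e1 : ∀ A B : Mt d, St L A → St L B → (mof B)⁻¹ - (mof A)⁻¹ =
      -((mof B)⁻¹ * (mof B - mof A) * (mof A)⁻¹) := fun A B hA hB  ↦ by
    rw [mul_sub, sub_mul, Ai_mul hB, mul_assoc, hA.2]
    simp
  have e2 := congrFun (congrFun (e1 _ _ s1 s2) i) j
  simp only [Matrix.sub_apply, Matrix.neg_apply, Matrix.mul_apply, Matrix.of_apply] at e2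
  simp only [DS, lf, AF, uF, cp, aA, Ai, sg, Pi.neg_apply, Finset.sum_apply, Pi.mul_apply]
  rw [e2]
  simp only [mul_sum, sum_mul, mul_neg]
  rw [sum_comm]
  congr 1
  exact sum_congr rfl fun _ _  ↦ sum_congr rfl fun _ _  ↦ by ring

include hθ in
lemma uF_t (i j) : Eqv θ T (Do θ none (uF D u0 θ i j)) (RH D u0 θ i j) := by
  intro a b ha hb
  filter_upwards [reg hθ ha hb] with n h q hq
  obtain ⟨J, hJ, -, -⟩ := h q hq
  have e1 := congrFun (stp_eq D (θ := θ) (τ := θ / ((n : ℝ) + 1) ^ 2) (μ := (n : ℝ) + 1) (by field_simp) (uu D θ (u0 n) J) i j) fun i  ↦ q (some i)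
  have e2 : (fun i  ↦ (q + (eo none : Qt d)) (some i)) = fun i  ↦ q (some i) := by funext i; simp [eo]
  have e3 : ((q + (eo none : Qt d)) none).toNat = J + 1 := by simp [eo, hJ]
  have e4 : (q none).toNat = J := by simp [hJ]
  have e5 : RH D u0 θ i j n q = rhs D (n + 1) (uu D θ (u0 n) J) i j fun i  ↦ q (some i) := by
    simp only [rhs, RH, DS_lf, uF, AF, PF, Dw]
    rw [Lop_sym D.hW (fun w  ↦ by funext p; simp [cc, D.hsym])]
    simp only [lf, Pi.add_apply, Pi.smul_apply, Finset.sum_apply, Pi.mul_apply, Pi.sub_apply, un, e4, Quad, smul_eq_mul]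
    simp only [cc, cp, mul_assoc]
  rw [e5]
  simp only [Do, DS]
  simp only [uF, lf, un, e2, e3, e4, uu_succ]
  rw [e1]
  simp only [Pi.add_apply, Pi.smul_apply, smul_eq_mul, ka]
  field_simp
  ring

lemma PF_mem {S : ShA d} (h : ∀ i j, AF D u0 θ i j ∈ S.A) (q) : PF D u0 θ q ∈ S.A := by
  induction q using MvPolynomial.induction_on with
  | C r =>
    have : PF D u0 θ (MvPolynomial.C r) = algebraMap ℝ (SF d) r := by funext n q; simp [PF, lf, ev]
    rw [this]
    exact S.A.algebraMap_mem r
  | add p q hp hq =>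
    have : PF D u0 θ (p + q) = PF D u0 θ p + PF D u0 θ q := by funext n x; simp [PF, lf, ev]
    rw [this]
    exact add_mem hp hq
  | mul_X p i hp =>
    have : PF D u0 θ (p * MvPolynomial.X i) = PF D u0 θ p * AF D u0 θ i.1 i.2 := by funext n x; simp [PF, AF, lf, ev, cp]
    rw [this]
    exact mul_mem hp (h _ _)

lemma RH_mem {S : ShA d} (h : ∀ i j, AF D u0 θ i j ∈ S.A) (hu : ∀ i j, uF D u0 θ i j ∈ S.A) (hD : ∀ w ∈ D.W, ∀ F ∈ S.A, Dw w F ∈ S.A)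
    (i j) : RH D u0 θ i j ∈ S.A := by
  have h2 : ∀ a i j, Dw (ee a) (uF D u0 θ i j) ∈ S.A := fun a i j  ↦ hD _ (D.hee a) _ (hu _ _)
  refine add_mem (S.A.smul_mem (sum_mem fun w hw  ↦ mul_mem (PF_mem h _) (hD _ (D.hW w hw) _ (hD _ hw _ (hu _ _)))) _)
    (S.A.smul_mem (sum_mem fun _ _  ↦ sum_mem fun _ _  ↦ sum_mem fun _ _  ↦ sum_mem fun _ _  ↦ mul_mem (mul_mem (h _ _) (h _ _)) ?_) _)
  have h3 : ∀ a i j ap ip jp, Dw (ee a) (uF D u0 θ i j) * Dw (ee ap) (uF D u0 θ ip jp) ∈ S.A := fun _ _ _ _ _ _  ↦ mul_mem (h2 _ _ _) (h2 _ _ _)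
  exact sub_mem (sub_mem (sub_mem (add_mem (h3 _ _ _ _ _ _) (S.A.smul_mem (h3 _ _ _ _ _ _) _)) (S.A.smul_mem (h3 _ _ _ _ _ _) _))
    (S.A.smul_mem (h3 _ _ _ _ _ _) _)) (S.A.smul_mem (h3 _ _ _ _ _ _) _)

def PP (W : Finset (Pt d)) (θ T : ℝ) (hθ : 0 < θ) : ShA d := ((BdA θ T hθ).tot (Ds W)).tot (Dt θ)

include hok hL in
lemma uA_PP : (∀ i j, uF D u0 θ i j ∈ (PP D.W θ T hθ).A) ∧ ∀ i j, AF D u0 θ i j ∈ (PP D.W θ T hθ).A := by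
  have c1 := tot_CC hθ (Δ := Ds D.W) (Bd_CC (d := d) (T := T) hθ)
  have hA1 : ∀ i j, AF D u0 θ i j ∈ ((BdA θ T hθ).tot (Ds D.W)).A := fun i j  ↦ mem_tot.2 fun k  ↦
    lv_inv hθ (Bd_CC hθ) (AF_bd hθ hL hok) (fun δ _  ↦ AF_D hθ hL hok δ.1 δ.2) k (uF_s hθ hL hok k) i j
  have hA2 : ∀ m, (∀ i j, uF D u0 θ i j ∈ (((BdA θ T hθ).tot (Ds D.W)).lv (Dt θ) m).A) →
      ∀ i j, AF D u0 θ i j ∈ (((BdA θ T hθ).tot (Ds D.W)).lv (Dt θ) m).A := fun m hm  ↦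
    lv_inv hθ c1 hA1 (fun δ _  ↦ AF_D hθ hL hok δ.1 δ.2) m hm
  have key : ∀ m i j, uF D u0 θ i j ∈ (((BdA θ T hθ).tot (Ds D.W)).lv (Dt θ) m).A := by
    intro m
    induction m with
    | zero => exact fun i j  ↦ mem_tot.2 fun k  ↦ uF_s hθ hL hok k i j
    | succ m ih =>
      refine fun i j  ↦ ⟨ih i j, ?_⟩
      rintro _ rfl
      exact lv_CC hθ c1 m _ _ (uF_t hθ i j) (RH_mem (hA2 m ih) ih (fun w hw  ↦ lv_closed (fun F hF  ↦ tot_D (Δ := Ds D.W) hF (δ := (fun n  ↦ (n : ℝ) + 1, hat w)) ⟨w, hw, rfl⟩) m) i j)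
  exact ⟨fun i j  ↦ mem_tot.2 fun m  ↦ key m i j, fun i j  ↦ mem_tot.2 fun m  ↦ hA2 m (key m) i j⟩

lemma PP_Dw (hw : w ∈ W) (hF : F ∈ (PP W θ T hθ).A) : Dw w F ∈ (PP W θ T hθ).A :=
  mem_tot.2 fun m  ↦ lv_closed (fun F hF  ↦ tot_D (Δ := Ds W) hF (δ := (fun n  ↦ (n : ℝ) + 1, hat w)) ⟨w, hw, rfl⟩) m F (mem_tot.1 hF m)

variable (D) in
lemma PP_tame : Tame θ T hθ (PP D.W θ T hθ) where
  bd := fun F hF  ↦ tot_le (tot_le hF)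
  dc := fun F hF o  ↦ by
    cases o with
    | none => exact tot_D hF (δ := (fun n  ↦ ka (d := d) θ n none, eo none)) rfl
    | some i =>
      have := PP_Dw hθ (D.hee i) hF
      rwa [Dw, ← eo_hat] at this
end

section

section
variable {hθ : 0 < θ} {S : ShA d} (hS : Tame θ T hθ S) (hF : F ∈ S.A)
include hS hF

lemma pd_U (ht : t ∈ Ioo 0 T) (c x) : pd c (fun y  ↦ U θ F (t, y)) x = U θ (Do θ (some c) F) (t, x) := by
  have h := (U_deriv hS hF (z := (t, x)) ht).comp x (hasFDerivAt_prodMk_right t x)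
  rw [pd, show (fun y  ↦ U θ F (t, y)) = U θ F ∘ Prod.mk t from rfl, h.fderiv]
  simp [Fintype.sum_option, coo_apply, zz]

lemma dt_U (ht : t ∈ Ioo 0 T) (x) : deriv (fun s  ↦ U θ F (s, x)) t = U θ (Do θ none F) (t, x) := by
  have h := (U_deriv hS hF (z := (t, x)) ht).comp t (hasFDerivAt_prodMk_left (𝕜 := ℝ) t x)
  rw [show (fun s  ↦ U θ F (s, x)) = U θ F ∘ (fun s  ↦ (s, x)) from rfl, h.hasDerivAt.deriv]
  simp [Fintype.sum_option, coo_apply, zz]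

lemma pd2_U (ht : t ∈ Ioo 0 T) (a b x) :
    pd2 a b (fun y  ↦ U θ F (t, y)) x = U θ (Do θ (some a) (Do θ (some b) F)) (t, x) := by
  rw [pd2, show pd b (fun y  ↦ U θ F (t, y)) = fun y  ↦ U θ (Do θ (some b) F) (t, y) from funext (pd_U hS hF ht b), pd_U hS (hS.dc _ hF _) ht]

lemma U_hat2 (w) (hw : Dw w F ∈ S.A) (hz : z.1 ∈ Ioo 0 T) :
    Tendsto (fun n  ↦ Dw (-w) (Dw w F) n (qn θ n z)) UF
      (nhds (-∑ i, ∑ j, w i * w j * U θ (Do θ (some i) (Do θ (some j) F)) z)) := by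
  convert U_hat hS hw (-w) hz using 2
  rw [← sum_neg_distrib]
  refine sum_congr rfl fun i _  ↦ ?_
  rw [Do, DS_comm, U_eq (U_hat hS (hS.dc _ hF (some i)) w hz), mul_sum, ← sum_neg_distrib]
  refine sum_congr rfl fun j _  ↦ ?_
  rw [show Do θ (some i) (Do θ (some j) F) = Do θ (some j) (Do θ (some i) F) from DS_comm _ _ _ _ _]
  simp
  ring
end

variable {D : SD d L} {u0 : ℕ → Pt d → Mt d} (hθ : 0 < θ) (hL : 0 < L) (hok : OK D u0 θ T ε Bk)

def gU (D : SD d L) (u0 : ℕ → Pt d → Mt d) (θ : ℝ) (z : Ze d) : Mt d := fun i j  ↦ U θ (uF D u0 θ i j) z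

include hok hθ hL
lemma g_lim (hz : z.1 ∈ Ioo 0 T) : Tendsto (fun n  ↦ un D u0 θ n (qn θ n z none) fun i  ↦ qn θ n z (some i)) UF (nhds (gU D u0 θ z)) :=
  tendsto_pi_nhds.2 fun i  ↦ tendsto_pi_nhds.2 fun j  ↦ U_lim (tot_le (tot_le ((uA_PP hθ hL hok).1 i j))) hz

omit hL in
lemma ev_reg (hz : z.1 ∈ Ioo 0 T) : ∀ᶠ n in UF, (∀ p, EllM L (un D u0 θ n (qn θ n z none) p)) := by
  filter_upwards [reg2 hθ hok (a := z.1 / 2) (b := (z.1 + T) / 2) (by linarith [hz.1]) (by linarith [hz.2]), qn_time hθ (z := z)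
    (a := z.1 / 2) (b := (z.1 + T) / 2) ⟨by linarith [hz.1], by linarith [hz.2]⟩] with n h1 h2 using (h1 _ h2).1

lemma g_Ell (hz : z.1 ∈ Ioo 0 T) : EllM L (gU D u0 θ z) :=
  (isCompact_EllM hL).isClosed.mem_of_tendsto (g_lim hθ hL hok hz) ((ev_reg hθ hok hz).mono fun _ h  ↦ h _)

lemma A_lim (hz : z.1 ∈ Ioo 0 T) (i j) : Tendsto (fun n  ↦ AF D u0 θ i j n (qn θ n z)) UF (nhds (Ai (gU D u0 θ z) i j)) := by
  have h1 : ∀ i j, Tendsto (fun n  ↦ AF D u0 θ i j n (qn θ n z)) UF (nhds (U θ (AF D u0 θ i j) z)) := fun i j  ↦ U_lim (tot_le (tot_le ((uA_PP hθ hL hok).2 i j))) hz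
  have h2 : mof (gU D u0 θ z) * mof (fun i j  ↦ U θ (AF D u0 θ i j) z) = 1 := by
    ext a b
    rw [Matrix.mul_apply]
    have h3 : Tendsto (fun n  ↦ ∑ k, uF D u0 θ a k n (qn θ n z) * AF D u0 θ k b n (qn θ n z)) UF (nhds (∑ k, gU D u0 θ z a k * U θ (AF D u0 θ k b) z)) :=
      tendsto_finsetSum _ fun k _  ↦ (U_lim (tot_le (tot_le ((uA_PP hθ hL hok).1 a k))) hz).mul (h1 k b)
    refine tendsto_nhds_unique h3 (tendsto_const_nhds.congr' ?_)
    filter_upwards [ev_reg hθ hok hz] with n hn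
    have := congrFun (congrFun ((hn fun i  ↦ qn θ n z (some i)).St hL).2 a) b
    rw [Matrix.mul_apply] at this
    exact this.symm
  rw [Ai, Matrix.inv_eq_right_inv h2]
  exact h1 i j

lemma g_eq (hz : z.1 ∈ Ioo 0 T) : IsRicciDeTurck (gU D u0 θ) z := by
  obtain ⟨t, x⟩ := z
  intro i j
  have hS := PP_tame (T := T) D hθ
  have hu := (uA_PP hθ hL hok).1
  have hA := A_lim hθ hL hok hz
  have hp : ∀ c i j, pd c (fun y  ↦ gU D u0 θ (t, y) i j) x = U θ (Do θ (some c) (uF D u0 θ i j)) (t, x) := fun c i j  ↦ pd_U hS (hu i j) hz c x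
  have hw : ∀ c i j, Tendsto (fun n  ↦ Dw (ee c) (uF D u0 θ i j) n (qn θ n (t, x))) UF (nhds (pd c (fun y  ↦ gU D u0 θ (t, y) i j) x)) := fun c i j  ↦ by
    rw [hp, Dw, ← eo_hat]
    exact U_lim (hS.bd _ (hS.dc _ (hu i j) (some c))) hz
  rw [show deriv (fun s  ↦ gU D u0 θ (s, x) i j) t = _ from dt_U hS (hu i j) hz x]
  have hl : Tendsto (fun n  ↦ RH D u0 θ i j n (qn θ n (t, x))) UF (nhds (U θ (Do θ none (uF D u0 θ i j)) (t, x))) := by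
    refine (U_lim (hS.bd _ (hS.dc _ (hu i j) none)) hz).congr' ?_
    have h1 : 0 < t / 2 := by linarith [hz.1]
    have h2 : (t + T) / 2 < T := by linarith [hz.2]
    filter_upwards [uF_t hθ i j _ _ h1 h2, qn_time hθ (z := (t, x))
      (a := t / 2) (b := (t + T) / 2) ⟨by linarith, by linarith [hz.2]⟩] with n e1 e2 using e1 _ e2
  refine tendsto_nhds_unique hl ?_
  have hP : ∀ q, Tendsto (fun n  ↦ PF D u0 θ q n (qn θ n (t, x))) UF (nhds (ev (Ai (gU D u0 θ (t, x))) q)) := fun q  ↦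
    ((ev_continuous q).tendsto _).comp (tendsto_pi_nhds.2 fun i  ↦ tendsto_pi_nhds.2 fun j  ↦ hA i j)
  have e1 : ∑ a, ∑ b, ((mof (gU D u0 θ (t, x)))⁻¹ : Matrix (Fin d) (Fin d) ℝ) a b * pd2 a b (fun y  ↦ gU D u0 θ (t, y) i j) x =
      (-(1/2) : ℝ) * ∑ w ∈ D.W, ev (Ai (gU D u0 θ (t, x))) (D.c w) * (-∑ a, ∑ b, w a * w b * U θ (Do θ (some a) (Do θ (some b) (uF D u0 θ i j))) (t, x)) := by
    have hc := D.hcons _ (Ai_sym (g_Ell hθ hL hok hz).1)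
    have : ∀ a b, ((mof (gU D u0 θ (t, x)))⁻¹ : Matrix (Fin d) (Fin d) ℝ) a b * pd2 a b (fun y  ↦ gU D u0 θ (t, y) i j) x =
      ∑ w ∈ D.W, (1/2) * (ev (Ai (gU D u0 θ (t, x))) (D.c w) * w a * w b) * U θ (Do θ (some a) (Do θ (some b) (uF D u0 θ i j))) (t, x) := fun a b  ↦ by
      rw [← sum_mul, ← mul_sum, hc, show pd2 a b (fun y  ↦ gU D u0 θ (t, y) i j) x = _ from pd2_U hS (hu i j) hz a b x, Ai]; ring
    simp only [this, mul_sum, ← sum_neg_distrib]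
    rw [sum_congr rfl fun a _  ↦ sum_comm, sum_comm]
    exact sum_congr rfl fun w _  ↦ sum_congr rfl fun a _  ↦ sum_congr rfl fun b _  ↦ by ring
  rw [e1]
  simp only [RH, Pi.add_apply, Pi.smul_apply, Finset.sum_apply, Pi.mul_apply, Pi.sub_apply, smul_eq_mul, mul_assoc (2 : ℝ)]
  refine Filter.Tendsto.add (Filter.Tendsto.const_mul _ (tendsto_finsetSum _ fun w hwz  ↦ (hP _).mul (U_hat2 hS (hu i j) w (PP_Dw hθ hwz (hu i j)) hz)))
    (Filter.Tendsto.const_mul _ (tendsto_finsetSum _ fun a _  ↦ tendsto_finsetSum _ fun b _  ↦ tendsto_finsetSum _ fun r _  ↦ tendsto_finsetSum _ fun s _  ↦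
      ((hA _ _).mul (hA _ _)).mul (((((((hw _ _ _).mul (hw _ _ _)).add ?_).sub ?_).sub ?_).sub ?_)))) <;>
  exact ((hw _ _ _).mul (hw _ _ _)).const_mul _

lemma g_grad (hε : 0 ≤ ε) (ht : t ∈ Ioo 0 T) (x c i j) :
    √t * |pd c (fun y  ↦ gU D u0 θ (t, y) i j) x| ≤ ε := by
  have hS := PP_tame (T := T) D hθ
  have hu := (uA_PP hθ hL hok).1 i j
  rw [show pd c (fun y  ↦ gU D u0 θ (t, y) i j) x = _ from pd_U hS hu ht c x]
  have key : ∀ a ∈ Ioo 0 t, √a * |U θ (Do θ (some c) (uF D u0 θ i j)) (t, x)| ≤ ε := fun a ha  ↦ by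
    have h1 : |U θ (Do θ (some c) (uF D u0 θ i j)) (t, x)| ≤ √(1 / a) * ε := by
      refine le_of_tendsto (U_lim (hS.bd _ (hS.dc _ hu (some c))) (z := (t, x)) ht).abs ?_
      filter_upwards [reg2 hθ hok (a := a) (b := (t + T) / 2) ha.1 (by linarith [ht.2]), qn_time hθ (z := (t, x))
        (a := a) (b := (t + T) / 2) ⟨ha.2, by linarith [ht.2]⟩] with n e1 e2
      have := (e1 _ e2).2.1 (fun i  ↦ qn θ n (t, x) (some i)) i j _ (D.hee c)
      rw [abs_of_nonneg hε] at this
      rw [Do, eo_hat]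
      change |Dw (ee c) (uF D u0 θ i j) n _| ≤ _
      rw [Dw, uF, DS_lf]
      exact this
    have h2 : √a * √(1 / a) = 1 := by rw [← Real.sqrt_mul ha.1.le, mul_one_div_cancel ha.1.ne', Real.sqrt_one]
    calc _ ≤ √a * (√(1 / a) * ε) := by gcongr
      _ = ε := by rw [← mul_assoc, h2, one_mul]
  have hc : Tendsto (fun a  ↦ √a * |U θ (Do θ (some c) (uF D u0 θ i j)) (t, x)|) (nhdsWithin t (Iio t)) (nhds (√t * |U θ (Do θ (some c) (uF D u0 θ i j)) (t, x)|)) :=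
    (Continuous.tendsto fnp t).mono_left nhdsWithin_le_nhds
  exact le_of_tendsto hc (by filter_upwards [Ioo_mem_nhdsLT ht.1] with a ha using key a ha)

lemma g_smooth : ContDiffOn ℝ (⊤ : ℕ∞) (gU D u0 θ) (Ioo 0 T ×ˢ univ) := by
  refine contDiffOn_pi.2 fun i  ↦ contDiffOn_pi.2 fun j  ↦ contDiffOn_infty.2 fun m  ↦ ?_
  exact U_smooth (PP_tame (T := T) D hθ) m _ ((uA_PP hθ hL hok).1 i j)
end

lemma conv_bd {ψ : EE d → ℝ} (hf : ∀ x, |f x| ≤ B) (hC : 0 ≤ C) (hψ : ∀ y, |ψ y| ≤ C) (hs : ∀ y, R < ‖y‖ → ψ y = 0) (x) :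
    |∫ t, ψ (x - t) * f t| ≤ C * B * volume.real (closedBall (0 : EE d) R) := by
  rw [← setIntegral_eq_integral_of_forall_compl_eq_zero (s := closedBall x R) fun t ht  ↦ ?_, ← norm_eq_abs]
  · rw [show volume.real (closedBall (0 : EE d) R) = volume.real (closedBall x R) by
      rw [Measure.real, Measure.real, Measure.addHaar_closedBall_center volume x]]
    refine norm_setIntegral_le_of_norm_le_const measure_closedBall_lt_top fun t _  ↦ ?_
    rw [norm_mul]
    exact mul_le_mul (hψ _) (hf _) (norm_nonneg _) hC
  · rw [hs, zero_mul]
    rw [mem_closedBall, not_le, dist_eq_norm, norm_sub_rev] at ht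
    exact ht

lemma moll (hf : UniformContinuous f) (hB : ∀ x, |f x| ≤ B) (hσ : 0 < σ) : ∃ r, ContDiff ℝ 1 r ∧
    (∀ x, |r x - f x| ≤ σ) ∧ ∃ M, 0 ≤ M ∧ ∀ x v, |r (x + v) - r x| ≤ M * ‖v‖ ∧ |r (x + v) + r (x - v) - 2 * r x| ≤ M * ‖v‖ ^ 2 := by
  obtain ⟨δ, hδ, h1⟩ := Metric.uniformContinuous_iff.1 hf σ hσ
  let φ : ContDiffBump (0 : EE d) := ⟨δ / 2, δ, by linarith, by linarith⟩
  obtain ⟨ψ, hψ⟩ := exi (φ.normed volume)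
  have hψc : ContDiff ℝ 2 ψ := hψ ▸ φ.contDiff_normed
  have hψs : HasCompactSupport ψ := hψ ▸ φ.hasCompactSupport_normed
  have hψ0 : ∀ y, δ ≤ ‖y‖ → ψ y = 0 := fun y hy  ↦ by
    by_contra h
    have : y ∈ Function.support ψ := h
    rw [hψ, φ.support_normed_eq, mem_ball_zero_iff] at this
    exact absurd this (not_lt.2 hy)
  have hr : ∀ x, (convolution ψ f (ContinuousLinearMap.lsmul ℝ ℝ) volume) x = ∫ t, ψ (x - t) * f t := fun x  ↦ by
    rw [convolution_eq_swap]
    rfl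
  have hrs : ContDiff ℝ 1 (convolution ψ f (ContinuousLinearMap.lsmul ℝ ℝ) volume) :=
    hψs.contDiff_convolution_left _ (hψc.of_le nmn) hf.continuous.locallyIntegrable
  have hrf : ∀ x, |convolution ψ f (ContinuousLinearMap.lsmul ℝ ℝ) volume x - f x| ≤ σ := fun x  ↦ by
    rw [hψ, ← Real.dist_eq]
    exact φ.dist_normed_convolution_le hf.continuous.aestronglyMeasurable fun y hy  ↦ (h1 hy).le
  obtain ⟨r, hrr⟩ := exi (convolution ψ f (ContinuousLinearMap.lsmul ℝ ℝ) volume)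
  rw [← hrr] at hr hrs hrf
  refine ⟨r, hrs, hrf, ?_⟩
  obtain ⟨K1, hK1⟩ := (hψc.of_le (m := 1) nmn).lipschitzWith_of_hasCompactSupport hψs one_ne_zero
  have hdc : ContDiff ℝ 1 (fderiv ℝ ψ) := hψc.fderiv_right nmn
  obtain ⟨K2, hK2⟩ := hdc.lipschitzWith_of_hasCompactSupport (hψs.fderiv ℝ) one_ne_zero
  have k1 : ∀ y v, |ψ (y + v) - ψ y| ≤ K1 * ‖v‖ := fun y v  ↦ by
    have := hK1.dist_le_mul (y + v) y
    rwa [Real.dist_eq, dist_eq_norm, add_sub_cancel_left] at this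
  have k2 : ∀ y v, |ψ (y + v) + ψ (y - v) - 2 * ψ y| ≤ K2 * ‖v‖ ^ 2 := fun y v  ↦ by
    have hd : Differentiable ℝ ψ := hψc.differentiable nmn
    have hk : ∀ z ∈ (univ : Set (EE d)), HasFDerivWithinAt (fun z  ↦ ψ (z + v) - ψ z) (fderiv ℝ ψ (z + v) - fderiv ℝ ψ z) univ z := fun z _  ↦
      (HasFDerivAt.sub (((hd (z + v)).hasFDerivAt).comp z ((hasFDerivAt_id z).add_const v)) (hd z).hasFDerivAt).hasFDerivWithinAt
    have := convex_univ.norm_image_sub_le_of_norm_hasFDerivWithin_le hk (C := K2 * ‖v‖) (fun z _  ↦ by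
      have := hK2.dist_le_mul (z + v) z
      rwa [dist_eq_norm, dist_eq_norm, add_sub_cancel_left] at this) (mem_univ (y - v)) (mem_univ y)
    rw [sub_add_cancel, sub_sub_cancel, norm_eq_abs] at this
    calc _ = |ψ (y + v) - ψ y - (ψ y - ψ (y - v))| := by congr 1; ring
      _ ≤ _ := this.trans (by rw [mul_assoc, sq])
  have hint : ∀ x, Integrable fun t  ↦ ψ (x - t) * f t := fun x  ↦ by
    refine Continuous.integrable_of_hasCompactSupport (by have := hf.continuous; have := hψc.continuous; fun_prop) ?_
    exact (hψs.comp_homeomorph (Homeomorph.subLeft x)).mul_right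
  obtain ⟨V, hV⟩ := exi (volume.real (closedBall (0 : EE d) (δ + 1)))
  have hV0 : 0 ≤ V := hV ▸ measureReal_nonneg
  have hB0 : 0 ≤ B := (abs_nonneg _).trans (hB 0)
  have hrB : ∀ x, |r x| ≤ B + σ := fun x  ↦ by
    have := abs_add_le (r x - f x) (f x)
    rw [sub_add_cancel] at this
    linarith [hrf x, hB x]
  refine ⟨K1 * B * V + K2 * B * V + 4 * (B + σ), by positivity, fun x v  ↦ ?_⟩
  have p1 : 0 ≤ K1 * B * V := by positivity
  have p2 : 0 ≤ K2 * B * V := by positivity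
  by_cases hv : ‖v‖ ≤ 1
  · have z0 : ∀ y, δ + 1 < ‖y‖ → ψ y = 0 ∧ ψ (y + v) = 0 ∧ ψ (y - v) = 0 := fun y hy  ↦
      ⟨hψ0 _ lna, hψ0 _ (by have := norm_sub_le_norm_add y v; linarith), hψ0 _ (by have := norm_sub_norm_le y v; linarith)⟩
    constructor
    · have := conv_bd hB psv (fun y  ↦ k1 y v) (fun y hy  ↦ by rw [(z0 y hy).1, (z0 y hy).2.1, sub_zero]) x
      rw [← hV] at this
      rw [hr, hr, ← integral_sub (hint _) (hint _)]
      simp only [← sub_mul, add_sub_right_comm x v]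
      refine this.trans ?_
      rw [show (K1 : ℝ) * ‖v‖ * B * V = K1 * B * V * ‖v‖ by ring]
      gcongr
      linarith
    · have := conv_bd hB psv (fun y  ↦ k2 y v) (fun y hy  ↦ by rw [(z0 y hy).1, (z0 y hy).2.1, (z0 y hy).2.2]; ring) x
      rw [← hV] at this
      rw [hr, hr, hr, ← integral_add (hint _) (hint _), ← integral_const_mul, ← integral_sub (by exact (hint _).add (hint _)) ((hint _).const_mul _)]
      have e : ∀ t, ψ (x + v - t) * f t + ψ (x - v - t) * f t - 2 * (ψ (x - t) * f t) = (ψ (x - t + v) + ψ (x - t - v) - 2 * ψ (x - t)) * f t := fun t  ↦ by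
        rw [add_sub_right_comm x v, sub_right_comm x v]
        ring
      simp only [e]
      refine this.trans ?_
      rw [show (K2 : ℝ) * ‖v‖ ^ 2 * B * V = K2 * B * V * ‖v‖ ^ 2 by ring]
      gcongr
      linarith
  · push Not at hv
    have hv2 : 1 ≤ ‖v‖ ^ 2 := by nlinarith
    have a1 := abs_le.1 (hrB (x + v))
    have a2 := abs_le.1 (hrB (x - v))
    have a3 := abs_le.1 (hrB x)
    have p3 : 0 ≤ B + σ := by linarith
    constructor
    · have : 4 * (B + σ) ≤ (K1 * B * V + K2 * B * V + 4 * (B + σ)) * ‖v‖ := by nlinarith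
      rw [abs_le]; constructor <;> linarith
    · have : 4 * (B + σ) ≤ (K1 * B * V + K2 * B * V + 4 * (B + σ)) * ‖v‖ ^ 2 := by nlinarith
      rw [abs_le]; constructor <;> linarith

section
def vc (p : Pt d) : EE d := WithLp.toLp 2 fun i  ↦ (p i : ℝ)
def lat (h : ℝ) (p : Pt d) : EE d := h • vc p

lemma lat_add (h) (p w : Pt d) : lat h (p + w) = lat h p + h • vc w := by
  ext i
  simp [lat, vc, mul_add]
lemma lat_neg (h) (p w : Pt d) : lat h (p + -w) = lat h p - h • vc w := by
  ext i
  simp [lat, vc, mul_add, sub_eq_add_neg]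

variable (D : SD d L)

lemma refs (hg : UniformContinuous g₀) (hB : ∀ x i j, |g₀ x i j| ≤ B) (hσ : 0 < σ) :
    ∃ r : EE d → Mt d, (∀ i j, ContDiff ℝ 1 fun x  ↦ r x i j) ∧ (∀ x i j, |r x i j - g₀ x i j| ≤ σ) ∧ ∃ M, 0 ≤ M ∧
      (∀ h, 0 ≤ h → Ref D M h fun p  ↦ r (lat h p)) ∧ ∀ i j x v, |r (x + v) i j - r x i j| ≤ M * ‖v‖ := by
  have hgp : ∀ i j, UniformContinuous fun x  ↦ g₀ x i j := fun i j  ↦ uniformContinuous_pi.1 (uniformContinuous_pi.1 hg i) j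
  choose r h1 h2 M hM h3 using fun i j  ↦ moll (hgp i j) (fun x  ↦ hB x i j) hσ
  obtain ⟨M0, hM0⟩ := exi (∑ i, ∑ j, M i j)
  have hMle : ∀ i j, M i j ≤ M0 := fun i j  ↦ by
    rw [hM0]
    exact (single_le_sum (f := fun j  ↦ M i j) (fun j _  ↦ hM i j) (Finset.mem_univ j)).trans
      (single_le_sum (f := fun i  ↦ ∑ j, M i j) (fun i _  ↦ sum_nonneg fun j _  ↦ hM i j) (Finset.mem_univ i))
  have hM00 : 0 ≤ M0 := hM0 ▸ sum_nonneg fun i _  ↦ sum_nonneg fun j _  ↦ hM i j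
  obtain ⟨V, hV⟩ := exi (∑ w ∈ D.W, ‖vc w‖ ^ 2)
  have hV0 : 0 ≤ V := hV ▸ sum_nonneg fun _ _  ↦ sq_nonneg _
  refine ⟨fun x i j  ↦ r i j x, h1, fun x i j  ↦ h2 i j x, (M0 ^ 2 + M0) * (V + 1), by positivity, fun h hh w hw p i j  ↦ ?_, fun i j x v  ↦ ?_⟩
  · have hv : ‖vc w‖ ^ 2 ≤ V := hV ▸ single_le_sum (f := fun w  ↦ ‖vc w‖ ^ 2) (fun _ _  ↦ sq_nonneg _) hw
    obtain ⟨e1, e2⟩ := h3 i j (lat h p) (h • vc w)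
    rw [norm_smul, Real.norm_of_nonneg hh] at e1 e2
    constructor
    · simp only [DD, cp, lat_add, one_mul]
      rw [← sq_abs]
      calc _ ≤ (M0 * (h * ‖vc w‖)) ^ 2 := by gcongr; exact e1.trans (by gcongr; exact hMle i j)
        _ = M0 ^ 2 * ‖vc w‖ ^ 2 * h ^ 2 := by ring
        _ ≤ _ := by gcongr <;> linarith
    · simp only [DD, cp, lat_neg, one_mul, neg_add_cancel_right]
      rw [lat_add]
      calc _ = |r i j (lat h p + h • vc w) + r i j (lat h p - h • vc w) - 2 * r i j (lat h p)| := by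
            rw [← abs_neg]
            congr 1
            ring
        _ ≤ M0 * (h * ‖vc w‖) ^ 2 := e2.trans (by gcongr; exact hMle i j)
        _ = M0 * ‖vc w‖ ^ 2 * h ^ 2 := by ring
        _ ≤ _ := by gcongr <;> nlinarith
  · refine (h3 i j x v).1.trans ?_
    gcongr
    nlinarith [hMle i j, mul_nonneg (sq_nonneg M0) hV0, mul_nonneg hM00 hV0, sq_nonneg M0]

lemma psi_ref (h : ∀ i j, |r p i j - u p i j| ≤ σ) : psi u r p ≤ d ^ 2 * σ ^ 2 := by
  calc _ ≤ ∑ _x, σ ^ 2 := sum_le_sum fun x _  ↦ by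
        rw [← sq_abs, abs_sub_comm]
        exact pow_le_pow_left₀ (abs_nonneg _) (h _ _) 2
    _ = _ := by rw [sum_const, Finset.card_univ, card_prod, card_fin, nsmul_eq_mul]; push_cast; ring

lemma lat_lim (hθ : 0 < θ) (z : Ze d) :
    Tendsto (fun n : ℕ  ↦ lat (1 / ((n) + 1)) fun i  ↦ qn θ n z (some i)) UF (nhds z.2) := by
  have := ((PiLp.continuous_toLp 2 fun _  ↦ ℝ).tendsto (fun i  ↦ z.2 i)).comp (tendsto_pi_nhds.2 fun i  ↦ qn_lim hθ z (some i))
  refine this.congr fun n  ↦ ?_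
  ext i
  simp [lat, vc, ka]
  ring

lemma GG_init (hg : UniformContinuous g₀) (hη : 0 < η) :
    ∀ᶠ n : ℕ in UF, ∀ p, GG D 1 1 (fun p  ↦ g₀ (lat (1 / ((n) + 1)) p)) p ≤ η := by
  obtain ⟨N, hN⟩ : ∃ N : ℝ, N = d ^ 2 * D.W.card + 1 := ⟨_, rfl⟩
  have hN0 : 0 < N := by rw [hN]; positivity
  obtain ⟨δ, hδ, h1⟩ := Metric.uniformContinuous_iff.1 hg (√(η / N)) psv
  have h2 : ∀ w ∈ D.W, ∀ᶠ n : ℕ in UF, 1 / ((n : ℝ) + 1) * ‖vc w‖ < δ := fun w _  ↦ by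
    have := (Filter.Tendsto.const_div_atTop nat_UF 1).mul_const ‖vc w‖
    rw [zero_mul] at this
    exact this.eventually (gt_mem_nhds hδ)
  filter_upwards [(Filter.eventually_all_finset _).2 h2] with n hn p
  rw [GG_one]
  have : ∀ x : Ix d, ∀ w ∈ D.W, (DD 1 w (cp (fun p  ↦ g₀ (lat (1 / ((n : ℝ) + 1)) p)) x.1 x.2) p) ^ 2 ≤ η / N := fun x w hw  ↦ by
    have h3 := h1 (a := lat (1 / ((n : ℝ) + 1)) (p + w)) (b := lat (1 / ((n : ℝ) + 1)) p) (by
      rw [lat_add, dist_eq_norm, add_sub_cancel_left, norm_smul, Real.norm_of_nonneg psv]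
      exact hn w hw)
    have h4 := ((dist_le_pi_dist (g₀ _ x.1) (g₀ _ x.1) x.2).trans (dist_le_pi_dist (g₀ _) (g₀ _) x.1)).trans h3.le
    rw [Real.dist_eq] at h4
    rw [← sq_abs, ← sq_sqrt (by positivity : 0 ≤ η / N)]
    simp only [DD, cp, one_mul]
    exact pow_le_pow_left₀ (abs_nonneg _) h4 2
  calc _ ≤ ∑ _x : Ix d, ∑ _w ∈ D.W, η / N := sum_le_sum fun x _  ↦ sum_le_sum fun w hw  ↦ this x w hw
    _ = (d ^ 2 * D.W.card) * (η / N) := by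
      rw [sum_const, sum_const, Finset.card_univ, card_prod, card_fin, nsmul_eq_mul, nsmul_eq_mul]
      push_cast
      ring
    _ ≤ N * (η / N) := by gcongr; linarith
    _ = η := by field_simp
end

theorem exist (d : ℕ) (lam : ℝ) (hlam : 1 < lam) (ε : ℝ) (hε : 0 < ε) (hε1 : ε ≤ 1) (g₀ : EE d → Mt d) (hg : UniformContinuous g₀)
    (hg0 : ∀ x, EllM lam (g₀ x)) : ∃ T > (0:ℝ), ∃ g : Ze d → Mt d, ContinuousOn g (Icc 0 T ×ˢ univ) ∧
      ContDiffOn ℝ (⊤ : ℕ∞) g (Ioo 0 T ×ˢ univ) ∧ (∀ x, g (0, x) = g₀ x) ∧ (∀ z : Ze d, z.1 ∈ Icc 0 T → EllM (2 * lam) (g z)) ∧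
      (∀ z : Ze d, 0 < z.1 → z.1 < T → IsRicciDeTurck g z) ∧
      ∀ t ∈ Ioc 0 T, ∀ (x : EE d) (c i j : Fin d), √t * |pd c (fun y  ↦ g (t, y) i j) x| ≤ ε := by
  have hL : 0 < 2 * lam := by linarith
  obtain ⟨D⟩ := SD.exists d (2 * lam) lna
  obtain ⟨θ, ⟨hθ, -⟩, Bk, C, hC, hr⟩ := runs d lam hlam D
  obtain ⟨η, hη, hr⟩ := hr ε hε hε1
  have hB : ∀ x i j, |g₀ x i j| ≤ lam := fun x  ↦ (hg0 x).bound lna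
  have hs0 : ∃ s0 > 0, d ^ 2 * s0 ^ 2 ≤ η := ⟨√(η / (d ^ 2 + 1)), by positivity, by
    rw [sq_sqrt psv, mul_div_assoc', div_le_iff₀ psv]
    nlinarith [sq_nonneg (d : ℝ)]⟩
  obtain ⟨s0, hs0, hs1⟩ := hs0
  obtain ⟨r, -, hr1, M, hM, hr2, -⟩ := refs D hg hB hs0
  obtain ⟨T, hT, hr⟩ := hr M hM
  obtain ⟨u0, hu0⟩ : ∃ u0 : ℕ → Pt d → Mt d, u0 = fun (n : ℕ) p  ↦ g₀ (lat (1 / ((n : ℝ) + 1)) p) := ⟨_, rfl⟩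
  have hn0 : ∀ n : ℕ, 0 ≤ 1 / ((n : ℝ) + 1) := fun n  ↦ by positivity
  have hmain : ∀ᶠ n : ℕ in UF, ∀ J : ℕ, (1 + θ * J) / ((n : ℝ) + 1) ^ 2 ≤ T → (∀ p, EllM (2 * lam) (uu D θ (u0 n) J p)) ∧
      (∀ p, GG D (mu θ J) 1 (uu D θ (u0 n) J) p ≤ ε ^ 2) ∧ (∀ (k : ℕ) a b, HH D.W (mu θ J) 0 (k + 1) (Bk k) (cp (uu D θ (u0 n) J) a b)) ∧
      ∀ (Mp : ℝ) (rp : Pt d → Mt d) (a : ℝ), 0 ≤ Mp → Ref D Mp (1 / ((n : ℝ) + 1)) rp → (∀ p, psi (u0 n) rp p ≤ η) →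
        Mp * ((1 / ((n : ℝ) + 1)) ^ 2 * (1 + θ * J)) ≤ 1 → (∀ p, psi (u0 n) rp p ≤ a) →
        ∀ p, psi (uu D θ (u0 n) J) rp p ≤ a + C * Mp * θ * (1 / ((n : ℝ) + 1)) ^ 2 * J := by
    filter_upwards [GG_init D hg hη] with n hn J hJ
    exact hr (1 / ((n : ℝ) + 1)) (u0 n) _ (fun p  ↦ by rw [hu0]; exact hg0 _) (by rw [hu0]; exact hn)
      (fun p  ↦ by rw [hu0]; exact (psi_ref fun i j  ↦ hr1 _ i j).trans hs1) (hr2 _ (hn0 n)) J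
      (by rw [div_pow, one_pow, one_div_mul_eq_div]; exact hJ) J le_rfl
  have hok : OK D u0 θ T ε Bk := by
    filter_upwards [hmain] with n hn J hJ using ⟨(hn J hJ).1, (hn J hJ).2.1, (hn J hJ).2.2.1⟩
  have C0 : ∀ σ > 0, d ^ 2 * σ ^ 2 ≤ η → ∃ t0 > 0, ∀ t ∈ Ioo 0 t0, ∀ x i j, |gU D u0 θ (t, x) i j - g₀ x i j| ≤ (d + 2) * σ := by
    intro σ hσ hση
    obtain ⟨rp, -, h1, Mp, hMp, h2, -⟩ := refs D hg hB hσ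
    have hCM : 0 ≤ C * Mp := mul_nonneg hC hMp
    obtain ⟨t0, ht0⟩ := exi (min T (min (1 / (Mp + 1)) (σ ^ 2 / (C * Mp + 1))))
    have ht00 : 0 < t0 := by rw [ht0]; positivity
    obtain ⟨l1, l2, l3⟩ : t0 ≤ T ∧ t0 ≤ 1 / (Mp + 1) ∧ t0 ≤ σ ^ 2 / (C * Mp + 1) := by rw [ht0]; simp
    refine ⟨t0, ht00, fun t ht x i j  ↦ ?_⟩
    have hz : (t, x).1 ∈ Ioo 0 T := ⟨ht.1, ht.2.trans_le l1⟩
    have lim1 := tendsto_pi_nhds.1 (tendsto_pi_nhds.1 (g_lim hθ hL hok hz) i) j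
    have lim2 := tendsto_pi_nhds.1 (tendsto_pi_nhds.1 ((hg.continuous.tendsto x).comp (lat_lim hθ (t, x))) i) j
    refine le_of_tendsto (lim1.sub lim2).abs ?_
    filter_upwards [hmain, reg (d := d) hθ (a := t / 2) (b := (t + t0) / 2) (T := t0) (by linarith [ht.1]) (by linarith [ht.2]),
      qn_time hθ (z := (t, x)) (a := t / 2) (b := (t + t0) / 2) ⟨by linarith [ht.1], by linarith [ht.2]⟩] with n hn h4 h5
    obtain ⟨J, hJ, hJ1, -⟩ := h4 _ h5
    obtain ⟨-, -, -, h6⟩ := hn J (hJ1.trans l1)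
    have h7 := h6 Mp _ (d ^ 2 * σ ^ 2) hMp (h2 _ (hn0 n)) (fun p  ↦ by rw [hu0]; exact (psi_ref fun i j  ↦ h1 _ i j).trans hση)
      (by
        rw [div_pow, one_pow, one_div_mul_eq_div]
        calc _ ≤ Mp * (1 / (Mp + 1)) := mul_le_mul_of_nonneg_left (hJ1.trans l2) hMp
          _ ≤ 1 := by rw [mul_one_div, div_le_one psv]; linarith) (fun p  ↦ by rw [hu0]; exact psi_ref fun i j  ↦ h1 _ i j)
      fun i  ↦ qn θ n (t, x) (some i)
    have h8 : C * Mp * θ * (1 / ((n : ℝ) + 1)) ^ 2 * J ≤ σ ^ 2 := by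
      have : θ * J / ((n : ℝ) + 1) ^ 2 ≤ σ ^ 2 / (C * Mp + 1) := le_trans (by gcongr; linarith) (hJ1.trans l3)
      calc _ = C * Mp * (θ * J / ((n : ℝ) + 1) ^ 2) := by field_simp
        _ ≤ C * Mp * (σ ^ 2 / (C * Mp + 1)) := by gcongr
        _ ≤ σ ^ 2 := by rw [mul_div_assoc', div_le_iff₀ psv]; nlinarith [sq_nonneg σ]
    have h9 := psi_abs (s := (d + 1) * σ) psv (h7.trans (by nlinarith [mul_nonneg (Nat.cast_nonneg (α := ℝ) d) (sq_nonneg σ)])) i j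
    have h10 := h1 (lat (1 / ((n : ℝ) + 1)) fun i  ↦ qn θ n (t, x) (some i)) i j
    have h11 := abs_add_le (uu D θ (u0 n) J (fun i  ↦ qn θ n (t, x) (some i)) i j - rp (lat (1 / ((n : ℝ) + 1)) fun i  ↦ qn θ n (t, x) (some i)) i j)
      (rp (lat (1 / ((n : ℝ) + 1)) fun i  ↦ qn θ n (t, x) (some i)) i j - g₀ (lat (1 / ((n : ℝ) + 1)) fun i  ↦ qn θ n (t, x) (some i)) i j)
    rw [sub_add_sub_cancel] at h11
    rw [hJ]
    change |uu D θ (u0 n) J (fun i  ↦ qn θ n (t, x) (some i)) i j - g₀ (lat (1 / ((n : ℝ) + 1)) fun i  ↦ qn θ n (t, x) (some i)) i j| ≤ _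
    linarith
  obtain ⟨g, hgd⟩ : ∃ g : Ze d → Mt d, g = fun z  ↦ if z.1 ≤ 0 then g₀ z.2 else gU D u0 θ z := ⟨_, rfl⟩
  have hgU : ∀ z : Ze d, 0 < z.1 → g z = gU D u0 θ z := fun z hz  ↦ by rw [hgd]; simp [not_le.2 hz]
  have hg00 : ∀ x, g (0, x) = g₀ x := fun x  ↦ by rw [hgd]; simp
  have hsl : ∀ t, 0 < t → (fun y  ↦ g (t, y)) = fun y  ↦ gU D u0 θ (t, y) := fun t ht  ↦ funext fun y  ↦ hgU _ ht
  have hsm := g_smooth hθ hL hok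
  have hop : IsOpen (Ioo 0 T ×ˢ (univ : Set (EE d))) := isOpen_Ioo.prod isOpen_univ
  refine ⟨T / 2, by linarith, g, ?_, ?_, hg00, ?_, ?_, ?_⟩
  · rintro ⟨t, x⟩ ⟨ht, -⟩
    rcases ht.1.eq_or_lt with h | h
    · simp only at h
      subst h
      refine Metric.continuousWithinAt_iff'.2 fun e he  ↦ ?_
      obtain ⟨σ, hσ, hσ1, hσ2⟩ : ∃ σ > 0, d ^ 2 * σ ^ 2 ≤ η ∧ (d + 2) * σ < e / 2 := ⟨min s0 (e / (4 * (d + 2))), by positivity,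
        (by gcongr; exact min_le_left _ _ : _ ≤ d ^ 2 * s0 ^ 2).trans hs1, by
          calc _ ≤ (d + 2) * (e / (4 * (d + 2))) := by gcongr; exact min_le_right _ _
            _ = e / 4 := by field_simp
            _ < _ := by linarith⟩
      obtain ⟨t0, ht0, h1⟩ := C0 σ hσ hσ1
      have n1 : ∀ᶠ z : Ze d in nhdsWithin (0, x) (Icc 0 (T / 2) ×ˢ univ), z.1 < t0 :=
        mem_nhdsWithin_of_mem_nhds ((continuous_fst.tendsto (0, x)).eventually (gt_mem_nhds ht0))
      have n2 : ∀ᶠ z : Ze d in nhdsWithin (0, x) (Icc 0 (T / 2) ×ˢ univ), dist (g₀ z.2) (g₀ x) < e / 2 :=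
        mem_nhdsWithin_of_mem_nhds (((hg.continuous.comp continuous_snd).tendsto (0, x)).eventually (ball_mem_nhds _ lna))
      filter_upwards [n1, n2, self_mem_nhdsWithin] with z hz1 hz2 hz3
      rw [hg00]
      have h3 : dist (g z) (g₀ z.2) < e / 2 := by
        rcases hz3.1.1.eq_or_lt with h | h
        · rw [show z = (0, z.2) from Prod.ext h.symm rfl, hg00, dist_self]
          linarith
        · rw [hgU z h]
          exact lt_of_le_of_lt ((dist_pi_le_iff psv).2 fun i  ↦ (dist_pi_le_iff psv).2 fun j  ↦ h1 z.1 ⟨h, hz1⟩ z.2 i j) hσ2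
      linarith [dist_triangle (g z) (g₀ z.2) (g₀ x)]
    · have hz : ((t, x) : Ze d) ∈ Ioo 0 T ×ˢ (univ : Set (EE d)) := ⟨⟨h, by linarith [ht.2]⟩, mem_univ _⟩
      refine ((hsm.continuousOn.continuousAt (hop.mem_nhds hz)).congr ?_).continuousWithinAt
      filter_upwards [hop.mem_nhds hz] with z hz using (hgU z hz.1.1).symm
  · refine (hsm.mono (prod_mono (Ioo_subset_Ioo_right lna) le_rfl)).congr fun z hz  ↦ hgU z hz.1.1
  · rintro ⟨t, x⟩ ht
    rcases ht.1.eq_or_lt with h | h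
    · simp only at h
      subst h
      rw [hg00]
      refine ⟨(hg0 x).1, fun ξ  ↦ ?_⟩
      have := (hg0 x).2 ξ
      have hs : 0 ≤ ∑ i, ξ i ^ 2 := sum_nonneg fun _ _  ↦ sq_nonneg _
      rw [mul_inv]
      have hl : 0 < lam⁻¹ := by positivity
      constructor <;> nlinarith [mul_nonneg hl.le hs]
    · rw [hgU _ h]
      exact g_Ell hθ hL hok ⟨h, by linarith [ht.2]⟩
  · rintro ⟨t, x⟩ h1 h2 i j
    have := g_eq hθ hL hok (z := (t, x)) ⟨h1, by linarith⟩ i j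
    have e1 : ∀ i j, (fun y  ↦ g (t, y) i j) = fun y  ↦ gU D u0 θ (t, y) i j := fun i j  ↦ funext fun y  ↦ by rw [hgU (t, y) h1]
    have e2 : deriv (fun s  ↦ g (s, x) i j) t = deriv (fun s  ↦ gU D u0 θ (s, x) i j) t :=
      Filter.EventuallyEq.deriv_eq (by filter_upwards [lt_mem_nhds h1] with s hs; rw [hgU (s, x) hs])
    simp only [e1, e2, hgU _ h1] at this ⊢
    exact this
  · intro t ht x c i j
    have := g_grad hθ hL hok hε.le (t := t) ⟨ht.1, by linarith [ht.2]⟩ x c i j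
    rwa [show (fun y  ↦ g (t, y) i j) = fun y  ↦ gU D u0 θ (t, y) i j from funext fun y  ↦ by rw [hgU (t, y) ht.1]]

lemma sum_le_b {ι : Type*} [Fintype ι] {f : ι → ℝ} (h : ∀ i, |f i| ≤ b) : |∑ i, f i| ≤ Fintype.card ι * b :=
  (abs_sum_le_sum_abs _ _).trans ((sum_le_sum fun i _  ↦ h i).trans_eq smp)

lemma ab2 (ha : |a| ≤ A) (hb : |b| ≤ B) : |a * b| ≤ A * B := by
  rw [abs_mul]
  exact mul_le_mul ha hb (abs_nonneg _) ((abs_nonneg _).trans ha)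

lemma ab3 (ha : |a| ≤ A) (hb : |b| ≤ B) : |a + b| ≤ A + B := (abs_add_le _ _).trans (add_le_add ha hb)

section

def Qf (A : Mt d) (p : Fin d → Mt d) (i j : Fin d) : ℝ :=
  (1/2) * ∑ a, ∑ b, ∑ r, ∑ s, A a b * A r s *
          (p i r a * p j s b + 2 * p a j r * p s i b - 2 * p a j r * p b i s - 2 * p j r a * p b i s - 2 * p i r a * p b j s)

def Cf (A : Mt d) (p : Fin d → Mt d) (i j : Fin d) : ℝ := ∑ a, ∑ b, ∑ r, ∑ s, A a r * p a r s * A s b * p b i j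

def EB (L ω s D : ℝ) : ℝ := 2 * L * ω * s ^ 2 + L ^ 2 * (2 * s * D + D ^ 2)

lemma tm {A1 A2 B1 B2 p1 p2 q1 q2} (hA1 : |A1| ≤ L) (hA2 : |A2| ≤ L) (hB1 : |B1| ≤ L) (h1 : |A1 - B1| ≤ ω)
    (h2 : |A2 - B2| ≤ ω) (hq1 : |q1| ≤ s) (hq2 : |q2| ≤ s) (hp1 : |p1 - q1| ≤ D) (hp2 : |p2 - q2| ≤ D) :
    |A1 * A2 * (p1 * p2) - B1 * B2 * (q1 * q2)| ≤ EB L ω s D := by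
  have e : A1 * A2 * (p1 * p2) - B1 * B2 * (q1 * q2) = ((A1 - B1) * A2 + B1 * (A2 - B2)) * (q1 * q2) +
    A1 * A2 * (((p1 - q1) * q2 + q1 * (p2 - q2)) + (p1 - q1) * (p2 - q2)) := by ring
  rw [e]
  refine (ab3 (ab2 (ab3 (ab2 h1 hA2) (ab2 hB1 h2)) (ab2 hq1 hq2)) (ab2 (ab2 hA1 hA2) (ab3 (ab3 (ab2 hp1 hq2) (ab2 hq1 hp2)) (ab2 hp1 hp2)))).trans_eq ?_
  unfold EB
  ring

lemma sum4 {f g : Fin d → Fin d → Mt d} (h : ∀ i j k l, |f i j k l - g i j k l| ≤ b) :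
    |∑ i, ∑ j, ∑ k, ∑ l, f i j k l - ∑ i, ∑ j, ∑ k, ∑ l, g i j k l| ≤ d ^ 4 * b := by
  simp only [← sum_sub_distrib]
  refine (sum_le_b fun i  ↦ sum_le_b fun j  ↦ sum_le_b fun k  ↦ sum_le_b fun l  ↦ h i j k l).trans_eq ?_
  simp
  ring

variable {A B : Mt d} {p q : Fin d → Mt d}

lemma Qf_diff (hA : ∀ i j, |A i j| ≤ L) (hB : ∀ i j, |B i j| ≤ L) (hw : ∀ i j, |A i j - B i j| ≤ ω)
    (hq : ∀ c i j, |q c i j| ≤ s) (hp : ∀ c i j, |p c i j - q c i j| ≤ D) (i j) :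
    |Qf A p i j - Qf B q i j| ≤ 5 * d ^ 4 * EB L ω s D := by
  unfold Qf
  rw [← mul_sub, abs_mul, abs_of_pos nmn]
  have := sum4 (d := d) (b := 9 * EB L ω s D) (f := fun a b r s  ↦ A a b * A r s *
          (p i r a * p j s b + 2 * p a j r * p s i b - 2 * p a j r * p b i s - 2 * p j r a * p b i s - 2 * p i r a * p b j s))
    (g := fun a b r s  ↦ B a b * B r s *
          (q i r a * q j s b + 2 * q a j r * q s i b - 2 * q a j r * q b i s - 2 * q j r a * q b i s - 2 * q i r a * q b j s)) (fun a b r s  ↦ by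
      have t := fun c1 i1 j1 c2 i2 j2  ↦ abs_le.1 (tm (hA a b) (hA r s) (hB a b) (hw a b) (hw r s) (hq c1 i1 j1) (hq c2 i2 j2) (hp c1 i1 j1) (hp c2 i2 j2))
      have t1 := t i r a j s b
      have t2 := t a j r s i b
      have t3 := t a j r b i s
      have t4 := t j r a b i s
      have t5 := t i r a b j s
      clear t hA hB hw hq hp
      rw [abs_le]; constructor <;> linarith)
  have h0 : 0 ≤ d ^ 4 * EB L ω s D := mul_nonneg psv ((abs_nonneg _).trans (tm (hA i i) (hA i i) (hB i i) (hw i i) (hw i i) (hq i i i) (hq i i i) (hp i i i) (hp i i i)))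
  linarith

lemma Cf_diff (hA : ∀ i j, |A i j| ≤ L) (hB : ∀ i j, |B i j| ≤ L) (hw : ∀ i j, |A i j - B i j| ≤ ω)
    (hq : ∀ c i j, |q c i j| ≤ s) (hp : ∀ c i j, |p c i j - q c i j| ≤ D) (i j) :
    |Cf A p i j - Cf B q i j| ≤ d ^ 4 * EB L ω s D :=
  sum4 fun a b r s  ↦ by
    rw [show A a r * p a r s * A s b * p b i j = A a r * A s b * (p a r s * p b i j) by ring, show B a r * q a r s * B s b * q b i j = B a r * B s b * (q a r s * q b i j) by ring]
    exact tm (hA _ _) (hA _ _) (hB _ _) (hw _ _) (hw _ _) (hq _ _ _) (hq _ _ _) (hp _ _ _) (hp _ _ _)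

lemma QC_zero (i j) : Qf A 0 i j = 0 ∧ Cf A 0 i j = 0 := by simp [Qf, Cf]

lemma Q_bd (hA : ∀ i j, |A i j| ≤ L) (hq : ∀ c i j, |q c i j| ≤ s) (i j) : |Qf A q i j| ≤ 5 * d ^ 4 * (L ^ 2 * s ^ 2) := by
  have := Qf_diff (A := A) (B := A) (q := 0) (p := q) (ω := 0) (s := 0) (D := s) hA hA smp smp (by simpa using hq) i j
  simpa [QC_zero, EB] using this

lemma QC_bd (hA : ∀ i j, |A i j| ≤ L) (hq : ∀ c i j, |q c i j| ≤ s) (i j) : |Qf A q i j + Cf A q i j| ≤ 6 * d ^ 4 * (L ^ 2 * s ^ 2) := by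
  have := Cf_diff (A := A) (B := A) (q := 0) (p := q) (ω := 0) (s := 0) (D := s) hA hA smp smp (by simpa using hq) i j
  have h2 := Q_bd hA hq i j
  simp [QC_zero, EB] at this
  refine (ab3 h2 this).trans_eq (by ring)

lemma Ai_diff {a b : Mt d} (hL : 0 < L) (ha : St L a) (hb : St L b) {W} (h : ∀ i j, |a i j - b i j| ≤ W) (i j) :
    |Ai a i j - Ai b i j| ≤ d ^ 2 * L ^ 2 * W := by
  have e : (mof a)⁻¹ - (mof b)⁻¹ = -((mof a)⁻¹ * (mof a - mof b) * (mof b)⁻¹) := by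
    rw [mul_sub, sub_mul, Ai_mul ha, mul_assoc, hb.2]
    simp
  have e2 := congrFun (congrFun e i) j
  simp only [Matrix.sub_apply, Matrix.neg_apply, Matrix.mul_apply, Matrix.of_apply] at e2
  unfold Ai
  rw [e2, abs_neg]
  refine (sum_le_b fun k  ↦ ab2 (sum_le_b fun l  ↦ ab2 (ha.1.bound hL i l) (h l k)) (hb.1.bound hL k j)).trans_eq ?_
  simp
  ring

def Xf (A : Mt d) (q : Fin d → Mt d) (c : Fin d) (x : Ix d) : ℝ := ∑ b, A c b * q b x.1 x.2

lemma Xf_bd (hA : ∀ i j, |A i j| ≤ L) (hq : ∀ c i j, |q c i j| ≤ s) (c x) : |Xf A q c x| ≤ d * (L * s) :=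
  (sum_le_b fun b  ↦ ab2 (hA c b) (hq b x.1 x.2)).trans_eq smp

lemma Xf_coer (hA : EllM L A) (q) :
    L⁻¹ * ∑ c, ∑ x : Ix d, q c x.1 x.2 ^ 2 ≤ ∑ c, ∑ x, q c x.1 x.2 * Xf A q c x := by
  rw [sum_comm, sum_comm (f := fun c (x : Ix d)  ↦ q c x.1 x.2 * Xf A q c x), mul_sum]
  refine sum_le_sum fun x _  ↦ ((hA.2 fun c  ↦ q c x.1 x.2).1).trans_eq ?_
  refine sum_congr rfl fun c _  ↦ ?_
  rw [Xf, mul_sum]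
  exact sum_congr rfl fun b _  ↦ by ring
end

lemma summand {dχ W w dw q r Z S1 S2 Zb Yb s1 s2} (hχ : 0 ≤ χ) (hK : 0 ≤ K) (hdχ : |dχ| ≤ η) (hWt : |Wt| ≤ 2) (hw : |w| ≤ W)
    (hZ : |Z| ≤ Zb) (hY : |Y| ≤ Yb) (he : |e| ≤ δ) (h1 : |S1| ≤ s1) (h2 : |S2| ≤ s2) (hr : |r| ≤ M) :
    -(2 * (2 * χ * dχ * Wt * w + χ ^ 2 * (2 * K * S1) * w + χ ^ 2 * Wt * dw) * Z)
      - 2 * K * (2 * χ * dχ * W ^ 2 * e + χ ^ 2 * (2 * S2) * e + χ ^ 2 * W ^ 2 * (q - r)) * Y ≤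
    (8 * χ * η * (W * Zb) + 4 * K * χ ^ 2 * (s1 * W * Zb) + 4 * K * χ * W ^ 2 * (η * δ * Yb) + 4 * K * χ ^ 2 * (s2 * δ * Yb) + 2 * K * χ ^ 2 * W ^ 2 * (M * Yb))
      - 2 * χ ^ 2 * Wt * (dw * Z) - 2 * K * χ ^ 2 * W ^ 2 * (q * Y) := by
  have a1 := mul_le_mul_of_nonneg_left (neg_le_of_abs_le (ab2 (ab2 hdχ hWt) (ab2 hw hZ))) hχ
  have a2 := mul_le_mul_of_nonneg_left (neg_le_of_abs_le (ab2 (ab2 h1 hw) hZ)) (mul_nonneg hK (sq_nonneg χ))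
  have a3 := mul_le_mul_of_nonneg_left (neg_le_of_abs_le (ab2 (ab2 hdχ he) hY)) (mul_nonneg (mul_nonneg hK hχ) (sq_nonneg W))
  have a4 := mul_le_mul_of_nonneg_left (neg_le_of_abs_le (ab2 (ab2 h2 he) hY)) (mul_nonneg hK (sq_nonneg χ))
  have a5 := mul_le_mul_of_nonneg_left (le_of_abs_le (ab2 hr hY)) (mul_nonneg (mul_nonneg hK (sq_nonneg χ)) (sq_nonneg W))
  linarith

lemma real_ineq {c u v} (hc : 0 < c) (hC : 0 ≤ C) (hK : 1 ≤ K) (hK2 : 16 * C ^ 2 / c + 12 * C ≤ K * c) (hM : 0 ≤ M) :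
    C * (u * (a + b)) + C * (b * (a + b) + M * v * (a + b)) + (-2 * c * a ^ 2 + C * (a * b)) + C * (u * b) + C * (a * b)
      + (-2 * K * c * b ^ 2 + C * K * M * (v * b)) + (C * (b ^ 2 + a * b) + c / 2 * a ^ 2) + C * b ^ 2 ≤
    (C ^ 2 / c + 4 * C ^ 2 / c + C ^ 2 * M ^ 2 / c + C ^ 2 * (1 + K) ^ 2 * M ^ 2 / c) * (u ^ 2 + v ^ 2) := by
  have am : ∀ x y k : ℝ, 0 < k → x * y ≤ k / 4 * x ^ 2 + y ^ 2 / k := fun x y k hk  ↦ by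
    have : 0 ≤ (k / 2 * x - y) ^ 2 / k := by positivity
    have e : (k / 2 * x - y) ^ 2 / k = k / 4 * x ^ 2 - x * y + y ^ 2 / k := by field_simp; ring
    linarith
  have h1 := am a (4 * C * b) c hc
  have h2 := am a (C * u) c hc
  have h3 := am a (C * (M * v)) c hc
  have hcK : c ≤ K * c := by nlinarith
  have h4 := am b (2 * (C * u)) (c) hc
  have h5 := am b (C * ((1 + K) * M * v)) (c) hc
  have e1 : (4 * C * b) ^ 2 / c = 16 * C ^ 2 / c * b ^ 2 := by ring
  have e2 : (C * u) ^ 2 / c = C ^ 2 / c * u ^ 2 := by ring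
  have e3 : (C * (M * v)) ^ 2 / c = C ^ 2 * M ^ 2 / c * v ^ 2 := by ring
  have e4 : (2 * (C * u)) ^ 2 / c = 4 * C ^ 2 / c * u ^ 2 := by ring
  have e5 : (C * ((1 + K) * M * v)) ^ 2 / c = C ^ 2 * (1 + K) ^ 2 * M ^ 2 / c * v ^ 2 := by ring
  rw [e1] at h1
  rw [e2] at h2
  rw [e3] at h3
  rw [e4] at h4
  rw [e5] at h5
  have h6 := mul_le_mul_of_nonneg_right hK2 (sq_nonneg b)
  have h7 := mul_le_mul_of_nonneg_right hcK (sq_nonneg b)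
  have p1 : 0 ≤ C ^ 2 / c * v ^ 2 := by positivity
  have p2 : 0 ≤ C ^ 2 * M ^ 2 / c * u ^ 2 := by positivity
  have p3 : 0 ≤ C ^ 2 * (1 + K) ^ 2 * M ^ 2 / c * u ^ 2 := by positivity
  have p4 : 0 ≤ C * b ^ 2 := by positivity
  have p5 : 0 ≤ 4 * C ^ 2 / c * v ^ 2 := by positivity
  have p6 : 0 ≤ c * a ^ 2 := by positivity
  have p7 : 0 ≤ c * b ^ 2 := by positivity
  linarith

lemma comb {c W dZ qY SP SQ} (hc : 0 < c) (hC : 0 ≤ C) (hK : 1 ≤ K) (hM : 0 ≤ M) (hN : 1 ≤ N) (hχ : 0 ≤ χ) (hη : 0 ≤ η)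
    (hD : 0 ≤ D) (hs : 0 ≤ s) (hW : 0 ≤ W) (hδ : 0 ≤ δ) (hKδ : K * δ ≤ 1) (h1 : 1 ≤ Wt) (h2 : Wt ≤ 2)
    (hK2 : 16 * (8 * N ^ 2 * C) ^ 2 / c + 12 * (8 * N ^ 2 * C) ≤ K * c) (hWc : 8 * N ^ 2 * C * W ≤ c / 2)
    (hdZ : c * D ^ 2 - C * (W * s * D) ≤ dZ) (hqY : c * s ^ 2 ≤ qY) (hSP : SP ≤ N * (W * (C * (W * s ^ 2 + s * D + D ^ 2)))) (hSP' : 0 ≤ N * (W * (C * (W * s ^ 2 + s * D + D ^ 2))))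
    (hSQ : SQ ≤ N * (δ * (C * s ^ 2))) :
    N * (8 * χ * η * (W * (C * (D + W * s))) + 4 * K * χ ^ 2 * (N * (δ * (s + M)) * W * (C * (D + W * s))) + 4 * K * χ * W ^ 2 * (η * δ * (C * s))
      + 4 * K * χ ^ 2 * (N * (W * D) * δ * (C * s)) + 2 * K * χ ^ 2 * W ^ 2 * (M * (C * s)))
      - 2 * χ ^ 2 * Wt * dZ - 2 * K * χ ^ 2 * W ^ 2 * qY + χ ^ 2 * (2 * Wt * SP + 2 * K * W ^ 2 * SQ) ≤
    ((8 * N ^ 2 * C) ^ 2 / c + 4 * (8 * N ^ 2 * C) ^ 2 / c + (8 * N ^ 2 * C) ^ 2 * M ^ 2 / c + (8 * N ^ 2 * C) ^ 2 * (1 + K) ^ 2 * M ^ 2 / c) * ((η * W) ^ 2 + (χ * W) ^ 2) := by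
  refine le_trans ?_ (real_ineq (a := χ * D) (b := χ * W * s) (u := η * W) (v := χ * W) hc (by positivity : 0 ≤ 8 * N ^ 2 * C) hK hK2 hM)
  have hNN : N ≤ N ^ 2 := le_self_pow₀ hN two_ne_zero
  have k0 : 0 ≤ K * δ := by positivity
  have n1 : 8 * N * C ≤ 8 * N ^ 2 * C := by gcongr
  have n0 : C ≤ N ^ 2 * C := le_mul_of_one_le_left hC (one_le_pow₀ hN)
  have n5 : 0 ≤ N ^ 2 * C := by positivity
  have kle : ∀ x y, 0 ≤ y → y ≤ x → y * (K * δ) ≤ x := fun x y hy h  ↦ (mul_le_of_le_one_right hy hKδ).trans h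
  have t1 := mul_le_mul_of_nonneg_right n1 (by positivity : 0 ≤ η * W * (χ * D + χ * W * s))
  have t2 := mul_le_mul_of_nonneg_right (kle (8 * N ^ 2 * C) (4 * N ^ 2 * C) psv lna)
    (by positivity : 0 ≤ χ * W * s * (χ * D + χ * W * s) + M * (χ * W) * (χ * D + χ * W * s))
  have t3 := mul_le_mul_of_nonneg_right (kle (8 * N ^ 2 * C) (4 * N * C) psv (by linarith [show 0 ≤ N * C by positivity])) (by positivity : 0 ≤ η * W * (χ * W * s))
  have t4 := mul_le_mul_of_nonneg_right (kle (8 * N ^ 2 * C) (4 * N ^ 2 * C) psv lna) (by positivity : 0 ≤ χ * D * (χ * W * s))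
  have t5 := mul_le_mul_of_nonneg_right (show 2 * N * C ≤ 8 * N ^ 2 * C by linarith [show 0 ≤ N * C by positivity]) (by positivity : 0 ≤ K * M * (χ * W * (χ * W * s)))
  have t6 : -(2 * χ ^ 2 * Wt * dZ) ≤ -2 * c * (χ * D) ^ 2 + 8 * N ^ 2 * C * (χ * D * (χ * W * s)) := by
    have e1 := mul_le_mul_of_nonneg_left hdZ (show 0 ≤ 2 * χ ^ 2 * Wt by positivity)
    have e2 := mul_le_mul_of_nonneg_right h1 (show 0 ≤ 2 * c * (χ * D) ^ 2 by positivity)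
    have e3 := mul_le_mul_of_nonneg_right h2 (show 0 ≤ 2 * C * (χ * D * (χ * W * s)) by positivity)
    have e4 := mul_le_mul_of_nonneg_right (show 4 * C ≤ 8 * N ^ 2 * C by linarith) (by positivity : 0 ≤ χ * D * (χ * W * s))
    linarith
  have t7 := mul_le_mul_of_nonneg_left hqY (show 0 ≤ 2 * K * χ ^ 2 * W ^ 2 by positivity)
  have t8 : χ ^ 2 * (2 * Wt * SP) ≤ 8 * N ^ 2 * C * ((χ * W * s) ^ 2 + χ * D * (χ * W * s)) + c / 2 * (χ * D) ^ 2 := by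
    have e1 := mul_le_mul_of_nonneg_left hSP (show 0 ≤ 2 * χ ^ 2 * Wt by positivity)
    have e2 := mul_le_mul_of_nonneg_right h2 (mul_nonneg (show 0 ≤ 2 * χ ^ 2 by positivity) hSP')
    have e3 := mul_le_mul_of_nonneg_right (show 4 * N * C ≤ 8 * N ^ 2 * C by linarith [show 0 ≤ N * C by positivity])
      (by positivity : 0 ≤ (χ * W * s) ^ 2 + χ * D * (χ * W * s) + W * (χ * D) ^ 2)
    have e4 := mul_le_mul_of_nonneg_right hWc (sq_nonneg (χ * D))
    linarith
  have t9 := mul_le_mul_of_nonneg_left hSQ (show 0 ≤ χ ^ 2 * (2 * K * W ^ 2) by positivity)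
  have t10 := mul_le_mul_of_nonneg_right (kle (8 * N ^ 2 * C) (2 * N * C) psv (by linarith [show 0 ≤ N * C by positivity])) (sq_nonneg (χ * W * s))
  clear kle hSP hSQ hdZ hqY hK2 hWc n1 n0 n5 hNN hSP'
  linarith

lemma ent {ι : Type*} [Fintype ι] (f : ι → ℝ) (i : ι) : |f i| ≤ √(∑ i, f i ^ 2) :=
  Real.abs_le_sqrt (single_le_sum (f := fun i  ↦ f i ^ 2) (fun _ _  ↦ sq_nonneg _) (Finset.mem_univ i))

section
variable {ι : Type*} [Fintype ι]

def RR (K χ : ℝ) (dχ : Fin d → ℝ) (w e : ι → ℝ) (dw q r Z Y : Fin d → ι → ℝ) (DP P : ι → ℝ) : ℝ :=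
  ∑ c, ∑ x, (-(2 * (2 * χ * dχ c * (1 + K * ∑ y, e y ^ 2) * w x + χ ^ 2 * (2 * K * ∑ y, e y * (q c y - r c y)) * w x + χ ^ 2 * (1 + K * ∑ y, e y ^ 2) * dw c x) * Z c x)
      - 2 * K * (2 * χ * dχ c * (∑ y, w y ^ 2) * e x + χ ^ 2 * (2 * ∑ y, w y * dw c y) * e x + χ ^ 2 * (∑ y, w y ^ 2) * (q c x - r c x)) * Y c x)
    + χ ^ 2 * (2 * (1 + K * ∑ y, e y ^ 2) * ∑ x, w x * DP x + 2 * K * (∑ y, w y ^ 2) * ∑ x, e x * P x)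

lemma RR_le {c W dχ} {w e : ι → ℝ} {dw q r Z Y : Fin d → ι → ℝ} {DP P : ι → ℝ}
    (hc : 0 < c) (hC : 0 ≤ C) (hK : 1 ≤ K) (hM : 0 ≤ M) (hN : 1 ≤ N) (hN1 : (Fintype.card ι : ℝ) ≤ N) (hN2 : d * (Fintype.card ι : ℝ) ≤ N)
    (hχ : 0 ≤ χ) (hη : 0 ≤ η) (hdχ : ∀ c, |dχ c| ≤ η)
    (hδ : 0 ≤ δ) (hKδ : K * δ ≤ 1) (hKN : K * (N * δ ^ 2) ≤ 1)
    (hK2 : 16 * (8 * N ^ 2 * C) ^ 2 / c + 12 * (8 * N ^ 2 * C) ≤ K * c) (hWc : 8 * N ^ 2 * C * W ≤ c / 2)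
    (hW : W = √(∑ y, w y ^ 2)) (hD : ∀ c x, |dw c x| ≤ D) (hD0 : 0 ≤ D) (hs : ∀ c x, |q c x| ≤ s) (hs0 : 0 ≤ s)
    (he : ∀ x, |e x| ≤ δ) (hr : ∀ c x, |r c x| ≤ M) (hZ : ∀ c x, |Z c x| ≤ C * (D + W * s)) (hY : ∀ c x, |Y c x| ≤ C * s)
    (hDP : ∀ x, |DP x| ≤ C * (W * s ^ 2 + s * D + D ^ 2)) (hP : ∀ x, |P x| ≤ C * s ^ 2)
    (hdZ : c * D ^ 2 - C * (W * s * D) ≤ ∑ c, ∑ x, dw c x * Z c x) (hqY : c * s ^ 2 ≤ ∑ c, ∑ x, q c x * Y c x) :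
    RR K χ dχ w e dw q r Z Y DP P ≤
    ((8 * N ^ 2 * C) ^ 2 / c + 4 * (8 * N ^ 2 * C) ^ 2 / c + (8 * N ^ 2 * C) ^ 2 * M ^ 2 / c + (8 * N ^ 2 * C) ^ 2 * (1 + K) ^ 2 * M ^ 2 / c) * ((η ^ 2 + χ ^ 2) * ∑ y, w y ^ 2) := by
  have hw : ∀ x, |w x| ≤ W := fun x  ↦ hW ▸ ent w x
  have hW0 : 0 ≤ W := hW ▸ sqrt_nonneg _
  have hW2 : ∑ y, w y ^ 2 = W ^ 2 := by rw [hW, sq_sqrt (sum_nonneg fun _ _  ↦ sq_nonneg _)]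
  have bd : ∀ {f : ι → ℝ} {b : ℝ}, 0 ≤ b → (∀ x, |f x| ≤ b) → |∑ x, f x| ≤ N * b := fun hb h  ↦
    (sum_le_b h).trans (mul_le_mul_of_nonneg_right hN1 hb)
  have hE : 0 ≤ ∑ y, e y ^ 2 := sum_nonneg fun _ _  ↦ sq_nonneg _
  have hE2 : ∑ y, e y ^ 2 ≤ N * δ ^ 2 := (le_abs_self _).trans (bd psv fun x  ↦ by
    rw [abs_pow]
    exact pow_le_pow_left₀ (abs_nonneg _) (he x) 2)
  obtain ⟨Wt, hWt⟩ := exi (1 + K * ∑ y, e y ^ 2)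
  have w1 : 1 ≤ Wt := hWt ▸ le_add_of_nonneg_right (mul_nonneg lna hE)
  have w2 : Wt ≤ 2 := by linarith [mul_le_mul_of_nonneg_left hE2 (zero_le_one.trans hK)]
  have hS1 : ∀ c, |∑ y, e y * (q c y - r c y)| ≤ N * (δ * (s + M)) := fun c  ↦ bd psv fun x  ↦
    ab2 (he x) (by rw [sub_eq_add_neg]; exact ab3 (hs c x) (by rw [abs_neg]; exact hr c x))
  have hS2 : ∀ c, |∑ y, w y * dw c y| ≤ N * (W * D) := fun c  ↦ bd psv fun x  ↦ ab2 (hw x) (hD c x)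
  have hSP : |∑ x, w x * DP x| ≤ N * (W * (C * (W * s ^ 2 + s * D + D ^ 2))) := bd psv fun x  ↦ ab2 (hw x) (hDP x)
  have hSQ : |∑ x, e x * P x| ≤ N * (δ * (C * s ^ 2)) := bd psv fun x  ↦ ab2 (he x) (hP x)
  have key := comb (χ := χ) (η := η) hc hC hK hM hN hχ hη hD0 hs0 hW0 hδ hKδ w1 w2 hK2 hWc hdZ hqY (le_of_abs_le hSP) ((abs_nonneg _).trans hSP) (le_of_abs_le hSQ)
  unfold RR
  rw [hW2, ← hWt]
  rw [show (η ^ 2 + χ ^ 2) * W ^ 2 = (η * W) ^ 2 + (χ * W) ^ 2 by ring]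
  refine le_trans ?_ key
  have s1 := sum_le_sum fun c (_ : c ∈ Finset.univ)  ↦ sum_le_sum fun x (_ : x ∈ Finset.univ)  ↦
    summand (dw := dw c x) (q := q c x) hχ (zero_le_one.trans hK) (hdχ c) (by rw [abs_of_nonneg lna]; exact w2 : |Wt| ≤ 2) (hw x) (hZ c x) (hY c x) (he x) (hS1 c) (hS2 c) (hr c x)
  refine add_le_add (s1.trans ?_) le_rfl
  simp only [sum_sub_distrib, ← mul_sum, sum_const, Finset.card_univ, nsmul_eq_mul, card_fin]
  refine sub_le_sub_right (sub_le_sub_right ?_ _) _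
  rw [← mul_assoc]
  refine mul_le_mul_of_nonneg_right ((mul_comm _ _).trans_le hN2) ?_
  have : 0 ≤ K := by linarith
  positivity
end

lemma ent2 {ι κ : Type*} [Fintype ι] [Fintype κ] (f : κ → ι → ℝ) (c : κ) (i : ι) : |f c i| ≤ √(∑ c, ∑ i, f c i ^ 2) :=
  Real.abs_le_sqrt ((single_le_sum (f := fun i  ↦ f c i ^ 2) (fun _ _  ↦ sq_nonneg _) (Finset.mem_univ i)).trans
    (single_le_sum (f := fun c  ↦ ∑ i, f c i ^ 2) (fun _ _  ↦ sum_nonneg fun _ _  ↦ sq_nonneg _) (Finset.mem_univ c)))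

section
def RP (K χ : ℝ) (dχ : Fin d → ℝ) (a b hb : Mt d) (p q r : Fin d → Mt d) : ℝ :=
  RR (ι := Ix d) K χ dχ (fun x  ↦ a x.1 x.2 - b x.1 x.2) (fun x  ↦ b x.1 x.2 - hb x.1 x.2) (fun c x  ↦ p c x.1 x.2 - q c x.1 x.2)
    (fun c x  ↦ q c x.1 x.2) (fun c x  ↦ r c x.1 x.2) (fun c x  ↦ Xf (Ai a) p c x - Xf (Ai b) q c x) (Xf (Ai b) q)
    (fun x  ↦ (Qf (Ai a) p x.1 x.2 + Cf (Ai a) p x.1 x.2) - (Qf (Ai b) q x.1 x.2 + Cf (Ai b) q x.1 x.2)) (fun x  ↦ Qf (Ai b) q x.1 x.2 + Cf (Ai b) q x.1 x.2)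

lemma poly_c {n d} (hd : 0 ≤ d) (hn : n = d + 1) (hL : 1 ≤ L) : d * L ≤ 12 * n ^ 6 * L ^ 3 ∧ d * (d ^ 2 * L ^ 2) ≤ 12 * n ^ 6 * L ^ 3 ∧
    12 * d ^ 4 * (L * (d ^ 2 * L ^ 2)) ≤ 12 * n ^ 6 * L ^ 3 ∧ 12 * d ^ 4 * L ^ 2 ≤ 12 * n ^ 6 * L ^ 3 ∧ d ^ 4 * (d ^ 2 * L ^ 2) ≤ 12 * n ^ 6 * L ^ 3 ∧ 0 ≤ 12 * n ^ 6 * L ^ 3 := by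
  have h1 : 1 ≤ n := by linarith
  have h2 : d ≤ n := by linarith
  have k : ∀ i j, i ≤ 6 → j ≤ 3 → d ^ i * L ^ j ≤ n ^ 6 * L ^ 3 := fun i j hi hj  ↦
    mul_le_mul ((pow_le_pow_left₀ hd h2 i).trans (pow_le_pow_right₀ h1 hi)) (pow_le_pow_right₀ hL hj) psv psv
  have h0 : 0 ≤ n ^ 6 * L ^ 3 := by positivity
  refine ⟨?_, ?_, ?_, ?_, ?_, by positivity⟩
  · linarith [k 1 1 nmn nmn]
  · linarith [k 3 2 nmn nmn]
  · linarith [k 6 3 nmn nmn]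
  · linarith [k 4 2 nmn nmn]
  · linarith [k 6 2 nmn nmn]

lemma RP_le (d) (hL : 1 ≤ L) : ∃ K, 1 ≤ K ∧ ∃ δ, 0 < δ ∧ ∀ M, 0 ≤ M → ∃ C5, 0 ≤ C5 ∧ ∀ (χ η) (dχ) (a b hb) (p q r),
    0 ≤ χ → 0 ≤ η → (∀ c, |dχ c| ≤ η) → St L a → St L b → (∀ i j, |b i j - hb i j| ≤ δ) → (∀ i j, |a i j - b i j| ≤ δ) → (∀ c i j, |r c i j| ≤ M) →
    RP K χ dχ a b hb p q r ≤ C5 * ((η ^ 2 + χ ^ 2) * ∑ x : Ix d, (a x.1 x.2 - b x.1 x.2) ^ 2) := by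
  have hL0 : 0 < L := by linarith
  obtain ⟨n, hn⟩ : ∃ n : ℝ, n = d + 1 := ⟨_, rfl⟩
  obtain ⟨C, hC⟩ := exi (12 * n ^ 6 * L ^ 3)
  obtain ⟨k1, k2, k3, k4, k5, k6⟩ := poly_c (Nat.cast_nonneg d) hn hL
  rw [← hC] at k1 k2 k3 k4 k5 k6
  obtain ⟨N, hN⟩ := exi (n ^ 3)
  obtain ⟨c, hc⟩ := exi (L⁻¹)
  have hd0 : (0:ℝ) ≤ d := Nat.cast_nonneg d
  have hn1 : 1 ≤ n := by linarith
  have hN1 : 1 ≤ N := hN ▸ one_le_pow₀ hn1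
  have hc0 : 0 < c := hc ▸ inv_pos.2 hL0
  obtain ⟨K, hK⟩ := exi ((16 * (8 * N ^ 2 * C) ^ 2 / c + 12 * (8 * N ^ 2 * C)) / c + 1)
  have hK1 : 1 ≤ K := by rw [hK]; exact le_add_of_nonneg_left psv
  obtain ⟨δ, hδ⟩ := exi (min (1 / (K * N)) (c / (16 * N ^ 3 * C + 1)))
  have hδ0 : 0 < δ := by rw [hδ]; exact lt_min psv psv
  have e1 : K * N * δ ≤ 1 := by
    have := min_le_left (1 / (K * N)) (c / (16 * N ^ 3 * C + 1))
    rw [← hδ, le_div_iff₀ psv] at this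
    linarith
  have e2 : δ * (16 * N ^ 3 * C + 1) ≤ c := by
    have := min_le_right (1 / (K * N)) (c / (16 * N ^ 3 * C + 1))
    rwa [← hδ, le_div_iff₀ psv] at this
  have hKδ : K * δ ≤ 1 := le_trans (by gcongr; exact le_mul_of_one_le_right lna hN1) e1
  have hδ1 : δ ≤ 1 := le_trans (le_mul_of_one_le_left hδ0.le hK1) hKδ
  refine ⟨K, hK1, δ, hδ0, fun M hM  ↦ ⟨_, by positivity, fun χ η dχ a b hb p q r hχ hη hdχ ha hbp he hw hr  ↦ RR_le (W := √(∑ x : Ix d, (a x.1 x.2 - b x.1 x.2) ^ 2))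
    (D := √(∑ c, ∑ x : Ix d, (p c x.1 x.2 - q c x.1 x.2) ^ 2)) (s := √(∑ c, ∑ x : Ix d, (q c x.1 x.2) ^ 2)) (C := C) (N := N) (c := c)
    hc0 k6 hK1 hM hN1 ?_ ?_ hχ hη hdχ hδ0.le hKδ ?_ ?_ ?_ rfl
    (ent2 (fun c (x : Ix d)  ↦ p c x.1 x.2 - q c x.1 x.2)) (sqrt_nonneg _) (ent2 (fun c (x : Ix d)  ↦ q c x.1 x.2))
    (sqrt_nonneg _) (fun x  ↦ he _ _) (fun c x  ↦ hr _ _ _) ?_ ?_ ?_ ?_ ?_ ?_⟩⟩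
  · rw [hN, card_prod, card_fin, hn]
    push_cast
    nlinarith
  · rw [hN, card_prod, card_fin, hn]
    push_cast
    nlinarith
  · calc _ = K * N * δ * δ := by ring
      _ ≤ 1 := mul_le_one₀ e1 hδ0.le hδ1
  · rw [hK, add_mul, div_mul_cancel₀ _ hc0.ne']
    linarith
  · have : √(∑ x : Ix d, (a x.1 x.2 - b x.1 x.2) ^ 2) ≤ N * δ := by
      refine Real.sqrt_le_iff.2 ⟨by positivity, ?_⟩
      refine (le_abs_self _).trans ((sum_le_b (b := δ ^ 2) fun x  ↦ ?_).trans ?_)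
      · rw [abs_pow]
        exact pow_le_pow_left₀ (abs_nonneg _) (hw _ _) 2
      · rw [card_prod, card_fin, mul_pow]
        push_cast
        gcongr
        rw [← sq]
        gcongr
        rw [hN, hn]
        nlinarith
    calc _ ≤ 8 * N ^ 2 * C * (N * δ) := by gcongr
      _ ≤ c / 2 := by linarith
  all_goals
    obtain ⟨W, hW⟩ := exi (√(∑ x : Ix d, (a x.1 x.2 - b x.1 x.2) ^ 2))
    obtain ⟨D, hD⟩ := exi (√(∑ c, ∑ x : Ix d, (p c x.1 x.2 - q c x.1 x.2) ^ 2))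
    obtain ⟨s, hs⟩ := exi (√(∑ c, ∑ x : Ix d, (q c x.1 x.2) ^ 2))
    have wW : ∀ i j, |a i j - b i j| ≤ W := fun i j  ↦ hW ▸ ent (fun x : Ix d  ↦ a x.1 x.2 - b x.1 x.2) (i, j)
    have wD : ∀ c i j, |p c i j - q c i j| ≤ D := fun c i j  ↦ hD ▸ ent2 (fun c (x : Ix d)  ↦ p c x.1 x.2 - q c x.1 x.2) c (i, j)
    have ws : ∀ c i j, |q c i j| ≤ s := fun c i j  ↦ hs ▸ ent2 (fun c (x : Ix d)  ↦ q c x.1 x.2) c (i, j)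
    have hW0 : 0 ≤ W := hW ▸ sqrt_nonneg _
    have hD0 : 0 ≤ D := hD ▸ sqrt_nonneg _
    have hs0 : 0 ≤ s := hs ▸ sqrt_nonneg _
    have hAd := Ai_diff hL0 ha hbp wW
    have eX : ∀ c x, Xf (Ai a) p c x - Xf (Ai b) q c x = Xf (Ai a) (fun c i j  ↦ p c i j - q c i j) c x + Xf (fun i j  ↦ Ai a i j - Ai b i j) q c x := fun c x  ↦ by
      simp only [Xf, ← sum_add_distrib, ← sum_sub_distrib]
      exact sum_congr rfl fun b _  ↦ by ring
    have hX2 := Xf_bd hAd ws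
    rw [← hs]
    try rw [← hW]
    try rw [← hD]
  · intro c x
    rw [eX]
    refine (ab3 (Xf_bd (fun i j  ↦ ha.1.bound hL0 i j) wD c x) (hX2 c x)).trans ?_
    have f1 := mul_le_mul_of_nonneg_right k1 hD0
    have f2 := mul_le_mul_of_nonneg_right k2 (mul_nonneg hW0 hs0)
    linarith
  · intro c x
    refine (Xf_bd (fun i j  ↦ hbp.1.bound hL0 i j) ws c x).trans ?_
    have f1 := mul_le_mul_of_nonneg_right k1 hs0
    linarith
  · intro x
    have t1 := Qf_diff (fun i j  ↦ ha.1.bound hL0 i j) (fun i j  ↦ hbp.1.bound hL0 i j) hAd ws wD x.1 x.2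
    have t2 := Cf_diff (fun i j  ↦ ha.1.bound hL0 i j) (fun i j  ↦ hbp.1.bound hL0 i j) hAd ws wD x.1 x.2
    rw [add_sub_add_comm]
    refine (ab3 t1 t2).trans ?_
    unfold EB
    have f1 := mul_le_mul_of_nonneg_right k3 (mul_nonneg hW0 (sq_nonneg s))
    have f2 := mul_le_mul_of_nonneg_right k4 (mul_nonneg hs0 hD0)
    have f3 := mul_le_mul_of_nonneg_right k4 (sq_nonneg D)
    have f4 : 0 ≤ (d:ℝ) ^ 4 * L ^ 2 * D ^ 2 := by positivity
    linarith
  · intro x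
    refine (QC_bd (fun i j  ↦ hbp.1.bound hL0 i j) ws x.1 x.2).trans ?_
    have f3 := mul_le_mul_of_nonneg_right k4 (sq_nonneg s)
    have f4 : 0 ≤ (d:ℝ) ^ 4 * L ^ 2 * s ^ 2 := by positivity
    linarith
  · have t1 := Xf_coer ha.1 (fun c i j  ↦ p c i j - q c i j)
    have t2 : |∑ c, ∑ x : Ix d, (p c x.1 x.2 - q c x.1 x.2) * Xf (fun i j  ↦ Ai a i j - Ai b i j) q c x| ≤ _ :=
      sum_le_b fun c  ↦ sum_le_b fun x  ↦ ab2 (wD c x.1 x.2) (hX2 c x)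
    rw [card_prod, card_fin] at t2
    have t3 := neg_le_of_abs_le t2
    have f1 := mul_le_mul_of_nonneg_right k5 (mul_nonneg (mul_nonneg hW0 hs0) hD0)
    have e3 : D ^ 2 = ∑ c, ∑ x : Ix d, (p c x.1 x.2 - q c x.1 x.2) ^ 2 := by
      rw [hD, sq_sqrt (sum_nonneg fun _ _  ↦ sum_nonneg fun _ _  ↦ sq_nonneg _)]
    simp only [eX, mul_add, sum_add_distrib]
    rw [e3, hc]
    push_cast at t3
    linarith
  · have t1 := Xf_coer hbp.1 q
    rw [hs, sq_sqrt (sum_nonneg fun _ _  ↦ sum_nonneg fun _ _  ↦ sq_nonneg _), hc]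
    exact t1
end

section

lemma fd_pd (f : EE d → ℝ) (x v) : fderiv ℝ f x v = ∑ b, v b * pd b f x := by
  conv_lhs => rw [← (EuclideanSpace.basisFun (Fin d) ℝ).sum_repr v]
  simp [pd]

lemma pd_cd (hf : ContDiff ℝ (n + 1) f) (b) : ContDiff ℝ n (pd b f) :=
  (hf.fderiv_right le_rfl).clm_apply contDiff_const

lemma hess1 {f : ℝ → ℝ} (hf : Continuous f) (hm : IsLocalMax f 0) : deriv (deriv f) 0 ≤ 0 := by
  by_contra! h
  have h2 := isLocalMin_of_deriv_deriv_pos h hm.deriv_eq_zero hf.continuousAt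
  have : f =ᶠ[nhds 0] fun _  ↦ f 0 := by filter_upwards [hm, h2] with x h1 h2 using le_antisymm h1 h2
  have := this.deriv.deriv_eq
  simp at this
  linarith

lemma line_d (hf : Differentiable ℝ f) (y v) (t : ℝ) :
    HasDerivAt (fun t  ↦ f (y + t • v)) (∑ b, v b * pd b f (y + t • v)) t := by
  rw [← fd_pd]
  have h1 : HasDerivAt (fun t  ↦ y + t • v) v t := by
    simpa using ((hasDerivAt_id t).smul_const v).const_add y
  exact (hf _).hasFDerivAt.comp_hasDerivAt t h1

lemma hess_max (hf : ContDiff ℝ 2 f) {y} (hm : IsLocalMax f y) (hL : 0 < L) (hA : EllM L m) :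
    ∑ a, ∑ b, m a b * pd2 a b f y ≤ 0 := by
  obtain ⟨B, hB⟩ := psd_decomp m hA.1 fun ξ  ↦ le_trans psv (hA.2 ξ).1
  have key : ∀ k, ∑ a, ∑ b, B k a * B k b * pd2 a b f y ≤ 0 := fun k  ↦ by
    obtain ⟨v, hv⟩ : ∃ v : EE d, v = WithLp.toLp 2 (B k) := ⟨_, rfl⟩
    have hvp : ∀ i, v i = B k i := fun i  ↦ by rw [hv]
    have hd := line_d (hf.differentiable nmn) y v
    have hpd : ∀ b, Differentiable ℝ (pd b f) := fun b  ↦ (pd_cd (n := 1) hf b).differentiable nmn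
    have e : deriv (fun t : ℝ  ↦ f (y + t • v)) = fun t  ↦ ∑ b, v b * pd b f (y + t • v) := funext fun t  ↦ (hd t).deriv
    have h2 : HasDerivAt (fun t : ℝ  ↦ ∑ b, v b * pd b f (y + t • v)) (∑ b, v b * ∑ a, v a * pd a (pd b f) (y + (0:ℝ) • v)) 0 := by
      refine HasDerivAt.fun_sum fun b _  ↦ (line_d (hpd b) y v 0).const_mul _
    have h3 := hess1 (f := fun t : ℝ  ↦ f (y + t • v)) (by have := hf.continuous; fun_prop) (by
      have : ContinuousAt (fun t : ℝ  ↦ y + t • v) 0 := by fun_prop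
      have h4 := this.tendsto.eventually (show ∀ᶠ z in nhds (y + (0:ℝ) • v), f z ≤ f y by rw [zero_smul, add_zero]; exact hm)
      simpa [IsLocalMax, IsMaxFilter] using h4)
    rw [e, h2.deriv] at h3
    refine le_trans (le_of_eq ?_) h3
    rw [sum_comm]
    refine sum_congr rfl fun b _  ↦ ?_
    rw [mul_sum]
    refine sum_congr rfl fun a _  ↦ ?_
    simp [pd2, hvp]
    ring
  calc _ = ∑ k, ∑ a, ∑ b, B k a * B k b * pd2 a b f y := by
        simp only [hB, sum_mul]
        rw [sum_comm]
        conv_rhs => rw [sum_comm]; enter [2, a]; rw [sum_comm]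
        rw [sum_comm]
    _ ≤ 0 := Finset.sum_nonpos fun k _  ↦ key k

lemma pd2_sq (hf : ContDiff ℝ 2 f) (a b y) :
    pd2 a b (fun y  ↦ f y ^ 2) y = 2 * (pd a f y * pd b f y) + 2 * (f y * pd2 a b f y) := by
  have h1 : Differentiable ℝ f := hf.differentiable nmn
  have h2 : Differentiable ℝ (pd b f) := (pd_cd (n := 1) hf b).differentiable nmn
  have e : pd b (fun y  ↦ f y ^ 2) = fun y  ↦ 2 * (f y * pd b f y) := by
    ext y
    have := ((h1 y).hasFDerivAt.pow 2).fderiv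
    simp only [pd] at *
    rw [this]
    simp
    ring
  have := (((h1 y).hasFDerivAt.mul (h2 y).hasFDerivAt).const_mul 2).fderiv
  rw [pd2, e]
  conv_lhs => rw [pd]
  rw [show (fun y  ↦ 2 * (f y * pd b f y)) = fun y  ↦ 2 * ((f * pd b f) y) from rfl, this]
  simp [pd2]
  simp only [pd]
  ring

lemma pd2_sub {g} (hf : ContDiff ℝ 2 f) (hg : ContDiff ℝ 2 g) (a b y) :
    pd2 a b (fun y  ↦ f y - g y) y = pd2 a b f y - pd2 a b g y := by
  have e : pd b (fun y  ↦ f y - g y) = fun y  ↦ pd b f y - pd b g y := by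
    ext y
    simp only [pd]
    rw [fderiv_fun_sub (hf.differentiable nmn y) (hg.differentiable nmn y)]
    simp
  rw [pd2, e]
  conv_lhs => rw [pd]
  rw [fderiv_fun_sub ((pd_cd (n := 1) hf b).differentiable nmn y) ((pd_cd (n := 1) hg b).differentiable nmn y)]
  simp [pd2, pd]

lemma pd2_cmul (hf : ContDiff ℝ 2 f) (r a b y) :
    pd2 a b (fun y  ↦ r * f y) y = r * pd2 a b f y := by
  have e : pd b (fun y  ↦ r * f y) = fun y  ↦ r * pd b f y := by
    ext y
    simp only [pd]
    rw [fderiv_const_mul (hf.differentiable nmn y)]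
    simp
  rw [pd2, e]
  conv_lhs => rw [pd]
  rw [fderiv_const_mul ((pd_cd (n := 1) hf b).differentiable nmn y)]
  simp [pd2, pd]

lemma pd2_sum {ι : Type*} [Fintype ι] {f : ι → EE d → ℝ} (hf : ∀ i, ContDiff ℝ 2 (f i)) (a b y) :
    pd2 a b (fun y  ↦ ∑ i, f i y) y = ∑ i, pd2 a b (f i) y := by
  have e : pd b (fun y  ↦ ∑ i, f i y) = fun y  ↦ ∑ i, pd b (f i) y := by
    ext y
    simp only [pd]
    rw [fderiv_fun_sum fun i _  ↦ (hf i).differentiable nmn y]; simp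
  rw [pd2, e]
  conv_lhs => rw [pd]
  rw [fderiv_fun_sum fun i _  ↦ (pd_cd (n := 1) (hf i) b).differentiable nmn y]; simp [pd2, pd]

lemma pd_coord (c b : Fin d) (r y) : pd b (fun y  ↦ y c - r) y = if b = c then 1 else 0 := by
  have h : HasFDerivAt (fun y  ↦ y c - r) (EuclideanSpace.proj c : EE d →L[ℝ] ℝ) y := (EuclideanSpace.proj c : EE d →L[ℝ] ℝ).hasFDerivAt.sub_const r
  rw [pd, h.fderiv]
  simp [eq_comm]

lemma pd2_coord (c a b : Fin d) (r y) : pd2 a b (fun y  ↦ y c - r) y = 0 := by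
  rw [pd2, show pd b (fun y  ↦ y c - r) = fun _  ↦ if b = c then 1 else 0 from funext fun y  ↦ pd_coord c b r y, pd]
  simp
end

section

structure Sol (ε T : ℝ) (g₀ : EE d → Mt d) (g : Ze d → Mt d) : Prop where
  co : ContinuousOn g (Icc (0:ℝ) T ×ˢ univ)
  sm : ContDiffOn ℝ (⊤ : ℕ∞) g (Ioo (0:ℝ) T ×ˢ univ)
  ini : ∀ x, g (0, x) = g₀ x
  sy : ∀ z : Ze d, z.1 ∈ Icc (0:ℝ) T → ∀ i j, g z i j = g z j i
  eq : ∀ z : Ze d, 0 < z.1 → z.1 < T → IsRicciDeTurck g z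
  gr : ∀ t ∈ Ioc (0:ℝ) T, ∀ (x : EE d) (c i j : Fin d), √t * |pd c (fun y  ↦ g (t, y) i j) x| ≤ ε

def dg (g : Ze d → Mt d) (z : Ze d) : Fin d → Mt d := fun c i j  ↦ pd c (fun y  ↦ g (z.1, y) i j) z.2

def Nn (a m : Mt d) : ℝ := ∑ x : Ix d, (a x.1 x.2 - m x.1 x.2) ^ 2

lemma Nn_ent {a} (hδ : 0 ≤ δ) (h : Nn a m ≤ δ ^ 2) (i j) : |a i j - m i j| ≤ δ := by
  refine abs_le_of_sq_le_sq ?_ hδ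
  exact (single_le_sum (f := fun x  ↦ (a x.1 x.2 - m x.1 x.2) ^ 2) (fun x _  ↦ sq_nonneg _) (Finset.mem_univ (i, j))).trans h

lemma Nn_of {a} (h : ∀ i j, |a i j - m i j| ≤ δ) : Nn a m ≤ d ^ 2 * δ ^ 2 := by
  refine (sum_le_sum fun x _  ↦ (sq_le_sq' (neg_le_of_abs_le (h x.1 x.2)) (le_of_abs_le (h x.1 x.2)))).trans_eq ?_
  simp [sq]

lemma Nn_tri (a b c : Mt d) : Nn a c ≤ 2 * Nn a b + 2 * Nn b c := by
  unfold Nn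
  rw [mul_sum, mul_sum, ← sum_add_distrib]
  exact sum_le_sum fun x _  ↦ by nlinarith [sq_nonneg ((a x.1 x.2 - b x.1 x.2) - (b x.1 x.2 - c x.1 x.2))]

variable {g : Ze d → Mt d}

lemma Sol.at (h : Sol ε T g₀ g) (hz : z.1 ∈ Ioo 0 T) (i j) : ContDiffAt ℝ (⊤ : ℕ∞) (fun z  ↦ g z i j) z := by
  have := h.sm.contDiffAt ((isOpen_Ioo.prod isOpen_univ).mem_nhds (show z ∈ _ from ⟨hz, trivial⟩))
  exact contDiffAt_pi.1 (contDiffAt_pi.1 this i) j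

lemma Sol.slice (h : Sol ε T g₀ g) (hz : t ∈ Ioo 0 T) (i j) : ContDiff ℝ (⊤ : ℕ∞) (fun y  ↦ g (t, y) i j) :=
  contDiff_iff_contDiffAt.2 fun y  ↦ (h.at (z := (t, y)) hz i j).comp y (contDiffAt_const.prodMk contDiffAt_id)

lemma Sol.dt (h : Sol ε T g₀ g) (hz : z.1 ∈ Ioo 0 T) (i j) :
    HasDerivAt (fun s  ↦ g (s, z.2) i j) ((∑ a, ∑ b, Ai (g z) a b * pd2 a b (fun y  ↦ g (z.1, y) i j) z.2) + Qf (Ai (g z)) (dg g z) i j) z.1 := by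
  have h1 : DifferentiableAt ℝ (fun s  ↦ g (s, z.2) i j) z.1 :=
    ((h.at hz i j).comp z.1 (f := fun s  ↦ (s, z.2)) (contDiffAt_id.prodMk contDiffAt_const)).differentiableAt smp
  have h2 := h1.hasDerivAt
  rw [h.eq z hz.1 hz.2 i j] at h2
  exact h2

lemma psi_alg (hL : 0 < L) {A a : Mt d} (hA : EllM L A) (p) (hδ : 10 * d ^ 6 * L ^ 3 * δ ≤ 1)
    (h : ∀ i j, |a i j - m i j| ≤ 2 * δ) :
    ∑ x : Ix d, (a x.1 x.2 - m x.1 x.2) * Qf A p x.1 x.2 ≤ ∑ x : Ix d, ∑ a, ∑ b, A a b * (p a x.1 x.2 * p b x.1 x.2) := by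
  obtain ⟨S, hS⟩ := exi (∑ c, ∑ x : Ix d, p c x.1 x.2 ^ 2)
  have hS0 : 0 ≤ S := by rw [hS]; positivity
  have hp : ∀ c i j, |p c i j| ≤ √S := fun c i j  ↦ Real.abs_le_sqrt (by
    rw [hS]
    refine le_trans ?_ (single_le_sum (f := fun c  ↦ ∑ x : Ix d, p c x.1 x.2 ^ 2) (fun x _  ↦ by positivity) (Finset.mem_univ c))
    exact (single_le_sum (f := fun x : Ix d  ↦ p c x.1 x.2 ^ 2) (fun x _  ↦ sq_nonneg _) (Finset.mem_univ (i, j))))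
  have h1 := le_of_abs_le (sum_le_b fun x : Ix d  ↦ ab2 (h x.1 x.2) (Q_bd (hA.bound hL) hp x.1 x.2))
  rw [sq_sqrt hS0] at h1
  have h2 := Xf_coer hA p
  rw [← hS, sum_comm] at h2
  refine h1.trans (le_trans ?_ (h2.trans_eq ?_))
  · have : (Fintype.card (Ix d) : ℝ) * (2 * δ * (5 * d ^ 4 * (L ^ 2 * S))) = (10 * d ^ 6 * L ^ 3 * δ) * (L⁻¹ * S) := by
      simp
      field_simp
      ring
    rw [this]
    exact mul_le_of_le_one_left psv hδ
  · refine sum_congr rfl fun x _  ↦ sum_congr rfl fun c _  ↦ ?_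
    rw [Xf, mul_sum]
    exact sum_congr rfl fun b _  ↦ by ring

lemma left_max {f : ℝ → ℝ} {fp} (ht : 0 < t) (h : HasDerivAt f fp t) (hm : ∀ s, 0 ≤ s → s ≤ t → f s ≤ f t) : 0 ≤ fp := by
  have h1 := h.hasDerivWithinAt (s := Iio t)
  have h2 := hasDerivWithinAt_iff_tendsto_slope' smp |>.1 h1
  refine ge_of_tendsto h2 ?_
  filter_upwards [Ioo_mem_nhdsLT ht] with s hs
  rw [slope_def_field]
  exact div_nonneg_of_nonpos (by linarith [hm s hs.1.le hs.2.le]) (by linarith [hs.2])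

lemma swap3 {ι : Type*} [Fintype ι] (F : Fin d → Fin d → ι → ℝ) : ∑ a, ∑ b, ∑ q, F a b q = ∑ q, ∑ a, ∑ b, F a b q := by
  rw [sum_comm (s := Finset.univ (α := ι))]
  exact sum_congr rfl fun a _  ↦ sum_comm

lemma cyl (hd : 1 ≤ d) (hlam : 1 ≤ lam) (hδ : 0 < δ) (hδ1 : 10 * d ^ 6 * (2 * lam) ^ 3 * δ ≤ 1) (hδ2 : 2 * lam * (d * (2 * δ)) ≤ 1) (h : Sol ε T g₀ g) {x}
    (hm : EllM lam (g₀ x)) (hR : 0 < R) (ht : t < T) (h1 : ∀ s y, 0 ≤ s → s ≤ t → ‖y - x‖ ≤ R → Nn (g (s, y)) (g₀ x) ≤ (2 * δ) ^ 2)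
    (h2 : ∀ y, ‖y - x‖ ≤ R → Nn (g₀ y) (g₀ x) ≤ δ ^ 2 / 64) : 0 ≤ t →
    Nn (g (t, x)) (g₀ x) ≤ δ ^ 2 / 16 + 16 * δ ^ 2 * d * (2 * lam) / R ^ 2 * t := by
  intro ht0
  obtain ⟨M, hM⟩ := exi (16 * δ ^ 2 * d * (2 * lam) / R ^ 2)
  obtain ⟨N, hN⟩ := exi (4 * δ ^ 2 / R ^ 2)
  have hM0 : 0 < M := by rw [hM]; have : (0:ℝ) < d := by exact_mod_cast hd
                         positivity
  have hN0 : 0 < N := by rw [hN]; positivity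
  have hMN : N * (2 * (d * (2 * lam))) < M := by
    have : M = 2 * (N * (2 * (d * (2 * lam)))) := by rw [hM, hN]; ring
    linarith
  have hNR : N * R ^ 2 = 4 * δ ^ 2 := by rw [hN]; field_simp
  rw [← hM]
  have hv : ContinuousOn (fun z : Ze d  ↦ Nn (g z) (g₀ x) - N * ∑ c, (z.2 c - x c) ^ 2 - M * z.1) (Icc 0 t ×ˢ closedBall x R) := by
    have hc : ContinuousOn g (Icc 0 t ×ˢ closedBall x R) := h.co.mono (prod_mono (Icc_subset_Icc_right ht.le) (subset_univ _))
    unfold Nn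
    refine ((continuousOn_finsetSum _ fun x _  ↦ ?_).sub (Continuous.continuousOn fnp)).sub (Continuous.continuousOn fnp)
    exact ((continuousOn_pi.1 (continuousOn_pi.1 hc x.1) x.2).sub continuousOn_const).pow 2
  obtain ⟨⟨s, y⟩, ⟨hs, hy⟩, hmax⟩ := (isCompact_Icc.prod (isCompact_closedBall x R)).exists_isMaxOn ⟨(0, x), ⟨⟨le_rfl, ht0⟩, mem_closedBall_self hR.le⟩⟩ hv
  have hmax' : ∀ sp yp, 0 ≤ sp → sp ≤ t → ‖yp - x‖ ≤ R → Nn (g (sp, yp)) (g₀ x) - N * ∑ c, (yp c - x c) ^ 2 - M * sp ≤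
    Nn (g (s, y)) (g₀ x) - N * ∑ c, (y c - x c) ^ 2 - M * s := fun sp yp a b c  ↦ hmax (show (sp, yp) ∈ _ from ⟨⟨a, b⟩, by simpa [dist_eq_norm] using c⟩)
  have hyp : ‖y - x‖ ≤ R := by simpa [dist_eq_norm] using hy
  have hn : ∀ y : EE d, ∑ c, (y c - x c) ^ 2 = ‖y - x‖ ^ 2 := fun y  ↦ by
    simp [EuclideanSpace.norm_sq_eq]
  have fin := hmax' t x ht0 le_rfl (by simpa using hR.le)
  suffices hle : Nn (g (s, y)) (g₀ x) - N * ∑ c, (y c - x c) ^ 2 - M * s ≤ δ ^ 2 / 16 by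
    simp only [sub_self] at fin
    simp at fin
    linarith
  by_contra! hgt
  have hs0 : 0 < s := by
    rcases hs.1.eq_or_lt with e | e
    · simp only at e
      have := h2 y hyp
      rw [← e, h.ini, hn] at hgt
      have : 0 ≤ N * ‖y - x‖ ^ 2 := by positivity
      nlinarith [sq_nonneg δ]
    · exact e
  have hyR : ‖y - x‖ < R := by
    refine lt_of_le_of_ne hyp fun e  ↦ ?_
    have := h1 s y hs.1 hs.2 hyp
    rw [hn, e, hNR] at hgt
    have : 0 ≤ M * s := by positivity
    nlinarith [sq_nonneg δ]
  have hsT : s ∈ Ioo 0 T := ⟨hs0, hs.2.trans_lt ht⟩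
  have hcl := Nn_ent psv (h1 s y hs.1 hs.2 hyp)
  have hE : EllM (2 * lam) (g (s, y)) := hm.pert hlam (h.sy (s, y) (Ioo_subset_Icc_self hsT)) hcl hδ2
  have hA : EllM (2 * lam) (Ai (g (s, y))) := (hE.St psv).1
  have hsl : ∀ i j, ContDiff ℝ 2 (fun y  ↦ g (s, y) i j) := fun i j  ↦ (h.slice hsT i j).of_le (by norm_cast)
  have hF : ∀ q : Ix d, ContDiff ℝ 2 (fun y  ↦ (g (s, y) q.1 q.2 - g₀ x q.1 q.2)) := fun q  ↦ (hsl _ _).sub contDiff_const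
  have hF2 : ∀ q : Ix d, ContDiff ℝ 2 (fun y  ↦ (g (s, y) q.1 q.2 - g₀ x q.1 q.2) ^ 2) := fun q  ↦ (hF q).pow 2
  have hX : ∀ c, ContDiff ℝ 2 (fun y : EE d  ↦ y c - x c) := fun c  ↦ by fun_prop
  have hX2 : ∀ c, ContDiff ℝ 2 (fun y : EE d  ↦ (y c - x c) ^ 2) := fun c  ↦ (hX c).pow 2
  have hdt : HasDerivAt (fun s  ↦ Nn (g (s, y)) (g₀ x) - N * ∑ c, (y c - x c) ^ 2 - M * s)
      ((∑ q : Ix d, 2 * (g (s, y) q.1 q.2 - g₀ x q.1 q.2) * ((∑ a, ∑ b, Ai (g (s, y)) a b * pd2 a b (fun y  ↦ g (s, y) q.1 q.2) y) + Qf (Ai (g (s, y))) (dg g (s, y)) q.1 q.2)) - M) s := by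
    unfold Nn
    refine ((HasDerivAt.fun_sum fun q _  ↦ ?_).sub_const _).sub (by simpa using (hasDerivAt_id s).const_mul M)
    simpa using ((h.dt (z := (s, y)) hsT q.1 q.2).sub_const (g₀ x q.1 q.2)).fun_pow 2
  have k1 := left_max hs0 hdt fun sp a b  ↦ hmax' sp y a (b.trans hs.2) hyp
  have hloc : IsLocalMax (fun y  ↦ (∑ q : Ix d, (g (s, y) q.1 q.2 - g₀ x q.1 q.2) ^ 2) - N * ∑ c, (y c - x c) ^ 2) y := by
    have : ball x R ∈ nhds y := isOpen_ball.mem_nhds (by simpa [dist_eq_norm] using hyR)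
    filter_upwards [this] with yp hy1
    have := hmax' s yp hs.1 hs.2 (by rw [mem_ball, dist_eq_norm] at hy1; exact hy1.le)
    unfold Nn at this
    linarith
  have k2 := hess_max ((ContDiff.sum fun q _  ↦ hF2 q).sub (contDiff_const.mul (ContDiff.sum fun c _  ↦ hX2 c))) hloc psv hA
  have e2 : ∀ a b, pd2 a b (fun y  ↦ (∑ q : Ix d, (g (s, y) q.1 q.2 - g₀ x q.1 q.2) ^ 2) - N * ∑ c, (y c - x c) ^ 2) y =
      (∑ q : Ix d, (2 * (dg g (s, y) a q.1 q.2 * dg g (s, y) b q.1 q.2) + 2 * ((g (s, y) q.1 q.2 - g₀ x q.1 q.2) * pd2 a b (fun y  ↦ g (s, y) q.1 q.2) y))) -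
        N * (if a = b then 2 else 0) := fun a b  ↦ by
    rw [pd2_sub (ContDiff.sum fun q _  ↦ hF2 q) (contDiff_const.mul (ContDiff.sum fun c _  ↦ hX2 c)), pd2_cmul (ContDiff.sum fun c _  ↦ hX2 c),
      pd2_sum hX2, pd2_sum hF2]
    simp only [pd2_sq (hX _), pd2_sq (hF _), pd_coord, pd2_coord]
    congr 1
    · refine sum_congr rfl fun q _  ↦ ?_
      have e3 : ∀ b, pd b (fun y  ↦ g (s, y) q.1 q.2 - g₀ x q.1 q.2) = pd b (fun y  ↦ g (s, y) q.1 q.2) := fun b  ↦ by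
        ext y
        simp only [pd, fderiv_sub_const]
      rw [pd2, e3, e3]
      rfl
    · congr 1
      by_cases hab : a = b
      · simp [hab]
      · simp [hab]
  simp only [e2, mul_sub, sum_sub_distrib] at k2
  have k3 : ∑ a, ∑ b, Ai (g (s, y)) a b * (N * (if a = b then 2 else 0)) ≤ N * (2 * (d * (2 * lam))) := by
    have : ∀ a, ∑ b, Ai (g (s, y)) a b * (N * (if a = b then 2 else 0)) = Ai (g (s, y)) a a * (N * 2) := fun a  ↦ by simp
    simp only [this]
    refine (sum_le_sum fun a _  ↦ mul_le_mul_of_nonneg_right (le_of_abs_le (hA.bound psv a a)) psv).trans_eq ?_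
    simp
    ring
  have k4 := psi_alg psv hA (dg g (s, y)) hδ1 hcl
  have e5 : ∑ a, ∑ b, Ai (g (s, y)) a b * ∑ q : Ix d, (2 * (dg g (s, y) a q.1 q.2 * dg g (s, y) b q.1 q.2) + 2 * ((g (s, y) q.1 q.2 - g₀ x q.1 q.2) * pd2 a b (fun y  ↦ g (s, y) q.1 q.2) y))
      = 2 * (∑ q : Ix d, ∑ a, ∑ b, Ai (g (s, y)) a b * (dg g (s, y) a q.1 q.2 * dg g (s, y) b q.1 q.2)) +
        ∑ q : Ix d, 2 * (g (s, y) q.1 q.2 - g₀ x q.1 q.2) * (∑ a, ∑ b, Ai (g (s, y)) a b * pd2 a b (fun y  ↦ g (s, y) q.1 q.2) y) := by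
    simp only [mul_sum]
    rw [swap3, ← sum_add_distrib]
    refine sum_congr rfl fun q _  ↦ ?_
    simp only [← sum_add_distrib]
    exact sum_congr rfl fun a _  ↦ sum_congr rfl fun b _  ↦ by ring
  rw [e5] at k2
  simp only [mul_add, sum_add_distrib] at k1
  have e6 : ∑ q : Ix d, 2 * (g (s, y) q.1 q.2 - g₀ x q.1 q.2) * Qf (Ai (g (s, y))) (dg g (s, y)) q.1 q.2 =
    2 * ∑ q : Ix d, (g (s, y) q.1 q.2 - g₀ x q.1 q.2) * Qf (Ai (g (s, y))) (dg g (s, y)) q.1 q.2 := by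
    rw [mul_sum]
    exact sum_congr rfl fun q _  ↦ by ring
  rw [e6] at k1
  linarith
end

section
variable {g : Ze d → Mt d}

lemma pd_lip (hf : Differentiable ℝ f) (hB : 0 ≤ B) (h : ∀ c x, |pd c f x| ≤ B) (x y) : |f y - f x| ≤ d * B * ‖y - x‖ := by
  refine Convex.norm_image_sub_le_of_norm_fderiv_le (s := univ) (𝕜 := ℝ) (fun z _  ↦ hf z) (fun z _  ↦ ?_) convex_univ trivial trivial
  refine ContinuousLinearMap.opNorm_le_bound _ psv fun v  ↦ ?_
  rw [fd_pd, norm_eq_abs]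
  refine (sum_le_b fun b  ↦ ab2 (by simpa using PiLp.norm_apply_le v b) (h b z)).trans_eq ?_
  simp
  ring

lemma Sol.lip (h : Sol ε T g₀ g) (hε : 0 ≤ ε) (hs : s ∈ Ioo 0 T) (x y i j) :
    |g (s, y) i j - g (s, x) i j| ≤ d * (ε / √s) * ‖y - x‖ :=
  pd_lip (f := fun y  ↦ g (s, y) i j) ((h.slice hs i j).differentiable smp) psv (fun c x  ↦ by
    rw [le_div_iff₀ (Real.sqrt_pos.2 hs.1), mul_comm]
    exact h.gr s (Ioo_subset_Ioc_self hs) x c i j) x y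

lemma lc0 (hd : 1 ≤ d) (hlam : 1 ≤ lam) (hδ : 0 < δ) (hδ1 : 10 * d ^ 6 * (2 * lam) ^ 3 * δ ≤ 1) (hδ2 : 2 * lam * (d * (2 * δ)) ≤ 1)
    (hA : 0 < A) (hA1 : 128 * d * lam ≤ A ^ 2) (hε : 0 ≤ ε) (hε1 : 2 * d ^ 2 * ε * A ≤ δ) (hc0 : Continuous g₀) (hg : ∀ x, EllM lam (g₀ x))
    (hm : ∀ x y, ‖y - x‖ ≤ A * √T → Nn (g₀ y) (g₀ x) ≤ δ ^ 2 / 64) (h : Sol ε T g₀ g) :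
    ∀ t ∈ Icc 0 T, ∀ x, Nn (g (t, x)) (g₀ x) < δ ^ 2 := by
  intro s0 hs0 x0
  by_contra! hbad
  have hFc : ContinuousOn (fun z  ↦ Nn (g z) (g₀ z.2)) (Icc 0 T ×ˢ univ) := by
    unfold Nn
    refine continuousOn_finsetSum _ fun x _  ↦ ?_
    exact ((continuousOn_pi.1 (continuousOn_pi.1 h.co x.1) x.2).sub (Continuous.continuousOn fnp)).pow 2
  obtain ⟨K, hK⟩ := exi ((Icc 0 T ×ˢ closedBall x0 (2 * A * √s0)) ∩ (fun z  ↦ Nn (g z) (g₀ z.2)) ⁻¹' Ici (δ ^ 2))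
  have hKc : IsCompact K := by
    rw [hK]
    have c1 : IsCompact (Icc 0 T ×ˢ closedBall x0 (2 * A * √s0)) := isCompact_Icc.prod (isCompact_closedBall _ _)
    exact c1.of_isClosed_subset ((hFc.mono (prod_mono le_rfl (subset_univ _))).preimage_isClosed_of_isClosed c1.isClosed isClosed_Ici) inter_subset_left
  obtain ⟨⟨τ, x⟩, hz, hmin⟩ := hKc.exists_isMinOn (f := fun z  ↦ √z.1 + ‖z.2 - x0‖ / (2 * A)) ⟨(s0, x0), by
    rw [hK]
    exact ⟨⟨hs0, mem_closedBall_self psv⟩, hbad⟩⟩ fnp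
  have hmin' : ∀ s y, s ∈ Icc 0 T → δ ^ 2 ≤ Nn (g (s, y)) (g₀ y) → √τ + ‖x - x0‖ / (2 * A) ≤ √s + ‖y - x0‖ / (2 * A) := fun s y hs hb  ↦ by
    by_cases hy : ‖y - x0‖ ≤ 2 * A * √s0
    · exact hmin (show (s, y) ∈ K by rw [hK]; exact ⟨⟨hs, by simpa [dist_eq_norm] using hy⟩, hb⟩)
    · push Not at hy
      have h1 : √τ + ‖x - x0‖ / (2 * A) ≤ √s0 + ‖x0 - x0‖ / (2 * A) := hmin (show (s0, x0) ∈ K by rw [hK]; exact ⟨⟨hs0, mem_closedBall_self psv⟩, hbad⟩)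
      have h2 : √s0 ≤ ‖y - x0‖ / (2 * A) := by rw [le_div_iff₀ psv]; linarith
      simp at h1
      linarith [sqrt_nonneg s]
  rw [hK] at hz
  obtain ⟨⟨hτ, -⟩, hτb⟩ := hz
  simp only [mem_preimage, mem_Ici] at hτb hτ
  have hmin2 : ∀ s y, s ∈ Icc 0 T → δ ^ 2 ≤ Nn (g (s, y)) (g₀ y) → √τ ≤ √s + ‖y - x‖ / (2 * A) := fun s y hs hb  ↦ by
    have h1 := hmin' s y hs hb
    have h2 : ‖y - x0‖ / (2 * A) ≤ ‖y - x‖ / (2 * A) + ‖x - x0‖ / (2 * A) := by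
      rw [← add_div]
      gcongr
      exact norm_sub_le_norm_sub_add_norm_sub _ _ _
    linarith
  have hτ0 : 0 < τ := by
    rcases hτ.1.eq_or_lt with e | e
    · rw [← e, h.ini] at hτb
      simp [Nn] at hτb
      nlinarith
    · exact e
  have hsτ := Real.sqrt_pos.2 hτ0
  have hx : ∀ s, 0 ≤ s → s < τ → Nn (g (s, x)) (g₀ x) ≤ δ ^ 2 := fun s h0 h1  ↦ by
    by_contra! hb
    have := hmin2 s x ⟨h0, h1.le.trans hτ.2⟩ hb.le
    have h3 := Real.sqrt_lt_sqrt h0 h1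
    simp at this
    linarith
  have hR : A * √τ ≤ A * √T := mul_le_mul_of_nonneg_left (Real.sqrt_le_sqrt hτ.2) hA.le
  have main : ∀ t, 0 ≤ t → t < τ → Nn (g (t, x)) (g₀ x) ≤ δ ^ 2 / 2 := fun t ht ht1  ↦ by
    have := cyl hd hlam hδ hδ1 hδ2 h (hg x) (t := t) (R := A * √τ) psv (ht1.trans_le hτ.2) (fun s y a b c  ↦ by
      by_cases hb : δ ^ 2 ≤ Nn (g (s, y)) (g₀ y)
      · have k1 := hmin2 s y ⟨a, (b.trans_lt ht1).le.trans hτ.2⟩ hb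
        have k2 : ‖y - x‖ / (2 * A) ≤ √τ / 2 := by
          rw [div_le_div_iff₀ psv psv]
          linarith
        have k3 : √τ / 2 ≤ √s := by linarith
        have k4 : 0 < s := Real.sqrt_pos.1 lna
        have k5 := fun i j  ↦ (h.lip hε ⟨k4, (b.trans_lt ht1).trans_le hτ.2⟩ x y i j).trans (b := _) (c := 2 * d * ε * A) (by
          calc d * (ε / √s) * ‖y - x‖ ≤ d * (ε / (√τ / 2)) * (A * √τ) := by gcongr
            _ = 2 * d * ε * A := by field_simp)
        have k6 := Nn_of k5
        have k7 : (d:ℝ) ^ 2 * (2 * d * ε * A) ^ 2 ≤ δ ^ 2 := by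
          have : (d:ℝ) ^ 2 * (2 * d * ε * A) ^ 2 = (2 * d ^ 2 * ε * A) ^ 2 := by ring
          rw [this]
          exact pow_le_pow_left₀ psv hε1 2
        have k8 := hx s a (b.trans_lt ht1)
        have k9 := Nn_tri (g (s, y)) (g (s, x)) (g₀ x)
        linarith
      · push Not at hb
        have k1 := hm x y (c.trans hR)
        have k9 := Nn_tri (g (s, y)) (g₀ y) (g₀ x)
        nlinarith [sq_nonneg δ]) (fun y c  ↦ hm x y (c.trans hR)) ht
    refine this.trans ?_
    have e : 16 * δ ^ 2 * d * (2 * lam) / (A * √τ) ^ 2 * t ≤ δ ^ 2 / 4 := by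
      rw [mul_pow, sq_sqrt hτ0.le, div_mul_eq_mul_div, div_le_div_iff₀ psv psv]
      have : δ ^ 2 * (128 * d * lam) * t ≤ δ ^ 2 * A ^ 2 * τ := by gcongr
      linarith
    nlinarith [sq_nonneg δ]
  have hlim : ContinuousWithinAt (fun t  ↦ Nn (g (t, x)) (g₀ x)) (Ico 0 τ) τ := by
    have h1 := hFc (τ, x) ⟨hτ, trivial⟩
    exact h1.comp (t := Icc 0 T ×ˢ univ) (f := fun t  ↦ (t, x)) (s := Ico 0 τ) fnp fun t ht  ↦ ⟨⟨ht.1, ht.2.le.trans hτ.2⟩, trivial⟩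
  have : (nhdsWithin τ (Ico 0 τ)).NeBot := by
    rw [← mem_closure_iff_nhdsWithin_neBot, closure_Ico hτ0.ne]
    exact ⟨hτ0.le, le_rfl⟩
  have hfin : Nn (g (τ, x)) (g₀ x) ≤ δ ^ 2 / 2 := le_of_tendsto hlim (by
    filter_upwards [self_mem_nhdsWithin] with t ht using main t ht.1 ht.2)
  nlinarith
end

section

lemma pd_mul {g} (hf : Differentiable ℝ f) (hg : Differentiable ℝ g) (c y) :
    pd c (fun y  ↦ f y * g y) y = pd c f y * g y + f y * pd c g y := by
  simp only [pd]
  rw [fderiv_fun_mul (hf y) (hg y)]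
  simp
  ring

lemma pd_add {g} (hf : Differentiable ℝ f) (hg : Differentiable ℝ g) (c y) :
    pd c (fun y  ↦ f y + g y) y = pd c f y + pd c g y := by
  simp only [pd]
  rw [fderiv_fun_add (hf y) (hg y)]
  simp

lemma pd_sub {g} (hf : Differentiable ℝ f) (hg : Differentiable ℝ g) (c y) :
    pd c (fun y  ↦ f y - g y) y = pd c f y - pd c g y := by
  simp only [pd]
  rw [fderiv_fun_sub (hf y) (hg y)]
  simp

lemma pd_cmul (r) (hf : Differentiable ℝ f) (c y) :
    pd c (fun y  ↦ r * f y) y = r * pd c f y := by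
  simp only [pd]
  rw [fderiv_const_mul (hf y)]
  simp

lemma pd_sum {ι : Type*} [Fintype ι] {f : ι → EE d → ℝ} (hf : ∀ i, Differentiable ℝ (f i)) (c y) :
    pd c (fun y  ↦ ∑ i, f i y) y = ∑ i, pd c (f i) y := by
  simp only [pd]; rw [fderiv_fun_sum fun i _  ↦ hf i y]; simp

lemma pd_const (r) (c : Fin d) (y) : pd c (fun _  ↦ r) y = 0 := by simp [pd]

lemma pd_sq (hf : Differentiable ℝ f) (c y) :
    pd c (fun y  ↦ f y ^ 2) y = 2 * (f y * pd c f y) := by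
  simp only [sq]
  rw [pd_mul hf hf]
  ring

lemma pd_cont (hf : ContDiff ℝ 1 f) (c) : Continuous (pd c f) := (pd_cd (n := 0) (by simpa using hf) c).continuous

lemma div0 (hf : ContDiff ℝ 1 f) (hc : HasCompactSupport f) (c) : Integrable (pd c f) ∧ ∫ y, pd c f y = 0 := by
  have hi : Integrable (pd c f) := (pd_cont hf c).integrable_of_hasCompactSupport (by
    refine (hc.fderiv ℝ).mono fun y hy hy2  ↦ hy ?_
    simp [pd, hy2])
  refine ⟨hi, ?_⟩
  have := integral_mul_fderiv_eq_neg_fderiv_mul_of_integrable (μ := (volume : Measure (EE d))) (f := fun _  ↦ (1:ℝ)) (g := f) (v := EuclideanSpace.single c 1)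
    smp (by simp only [one_mul]; exact hi) (by simpa using hf.continuous.integrable_of_hasCompactSupport hc) fnp (fun x _  ↦ hf.differentiable nmn x)
  simpa [pd] using this

variable {ι : Type*} [Fintype ι]

lemma slice_id {χ} {dχ : Fin d → EE d → ℝ} (hχ : Continuous χ) (hdχ : ∀ c, Continuous (dχ c)) (hu : ContDiff ℝ 1 (fun y  ↦ χ y ^ 2))
    (hcs : HasCompactSupport χ) (hdu : ∀ c y, pd c (fun y  ↦ χ y ^ 2) y = 2 * χ y * dχ c y) {w e : ι → EE d → ℝ} (hw : ∀ x, ContDiff ℝ 1 (w x))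
    (he : ∀ x, ContDiff ℝ 1 (e x)) {Z Y : Fin d → ι → EE d → ℝ} (hZ : ∀ c x, ContDiff ℝ 1 (Z c x)) (hY : ∀ c x, ContDiff ℝ 1 (Y c x))
    {DP P : ι → EE d → ℝ} (hDP : ∀ x, Continuous (DP x)) (hP : ∀ x, Continuous (P x)) {q r : Fin d → ι → EE d → ℝ} (hqr : ∀ c x y, pd c (e x) y = q c x y - r c x y) :
    Integrable (fun y  ↦ RR K (χ y) (fun c  ↦ dχ c y) (fun x  ↦ w x y) (fun x  ↦ e x y) (fun c x  ↦ pd c (w x) y) (fun c x  ↦ q c x y) (fun c x  ↦ r c x y)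
      (fun c x  ↦ Z c x y) (fun c x  ↦ Y c x y) (fun x  ↦ DP x y) (fun x  ↦ P x y)) ∧
    ∫ y, χ y ^ 2 * (2 * (1 + K * ∑ x, e x y ^ 2) * ∑ x, w x y * (∑ c, pd c (Z c x) y + DP x y) + 2 * K * (∑ x, w x y ^ 2) * ∑ x, e x y * (∑ c, pd c (Y c x) y + P x y)) =
    ∫ y, RR K (χ y) (fun c  ↦ dχ c y) (fun x  ↦ w x y) (fun x  ↦ e x y) (fun c x  ↦ pd c (w x) y) (fun c x  ↦ q c x y) (fun c x  ↦ r c x y)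
      (fun c x  ↦ Z c x y) (fun c x  ↦ Y c x y) (fun x  ↦ DP x y) (fun x  ↦ P x y) := by
  have hwd := fun x  ↦ (hw x).differentiable nmn
  have hed := fun x  ↦ (he x).differentiable nmn
  have hZd := fun c x  ↦ (hZ c x).differentiable nmn
  have hYd := fun c x  ↦ (hY c x).differentiable nmn
  have hud := hu.differentiable nmn
  have hwc := fun x  ↦ (hw x).continuous
  have hec := fun x  ↦ (he x).continuous
  have hZc := fun c x  ↦ (hZ c x).continuous
  have hYc := fun c x  ↦ (hY c x).continuous
  have hwp := fun c x  ↦ pd_cont (hw x) c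
  have hep := fun c x  ↦ pd_cont (he x) c
  have hV : ContDiff ℝ 1 (fun y  ↦ 1 + K * ∑ x, e x y ^ 2) := by fun_prop
  have hN : ContDiff ℝ 1 (fun y  ↦ ∑ x, w x y ^ 2) := by fun_prop
  have hVd := hV.differentiable nmn
  have hNd := hN.differentiable nmn
  have hR : Integrable (fun y  ↦ RR K (χ y) (fun c  ↦ dχ c y) (fun x  ↦ w x y) (fun x  ↦ e x y) (fun c x  ↦ pd c (w x) y) (fun c x  ↦ q c x y) (fun c x  ↦ r c x y)
      (fun c x  ↦ Z c x y) (fun c x  ↦ Y c x y) (fun x  ↦ DP x y) (fun x  ↦ P x y)) := by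
    refine Continuous.integrable_of_hasCompactSupport ?_ (hcs.mono fun y hy h0  ↦ hy ?_)
    · unfold RR
      simp only [← hqr]
      fun_prop
    · simp [RR, h0]
  refine ⟨hR, ?_⟩
  have hΦ : ∀ c x, ContDiff ℝ 1 (fun y  ↦ (2 * (χ y ^ 2 * ((1 + K * ∑ x, e x y ^ 2) * w x y))) * Z c x y + (2 * K * (χ y ^ 2 * ((∑ x, w x y ^ 2) * e x y))) * Y c x y) := fun c x  ↦ by
    fun_prop
  have hΦ0 : ∀ c x, HasCompactSupport (fun y  ↦ (2 * (χ y ^ 2 * ((1 + K * ∑ x, e x y ^ 2) * w x y))) * Z c x y + (2 * K * (χ y ^ 2 * ((∑ x, w x y ^ 2) * e x y))) * Y c x y) :=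
    fun c x  ↦ hcs.mono fun y hy h0  ↦ hy (by simp [h0])
  have hpV : ∀ c y, pd c (fun y  ↦ 1 + K * ∑ x, e x y ^ 2) y = 2 * K * ∑ x, e x y * (q c x y - r c x y) := fun c y  ↦ by
    rw [pd_add fnp fnp, pd_const, pd_cmul _ fnp, pd_sum fnp]
    simp only [pd_sq (hed _), hqr, ← mul_sum]
    ring
  have hpN : ∀ c y, pd c (fun y  ↦ ∑ x, w x y ^ 2) y = 2 * ∑ x, w x y * pd c (w x) y := fun c y  ↦ by
    rw [pd_sum fnp]
    simp only [pd_sq (hwd _), ← mul_sum]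
  have hpΦ : ∀ c x y, pd c (fun y  ↦ (2 * (χ y ^ 2 * ((1 + K * ∑ x, e x y ^ 2) * w x y))) * Z c x y + (2 * K * (χ y ^ 2 * ((∑ x, w x y ^ 2) * e x y))) * Y c x y) y =
    (2 * (2 * χ y * dχ c y * ((1 + K * ∑ x, e x y ^ 2) * w x y) + χ y ^ 2 * ((2 * K * ∑ x, e x y * (q c x y - r c x y)) * w x y + (1 + K * ∑ x, e x y ^ 2) * pd c (w x) y)) * Z c x y
      + 2 * (χ y ^ 2 * ((1 + K * ∑ x, e x y ^ 2) * w x y)) * pd c (Z c x) y) +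
    (2 * K * (2 * χ y * dχ c y * ((∑ x, w x y ^ 2) * e x y) + χ y ^ 2 * ((2 * ∑ x, w x y * pd c (w x) y) * e x y + (∑ x, w x y ^ 2) * (q c x y - r c x y))) * Y c x y
      + 2 * K * (χ y ^ 2 * ((∑ x, w x y ^ 2) * e x y)) * pd c (Y c x) y) := fun c x y  ↦ by
    have d1 : Differentiable ℝ (fun y  ↦ (1 + K * ∑ x, e x y ^ 2) * w x y) := hVd.fun_mul (hwd x)
    have d2 : Differentiable ℝ (fun y  ↦ (∑ x, w x y ^ 2) * e x y) := hNd.fun_mul (hed x)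
    have d3 := hud.fun_mul d1
    have d4 := hud.fun_mul d2
    rw [pd_add ((d3.const_mul 2).fun_mul (hZd c x)) ((d4.const_mul (2 * K)).fun_mul (hYd c x)), pd_mul (d3.const_mul 2) (hZd c x), pd_mul (d4.const_mul (2 * K)) (hYd c x),
      pd_cmul _ d3, pd_cmul _ d4, pd_mul hud d1, pd_mul hud d2, pd_mul hVd (hwd x), pd_mul hNd (hed x), hdu, hpV, hpN, hqr]
  have key : ∀ y, χ y ^ 2 * (2 * (1 + K * ∑ x, e x y ^ 2) * ∑ x, w x y * (∑ c, pd c (Z c x) y + DP x y) + 2 * K * (∑ x, w x y ^ 2) * ∑ x, e x y * (∑ c, pd c (Y c x) y + P x y)) =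
    RR K (χ y) (fun c  ↦ dχ c y) (fun x  ↦ w x y) (fun x  ↦ e x y) (fun c x  ↦ pd c (w x) y) (fun c x  ↦ q c x y) (fun c x  ↦ r c x y)
      (fun c x  ↦ Z c x y) (fun c x  ↦ Y c x y) (fun x  ↦ DP x y) (fun x  ↦ P x y) +
    ∑ c, ∑ x, pd c (fun y  ↦ (2 * (χ y ^ 2 * ((1 + K * ∑ x, e x y ^ 2) * w x y))) * Z c x y + (2 * K * (χ y ^ 2 * ((∑ x, w x y ^ 2) * e x y))) * Y c x y) y := fun y  ↦ by
    simp only [hpΦ]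
    unfold RR
    generalize (1 + K * ∑ x, e x y ^ 2) = V
    generalize (∑ x, w x y ^ 2) = N
    have a1 : ∀ (f : ι → ℝ) (F : Fin d → ι → ℝ) (G : ι → ℝ), ∑ x, f x * (∑ c, F c x + G x) = ∑ c, ∑ x, f x * F c x + ∑ x, f x * G x := fun f F G  ↦ by
      simp only [mul_add, sum_add_distrib, mul_sum]
      rw [sum_comm]
    rw [a1, a1]
    have a2 : ∀ (F G : Fin d → ι → ℝ) (S : ℝ), (∑ c, ∑ x, F c x + S) + ∑ c, ∑ x, G c x = ∑ c, ∑ x, (F c x + G c x) + S := fun F G S  ↦ by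
      simp only [sum_add_distrib]
      ring
    rw [a2]
    have a3 : ∀ (F G : Fin d → ι → ℝ) (a b f h k l : ℝ), k * (a * (∑ c, ∑ x, F c x + f) + b * (∑ c, ∑ x, G c x + h)) = ∑ c, ∑ x, (k * a * F c x + k * b * G c x) + k * (a * f + b * h) := fun F G a b f h k l  ↦ by
      simp only [sum_add_distrib, ← mul_sum]
      ring
    rw [a3 _ _ _ _ _ _ _ 0]
    congr 1
    exact sum_congr rfl fun c _  ↦ sum_congr rfl fun x _  ↦ by ring
  simp only [key]
  rw [integral_add hR (integrable_finsetSum _ fun c _  ↦ integrable_finsetSum _ fun x _  ↦ (div0 (hΦ c x) (hΦ0 c x) c).1),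
    integral_finsetSum _ fun c _  ↦ integrable_finsetSum _ fun x _  ↦ (div0 (hΦ c x) (hΦ0 c x) c).1]
  rw [Finset.sum_eq_zero, add_zero]
  intro c _
  rw [integral_finsetSum _ fun x _  ↦ (div0 (hΦ c x) (hΦ0 c x) c).1]
  exact Finset.sum_eq_zero fun x _  ↦ (div0 (hΦ c x) (hΦ0 c x) c).2
end

section

lemma det_cd {a : EE d → Matrix (Fin d) (Fin d) ℝ} (ha : ∀ i j, ContDiff ℝ n (fun y  ↦ a y i j)) : ContDiff ℝ n (fun y  ↦ (a y).det) := by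
  simp only [Matrix.det_apply]
  refine ContDiff.sum fun σ _  ↦ ContDiff.const_smul _ (contDiff_prod fun i _  ↦ ha _ _)

lemma Ai_cd {a : EE d → Mt d} (ha : ∀ i j, ContDiff ℝ n (fun y  ↦ a y i j)) (hs : ∀ y, St L (a y)) (i j) :
    ContDiff ℝ n (fun y  ↦ Ai (a y) i j) := by
  have h1 : ∀ y, (mof (a y)).det ≠ 0 := fun y h0  ↦ by
    have := congrArg Matrix.det (hs y).2
    rw [Matrix.det_mul, h0] at this
    simp at this
  simp only [Ai, Matrix.inv_def, Ring.inverse_eq_inv', Matrix.smul_apply, smul_eq_mul, Matrix.adjugate_apply]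
  refine ((det_cd fun i j  ↦ ha i j).inv h1).mul (det_cd fun k l  ↦ ?_)
  simp only [Matrix.updateRow_apply]
  split_ifs
  · exact contDiff_const
  · exact ha k l

variable {a : EE d → Mt d}

lemma pd_Ai (ha : ∀ i j, ContDiff ℝ 1 (fun y  ↦ a y i j)) (hs : ∀ y, St L (a y)) (c i j y) :
    pd c (fun y  ↦ Ai (a y) i j) y = -∑ r, ∑ s, Ai (a y) i r * pd c (fun y  ↦ a y r s) y * Ai (a y) s j := by
  have hG := fun i j  ↦ (Ai_cd ha hs i j).differentiable nmn
  have hD := fun i j  ↦ (ha i j).differentiable nmn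
  have e1 : ∀ s, ∑ r, pd c (fun y  ↦ Ai (a y) i r) y * a y r s = -∑ r, Ai (a y) i r * pd c (fun y  ↦ a y r s) y := fun s  ↦ by
    have h0 : (fun y  ↦ ∑ r, Ai (a y) i r * a y r s) = fun _  ↦ (1 : Matrix (Fin d) (Fin d) ℝ) i s := funext fun y  ↦ by
      rw [← Ai_mul (hs y)]
      simp [Matrix.mul_apply, Ai]
    have h1 := pd_sum (f := fun r y  ↦ Ai (a y) i r * a y r s) (fun r  ↦ (hG i r).fun_mul (hD r s)) c y
    rw [h0, pd_const] at h1
    simp only [pd_mul (hG i _) (hD _ s), sum_add_distrib] at h1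
    linarith
  have e2 : ∀ r, ∑ s, a y r s * Ai (a y) s j = (1 : Matrix (Fin d) (Fin d) ℝ) r j := fun r  ↦ by
    rw [← (hs y).2]
    simp [Matrix.mul_apply, Ai]
  have e3 : pd c (fun y  ↦ Ai (a y) i j) y = ∑ r, pd c (fun y  ↦ Ai (a y) i r) y * ∑ s, a y r s * Ai (a y) s j := by
    simp only [e2, Matrix.one_apply]
    simp
  rw [e3]
  simp only [mul_sum]
  rw [sum_comm]
  simp only [← mul_assoc, ← sum_mul, e1]
  rw [sum_comm]
  simp only [neg_mul, sum_mul, sum_neg_distrib]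

def pf (a : EE d → Mt d) (y : EE d) : Fin d → Mt d := fun c i j  ↦ pd c (fun y  ↦ a y i j) y

lemma pf_cd (ha : ∀ i j, ContDiff ℝ (n+1) (fun y  ↦ a y i j)) (c i j) : ContDiff ℝ n (fun y  ↦ pf a y c i j) := pd_cd (ha i j) c

lemma Xf_cd (ha : ∀ i j, ContDiff ℝ 2 (fun y  ↦ a y i j)) (hs : ∀ y, St L (a y)) (c x) : ContDiff ℝ 1 (fun y  ↦ Xf (Ai (a y)) (pf a y) c x) := by
  unfold Xf
  exact ContDiff.sum fun b _  ↦ (Ai_cd (fun i j  ↦ (ha i j).of_le nmn) hs c b).mul (pf_cd (n := 1) (by rw [one_add_one_eq_two]; exact ha) b x.1 x.2)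

lemma QC_co (ha : ∀ i j, ContDiff ℝ 1 (fun y  ↦ a y i j)) (hs : ∀ y, St L (a y)) (x : Ix d) :
    Continuous (fun y  ↦ Qf (Ai (a y)) (pf a y) x.1 x.2 + Cf (Ai (a y)) (pf a y) x.1 x.2) := by
  have h1 := fun i j  ↦ (Ai_cd (fun i j  ↦ (ha i j)) hs i j).continuous
  have h2 := fun c i j  ↦ (pf_cd (n := 0) (by simpa using ha) c i j).continuous
  unfold Qf Cf
  fun_prop

lemma divf (ha : ∀ i j, ContDiff ℝ 2 (fun y  ↦ a y i j)) (hs : ∀ y, St L (a y)) (x y) :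
    (∑ k, ∑ b, Ai (a y) k b * pd2 k b (fun y  ↦ a y x.1 x.2) y) + Qf (Ai (a y)) (pf a y) x.1 x.2 =
    ∑ c, pd c (fun y  ↦ Xf (Ai (a y)) (pf a y) c x) y + (Qf (Ai (a y)) (pf a y) x.1 x.2 + Cf (Ai (a y)) (pf a y) x.1 x.2) := by
  have ha1 := fun i j  ↦ (ha i j).of_le (m := 1) nmn
  have hG := fun i j  ↦ (Ai_cd ha1 hs i j).differentiable nmn
  have hP := fun c i j  ↦ (pf_cd (n := 1) (by rw [one_add_one_eq_two]; exact ha) c i j).differentiable nmn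
  have : ∀ c, pd c (fun y  ↦ Xf (Ai (a y)) (pf a y) c x) y = ∑ b, Ai (a y) c b * pd2 c b (fun y  ↦ a y x.1 x.2) y -
      ∑ b, ∑ r, ∑ s, Ai (a y) c r * pf a y c r s * Ai (a y) s b * pf a y b x.1 x.2 := fun c  ↦ by
    unfold Xf
    rw [pd_sum (fun b  ↦ (hG c b).fun_mul (hP b x.1 x.2)), ← sum_sub_distrib]
    refine sum_congr rfl fun b _  ↦ ?_
    rw [pd_mul (hG c b) (hP b x.1 x.2), pd_Ai ha1 hs]
    simp only [← sum_mul, neg_mul]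
    rw [add_comm, ← sub_eq_add_neg]
    rfl
  simp only [this, sum_sub_distrib, Cf]
  ring
end

section

lemma posq (s : ℝ) : HasDerivAt (fun s  ↦ (max s 0) ^ 2) (2 * max s 0) s := by
  rw [hasDerivAt_iff_isLittleO]
  have h1 : (fun y  ↦ (max y 0) ^ 2 - (max s 0) ^ 2 - (y - s) • (2 * max s 0)) =O[nhds s] fun y  ↦ (y - s) ^ 2 := by
    refine Asymptotics.IsBigO.of_bound 1 (Filter.Eventually.of_forall fun y  ↦ ?_)
    rw [one_mul, norm_eq_abs, norm_eq_abs, abs_of_nonneg (sq_nonneg (y - s)), abs_le, smul_eq_mul]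
    rcases le_total y 0 with h | h <;> rcases le_total s 0 with h' | h' <;> simp only [max_eq_left, max_eq_right, h, h'] <;> constructor <;> nlinarith [mul_nonneg (sub_nonneg.2 h) (sub_nonneg.2 h'), sq_nonneg (y-s), sq_nonneg y, sq_nonneg s]
  refine h1.trans_isLittleO ?_
  have : (fun y  ↦ y - s) =o[nhds s] fun _  ↦ (1:ℝ) := by
    rw [Asymptotics.isLittleO_one_iff]
    exact (by fun_prop : Continuous fun y  ↦ y - s).tendsto' _ _ smp
  simpa [sq] using this.mul_isBigO (Asymptotics.isBigO_refl (fun y  ↦ y - s) (nhds s))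

def rhw (y : EE d) : ℝ := ((1 + ‖y‖ ^ 2) ^ (d + 1))⁻¹

def chi (κ : ℝ) (y : EE d) : ℝ := max (rhw y - κ) 0

lemma rhw_pos (y : EE d) : 0 < rhw y := by unfold rhw; positivity

lemma rhw_cd : ContDiff ℝ n (rhw (d := d)) := by
  unfold rhw
  exact ((contDiff_const.add (contDiff_norm_sq ℝ)).pow _).inv fun y  ↦ by positivity

lemma rhw_pd (c : Fin d) (y) : |pd c rhw y| ≤ (d + 1) * rhw y := by
  have h1 : HasFDerivAt (fun y  ↦ 1 + ‖y‖ ^ 2) (2 • innerSL ℝ y) y := (hasStrictFDerivAt_norm_sq y).hasFDerivAt.const_add 1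
  have h2 := (h1.pow (d + 1))
  have h3 := (hasDerivAt_inv (x := (1 + ‖y‖ ^ 2) ^ (d + 1)) psv).comp_hasFDerivAt y h2
  have h4 : pd c rhw y = -((d + 1) * rhw y) * ((2 * y c) / (1 + ‖y‖ ^ 2)) := by
    unfold pd
    have : fderiv ℝ (rhw (d := d)) y = _ := h3.fderiv
    rw [this]
    have h0 : (1 + ‖y‖ ^ 2) ≠ 0 := by positivity
    simp [rhw, EuclideanSpace.inner_single_right]
    field_simp
    ring
  rw [h4, abs_mul, abs_neg, abs_of_nonneg (a := (d + 1) * rhw y) (by have := rhw_pos y; positivity)]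
  refine mul_le_of_le_one_right (by have := rhw_pos y; positivity) ?_
  rw [abs_div, abs_of_pos (a := 1 + ‖y‖ ^ 2) psv, div_le_one psv, abs_mul, abs_two]
  have : |y c| ≤ ‖y‖ := by simpa using PiLp.norm_apply_le y c
  nlinarith [sq_nonneg (‖y‖ - 1)]

lemma rhw_int : Integrable (rhw (d := d)) := by
  have := integrable_rpow_neg_one_add_norm_sq (E := EE d) (μ := volume) (r := 2 * (d + 1)) (by simp; linarith [d.cast_nonneg (α := ℝ)])
  refine this.congr (Filter.Eventually.of_forall fun y  ↦ ?_)
  simp only [rhw]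
  rw [show (-(2 * ((d:ℝ) + 1)) / 2) = -((d + 1 : ℕ) : ℝ) by push_cast; ring, Real.rpow_neg psv, Real.rpow_natCast]

lemma chi_co (κ) : Continuous (chi (d := d) κ) := by
  have := (rhw_cd (d := d) (n := 0)).continuous
  unfold chi
  fun_prop

lemma chi_hf (κ) (y : EE d) : HasFDerivAt (fun y  ↦ chi κ y ^ 2) ((2 * chi κ y) • fderiv ℝ rhw y) y := by
  have h1 : HasFDerivAt (fun y  ↦ rhw y - κ) (fderiv ℝ rhw y) y := (((rhw_cd (d := d) (n := 1)).differentiable nmn y).hasFDerivAt).sub_const κ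
  exact (posq (rhw y - κ)).comp_hasFDerivAt y h1

lemma chi_pd (κ) (c : Fin d) (y) : pd c (fun y  ↦ chi κ y ^ 2) y = 2 * chi κ y * pd c rhw y := by
  unfold pd
  rw [(chi_hf κ y).fderiv]
  simp

lemma chi_cd (κ) : ContDiff ℝ 1 (fun y : EE d  ↦ chi κ y ^ 2) := by
  rw [contDiff_one_iff_fderiv]
  refine ⟨fun y  ↦ (chi_hf κ y).differentiableAt, ?_⟩
  rw [show fderiv ℝ (fun y  ↦ chi κ y ^ 2) = fun y  ↦ (2 * chi κ y) • fderiv ℝ rhw y from funext fun y  ↦ (chi_hf κ y).fderiv]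
  exact (continuous_const.mul (chi_co κ)).smul ((rhw_cd (n := 1)).continuous_fderiv nmn)

lemma chi_cs (hκ : 0 < κ) : HasCompactSupport (chi (d := d) κ) := by
  refine HasCompactSupport.of_support_subset_isCompact (isCompact_closedBall (0 : EE d) (1 / κ)) fun y hy  ↦ ?_
  rw [mem_closedBall_zero_iff]
  by_contra! h
  refine hy ?_
  have h1 : κ * ‖y‖ > 1 := by rw [div_lt_iff₀ hκ] at h; linarith
  have h2 : rhw y ≤ κ := by
    rw [rhw, inv_le_comm₀ psv hκ]
    refine le_trans ?_ (le_self_pow₀ (by nlinarith [sq_nonneg ‖y‖]) omg)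
    rw [inv_le_iff_one_le_mul₀ hκ]
    nlinarith [mul_nonneg hκ.le (sq_nonneg (‖y‖ - 1)), mul_pos hκ (show 0 < 1 + ‖y‖ by positivity)]
  simp [chi, h2]

lemma chi_nn (κ) (y : EE d) : 0 ≤ chi κ y := le_max_right _ _

lemma chi_eta (hκ : 0 < κ) (y : EE d) : rhw y ^ 2 ≤ 2 * chi κ y ^ 2 + 2 * κ * rhw y := by
  have := rhw_pos y
  unfold chi
  rcases le_total (rhw y - κ) 0 with h | h
  · rw [max_eq_right h]
    nlinarith
  · rw [max_eq_left h]
    nlinarith [sq_nonneg (rhw y - κ)]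

lemma chi_anti {κp} (h : κ ≤ κp) (y : EE d) : chi κp y ≤ chi κ y := max_le_max lna le_rfl
end

section

def Rh (a : EE d → Mt d) (x : Ix d) (y : EE d) : ℝ :=
  (∑ k, ∑ b, Ai (a y) k b * pd2 k b (fun y  ↦ a y x.1 x.2) y) + Qf (Ai (a y)) (pf a y) x.1 x.2

lemma slice_le (hK : 0 ≤ K) (hδ : 0 ≤ δ) (hC : 0 ≤ C5) (hκ : 0 < κ)
    (HR : ∀ (χ η) (dχ) (a b hb) (p q r),
    0 ≤ χ → 0 ≤ η → (∀ c, |dχ c| ≤ η) → St L a → St L b → (∀ i j, |b i j - hb i j| ≤ δ) → (∀ i j, |a i j - b i j| ≤ δ) → (∀ c i j, |r c i j| ≤ M) →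
    RP K χ dχ a b hb p q r ≤ C5 * ((η ^ 2 + χ ^ 2) * ∑ x : Ix d, (a x.1 x.2 - b x.1 x.2) ^ 2))
    {a b} (ha : ∀ i j, ContDiff ℝ 2 (fun y  ↦ a y i j)) (hb : ∀ i j, ContDiff ℝ 2 (fun y  ↦ b y i j)) (hh : ∀ i j, ContDiff ℝ 1 (fun y  ↦ h y i j))
    (sa : ∀ y, St L (a y)) (sb : ∀ y, St L (b y)) (hbh : ∀ y i j, |b y i j - h y i j| ≤ δ) (hab : ∀ y i j, |a y i j - b y i j| ≤ δ) (hM : ∀ y c i j, |pf h y c i j| ≤ M) :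
    ∫ y, chi κ y ^ 2 * (2 * (1 + K * ∑ x : Ix d, (b y x.1 x.2 - h y x.1 x.2) ^ 2) * ∑ x, (a y x.1 x.2 - b y x.1 x.2) * (Rh a x y - Rh b x y)
      + 2 * K * (∑ x : Ix d, (a y x.1 x.2 - b y x.1 x.2) ^ 2) * ∑ x, (b y x.1 x.2 - h y x.1 x.2) * Rh b x y) ≤
    C5 * (2 * (d + 1) ^ 2 + 1) * (1 + d ^ 2 * δ ^ 2) * ((∫ y, chi κ y ^ 2 * ((1 + K * ∑ x : Ix d, (b y x.1 x.2 - h y x.1 x.2) ^ 2) * ∑ x : Ix d, (a y x.1 x.2 - b y x.1 x.2) ^ 2))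
      + κ * ∫ y : EE d, rhw y) := by
  have ha1 := fun i j  ↦ (ha i j).of_le (m := 1) nmn
  have hb1 := fun i j  ↦ (hb i j).of_le (m := 1) nmn
  have hac := fun i j  ↦ (ha i j).continuous
  have hbc := fun i j  ↦ (hb i j).continuous
  have hhc := fun i j  ↦ (hh i j).continuous
  have hcc := chi_co (d := d) κ
  obtain ⟨I1, I2⟩ := slice_id (ι := Ix d) (K := K) (χ := chi κ) (dχ := fun c  ↦ pd c rhw) (chi_co κ) (fun c  ↦ pd_cont rhw_cd c) (chi_cd κ) (chi_cs hκ) (chi_pd κ)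
    (w := fun x y  ↦ a y x.1 x.2 - b y x.1 x.2) (e := fun x y  ↦ b y x.1 x.2 - h y x.1 x.2) (fun x  ↦ (ha1 _ _).sub (hb1 _ _)) (fun x  ↦ (hb1 _ _).sub (hh _ _))
    (Z := fun c x y  ↦ Xf (Ai (a y)) (pf a y) c x - Xf (Ai (b y)) (pf b y) c x) (Y := fun c x y  ↦ Xf (Ai (b y)) (pf b y) c x)
    (fun c x  ↦ (Xf_cd ha sa c x).sub (Xf_cd hb sb c x)) (fun c x  ↦ Xf_cd hb sb c x)
    (DP := fun x y  ↦ (Qf (Ai (a y)) (pf a y) x.1 x.2 + Cf (Ai (a y)) (pf a y) x.1 x.2) - (Qf (Ai (b y)) (pf b y) x.1 x.2 + Cf (Ai (b y)) (pf b y) x.1 x.2))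
    (P := fun x y  ↦ Qf (Ai (b y)) (pf b y) x.1 x.2 + Cf (Ai (b y)) (pf b y) x.1 x.2) (fun x  ↦ (QC_co ha1 sa x).sub (QC_co hb1 sb x)) (fun x  ↦ QC_co hb1 sb x)
    (q := fun c x y  ↦ pf b y c x.1 x.2) (r := fun c x y  ↦ pf h y c x.1 x.2)
    (fun c x y  ↦ pd_sub ((hb1 _ _).differentiable nmn) ((hh _ _).differentiable nmn) c y)
  have e1 : ∀ x y, Rh b x y = ∑ c, pd c (fun y  ↦ Xf (Ai (b y)) (pf b y) c x) y + (Qf (Ai (b y)) (pf b y) x.1 x.2 + Cf (Ai (b y)) (pf b y) x.1 x.2) := fun x y  ↦ divf hb sb x y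
  have e2 : ∀ x y, Rh a x y - Rh b x y = ∑ c, pd c (fun y  ↦ Xf (Ai (a y)) (pf a y) c x - Xf (Ai (b y)) (pf b y) c x) y +
      ((Qf (Ai (a y)) (pf a y) x.1 x.2 + Cf (Ai (a y)) (pf a y) x.1 x.2) - (Qf (Ai (b y)) (pf b y) x.1 x.2 + Cf (Ai (b y)) (pf b y) x.1 x.2)) := fun x y  ↦ by
    rw [e1, show Rh a x y = _ from divf ha sa x y]
    simp only [pd_sub ((Xf_cd ha sa _ x).differentiable nmn) ((Xf_cd hb sb _ x).differentiable nmn), sum_sub_distrib]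
    ring
  simp only [e2]
  simp only [e1]
  obtain ⟨C6, hC6⟩ := exi (C5 * (2 * ((d:ℝ) + 1) ^ 2 + 1) * (1 + d ^ 2 * δ ^ 2))
  rw [← hC6, I2, mul_add, ← mul_assoc, ← integral_const_mul C6, ← integral_const_mul (C6 * κ), ← integral_add]
  · refine integral_mono I1 ?_ fun y  ↦ ?_
    · refine Integrable.add (Integrable.const_mul ?_ _) (rhw_int.const_mul _)
      refine Continuous.integrable_of_hasCompactSupport fnp ((chi_cs hκ).mono fun y hy h0  ↦ hy (by simp [h0]))
    · have h1 := HR (chi κ y) ((d + 1) * rhw y) (fun c  ↦ pd c rhw y) (a y) (b y) (h y) (pf a y) (pf b y) (pf h y) (chi_nn κ y)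
        (by have := rhw_pos y; positivity) (fun c  ↦ rhw_pd c y) (sa y) (sb y) (hbh y) (hab y) (hM y)
      have e3 : RP K (chi κ y) (fun c  ↦ pd c rhw y) (a y) (b y) (h y) (pf a y) (pf b y) (pf h y) =
        RR K (chi κ y) (fun c  ↦ pd c rhw y) (fun x : Ix d  ↦ a y x.1 x.2 - b y x.1 x.2) (fun x  ↦ b y x.1 x.2 - h y x.1 x.2) (fun c x  ↦ pd c (fun y  ↦ a y x.1 x.2 - b y x.1 x.2) y)
          (fun c x  ↦ pf b y c x.1 x.2) (fun c x  ↦ pf h y c x.1 x.2) (fun c x  ↦ Xf (Ai (a y)) (pf a y) c x - Xf (Ai (b y)) (pf b y) c x) (fun c x  ↦ Xf (Ai (b y)) (pf b y) c x)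
          (fun x  ↦ (Qf (Ai (a y)) (pf a y) x.1 x.2 + Cf (Ai (a y)) (pf a y) x.1 x.2) - (Qf (Ai (b y)) (pf b y) x.1 x.2 + Cf (Ai (b y)) (pf b y) x.1 x.2))
          (fun x  ↦ Qf (Ai (b y)) (pf b y) x.1 x.2 + Cf (Ai (b y)) (pf b y) x.1 x.2) := by
        unfold RP
        simp only [pd_sub ((ha1 _ _).differentiable nmn) ((hb1 _ _).differentiable nmn)]
        rfl
      rw [e3] at h1
      refine h1.trans ?_
      obtain ⟨N, hN⟩ := exi (∑ x : Ix d, (a y x.1 x.2 - b y x.1 x.2) ^ 2)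
      obtain ⟨V, hV⟩ := exi (∑ x : Ix d, (b y x.1 x.2 - h y x.1 x.2) ^ 2)
      have hN0 : 0 ≤ N := by rw [hN]; positivity
      have hV0 : 0 ≤ V := by rw [hV]; positivity
      have hN1 : N ≤ d ^ 2 * δ ^ 2 := by rw [hN]; exact Nn_of (hab y)
      simp only [← hN, ← hV]
      have h2 := chi_eta hκ y
      have h3 := rhw_pos y
      clear hN hV h1 e3 I1 I2 e1 e2 HR
      obtain ⟨c, hc⟩ := exi (chi κ y ^ 2)
      obtain ⟨ρ, hρ⟩ := exi (rhw y)
      obtain ⟨D, hD⟩ := exi (((d:ℝ) + 1) ^ 2)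
      obtain ⟨S, hS⟩ := exi ((d:ℝ) ^ 2 * δ ^ 2)
      have hc0 : 0 ≤ c := by rw [hc]; positivity
      have hD0 : 0 ≤ D := by rw [hD]; positivity
      rw [hC6, mul_pow, ← hc, ← hD, ← hρ, ← hS]
      rw [← hc, ← hρ] at h2
      rw [← hS] at hN1
      rw [← hρ] at h3
      have hS0 : 0 ≤ S := hN0.trans hN1
      calc C5 * ((D * ρ ^ 2 + c) * N) ≤ C5 * ((D * (2 * c + 2 * κ * ρ) + c) * N) := by gcongr
        _ = C5 * ((2 * D + 1) * (c * N) + 2 * D * (κ * ρ) * N) := by ring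
        _ ≤ C5 * ((2 * D + 1) * ((1 + S) * (c * ((1 + K * V) * N))) + (2 * D + 1) * (κ * ρ) * (1 + S)) := by
          have : c * N ≤ (1 + S) * (c * ((1 + K * V) * N)) := by
            have h4 : N ≤ (1 + K * V) * N := le_mul_of_one_le_left hN0 (by nlinarith [mul_nonneg hK hV0])
            have h5 : c * N ≤ c * ((1 + K * V) * N) := by gcongr
            exact h5.trans (le_mul_of_one_le_left psv lna)
          gcongr <;> linarith
        _ = _ := by ring
  · refine Integrable.const_mul ?_ _
    refine Continuous.integrable_of_hasCompactSupport fnp ((chi_cs hκ).mono fun y hy h0  ↦ hy (by simp [h0]))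
  · exact rhw_int.const_mul _

lemma dint {G : Ze d → ℝ} (hG : ∀ z, z.1 ∈ Ioo 0 T → ContDiffAt ℝ 1 G z) {u} (hu : Continuous u) (hc : HasCompactSupport u) (ht : t ∈ Ioo 0 T) :
    HasDerivAt (fun s  ↦ ∫ y, u y * G (s, y)) (∫ y, u y * deriv (fun s  ↦ G (s, y)) t) t := by
  have hO : IsOpen (Ioo (0:ℝ) T ×ˢ (univ : Set (EE d))) := isOpen_Ioo.prod isOpen_univ
  have hGo : ContDiffOn ℝ 1 G (Ioo (0:ℝ) T ×ˢ univ) := fun z hz  ↦ (hG z hz.1).contDiffWithinAt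
  have hF : ContinuousOn (fun z  ↦ fderiv ℝ G z (1, 0)) (Ioo (0:ℝ) T ×ˢ (univ : Set (EE d))) :=
    (hGo.continuousOn_fderiv_of_isOpen hO nmn).clm_apply continuousOn_const
  have hd : ∀ s ∈ Ioo 0 T, ∀ y, HasDerivAt (fun s  ↦ G (s, y)) (fderiv ℝ G (s, y) (1, 0)) s := fun s hs y  ↦ by
    have h1 := ((hG (s, y) hs).differentiableAt nmn).hasFDerivAt
    have h2 : HasDerivAt (fun s  ↦ (s, y)) ((1:ℝ), (0:EE d)) s := (hasDerivAt_id s).prodMk (hasDerivAt_const s y)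
    exact h1.comp_hasDerivAt s h2
  have hdp : ∀ s ∈ Ioo 0 T, ∀ y, deriv (fun s  ↦ G (s, y)) s = fderiv ℝ G (s, y) (1, 0) := fun s hs y  ↦ (hd s hs y).deriv
  obtain ⟨r, hr, hrs⟩ := Metric.nhds_basis_closedBall.mem_iff.1 (Ioo_mem_nhds ht.1 ht.2)
  obtain ⟨B, hB⟩ := ((isCompact_closedBall t r).prod hc).exists_bound_of_continuousOn (hF.mono (prod_mono hrs (subset_univ _)))
  have hsl : ∀ s ∈ Ioo 0 T, Continuous fun y  ↦ G (s, y) := fun s hs  ↦ continuous_iff_continuousAt.2 fun y  ↦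
    (hG (s, y) hs).continuousAt.comp (f := fun y  ↦ (s, y)) fnp
  have hsl' : Continuous fun y  ↦ fderiv ℝ G (t, y) (1, 0) := hF.comp_continuous (f := fun y  ↦ (t, y)) fnp fun y  ↦ ⟨ht, trivial⟩
  have h := hasDerivAt_integral_of_dominated_loc_of_deriv_le (μ := (volume : Measure (EE d))) (s := closedBall t r) (x₀ := t) (F := fun s y  ↦ u y * G (s, y))
    (F' := fun s y  ↦ u y * fderiv ℝ G (s, y) (1, 0)) (bound := fun y  ↦ |u y| * B) (closedBall_mem_nhds t hr)
    (Filter.eventually_of_mem (closedBall_mem_nhds t hr) fun s hs  ↦ (hu.mul (hsl s (hrs hs))).aestronglyMeasurable)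
    ((hu.mul (hsl t ht)).integrable_of_hasCompactSupport (hc.mono fun y hy h0  ↦ hy (by simp [h0])))
    (hu.mul hsl').aestronglyMeasurable
    (Filter.Eventually.of_forall fun y s hs  ↦ by
      rw [norm_mul, norm_eq_abs]
      by_cases hy : u y = 0
      · simp [hy]
      · exact mul_le_mul_of_nonneg_left (hB (s, y) ⟨hs, subset_tsupport _ hy⟩) (abs_nonneg _))
    ((hu.abs.mul continuous_const).integrable_of_hasCompactSupport (hc.mono fun y hy h0  ↦ hy (by simp [h0])))
    (Filter.Eventually.of_forall fun y s hs  ↦ (hd s (hrs hs) y).const_mul _)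
  simp only [hdp t ht]
  exact h.2
end

section

def Gf (K : ℝ) (h : EE d → Mt d) (a b : Ze d → Mt d) (z : Ze d) : ℝ :=
  (1 + K * ∑ x : Ix d, (b z x.1 x.2 - h z.2 x.1 x.2) ^ 2) * ∑ x : Ix d, (a z x.1 x.2 - b z x.1 x.2) ^ 2

lemma gron {E : ℝ → ℝ} {I} (hc : ContinuousOn E (Icc 0 T)) (h0 : E 0 = 0) (hI : 0 ≤ I) (hd : ∀ t ∈ Ioo 0 T, ∃ D, HasDerivAt E D t ∧ D ≤ C * (E t + I)) (ht : t ∈ Icc 0 T) :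
    E t ≤ exp (C * t) * I := by
  have h1 : AntitoneOn (fun t  ↦ exp (-(C * t)) * (E t + I)) (Icc 0 T) := by
    have hD : ∀ t ∈ Ioo 0 T, ∃ Dp, HasDerivAt (fun t  ↦ exp (-(C * t)) * (E t + I)) Dp t ∧ Dp ≤ 0 := fun t ht  ↦ by
      obtain ⟨D, hD, hD2⟩ := hd t ht
      have e1 : HasDerivAt (fun t  ↦ exp (-(C * t))) (exp (-(C * t)) * (-(C * 1))) t := (((hasDerivAt_id t).const_mul C).fun_neg).exp
      refine ⟨_, e1.fun_mul (hD.add_const I), ?_⟩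
      have : exp (-(C * t)) * (-(C * 1)) * (E t + I) + exp (-(C * t)) * D = exp (-(C * t)) * (D - C * (E t + I)) := by ring
      rw [this]
      exact mul_nonpos_of_nonneg_of_nonpos (Real.exp_pos _).le lna
    refine antitoneOn_of_deriv_nonpos (convex_Icc 0 T) ?_ ?_ ?_
    · exact (Continuous.continuousOn fnp).mul (hc.add continuousOn_const)
    · rw [interior_Icc]
      intro t ht
      obtain ⟨D, hD, -⟩ := hD t ht
      exact hD.differentiableAt.differentiableWithinAt
    · rw [interior_Icc]
      intro t ht
      obtain ⟨D, hD, hD2⟩ := hD t ht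
      rw [hD.deriv]
      exact hD2
  have h2 := h1 ⟨le_rfl, ht.1.trans ht.2⟩ ht ht.1
  simp only [h0, mul_zero, neg_zero, Real.exp_zero, one_mul, zero_add] at h2
  have h3 : E t + I = exp (C * t) * (exp (-(C * t)) * (E t + I)) := by rw [← mul_assoc, ← Real.exp_add]; simp
  have h4 := mul_le_mul_of_nonneg_left h2 (Real.exp_pos (C * t)).le
  linarith

lemma uniq {εp} (hK : 0 ≤ K) (hδ : 0 ≤ δ) (hC : 0 ≤ C5)
    (HR : ∀ (χ η) (dχ) (a b hb) (p q r),
    0 ≤ χ → 0 ≤ η → (∀ c, |dχ c| ≤ η) → St L a → St L b → (∀ i j, |b i j - hb i j| ≤ δ) → (∀ i j, |a i j - b i j| ≤ δ) → (∀ c i j, |r c i j| ≤ M) →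
    RP K χ dχ a b hb p q r ≤ C5 * ((η ^ 2 + χ ^ 2) * ∑ x : Ix d, (a x.1 x.2 - b x.1 x.2) ^ 2))
    {a b} (ha : Sol ε T g₀ a) (hb : Sol εp T g₀ b) (hh : ∀ i j, ContDiff ℝ 1 (fun y  ↦ h y i j))
    (sa : ∀ z, z.1 ∈ Icc 0 T → St L (a z)) (sb : ∀ z, z.1 ∈ Icc 0 T → St L (b z)) (hbh : ∀ z, z.1 ∈ Icc 0 T → ∀ i j, |b z i j - h z.2 i j| ≤ δ)
    (hab : ∀ z, z.1 ∈ Icc 0 T → ∀ i j, |a z i j - b z i j| ≤ δ) (hM : ∀ y c i j, |pf h y c i j| ≤ M) :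
    ∀ t ∈ Icc 0 T, ∀ x, a (t, x) = b (t, x) := by
  have hGc : ContinuousOn (Gf K h a b) (Icc 0 T ×ˢ univ) := by
    have h1 := fun i j  ↦ continuousOn_pi.1 (continuousOn_pi.1 ha.co i) j
    have h2 := fun i j  ↦ continuousOn_pi.1 (continuousOn_pi.1 hb.co i) j
    have h3 : ∀ i j, ContinuousOn (fun z : Ze d  ↦ h z.2 i j) (Icc 0 T ×ˢ univ) := fun i j  ↦ ((hh i j).continuous.comp continuous_snd).continuousOn
    unfold Gf
    exact (continuousOn_const.add (continuousOn_const.mul (continuousOn_finsetSum _ fun x _  ↦ ((h2 _ _).sub (h3 _ _)).pow 2))).mul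
      (continuousOn_finsetSum _ fun x _  ↦ ((h1 _ _).sub (h2 _ _)).pow 2)
  have hGd : ∀ z : Ze d, z.1 ∈ Ioo 0 T → ContDiffAt ℝ 1 (Gf K h a b) z := fun z hz  ↦ by
    have h1 := fun i j  ↦ (ha.at hz i j).of_le (m := 1) (by norm_cast)
    have h2 := fun i j  ↦ (hb.at hz i j).of_le (m := 1) (by norm_cast)
    have h3 : ∀ i j, ContDiffAt ℝ 1 (fun z : Ze d  ↦ h z.2 i j) z := fun i j  ↦ ((hh i j).comp contDiff_snd).contDiffAt
    unfold Gf
    exact (contDiffAt_const.add (contDiffAt_const.mul (ContDiffAt.sum fun x _  ↦ ((h2 _ _).sub (h3 _ _)).pow 2))).mul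
      (ContDiffAt.sum fun x _  ↦ ((h1 _ _).sub (h2 _ _)).pow 2)
  have hG0 : ∀ z, 0 ≤ Gf K h a b z := fun z  ↦ by unfold Gf; positivity
  have hGs : ∀ t ∈ Icc 0 T, Continuous fun y  ↦ Gf K h a b (t, y) := fun t ht  ↦ hGc.comp_continuous (f := fun y  ↦ (t, y)) fnp fun y  ↦ ⟨ht, trivial⟩
  have hcs : ∀ κ, 0 < κ → HasCompactSupport fun y : EE d  ↦ chi κ y ^ 2 := fun κ hκ  ↦ (chi_cs hκ).mono fun y hy h0  ↦ hy (by simp [h0])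
  have hcc : ∀ κ, Continuous fun y : EE d  ↦ chi κ y ^ 2 := fun κ  ↦ (chi_co κ).pow 2
  have hFi : ∀ κ, 0 < κ → ∀ t ∈ Icc 0 T, Integrable fun y : EE d  ↦ chi κ y ^ 2 * Gf K h a b (t, y) := fun κ hκ t ht  ↦
    ((hcc κ).mul (hGs t ht)).integrable_of_hasCompactSupport ((chi_cs hκ).mono fun y hy h0  ↦ hy (by simp [h0]))
  have hd : ∀ t ∈ Ioo 0 T, ∀ y, deriv (fun s  ↦ Gf K h a b (s, y)) t =
      2 * (1 + K * ∑ x : Ix d, (b (t, y) x.1 x.2 - h y x.1 x.2) ^ 2) * ∑ x : Ix d, (a (t, y) x.1 x.2 - b (t, y) x.1 x.2) * (Rh (fun y  ↦ a (t, y)) x y - Rh (fun y  ↦ b (t, y)) x y)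
      + 2 * K * (∑ x : Ix d, (a (t, y) x.1 x.2 - b (t, y) x.1 x.2) ^ 2) * ∑ x : Ix d, (b (t, y) x.1 x.2 - h y x.1 x.2) * Rh (fun y  ↦ b (t, y)) x y := fun t ht y  ↦ by
    have h1 : ∀ x : Ix d, HasDerivAt (fun s  ↦ a (s, y) x.1 x.2) (Rh (fun y  ↦ a (t, y)) x y) t := fun x  ↦ ha.dt (z := (t, y)) ht x.1 x.2
    have h2 : ∀ x : Ix d, HasDerivAt (fun s  ↦ b (s, y) x.1 x.2) (Rh (fun y  ↦ b (t, y)) x y) t := fun x  ↦ hb.dt (z := (t, y)) ht x.1 x.2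
    have h3 := ((HasDerivAt.fun_sum fun (x : Ix d) (_ : x ∈ Finset.univ)  ↦ ((h2 x).sub_const (h y x.1 x.2)).fun_pow 2).const_mul K).const_add 1
    have h4 := HasDerivAt.fun_sum fun (x : Ix d) (_ : x ∈ Finset.univ)  ↦ ((h1 x).fun_sub (h2 x)).fun_pow 2
    refine ((h3.fun_mul h4).deriv).trans ?_
    simp only [mul_sum, sum_mul, Nat.cast_ofNat, Nat.add_one_sub_one, pow_one]
    rw [add_comm]
    congr 1
    · refine sum_congr rfl fun x _  ↦ ?_
      ring
    · rw [sum_comm]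
      refine sum_congr rfl fun x _  ↦ sum_congr rfl fun xp _  ↦ ?_
      ring
  obtain ⟨C6, hC6⟩ := exi (C5 * (2 * ((d:ℝ) + 1) ^ 2 + 1) * (1 + d ^ 2 * δ ^ 2))
  have hE : ∀ κ, 0 < κ → ∀ t ∈ Icc 0 T, ∫ y, chi κ y ^ 2 * Gf K h a b (t, y) ≤ exp (C6 * t) * (κ * ∫ y : EE d, rhw y) := fun κ hκ t ht  ↦ by
    refine gron (T := T) (E := fun t  ↦ ∫ y, chi κ y ^ 2 * Gf K h a b (t, y)) ?_ ?_ ?_ (fun t ht  ↦ ?_) ht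
    · refine continuousOn_integral_of_compact_support (k := tsupport fun y : EE d  ↦ chi κ y ^ 2) (hcs κ hκ) ?_ fun t y _ hy  ↦ ?_
      · exact ((hcc κ).comp continuous_snd).continuousOn.mul hGc
      · rw [show chi κ y ^ 2 = 0 from image_eq_zero_of_notMem_tsupport (f := fun y : EE d  ↦ chi κ y ^ 2) hy, zero_mul]
    · simp [Gf, ha.ini, hb.ini]
    · exact mul_nonneg hκ.le (integral_nonneg fun y  ↦ (rhw_pos y).le)
    · refine ⟨_, dint hGd (hcc κ) (hcs κ hκ) ht, ?_⟩
      simp only [hd t ht]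
      rw [hC6]
      have hI : ∀ y : EE d, ((t, y) : Ze d).1 ∈ Icc 0 T := fun y  ↦ Ioo_subset_Icc_self ht
      exact slice_le hK hδ hC hκ HR (a := fun y  ↦ a (t, y)) (b := fun y  ↦ b (t, y)) (fun i j  ↦ (ha.slice ht i j).of_le (by norm_cast)) (fun i j  ↦ (hb.slice ht i j).of_le (by norm_cast))
        hh (fun y  ↦ sa _ (hI y)) (fun y  ↦ sb _ (hI y)) (fun y  ↦ hbh _ (hI y)) (fun y  ↦ hab _ (hI y)) hM
  intro t ht x
  obtain ⟨κ0, hκ0⟩ := exi (rhw x / 2)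
  have hρ := rhw_pos x
  have hκ1 : 0 < κ0 := by rw [hκ0]; linarith
  obtain ⟨B, hB⟩ := exi (exp (C6 * t) * ∫ y : EE d, rhw y)
  have hB0 : 0 ≤ B := by rw [hB]; exact mul_nonneg (Real.exp_pos _).le (integral_nonneg fun y  ↦ (rhw_pos y).le)
  have hle : ∀ κ, 0 < κ → κ ≤ κ0 → ∫ y, chi κ0 y ^ 2 * Gf K h a b (t, y) ≤ κ * B := fun κ h1 h2  ↦ by
    refine le_trans (integral_mono (hFi κ0 hκ1 t ht) (hFi κ h1 t ht) fun y  ↦ ?_) ((hE κ h1 t ht).trans_eq (by rw [hB]; ring))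
    exact mul_le_mul_of_nonneg_right (pow_le_pow_left₀ (chi_nn _ _) (chi_anti h2 y) 2) (hG0 _)
  have hz : ∫ y, chi κ0 y ^ 2 * Gf K h a b (t, y) ≤ 0 := by
    by_contra! hp
    obtain ⟨J, hJ⟩ := exi (∫ y, chi κ0 y ^ 2 * Gf K h a b (t, y))
    rw [← hJ] at hp hle
    have h1 := hle (min κ0 (J / (2 * (B + 1)))) (lt_min hκ1 psv) (min_le_left _ _)
    have h2 : min κ0 (J / (2 * (B + 1))) * B ≤ J / (2 * (B + 1)) * (B + 1) := mul_le_mul (min_le_right _ _) lna hB0 psv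
    have h3 : J / (2 * (B + 1)) * (B + 1) = J / 2 := by field_simp
    linarith
  have hx : Gf K h a b (t, x) = 0 := by
    by_contra hne
    refine absurd (Continuous.integral_pos_of_hasCompactSupport_nonneg_nonzero (μ := volume) (x := x) ((hcc κ0).mul (hGs t ht)) ((chi_cs hκ1).mono fun y hy h0  ↦ hy (by simp [h0]))
      (fun y  ↦ mul_nonneg (sq_nonneg _) (hG0 _)) (mul_ne_zero ?_ hne)) (not_lt.2 hz)
    have : chi κ0 x = rhw x / 2 := by rw [chi, hκ0, max_eq_left lna]; ring
    simp only [this]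
    positivity
  unfold Gf at hx
  have h1 : ∑ xp : Ix d, (a (t, x) xp.1 xp.2 - b (t, x) xp.1 xp.2) ^ 2 = 0 := by
    rcases mul_eq_zero.1 hx with h' | h'
    · have : 0 ≤ K * ∑ xp : Ix d, (b (t, x) xp.1 xp.2 - h (t, x).2 xp.1 xp.2) ^ 2 := by positivity
      linarith
    · exact h'
  funext i j
  have h2 := (Finset.sum_eq_zero_iff_of_nonneg fun xp _  ↦ sq_nonneg _).1 h1 (i, j) (Finset.mem_univ _)
  have h3 := pow_eq_zero_iff (two_ne_zero) |>.1 h2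
  simp only at h3
  linarith
end

lemma hsum {a} (hs : ∀ i j, a i j = a j i) (h : ∀ ξ : EE d, lam⁻¹ * ‖ξ‖ ^ 2 ≤ ∑ i, ∑ j, a i j * ξ i * ξ j ∧ ∑ i, ∑ j, a i j * ξ i * ξ j ≤ lam * ‖ξ‖ ^ 2) :
    EllM lam a := ⟨hs, fun ξ  ↦ by simpa [EuclideanSpace.norm_sq_eq] using h (WithLp.toLp 2 ξ)⟩

lemma epos {a} (hL : 0 < L) (h : EllM L a) (ξ : EE d) (hξ : ξ ≠ 0) : 0 < ∑ i, ∑ j, a i j * ξ i * ξ j := by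
  refine lt_of_lt_of_le ?_ (h.2 ξ).1
  have h1 : ∑ i, ξ i ^ 2 = ‖ξ‖ ^ 2 := by simp [EuclideanSpace.norm_sq_eq]
  rw [h1]
  have := norm_pos_iff.2 hξ
  positivity
end

/-- existence and uniqueness for the Ricci–DeTurck flow on `ℝᵈ`
with uniformly continuous initial metric comparable to the Euclidean metric,
with the gradient bound `t^{1/2}‖∂g(t)‖_∞ ≤ ε`. -/
theorem statement_5 (d : ℕ) (hd : 1 ≤ d) (lam : ℝ) (hlam : 1 < lam) :
    ∃ ε > (0:ℝ),
      ∀ g₀ : EuclideanSpace ℝ (Fin d) → Fin d → Fin d → ℝ,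
        UniformContinuous g₀ →
        (∀ x i j, g₀ x i j = g₀ x j i) →
        (∀ (x : EuclideanSpace ℝ (Fin d)) (ξ : EuclideanSpace ℝ (Fin d)),
          lam⁻¹ * ‖ξ‖ ^ 2 ≤ ∑ i, ∑ j, g₀ x i j * ξ i * ξ j ∧
          ∑ i, ∑ j, g₀ x i j * ξ i * ξ j ≤ lam * ‖ξ‖ ^ 2) →
        ∃ T > (0:ℝ), ∃ g : ℝ × EuclideanSpace ℝ (Fin d) → Fin d → Fin d → ℝ,
          (ContinuousOn g (Icc (0:ℝ) T ×ˢ (univ : Set (EuclideanSpace ℝ (Fin d)))) ∧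
           ContDiffOn ℝ (⊤ : ℕ∞) g
             (Ioo (0:ℝ) T ×ˢ (univ : Set (EuclideanSpace ℝ (Fin d)))) ∧
           (∀ x, g (0, x) = g₀ x) ∧
           -- the flow takes values in symmetric positive definite matrices
           (∀ z : ℝ × EuclideanSpace ℝ (Fin d), z.1 ∈ Icc (0:ℝ) T →
             (∀ i j, g z i j = g z j i) ∧
             (∀ ξ : EuclideanSpace ℝ (Fin d), ξ ≠ 0 →
               0 < ∑ i, ∑ j, g z i j * ξ i * ξ j)) ∧
           -- the Ricci-DeTurck flow equation
           (∀ z : ℝ × EuclideanSpace ℝ (Fin d), 0 < z.1 → z.1 < T →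
             IsRicciDeTurck g z) ∧
           -- gradient bound  t^{1/2} ‖∂g(t)‖_∞ ≤ ε
           (∀ t ∈ Ioc (0:ℝ) T, ∀ (x : EuclideanSpace ℝ (Fin d)) (c i j : Fin d),
             Real.sqrt t * |pd c (fun y => g (t, y) i j) x| ≤ ε)) ∧
          -- uniqueness among solutions with the same gradient bound
          (∀ g' : ℝ × EuclideanSpace ℝ (Fin d) → Fin d → Fin d → ℝ,
            ContinuousOn g' (Icc (0:ℝ) T ×ˢ (univ : Set (EuclideanSpace ℝ (Fin d)))) →
            ContDiffOn ℝ (⊤ : ℕ∞) g'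
              (Ioo (0:ℝ) T ×ˢ (univ : Set (EuclideanSpace ℝ (Fin d)))) →
            (∀ x, g' (0, x) = g₀ x) →
            (∀ z : ℝ × EuclideanSpace ℝ (Fin d), z.1 ∈ Icc (0:ℝ) T →
              (∀ i j, g' z i j = g' z j i) ∧
              (∀ ξ : EuclideanSpace ℝ (Fin d), ξ ≠ 0 →
                0 < ∑ i, ∑ j, g' z i j * ξ i * ξ j)) →
            (∀ z : ℝ × EuclideanSpace ℝ (Fin d), 0 < z.1 → z.1 < T →
              IsRicciDeTurck g' z) →
            (∀ t ∈ Ioc (0:ℝ) T, ∀ (x : EuclideanSpace ℝ (Fin d)) (c i j : Fin d),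
              Real.sqrt t * |pd c (fun y => g' (t, y) i j) x| ≤ ε) →
            ∀ t ∈ Icc (0:ℝ) T, ∀ x, g' (t, x) = g (t, x)) := by
  have hl0 : 0 < lam := by linarith
  have hd0 : (0:ℝ) < d := by exact_mod_cast hd
  obtain ⟨K, hK, δ, hδ, HR⟩ := RP_le d (L := 2 * lam) (by linarith)
  obtain ⟨δ', hδ', k1, k2, k3⟩ : ∃ δ' > 0, δ' ≤ δ / 2 ∧ 10 * d ^ 6 * (2 * lam) ^ 3 * δ' ≤ 1 ∧ 2 * lam * (d * (2 * δ')) ≤ 1 := by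
    refine ⟨min (δ / 2) (min (10 * d ^ 6 * (2 * lam) ^ 3)⁻¹ (2 * lam * (d * 2))⁻¹), by positivity, min_le_left _ _, ?_, ?_⟩
    · refine (mul_le_mul_of_nonneg_left ((min_le_right _ _).trans (min_le_left _ _)) (by positivity)).trans_eq (mul_inv_cancel₀ (by positivity))
    · rw [← mul_assoc (d:ℝ), ← mul_assoc (2 * lam)]
      refine (mul_le_mul_of_nonneg_left ((min_le_right _ _).trans (min_le_right _ _)) (by positivity)).trans_eq (mul_inv_cancel₀ (by positivity))
  obtain ⟨A, hA, hA1⟩ : ∃ A > 0, 128 * d * lam ≤ A ^ 2 := ⟨√(128 * d * lam), by positivity, (Real.sq_sqrt (by positivity)).ge⟩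
  obtain ⟨ε, hε, hε1, hε2⟩ : ∃ ε > 0, ε ≤ 1 ∧ 2 * d ^ 2 * ε * A ≤ δ' := by
    refine ⟨min 1 (δ' / (2 * d ^ 2 * A)), by positivity, min_le_left _ _, ?_⟩
    have h1 := mul_le_mul_of_nonneg_left (min_le_right 1 (δ' / (2 * d ^ 2 * A))) (show 0 ≤ 2 * (d:ℝ) ^ 2 * A by positivity)
    rw [mul_div_cancel₀ _ (by positivity)] at h1
    linarith
  refine ⟨ε, hε, fun g₀ hg hsy hell  ↦ ?_⟩
  have hE0 : ∀ x, EllM lam (g₀ x) := fun x  ↦ hsum (hsy x) (hell x)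
  obtain ⟨T1, hT1, g, q1, q2, q3, q4, q5, q6⟩ := exist d lam hlam ε hε hε1 g₀ hg hE0
  obtain ⟨r0, hr0, hr⟩ : ∃ r0 > 0, ∀ x y : EE d, ‖y - x‖ ≤ r0 → Nn (g₀ y) (g₀ x) ≤ δ' ^ 2 / 64 := by
    obtain ⟨r, hr, h⟩ := Metric.uniformContinuous_iff.1 hg (δ' / (8 * d)) (by positivity)
    refine ⟨r / 2, by positivity, fun x y hxy  ↦ ?_⟩
    have h1 := (h (show dist y x < r by rw [dist_eq_norm]; linarith)).le
    refine (Nn_of (δ := δ' / (8 * d)) fun i j  ↦ ?_).trans_eq (by field_simp; norm_num)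
    exact ((dist_le_pi_dist (g₀ y i) (g₀ x i) j).trans (dist_le_pi_dist (g₀ y) (g₀ x) i)).trans h1
  obtain ⟨T, hT, hTT, hTA⟩ : ∃ T > 0, T ≤ T1 ∧ A * √T ≤ r0 := by
    refine ⟨min T1 ((r0 / A) ^ 2), by positivity, min_le_left _ _, ?_⟩
    have h1 : √(min T1 ((r0 / A) ^ 2)) ≤ r0 / A := (Real.sqrt_le_sqrt (min_le_right _ _)).trans_eq (Real.sqrt_sq (by positivity))
    exact (mul_le_mul_of_nonneg_left h1 hA.le).trans_eq (mul_div_cancel₀ _ hA.ne')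
  have hI : Icc 0 T ⊆ Icc 0 T1 := Icc_subset_Icc_right hTT
  have p1 := q1.mono (prod_mono hI (subset_refl (univ : Set (EE d))))
  have p2 := q2.mono (prod_mono (Ioo_subset_Ioo_right hTT) (subset_refl (univ : Set (EE d))))
  have p4 : ∀ z : ℝ × EE d, z.1 ∈ Icc 0 T → EllM (2 * lam) (g z) := fun z hz  ↦ q4 z (hI hz)
  have p5 : ∀ z : ℝ × EE d, 0 < z.1 → z.1 < T → IsRicciDeTurck g z := fun z h1 h2  ↦ q5 z h1 (h2.trans_le hTT)
  have p6 : ∀ t ∈ Ioc 0 T, ∀ (x : EE d) (c i j : Fin d), √t * |pd c (fun y  ↦ g (t, y) i j) x| ≤ ε := fun t ht  ↦ q6 t ⟨ht.1, ht.2.trans hTT⟩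
  refine ⟨T, hT, g, ⟨p1, p2, q3, fun z hz  ↦ ⟨(p4 z hz).1, epos (by positivity) (p4 z hz)⟩, p5, p6⟩, fun g' r1 r2 r3 r4 r5 r6  ↦ ?_⟩
  have S : Sol ε T g₀ g := ⟨p1, p2, q3, fun z hz  ↦ (p4 z hz).1, p5, p6⟩
  have S' : Sol ε T g₀ g' := ⟨r1, r2, r3, fun z hz  ↦ (r4 z hz).1, r5, r6⟩
  have hm : ∀ x y, ‖y - x‖ ≤ A * √T → Nn (g₀ y) (g₀ x) ≤ δ' ^ 2 / 64 := fun x y h  ↦ hr x y (h.trans hTA)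
  have c1 : ∀ z : ℝ × EE d, z.1 ∈ Icc 0 T → ∀ i j, |g z i j - g₀ z.2 i j| ≤ δ' := fun z hz  ↦
    Nn_ent hδ'.le (lc0 hd hlam.le hδ' k2 k3 hA hA1 hε.le hε2 hg.continuous hE0 hm S z.1 hz z.2).le
  have c2 : ∀ z : ℝ × EE d, z.1 ∈ Icc 0 T → ∀ i j, |g' z i j - g₀ z.2 i j| ≤ δ' := fun z hz  ↦
    Nn_ent hδ'.le (lc0 hd hlam.le hδ' k2 k3 hA hA1 hε.le hε2 hg.continuous hE0 hm S' z.1 hz z.2).le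
  obtain ⟨D⟩ := SD.exists d (2 * lam) (by linarith)
  obtain ⟨h, hh, hσ, M, hM, -, hlip⟩ := refs D hg (fun x  ↦ (hE0 x).bound hl0) (show 0 < δ / 2 by positivity)
  obtain ⟨C5, hC5, HR⟩ := HR M hM
  have k4 : 2 * lam * (d * δ') ≤ 1 := by
    have : 0 < 2 * lam * (d * δ') := by positivity
    linarith
  refine uniq (by linarith) hδ.le hC5 HR S' S hh (fun z hz  ↦ ((hE0 z.2).pert hlam.le (r4 z hz).1 (c2 z hz) k4).St (by positivity)) (fun z hz  ↦ (p4 z hz).St (by positivity)) ?_ ?_ ?_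
  · intro z hz i j
    have h1 := c1 z hz i j
    have h2 := hσ z.2 i j
    rw [abs_le] at *
    constructor <;> linarith [h1.1, h1.2, h2.1, h2.2]
  · intro z hz i j
    have h1 := c1 z hz i j
    have h2 := c2 z hz i j
    rw [abs_le] at *
    constructor <;> linarith [h1.1, h1.2, h2.1, h2.2]
  · intro y c i j
    have h1 := ((hh i j).differentiable (by norm_num) y).hasFDerivAt.le_of_lip' hM (Filter.Eventually.of_forall fun z  ↦ by
      simpa using hlip i j y (z - y))
    have h2 := (fderiv ℝ (fun x  ↦ h x i j) y).le_opNorm (EuclideanSpace.single c 1)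
    rw [EuclideanSpace.norm_single, norm_one, mul_one] at h2
    exact h2.trans h1
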